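/- For every integer d ≥ 3, let C_d be the smallest constant C > 0 such that for all nonnegative u in D^{1,2}(ℝ^d), with q = (d+2)/(d−2), S_d ‖u^q‖_{2d/(d+2)}^2 − ∫ u^q (−Δ)^{−1}(u^q) dx ≤ C ‖u‖_{2^*}^{8/(d−2)} [ S_d ‖∇u‖_2^2 − ‖u‖_{2^*}^2 ]. Then (d/(d+4)) S_d ≤ C_d < S_d. -/

import Mathlib

open MeasureTheory Real

noncomputable section

/-- Surface area of the unit sphere `𝕊^{d-1} ⊆ ℝ^d`. -/
def sphereArea (d : ℕ) : ℝ := 2 * Real.pi ^ ((d : ℝ) / 2) / Real.Gamma ((d : ℝ) / 2)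

/-- Green function of `-Δ` on `ℝ^d`, `d ≥ 3`: `G_d(x) = |x|^{2-d} / ((d-2)|𝕊^{d-1}|)`. -/
def greenKernel (d : ℕ) (x : EuclideanSpace ℝ (Fin d)) : ℝ :=
  ‖x‖ ^ ((2 : ℝ) - d) / (((d : ℝ) - 2) * sphereArea d)

/-- `(−Δ)⁻¹ v`, the convolution of `v` with the Green function of `-Δ` on `ℝ^d`. -/
def invLap (d : ℕ) (v : EuclideanSpace ℝ (Fin d) → ℝ) (x : EuclideanSpace ℝ (Fin d)) : ℝ :=
  ∫ y, greenKernel d (x - y) * v y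

/-- The Aubin–Talenti (optimal Sobolev) constant
`S_d = (1/(π d (d−2))) (Γ(d)/Γ(d/2))^{2/d}`. -/
def sobolevConst (d : ℕ) : ℝ :=
  1 / (Real.pi * d * ((d : ℝ) - 2)) *
    (Real.Gamma (d : ℝ) / Real.Gamma ((d : ℝ) / 2)) ^ ((2 : ℝ) / (d : ℝ))

/-- Membership in `D^{1,2}(ℝ^d)`: a (weakly) differentiable function with
`∇u ∈ L²` and `u ∈ L^{2*}`, `2* = 2d/(d-2)`. -/
def MemD12 (d : ℕ) (u : EuclideanSpace ℝ (Fin d) → ℝ) : Prop :=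
  Differentiable ℝ u ∧
  Integrable (fun x => ‖gradient u x‖ ^ 2) ∧
  Integrable (fun x => |u x| ^ (2 * (d : ℝ) / ((d : ℝ) - 2)))

/-- The `L^p` norm of `u`, written with real exponents: `(∫ |u|^p)^{1/p}`. -/
def lpNorm' {d : ℕ} (p : ℝ) (u : EuclideanSpace ℝ (Fin d) → ℝ) : ℝ :=
  (∫ x, |u x| ^ p) ^ (1 / p)

/-- The Laplacian `Δu = ∑ ∂²u/∂x_i²`. -/
def lap (d : ℕ) (u : EuclideanSpace ℝ (Fin d) → ℝ) (x : EuclideanSpace ℝ (Fin d)) : ℝ :=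
  ∑ i : Fin d, iteratedFDeriv ℝ 2 u x ![EuclideanSpace.single i 1, EuclideanSpace.single i 1]

open MeasureTheory Real
noncomputable section

open scoped ContDiff Topology
open Filter

/-- Japanese bracket squared. -/
def jb {d : ℕ} (x : EuclideanSpace ℝ (Fin d)) : ℝ := 1 + ‖x‖ ^ 2

lemma jb_pos {d : ℕ} (x : EuclideanSpace ℝ (Fin d)) : 0 < jb x := by unfold jb; positivity
lemma one_le_jb {d : ℕ} (x : EuclideanSpace ℝ (Fin d)) : 1 ≤ jb x := by
  unfold jb; nlinarith [sq_nonneg ‖x‖]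

lemma continuous_jb {d : ℕ} : Continuous (jb : EuclideanSpace ℝ (Fin d) → ℝ) := by
  unfold jb; fun_prop

lemma norm_gradient_eq {d : ℕ} (u : EuclideanSpace ℝ (Fin d) → ℝ) (x : EuclideanSpace ℝ (Fin d)) :
    ‖gradient u x‖ = ‖fderiv ℝ u x‖ := by
  rw [← toDual_gradient, LinearIsometryEquiv.norm_map]

lemma measurable_gradient {d : ℕ} (u : EuclideanSpace ℝ (Fin d) → ℝ) :
    Measurable (gradient u) := by
  have : gradient u = fun x => (InnerProductSpace.toDual ℝ (EuclideanSpace ℝ (Fin d))).symm (fderiv ℝ u x) := rfl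
  rw [this]
  exact (LinearIsometryEquiv.continuous _).measurable.comp (measurable_fderiv ℝ u)

lemma exists_cutoff (d : ℕ) : ∃ (χ : ℕ → EuclideanSpace ℝ (Fin d) → ℝ) (C : ℝ), 0 ≤ C ∧
    (∀ n, ContDiff ℝ ∞ (χ n)) ∧ (∀ n, HasCompactSupport (χ n)) ∧
    (∀ n x, 0 ≤ χ n x ∧ χ n x ≤ 1) ∧
    (∀ n x, ‖gradient (χ n) x‖ ≤ C / √(jb x)) ∧
    (∀ x, ∀ᶠ n in atTop, χ n x = 1) ∧
    (∀ x, ∀ᶠ n in atTop, gradient (χ n) x = 0) := by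
  let f : ContDiffBump (0 : EuclideanSpace ℝ (Fin d)) := ⟨1, 2, by norm_num, by norm_num⟩
  have hf : ContDiff ℝ ∞ (f : EuclideanSpace ℝ (Fin d) → ℝ) := f.contDiff
  have hc : HasCompactSupport (f : EuclideanSpace ℝ (Fin d) → ℝ) := f.hasCompactSupport
  obtain ⟨C, hC⟩ := (hc.fderiv (𝕜 := ℝ)).exists_bound_of_continuous (hf.continuous_fderiv (by simp))
  have hC0 : 0 ≤ C := (norm_nonneg _).trans (hC 0)
  have hev : ∀ x : EuclideanSpace ℝ (Fin d), ∀ᶠ n : ℕ in atTop,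
      (fun y : EuclideanSpace ℝ (Fin d) => f (((n : ℝ) + 1)⁻¹ • y)) =ᶠ[𝓝 x] fun _ => 1 := by
    intro x
    obtain ⟨N, hN⟩ := exists_nat_gt (‖x‖)
    filter_upwards [eventually_ge_atTop N] with n hn
    have hn' : ‖x‖ < (n:ℝ) + 1 := by
      have : (N:ℝ) ≤ n := by exact_mod_cast hn
      linarith
    have : ∀ᶠ y in 𝓝 x, ‖y‖ < (n:ℝ)+1 := continuous_norm.continuousAt.eventually_lt continuousAt_const hn'
    filter_upwards [this] with y hy
    apply f.one_of_mem_closedBall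
    rw [mem_closedBall_zero_iff, norm_smul, norm_inv, Real.norm_of_nonneg (by positivity)]
    change _ ≤ (1:ℝ)
    rw [inv_mul_le_iff₀ (by positivity)]; linarith
  refine ⟨fun n x => f (((n : ℝ) + 1)⁻¹ • x), C * 3, by positivity, ?_, ?_, ?_, ?_, ?_, ?_⟩
  · intro n; exact hf.comp (contDiff_const_smul _)
  · intro n; exact hc.comp_smul (by positivity)
  · intro n x; exact ⟨f.nonneg, f.le_one⟩
  · intro n x
    have h1 : (0:ℝ) < (n:ℝ)+1 := by positivity
    rw [norm_gradient_eq]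
    have hfd : fderiv ℝ (fun x => f (((n : ℝ) + 1)⁻¹ • x)) x = ((n : ℝ) + 1)⁻¹ • fderiv ℝ f (((n : ℝ) + 1)⁻¹ • x) := by
      exact fderiv_comp_smul (𝕜 := ℝ) (f := f) ((n : ℝ) + 1)⁻¹
    rw [hfd, norm_smul, norm_inv, Real.norm_of_nonneg h1.le]
    by_cases hx : ‖x‖ ≤ 2 * ((n:ℝ)+1)
    · have : √(jb x) ≤ 3 * ((n:ℝ)+1) := by
        apply Real.sqrt_le_iff.2 ⟨by positivity, ?_⟩
        unfold jb
        have : (1:ℝ) ≤ (n:ℝ)+1 := by simp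
        nlinarith [norm_nonneg x]
      have hs : 0 < √(jb x) := Real.sqrt_pos.2 (jb_pos x)
      rw [le_div_iff₀ hs, inv_mul_eq_div, div_mul_eq_mul_div, div_le_iff₀ h1]
      have h3 := hC (((n : ℝ) + 1)⁻¹ • x)
      calc ‖fderiv ℝ f (((n : ℝ) + 1)⁻¹ • x)‖ * √(jb x) ≤ C * (3 * ((n:ℝ)+1)) := by gcongr
        _ = _ := by ring
    · have : ((n : ℝ) + 1)⁻¹ • x ∉ tsupport (f : EuclideanSpace ℝ (Fin d) → ℝ) := by
        rw [f.tsupport_eq, mem_closedBall_zero_iff, norm_smul, norm_inv, Real.norm_of_nonneg h1.le]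
        change ¬ (_ ≤ (2:ℝ))
        rw [inv_mul_le_iff₀ h1]; intro h; apply hx; linarith
      have h0 : fderiv ℝ (f : EuclideanSpace ℝ (Fin d) → ℝ) (((n : ℝ) + 1)⁻¹ • x) = 0 := by
        by_contra h
        exact this (support_fderiv_subset ℝ h)
      rw [h0]; simp; positivity
  · intro x
    filter_upwards [hev x] with n hn
    exact hn.self_of_nhds
  · intro x
    filter_upwards [hev x] with n hn
    have : fderiv ℝ (fun y : EuclideanSpace ℝ (Fin d) => f (((n : ℝ) + 1)⁻¹ • y)) x = 0 := by
      rw [hn.fderiv_eq]; simp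
    rw [← norm_eq_zero, norm_gradient_eq, this, norm_zero]

/-- divergence of a vector field -/
def dvg {d : ℕ} (X : EuclideanSpace ℝ (Fin d) → EuclideanSpace ℝ (Fin d)) (x : EuclideanSpace ℝ (Fin d)) : ℝ :=
  ∑ i, (fderiv ℝ X x (EuclideanSpace.single i 1)) i

lemma inner_gradient_sum {d : ℕ} (g : EuclideanSpace ℝ (Fin d) → ℝ) (x v : EuclideanSpace ℝ (Fin d)) :
    inner ℝ (gradient g x) v = ∑ i, fderiv ℝ g x (EuclideanSpace.single i 1) * v i := by
  rw [inner_gradient_left]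
  conv_lhs => rw [show v = ∑ i, v i • EuclideanSpace.single i (1:ℝ) by
    ext j; simp [Finset.sum_apply, Pi.single_apply]]
  rw [map_sum]
  simp [mul_comm]

lemma fderiv_coord {d : ℕ} (X : EuclideanSpace ℝ (Fin d) → EuclideanSpace ℝ (Fin d))
    (x v : EuclideanSpace ℝ (Fin d)) (hX : DifferentiableAt ℝ X x) (i : Fin d) :
    fderiv ℝ (fun y => X y i) x v = (fderiv ℝ X x v) i := by
  have h := ((EuclideanSpace.proj (𝕜 := ℝ) i : EuclideanSpace ℝ (Fin d) →L[ℝ] ℝ).hasFDerivAt.comp x hX.hasFDerivAt).fderiv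
  have h2 : (⇑(EuclideanSpace.proj (𝕜 := ℝ) i : EuclideanSpace ℝ (Fin d) →L[ℝ] ℝ) ∘ X) = fun y => X y i := rfl
  rw [h2] at h
  rw [h]; rfl

lemma ibp_compact {d : ℕ} (g : EuclideanSpace ℝ (Fin d) → ℝ) (X : EuclideanSpace ℝ (Fin d) → EuclideanSpace ℝ (Fin d))
    (hg : Differentiable ℝ g) (hgc : HasCompactSupport g) (hX : ContDiff ℝ 1 X)
    (hloc : LocallyIntegrable (gradient g)) :
    ∫ x, (inner ℝ (gradient g x) (X x) + g x * dvg X x) = 0 := by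
  have hXd : Differentiable ℝ X := hX.differentiable (by simp)
  have hXi : ∀ i, ContDiff ℝ 1 (fun x => X x i) := fun i =>
    (EuclideanSpace.proj (𝕜 := ℝ) i : EuclideanSpace ℝ (Fin d) →L[ℝ] ℝ).contDiff.comp hX
  have hfi : ∀ i, Continuous fun x => fderiv ℝ X x (EuclideanSpace.single i 1) i := by
    intro i
    have := (hXi i).continuous_fderiv (by simp)
    have h2 := this.clm_apply (continuous_const (y := EuclideanSpace.single i (1:ℝ)))
    have h3 : (fun x => fderiv ℝ X x (EuclideanSpace.single i 1) i) =
        fun x => fderiv ℝ (fun y => X y i) x (EuclideanSpace.single i 1) := by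
      ext x; exact (fderiv_coord X x _ (hXd x) i).symm
    rw [h3]; exact h2
  -- integrability
  have hgi : Integrable (gradient g) := by
    have hsub : Function.support (gradient g) ⊆ tsupport g := by
      intro x hx
      by_contra h
      apply hx
      have : fderiv ℝ g x = 0 := by
        by_contra h'
        exact h (support_fderiv_subset ℝ h')
      rw [← norm_eq_zero, norm_gradient_eq, this, norm_zero]
    exact (integrableOn_iff_integrable_of_support_subset hsub).1 (hloc.integrableOn_isCompact hgc)
  have hsupp : ∀ x, x ∉ tsupport g → fderiv ℝ g x = 0 := by
    intro x h
    by_contra h'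
    exact h (support_fderiv_subset ℝ h')
  have hi1 : ∀ i, Integrable fun x => fderiv ℝ g x (EuclideanSpace.single i 1) * X x i := by
    intro i
    obtain ⟨K, hK⟩ := hgc.exists_bound_of_continuousOn (f := fun x => X x i) (hXi i).continuous.continuousOn
    refine Integrable.mono' (hgi.norm.mul_const K) ?_ (Eventually.of_forall fun x => ?_)
    · exact ((measurable_fderiv_apply_const ℝ g _).mul (hXi i).continuous.measurable).aestronglyMeasurable
    · by_cases hx : x ∈ tsupport g
      · rw [norm_mul, norm_gradient_eq]
        refine mul_le_mul ?_ (hK x hx) (norm_nonneg _) (norm_nonneg _)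
        refine (ContinuousLinearMap.le_opNorm _ _).trans ?_
        simp
      · rw [norm_gradient_eq, hsupp x hx]; simp
  have hi2 : ∀ i, Integrable fun x => g x * fderiv ℝ X x (EuclideanSpace.single i 1) i := by
    intro i
    exact (hg.continuous.mul (hfi i)).integrable_of_hasCompactSupport (hgc.mul_right)
  have hi3 : ∀ i, Integrable fun x => g x * X x i := by
    intro i
    exact (hg.continuous.mul (hXi i).continuous).integrable_of_hasCompactSupport (hgc.mul_right)
  have key : ∀ i, ∫ x, (fderiv ℝ g x (EuclideanSpace.single i 1) * X x i + g x * fderiv ℝ X x (EuclideanSpace.single i 1) i) = 0 := by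
    intro i
    rw [integral_add (hi1 i) (hi2 i)]
    have := integral_mul_fderiv_eq_neg_fderiv_mul_of_integrable (μ := (volume : Measure (EuclideanSpace ℝ (Fin d))))
      (f := g) (g := fun x => X x i) (v := EuclideanSpace.single i (1:ℝ)) (hi1 i) ?_ (hi3 i) (fun x _ => hg x)
      (fun x _ => (hXi i).differentiable (by simp) x)
    · simp_rw [fun x => fderiv_coord X x (EuclideanSpace.single i 1) (hXd x) i] at this
      linarith
    · simp_rw [fun x => fderiv_coord X x (EuclideanSpace.single i 1) (hXd x) i]
      exact hi2 i
  have : ∀ x, inner ℝ (gradient g x) (X x) + g x * dvg X x =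
      ∑ i, (fderiv ℝ g x (EuclideanSpace.single i 1) * X x i + g x * fderiv ℝ X x (EuclideanSpace.single i 1) i) := by
    intro x
    rw [inner_gradient_sum, dvg, Finset.mul_sum, Finset.sum_add_distrib]
  simp_rw [this]
  have hi12 : ∀ i ∈ Finset.univ, Integrable fun x => (fderiv ℝ g x (EuclideanSpace.single i 1) * X x i + g x * fderiv ℝ X x (EuclideanSpace.single i 1) i) :=
    fun i _ => (hi1 i).add (hi2 i)
  rw [integral_finsetSum _ hi12]
  exact Finset.sum_eq_zero fun i _ => key i

lemma HasGradientAt.mul' {d : ℕ} {u v : EuclideanSpace ℝ (Fin d) → ℝ} {a b x : EuclideanSpace ℝ (Fin d)}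
    (hu : HasGradientAt u a x) (hv : HasGradientAt v b x) :
    HasGradientAt (fun y => u y * v y) (v x • a + u x • b) x := by
  rw [hasGradientAt_iff_hasFDerivAt] at *
  refine (hu.mul hv).congr_fderiv ?_
  rw [map_add, map_smul, map_smul, add_comm]

lemma gradient_mul' {d : ℕ} {u v : EuclideanSpace ℝ (Fin d) → ℝ} {x : EuclideanSpace ℝ (Fin d)}
    (hu : DifferentiableAt ℝ u x) (hv : DifferentiableAt ℝ v x) :
    gradient (fun y => u y * v y) x = v x • gradient u x + u x • gradient v x :=
  (hu.hasGradientAt.mul' hv.hasGradientAt).gradient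

lemma ibp {d : ℕ} (g : EuclideanSpace ℝ (Fin d) → ℝ) (X : EuclideanSpace ℝ (Fin d) → EuclideanSpace ℝ (Fin d))
    (hg : Differentiable ℝ g) (hX : ContDiff ℝ 1 X)
    (hloc : LocallyIntegrable (gradient g))
    (hdiv : Integrable fun x => inner ℝ (gradient g x) (X x) + g x * dvg X x)
    (hF : Integrable fun x => g x * ‖X x‖ / √(jb x)) :
    ∫ x, (inner ℝ (gradient g x) (X x) + g x * dvg X x) = 0 := by
  obtain ⟨χ, C, hC, h1, h2, h3, h4, h5, h6⟩ := exists_cutoff d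
  have hχd : ∀ n, Differentiable ℝ (χ n) := fun n => (h1 n).differentiable (by simp)
  have hχg : ∀ n, Continuous (gradient (χ n)) := fun n => by
    have : gradient (χ n) = fun x => (InnerProductSpace.toDual ℝ (EuclideanSpace ℝ (Fin d))).symm (fderiv ℝ (χ n) x) := rfl
    rw [this]
    exact (LinearIsometryEquiv.continuous _).comp ((h1 n).continuous_fderiv (by simp))
  have e1 : ∀ n, ∫ x, (χ n x * (inner ℝ (gradient g x) (X x) + g x * dvg X x) + g x * inner ℝ (gradient (χ n) x) (X x)) = 0 := by
    intro n
    have := ibp_compact (fun x => χ n x * g x) X ((hχd n).mul hg) ((h2 n).mul_right) hX ?_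
    · rw [← this]
      congr 1; ext x
      rw [gradient_mul' (hχd n x) (hg x), inner_add_left, inner_smul_left, inner_smul_left]
      simp; ring
    · have : gradient (fun x => χ n x * g x) = fun x => g x • gradient (χ n) x + χ n x • gradient g x := by
        ext1 x; exact gradient_mul' (hχd n x) (hg x)
      rw [this]
      apply LocallyIntegrable.add
      · exact (hg.continuous.smul (hχg n)).locallyIntegrable
      · exact hloc.continuous_smul (h1 n).continuous
  have hbound : ∀ n x, |g x * inner ℝ (gradient (χ n) x) (X x)| ≤ C * |g x * ‖X x‖ / √(jb x)| := by
    intro n x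
    rw [abs_mul, abs_div, abs_mul, abs_norm, abs_of_nonneg (Real.sqrt_nonneg _)]
    calc |g x| * |inner ℝ (gradient (χ n) x) (X x)| ≤ |g x| * ((C / √(jb x)) * ‖X x‖) := by
          gcongr
          exact (abs_real_inner_le_norm _ _).trans (by gcongr; exact h4 n x)
      _ = _ := by ring
  have t : Tendsto (fun n => ∫ x, (χ n x * (inner ℝ (gradient g x) (X x) + g x * dvg X x) + g x * inner ℝ (gradient (χ n) x) (X x))) atTop
      (𝓝 (∫ x, (inner ℝ (gradient g x) (X x) + g x * dvg X x))) := by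
    refine tendsto_integral_of_dominated_convergence
      (fun x => |inner ℝ (gradient g x) (X x) + g x * dvg X x| + C * |g x * ‖X x‖ / √(jb x)|) ?_ ?_ ?_ ?_
    · intro n
      apply AEStronglyMeasurable.add
      · exact (h1 n).continuous.aestronglyMeasurable.mul hdiv.aestronglyMeasurable
      · exact (hg.continuous.mul ((hχg n).inner hX.continuous)).aestronglyMeasurable
    · exact hdiv.abs.add (hF.abs.const_mul C)
    · intro n
      refine Eventually.of_forall fun x => ?_
      rw [Real.norm_eq_abs]
      refine (abs_add_le _ _).trans (add_le_add ?_ (hbound n x))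
      rw [abs_mul, abs_of_nonneg (h3 n x).1]
      exact mul_le_of_le_one_left (abs_nonneg _) (h3 n x).2
    · refine Eventually.of_forall fun x => ?_
      apply tendsto_const_nhds.congr'
      filter_upwards [h5 x, h6 x] with n a b
      rw [a, b]; simp
  simp_rw [e1] at t
  exact tendsto_nhds_unique t tendsto_const_nhds |>.symm ▸ rfl
end

open MeasureTheory Real
noncomputable section
open scoped ContDiff Topology
open Filter

abbrev EE (d : ℕ) := EuclideanSpace ℝ (Fin d)
/-- the Sobolev exponent -/
def pp (d : ℕ) : ℝ := 2 * (d : ℝ) / ((d : ℝ) - 2)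

lemma fatou_real {α : Type*} [MeasurableSpace α] {μ : Measure α} {f : ℕ → α → ℝ} {g : α → ℝ} {c : ℕ → ℝ} {C : ℝ}
    (h0 : ∀ n x, 0 ≤ f n x) (hf : ∀ n, Integrable (f n) μ) (hc : ∀ n, ∫ x, f n x ∂μ ≤ c n)
    (hC : Tendsto c atTop (𝓝 C)) (hg : ∀ᵐ x ∂μ, Tendsto (fun n => f n x) atTop (𝓝 (g x))) :
    Integrable g μ ∧ ∫ x, g x ∂μ ≤ C := by
  have hgm : AEStronglyMeasurable g μ := aestronglyMeasurable_of_tendsto_ae atTop (fun n => (hf n).1) hg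
  have hg0 : 0 ≤ᵐ[μ] g := by
    filter_upwards [hg] with x hx
    exact ge_of_tendsto' hx fun n => h0 n x
  have hC0 : 0 ≤ C := ge_of_tendsto' hC fun n => (integral_nonneg (h0 n)).trans (hc n)
  have key : ∫⁻ x, ENNReal.ofReal (g x) ∂μ ≤ ENNReal.ofReal C := by
    calc ∫⁻ x, ENNReal.ofReal (g x) ∂μ = ∫⁻ x, liminf (fun n => ENNReal.ofReal (f n x)) atTop ∂μ := by
          apply lintegral_congr_ae
          filter_upwards [hg] with x hx
          exact ((ENNReal.continuous_ofReal.tendsto _).comp hx).liminf_eq.symm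
      _ ≤ liminf (fun n => ∫⁻ x, ENNReal.ofReal (f n x) ∂μ) atTop :=
          lintegral_liminf_le' fun n => (hf n).1.aemeasurable.ennreal_ofReal
      _ ≤ liminf (fun n => ENNReal.ofReal (c n)) atTop := by
          refine liminf_le_liminf (Eventually.of_forall fun n => ?_)
          change ∫⁻ x, ENNReal.ofReal (f n x) ∂μ ≤ ENNReal.ofReal (c n)
          rw [← ofReal_integral_eq_lintegral_ofReal (hf n) (Eventually.of_forall (h0 n))]
          exact ENNReal.ofReal_le_ofReal (hc n)
      _ = ENNReal.ofReal C := ((ENNReal.continuous_ofReal.tendsto _).comp hC).liminf_eq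
  have hi : Integrable g μ := ⟨hgm, (hasFiniteIntegral_iff_ofReal hg0).2 (key.trans_lt ENNReal.ofReal_lt_top)⟩
  refine ⟨hi, ?_⟩
  rw [← ofReal_integral_eq_lintegral_ofReal hi hg0] at key
  exact (ENNReal.ofReal_le_ofReal_iff hC0).1 key

lemma dvg_smul {d : ℕ} {a : EE d → ℝ} {X : EE d → EE d} {x : EE d} (ha : DifferentiableAt ℝ a x)
    (hX : DifferentiableAt ℝ X x) :
    dvg (fun y => a y • X y) x = inner ℝ (gradient a x) (X x) + a x * dvg X x := by
  unfold dvg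
  rw [inner_gradient_sum, Finset.mul_sum, ← Finset.sum_add_distrib]
  refine Finset.sum_congr rfl fun i _ => ?_
  rw [fderiv_fun_smul ha hX]
  simp [add_comm]

lemma dvg_add {d : ℕ} {X Y : EE d → EE d} {x : EE d} (hX : DifferentiableAt ℝ X x)
    (hY : DifferentiableAt ℝ Y x) :
    dvg (fun y => X y + Y y) x = dvg X x + dvg Y x := by
  unfold dvg
  rw [← Finset.sum_add_distrib]
  refine Finset.sum_congr rfl fun i _ => ?_
  rw [fderiv_fun_add hX hY]; simp

lemma dvg_id {d : ℕ} (x : EE d) : dvg (fun y : EE d => y) x = d := by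
  unfold dvg
  rw [fderiv_fun_id]; simp

lemma dvg_const {d : ℕ} (b x : EE d) : dvg (fun _ : EE d => b) x = 0 := by
  unfold dvg
  simp

/-- quadratic function -/
def qf {d : ℕ} (A : ℝ) (b : EE d) (C : ℝ) (x : EE d) : ℝ := A * ‖x‖ ^ 2 + inner ℝ b x + C

lemma jb_eq_qf {d : ℕ} (x : EE d) : jb x = qf 1 0 1 x := by simp [jb, qf, add_comm]

lemma hasGradientAt_qf {d : ℕ} (A : ℝ) (b : EE d) (C : ℝ) (x : EE d) :
    HasGradientAt (qf A b C) ((2 * A) • x + b) x := by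
  rw [hasGradientAt_iff_hasFDerivAt]
  have h1 : HasFDerivAt (fun x : EE d => ‖x‖ ^ 2) (2 • innerSL ℝ x) x :=
    (hasStrictFDerivAt_norm_sq x).hasFDerivAt
  have h2 : HasFDerivAt (fun x : EE d => inner ℝ b x) (innerSL ℝ b) x := (innerSL ℝ b).hasFDerivAt
  refine (((h1.const_mul A).add h2).add_const C).congr_fderiv ?_
  ext v
  simp [inner_add_left, inner_smul_left]; ring

lemma hasGradientAt_jb {d : ℕ} (x : EE d) : HasGradientAt jb ((2:ℝ) • x) x := by
  have := hasGradientAt_qf 1 0 1 x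
  have h : (jb : EE d → ℝ) = qf 1 0 1 := funext jb_eq_qf
  rw [h]; simpa using this

lemma HasGradientAt.scomp {d : ℕ} {u : EE d → ℝ} {a x : EE d} {f : ℝ → ℝ} {f' : ℝ}
    (hf : HasDerivAt f f' (u x)) (hu : HasGradientAt u a x) :
    HasGradientAt (fun y => f (u y)) (f' • a) x := by
  rw [hasGradientAt_iff_hasFDerivAt] at *
  refine (hf.comp_hasFDerivAt x hu).congr_fderiv ?_
  rw [map_smul]

lemma HasGradientAt.rpow_const' {d : ℕ} {u : EE d → ℝ} {a x : EE d} (s : ℝ) (hu : HasGradientAt u a x) (h : u x ≠ 0 ∨ 1 ≤ s) :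
    HasGradientAt (fun y => u y ^ s) ((s * u x ^ (s - 1)) • a) x :=
  HasGradientAt.scomp (f := fun t => t ^ s) (Real.hasDerivAt_rpow_const h) hu

lemma HasGradientAt.differentiableAt' {d : ℕ} {u : EE d → ℝ} {a x : EE d} (hu : HasGradientAt u a x) : DifferentiableAt ℝ u x :=
  (hasGradientAt_iff_hasFDerivAt.1 hu).differentiableAt

lemma hasGradientAt_jb_rpow {d : ℕ} (s : ℝ) (x : EE d) :
    HasGradientAt (fun y => jb y ^ s) ((2 * s * jb x ^ (s - 1)) • x) x := by
  have := (hasGradientAt_jb x).rpow_const' s (Or.inl (jb_pos x).ne')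
  rw [smul_smul] at this
  convert this using 2; ring

lemma contDiff_qf {d : ℕ} (A : ℝ) (b : EE d) (C : ℝ) {n : WithTop ℕ∞} : ContDiff ℝ n (qf A b C) := by
  unfold qf
  have := contDiff_norm_sq ℝ (E := EE d) (n := n)
  have h2 : ContDiff ℝ n (fun x : EE d => inner ℝ b x) := (innerSL ℝ b).contDiff
  exact ((contDiff_const.mul this).add h2).add contDiff_const

lemma contDiff_jb {d : ℕ} {n : WithTop ℕ∞} : ContDiff ℝ n (jb : EE d → ℝ) := by
  have h : (jb : EE d → ℝ) = qf 1 0 1 := funext jb_eq_qf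
  rw [h]; exact contDiff_qf _ _ _

lemma contDiff_jb_rpow {d : ℕ} {n : WithTop ℕ∞} (s : ℝ) : ContDiff ℝ n (fun x : EE d => jb x ^ s) :=
  contDiff_jb.rpow_const_of_ne fun x => (jb_pos x).ne'

lemma integrable_jb_rpow {d : ℕ} {s : ℝ} (hs : (d : ℝ) / 2 < s) : Integrable (fun x : EE d => jb x ^ (-s)) := by
  have := integrable_rpow_neg_one_add_norm_sq (μ := (volume : Measure (EE d))) (r := 2 * s) (by simp; linarith)
  convert this using 3
  · rfl
  · ring

lemma norm_le_sqrt_jb {d : ℕ} (x : EE d) : ‖x‖ ≤ √(jb x) := by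
  apply Real.le_sqrt_of_sq_le; unfold jb; linarith

lemma sqrt_jb_eq {d : ℕ} (x : EE d) : √(jb x) = jb x ^ (1/2 : ℝ) := Real.sqrt_eq_rpow _

lemma two_lt_pp {d : ℕ} (hd : 3 ≤ d) : 2 < pp d := by
  have : (3:ℝ) ≤ d := by exact_mod_cast hd
  unfold pp
  rw [lt_div_iff₀ (by linarith)]; linarith

namespace MemD12
variable {d : ℕ} {u : EE d → ℝ}

lemma diff (h : MemD12 d u) : Differentiable ℝ u := h.1
lemma cont (h : MemD12 d u) : Continuous u := h.1.continuous
lemma memLp_grad (h : MemD12 d u) : MemLp (gradient u) 2 :=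
  (memLp_two_iff_integrable_sq_norm (measurable_gradient u).aestronglyMeasurable).2 h.2.1
lemma int_pp (h : MemD12 d u) : Integrable (fun x => |u x| ^ pp d) := h.2.2
lemma hasGrad (h : MemD12 d u) (x : EE d) : HasGradientAt u (gradient u x) x := (h.1 x).hasGradientAt
lemma memLp_pp (hd : 3 ≤ d) (h : MemD12 d u) : MemLp u (ENNReal.ofReal (pp d)) := by
  have h2 := two_lt_pp hd
  rw [← integrable_norm_rpow_iff h.cont.aestronglyMeasurable (by simp; linarith) (by simp)]
  rw [ENNReal.toReal_ofReal (by linarith)]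
  exact h.int_pp
lemma mk' (hd : 3 ≤ d) (h : Differentiable ℝ u) (h1 : MemLp (gradient u) 2) (h2 : MemLp u (ENNReal.ofReal (pp d))) : MemD12 d u := by
  have h3 := two_lt_pp hd
  refine ⟨h, (memLp_two_iff_integrable_sq_norm (measurable_gradient u).aestronglyMeasurable).1 h1, ?_⟩
  rw [← integrable_norm_rpow_iff h.continuous.aestronglyMeasurable (by simp; linarith) (by simp)] at h2
  rw [ENNReal.toReal_ofReal (by linarith)] at h2
  exact h2

lemma gradient_add' {u v : EE d → ℝ} (hu : Differentiable ℝ u) (hv : Differentiable ℝ v) :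
    gradient (fun x => u x + v x) = fun x => gradient u x + gradient v x := by
  ext1 x
  refine HasGradientAt.gradient ?_
  have h1 := (hu x).hasGradientAt
  have h2 := (hv x).hasGradientAt
  rw [hasGradientAt_iff_hasFDerivAt] at *
  rw [map_add]; exact h1.add h2

lemma gradient_const_mul' {u : EE d → ℝ} (hu : Differentiable ℝ u) (c : ℝ) :
    gradient (fun x => c * u x) = fun x => c • gradient u x := by
  ext1 x
  refine HasGradientAt.gradient ?_
  have h1 := (hu x).hasGradientAt
  rw [hasGradientAt_iff_hasFDerivAt] at *
  rw [map_smul]; exact h1.const_mul c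

lemma add (hd : 3 ≤ d) {v : EE d → ℝ} (hu : MemD12 d u) (hv : MemD12 d v) : MemD12 d (fun x => u x + v x) := by
  refine mk' hd (hu.1.add hv.1) ?_ ((hu.memLp_pp hd).add (hv.memLp_pp hd))
  rw [gradient_add' hu.1 hv.1]; exact hu.memLp_grad.add hv.memLp_grad

lemma const_mul (hd : 3 ≤ d) (hu : MemD12 d u) (c : ℝ) : MemD12 d (fun x => c * u x) := by
  refine mk' hd (hu.1.const_mul c) ?_ ((hu.memLp_pp hd).const_mul c)
  rw [gradient_const_mul' hu.1]; exact hu.memLp_grad.const_smul c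

lemma gradient_sq (hu : Differentiable ℝ u) (x : EE d) : gradient (fun x => u x ^ 2) x = (2 * u x) • gradient u x := by
  have := gradient_mul' (hu x) (hu x)
  simp_rw [pow_two]
  rw [this, ← add_smul]; congr 1; ring

lemma loc_grad_sq (hu : MemD12 d u) : LocallyIntegrable (gradient (fun x => u x ^ 2)) := by
  have : gradient (fun x => u x ^ 2) = fun x => (2 * u x) • gradient u x := by
    ext1 x; exact gradient_sq hu.1 x
  rw [this]
  exact (hu.memLp_grad.locallyIntegrable (by norm_num)).continuous_smul (continuous_const.mul hu.cont)

lemma int_sq_mul {s : ℝ} (hd : 3 ≤ d) (hu : MemD12 d u) (hs : 1 < s) : Integrable (fun x => u x ^ 2 * jb x ^ (-s)) := by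
  have hd' : (3:ℝ) ≤ d := by exact_mod_cast hd
  have h2 := two_lt_pp hd
  have hi : Integrable (fun x : EE d => jb x ^ (-(s * (d / 2)))) := integrable_jb_rpow (by nlinarith)
  refine Integrable.mono' (hu.int_pp.add hi) ?_ (Eventually.of_forall fun x => ?_)
  · exact ((hu.cont.pow 2).mul (contDiff_jb_rpow (n := 0) _).continuous).aestronglyMeasurable
  · have hP := jb_pos x
    rw [Real.norm_of_nonneg (by positivity)]
    change _ ≤ |u x| ^ pp d + _
    have hconj : (pp d / 2).HolderConjugate ((d:ℝ)/2) := by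
      rw [Real.holderConjugate_iff]
      refine ⟨by linarith, ?_⟩
      unfold pp
      have : (d:ℝ) - 2 ≠ 0 := by linarith
      field_simp; ring
    have := Real.young_inequality_of_nonneg (sq_nonneg (u x)) (Real.rpow_nonneg hP.le (-s)) hconj
    refine this.trans ?_
    have e1 : (u x ^ 2) ^ (pp d / 2) = |u x| ^ pp d := by
      rw [← sq_abs, ← Real.rpow_natCast, ← Real.rpow_mul (abs_nonneg _)]
      congr 1; push_cast; ring
    have e2 : (jb x ^ (-s)) ^ ((d:ℝ)/2) = jb x ^ (-(s * (d / 2))) := by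
      rw [← Real.rpow_mul hP.le]; congr 1; ring
    rw [e1, e2]
    apply add_le_add
    · exact div_le_self (by positivity) (by linarith)
    · exact div_le_self (by positivity) (by linarith)

end MemD12
end

open MeasureTheory Real
noncomputable section
open scoped ContDiff Topology
open Filter

namespace MemD12
variable {d : ℕ} {u : EE d → ℝ}

lemma contDiff_pow_smul_id (s : ℝ) : ContDiff ℝ 1 (fun x : EE d => jb x ^ s • x) :=
  (contDiff_jb_rpow s).smul contDiff_id

lemma dvg_pow_smul_id (s : ℝ) (x : EE d) : dvg (fun x : EE d => jb x ^ s • x) x =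
    2 * s * jb x ^ (s - 1) * ‖x‖ ^ 2 + d * jb x ^ s := by
  have h := hasGradientAt_jb_rpow s x
  rw [dvg_smul h.differentiableAt' (X := fun y => y) differentiableAt_id, h.gradient, dvg_id, inner_smul_left,
    real_inner_self_eq_norm_sq]
  simp; ring

lemma hardy_eps (hd : 3 ≤ d) (hu : MemD12 d u) {ε : ℝ} (h0 : 0 < ε) (h1 : ε ≤ 1/4) :
    ∫ x, u x ^ 2 * jb x ^ (-(1 + ε)) ≤ 16 * ∫ x, ‖gradient u x‖ ^ 2 := by
  have hd' : (3:ℝ) ≤ d := by exact_mod_cast hd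
  have hi := hu.int_sq_mul hd (s := 1 + ε) (by linarith)
  set X : EE d → EE d := fun x => jb x ^ (-(1 + ε)) • x with hX
  have hXc : ContDiff ℝ 1 X := contDiff_pow_smul_id _
  have hXn : ∀ x, ‖X x‖ ≤ jb x ^ (-(1+ε)) * √(jb x) := fun x => by
    have := jb_pos x
    rw [hX]; simp only; rw [norm_smul, Real.norm_of_nonneg (by positivity)]
    gcongr; exact norm_le_sqrt_jb x
  have hdv : ∀ x, dvg X x = d * jb x ^ (-(1+ε)) - 2 * (1 + ε) * jb x ^ (-(1+ε) - 1) * ‖x‖ ^ 2 := fun x => by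
    rw [hX, dvg_pow_smul_id]; ring
  have hP1 : ∀ x : EE d, 0 ≤ jb x ^ (-(1+ε) - 1) * ‖x‖ ^ 2 ∧ jb x ^ (-(1+ε) - 1) * ‖x‖ ^ 2 ≤ jb x ^ (-(1+ε)) := fun x => by
    have hp := jb_pos x
    refine ⟨by positivity, ?_⟩
    rw [Real.rpow_sub hp, Real.rpow_one, div_mul_eq_mul_div, div_le_iff₀ hp]
    gcongr; unfold jb; linarith
  have hgX : ∀ x, |inner ℝ (gradient (fun x => u x ^ 2) x) (X x)| ≤ 1/4 * (u x ^ 2 * jb x ^ (-(1 + ε))) + 4 * ‖gradient u x‖ ^ 2 := by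
    intro x
    have hp := jb_pos x
    have hp1 := one_le_jb x
    rw [gradient_sq hu.1, inner_smul_left]
    simp only [conj_trivial]
    rw [abs_mul]
    have h2 : |2 * u x| * |inner ℝ (gradient u x) (X x)| ≤ (2 * |u x|) * (‖gradient u x‖ * (jb x ^ (-(1+ε)) * √(jb x))) := by
      rw [abs_mul, abs_two]
      gcongr
      exact (abs_real_inner_le_norm _ _).trans (by gcongr; exact hXn x)
    refine h2.trans ?_
    set a := jb x ^ (-(1+ε)) with ha
    have ha0 : 0 < a := by positivity
    have hs : √(jb x) * √(jb x) = jb x := Real.mul_self_sqrt hp.le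
    have haj : a * jb x ≤ 1 := by
      rw [ha, ← Real.rpow_add_one hp.ne']
      apply Real.rpow_le_one_of_one_le_of_nonpos hp1; linarith
    have h4 : (|u x| * (a * √(jb x)))^2 ≤ u x ^2 * a := by
      have : (|u x| * (a * √(jb x)))^2 = (u x ^2 * a) * (a * jb x) := by
        rw [mul_pow, sq_abs, mul_pow, Real.sq_sqrt hp.le]; ring
      rw [this]
      exact mul_le_of_le_one_right (by positivity) haj
    nlinarith [sq_nonneg (|u x| * (a * √(jb x)) - 4 * ‖gradient u x‖)]
  have hgm : Measurable (gradient (fun x => u x ^ 2)) := measurable_gradient _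
  have hi1 : Integrable fun x => inner ℝ (gradient (fun x => u x ^ 2) x) (X x) := by
    refine Integrable.mono' ((hi.const_mul (1/4)).add (hu.2.1.const_mul 4)) ?_ (Eventually.of_forall hgX)
    exact (hgm.inner hXc.continuous.measurable).aestronglyMeasurable
  have hdvc : Continuous (dvg X) := by
    have : dvg X = fun x => d * jb x ^ (-(1+ε)) - 2 * (1 + ε) * jb x ^ (-(1+ε) - 1) * ‖x‖ ^ 2 := funext hdv
    rw [this]
    have := (contDiff_jb_rpow (d := d) (n := 0) (-(1+ε))).continuous
    have := (contDiff_jb_rpow (d := d) (n := 0) (-(1+ε) - 1)).continuous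
    fun_prop
  have hi2 : Integrable fun x => u x ^ 2 * dvg X x := by
    refine Integrable.mono' (hi.const_mul (d + 2 * (1+ε))) ((hu.cont.pow 2).mul hdvc).aestronglyMeasurable (Eventually.of_forall fun x => ?_)
    obtain ⟨h3, h4⟩ := hP1 x
    have hp := jb_pos x
    rw [norm_mul, Real.norm_of_nonneg (sq_nonneg _), hdv, Real.norm_eq_abs]
    have : |d * jb x ^ (-(1+ε)) - 2 * (1 + ε) * jb x ^ (-(1+ε) - 1) * ‖x‖ ^ 2| ≤ (d + 2 * (1+ε)) * jb x ^ (-(1+ε)) := by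
      have h5 : 0 < jb x ^ (-(1+ε)) := by positivity
      rw [abs_le]; constructor <;> nlinarith
    calc _ ≤ u x ^ 2 * ((d + 2 * (1+ε)) * jb x ^ (-(1+ε))) := by gcongr
      _ = _ := by ring
  have key := ibp (fun x => u x ^ 2) X (hu.1.pow 2) hXc hu.loc_grad_sq (hi1.add hi2) (by
    refine Integrable.mono' hi ?_ (Eventually.of_forall fun x => ?_)
    · have := hXc.continuous
      refine Continuous.aestronglyMeasurable ?_
      exact ((hu.cont.pow 2).mul this.norm).div (continuous_jb.sqrt) (fun x => (Real.sqrt_pos.2 (jb_pos x)).ne')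
    · have hs := Real.sqrt_pos.2 (jb_pos x)
      rw [Real.norm_of_nonneg (by positivity), mul_div_assoc]
      gcongr
      rw [div_le_iff₀ hs]; exact hXn x)
  rw [integral_add hi1 hi2] at key
  have k1 : -∫ x, inner ℝ (gradient (fun x => u x ^ 2) x) (X x) ≤ 1/4 * (∫ x, u x ^ 2 * jb x ^ (-(1 + ε))) + 4 * ∫ x, ‖gradient u x‖ ^ 2 := by
    rw [← integral_const_mul, ← integral_const_mul, ← integral_add (hi.const_mul _) (hu.2.1.const_mul 4), ← integral_neg]
    refine integral_mono hi1.neg ((hi.const_mul (1/4)).add (hu.2.1.const_mul 4)) fun x => ?_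
    exact (neg_le_abs _).trans (hgX x)
  have k2 : (1/2) * (∫ x, u x ^ 2 * jb x ^ (-(1 + ε))) ≤ ∫ x, u x ^ 2 * dvg X x := by
    rw [← integral_const_mul]
    refine integral_mono (hi.const_mul _) hi2 fun x => ?_
    simp only
    obtain ⟨h3, h4⟩ := hP1 x
    have h5 : (1/2) * jb x ^ (-(1+ε)) ≤ dvg X x := by
      have hp := jb_pos x
      have h5 : 0 < jb x ^ (-(1+ε)) := by positivity
      rw [hdv]; nlinarith
    nlinarith [sq_nonneg (u x)]
  linarith

lemma hardy (hd : 3 ≤ d) (hu : MemD12 d u) :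
    Integrable (fun x => u x ^ 2 / jb x) ∧ ∫ x, u x ^ 2 / jb x ≤ 16 * ∫ x, ‖gradient u x‖ ^ 2 := by
  have he : ∀ n : ℕ, (0:ℝ) < 1 / ((n:ℝ) + 4) ∧ 1 / ((n:ℝ) + 4) ≤ 1/4 := fun n => by
    refine ⟨by positivity, ?_⟩
    apply one_div_le_one_div_of_le (by norm_num); linarith [Nat.cast_nonneg (α := ℝ) n]
  have ht : Tendsto (fun n : ℕ => 1 / ((n:ℝ) + 4)) atTop (𝓝 0) := by
    simp_rw [one_div]
    exact (tendsto_atTop_add_const_right _ _ tendsto_natCast_atTop_atTop).inv_tendsto_atTop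
  refine fatou_real (f := fun n x => u x ^ 2 * jb x ^ (-(1 + 1 / ((n:ℝ) + 4)))) (c := fun _ => 16 * ∫ x, ‖gradient u x‖ ^ 2)
    (fun n x => ?_) (fun n => hu.int_sq_mul hd (by linarith [(he n).1])) (fun n => hu.hardy_eps hd (he n).1 (he n).2) tendsto_const_nhds
    (Eventually.of_forall fun x => ?_)
  · have := jb_pos x; positivity
  · have hp := jb_pos x
    have : Tendsto (fun n : ℕ => -(1 + 1 / ((n:ℝ) + 4))) atTop (𝓝 (-1)) := by
      simpa using (ht.const_add 1).neg
    have h1 := ((Real.continuousAt_const_rpow (a := jb x) (b := -1) hp.ne').tendsto.comp this).const_mul (u x ^ 2)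
    rw [Real.rpow_neg_one] at h1
    exact h1

/-- Closure of the energy space under multiplication. -/
lemma mul_bdd (hd : 3 ≤ d) (hu : MemD12 d u) {h : EE d → ℝ} (hh : Differentiable ℝ h) {K : ℝ}
    (h1 : ∀ x, |h x| ≤ K) (h2 : ∀ x, ‖gradient h x‖ ≤ K / √(jb x)) : MemD12 d (fun x => u x * h x) := by
  have hK : 0 ≤ K := (abs_nonneg _).trans (h1 0)
  refine mk' hd (hu.1.mul hh) ?_ ?_
  · have : gradient (fun x => u x * h x) = fun x => h x • gradient u x + u x • gradient h x := by
      ext1 x; exact gradient_mul' (hu.1 x) (hh x)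
    rw [this]
    have m1 : MemLp (fun x => u x / √(jb x)) 2 := by
      rw [memLp_two_iff_integrable_sq]
      · simp_rw [div_pow]
        convert (hu.hardy hd).1 using 3 with x
        exact Real.sq_sqrt (jb_pos _).le
      · exact (hu.cont.div continuous_jb.sqrt (fun x => (Real.sqrt_pos.2 (jb_pos x)).ne')).aestronglyMeasurable
    refine MemLp.add ?_ ?_
    · refine (hu.memLp_grad).of_le_mul (c := K) ?_ (Eventually.of_forall fun x => ?_)
      · exact (hh.continuous.measurable.smul (measurable_gradient u)).aestronglyMeasurable
      · rw [norm_smul]; gcongr; exact h1 x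
    · refine m1.of_le_mul (c := K) ?_ (Eventually.of_forall fun x => ?_)
      · exact (hu.cont.measurable.smul (measurable_gradient h)).aestronglyMeasurable
      · rw [norm_smul, norm_div, Real.norm_of_nonneg (Real.sqrt_nonneg (jb x))]
        calc ‖u x‖ * ‖gradient h x‖ ≤ ‖u x‖ * (K / √(jb x)) := by gcongr; exact h2 x
          _ = _ := by ring
  · refine (hu.memLp_pp hd).of_le_mul (c := K) (hu.cont.mul hh.continuous).aestronglyMeasurable (Eventually.of_forall fun x => ?_)
    rw [norm_mul, mul_comm]; gcongr; exact h1 x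

end MemD12

/-- the (unnormalised) bubble -/
def UU {d : ℕ} (x : EE d) : ℝ := jb x ^ (-(((d:ℝ) - 2) / 2))

lemma UU_pos {d : ℕ} (x : EE d) : 0 < UU x := Real.rpow_pos_of_pos (jb_pos x) _

lemma UU_pp {d : ℕ} (hd : 3 ≤ d) (x : EE d) : UU x ^ pp d = jb x ^ (-(d:ℝ)) := by
  have hd' : (3:ℝ) ≤ d := by exact_mod_cast hd
  rw [UU, ← Real.rpow_mul (jb_pos x).le, pp]
  congr 1
  have : (d:ℝ) - 2 ≠ 0 := by linarith
  field_simp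

lemma UU_grad {d : ℕ} (x : EE d) : HasGradientAt UU ((-((d:ℝ) - 2) * jb x ^ (-((d:ℝ)/2))) • x) x := by
  convert hasGradientAt_jb_rpow (d := d) (-(((d:ℝ) - 2) / 2)) x using 2
  · rfl
  · rw [show -(((d:ℝ) - 2) / 2) - 1 = -((d:ℝ)/2) by ring]; ring

lemma memD12_UU {d : ℕ} (hd : 3 ≤ d) : MemD12 d UU := by
  have hd' : (3:ℝ) ≤ d := by exact_mod_cast hd
  refine ⟨fun x => (UU_grad x).differentiableAt', ?_, ?_⟩
  · have hi : Integrable (fun x : EE d => ((d:ℝ) - 2)^2 * jb x ^ (-((d:ℝ) - 1))) := (integrable_jb_rpow (by linarith)).const_mul _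
    refine hi.mono' ((measurable_gradient _).norm.pow_const 2).aestronglyMeasurable (Eventually.of_forall fun x => ?_)
    have hp := jb_pos x
    rw [Real.norm_of_nonneg (by positivity), (UU_grad x).gradient, norm_smul, mul_pow, norm_mul, Real.norm_of_nonneg (by positivity : 0 ≤ jb x ^ (-((d:ℝ)/2)))]
    rw [mul_pow, norm_neg, Real.norm_of_nonneg (by linarith), mul_assoc]
    gcongr
    rw [← Real.rpow_natCast, ← Real.rpow_mul hp.le]
    calc jb x ^ (-((d:ℝ)/2) * (2:ℕ)) * ‖x‖^2 ≤ jb x ^ (-(d:ℝ)) * jb x := by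
          gcongr
          · exact one_le_jb x
          · push_cast; linarith
          · unfold jb; linarith
      _ = _ := by rw [← Real.rpow_add_one hp.ne']; congr 1; ring
  · change Integrable (fun x => |UU x| ^ pp d)
    simp_rw [abs_of_pos (UU_pos _), UU_pp hd]
    exact integrable_jb_rpow (by linarith)
end

open MeasureTheory Real
noncomputable section
open scoped ContDiff Topology
open Filter

/-- Admissible conformal quadratic. -/
structure AdmT {d : ℕ} (A : ℝ) (b : EE d) (C : ℝ) : Prop where
  disc : A * C - ‖b‖ ^ 2 / 4 = 1
  posA : 0 < A
  cmp : ∃ m > 0, ∀ x, m * jb x ≤ qf A b C x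

/-- field X_T = -κ ∇T / T -/
def XT {d : ℕ} (A : ℝ) (b : EE d) (C : ℝ) (x : EE d) : EE d :=
  (-(((d:ℝ) - 2) / 2) * (qf A b C x)⁻¹) • ((2 * A) • x + b)

namespace AdmT
variable {d : ℕ} {A C : ℝ} {b : EE d}

lemma pos (h : AdmT A b C) (x : EE d) : 0 < qf A b C x := by
  obtain ⟨m, hm, h2⟩ := h.cmp
  exact (mul_pos hm (jb_pos x)).trans_le (h2 x)

lemma norm_grad_sq (h : AdmT A b C) (x : EE d) : ‖(2 * A) • x + b‖ ^ 2 = 4 * A * qf A b C x - 4 := by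
  have := h.disc
  rw [norm_add_sq_real, norm_smul, inner_smul_left, qf, real_inner_comm]
  simp
  rw [mul_pow, mul_pow, sq_abs]
  have h2 : ‖b‖^2 = 4 * (A * C) - 4 := by linarith
  rw [h2]; ring

lemma dvg_grad (x : EE d) : dvg (fun x => (2 * A) • x + b) x = 2 * A * d := by
  have h1 : DifferentiableAt ℝ (fun y : EE d => (2 * A) • y) x := by fun_prop
  rw [dvg_add h1 (differentiableAt_const b), dvg_const]
  have := dvg_smul (a := fun _ => 2 * A) (X := fun y : EE d => y) (x := x) (differentiableAt_const _) differentiableAt_id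
  rw [this, dvg_id, gradient_fun_const]; simp

lemma grad_inv (h : AdmT A b C) (x : EE d) :
    HasGradientAt (fun x => -(((d:ℝ) - 2) / 2) * (qf A b C x)⁻¹) ((((d:ℝ) - 2) / 2 / (qf A b C x) ^ 2) • ((2 * A) • x + b)) x := by
  have h1 : HasDerivAt (fun t : ℝ => -(((d:ℝ) - 2) / 2) * t⁻¹) (((d:ℝ) - 2) / 2 / (qf A b C x) ^ 2) (qf A b C x) := by
    refine ((hasDerivAt_inv (h.pos x).ne').const_mul (-(((d:ℝ) - 2) / 2))).congr_deriv ?_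
    ring
  exact HasGradientAt.scomp (f := fun t : ℝ => -(((d:ℝ) - 2) / 2) * t⁻¹) h1 (hasGradientAt_qf A b C x)

lemma contDiff_XT (h : AdmT A b C) {n : WithTop ℕ∞} : ContDiff ℝ n (XT A b C) := by
  unfold XT
  have h1 : ContDiff ℝ n (fun x => (qf A b C x)⁻¹) := (contDiff_qf A b C).inv fun x => (h.pos x).ne'
  exact (contDiff_const.mul h1).smul (by fun_prop)

lemma norm_XT_sq (h : AdmT A b C) (x : EE d) : ‖XT A b C x‖ ^ 2 =
    (((d:ℝ) - 2) / 2) ^ 2 * (qf A b C x)⁻¹ ^ 2 * (4 * A * qf A b C x - 4) := by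
  rw [XT, norm_smul, mul_pow, h.norm_grad_sq, Real.norm_eq_abs, sq_abs]; ring

lemma dvg_XT (h : AdmT A b C) (x : EE d) : dvg (XT A b C) x =
    (((d:ℝ) - 2) / 2) * (qf A b C x)⁻¹ ^ 2 * (4 * A * qf A b C x - 4) - ((d:ℝ) - 2) / 2 * (qf A b C x)⁻¹ * (2 * A * d) := by
  have hg := h.grad_inv x
  have h2 : DifferentiableAt ℝ (fun x : EE d => (2 * A) • x + b) x := by fun_prop
  have := dvg_smul hg.differentiableAt' h2
  unfold XT
  rw [this, hg.gradient, inner_smul_left, real_inner_self_eq_norm_sq, h.norm_grad_sq, dvg_grad]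
  simp; ring

lemma riccati (h : AdmT A b C) (x : EE d) : dvg (XT A b C) x + ‖XT A b C x‖ ^ 2 = - (d * ((d:ℝ) - 2) / (qf A b C x) ^ 2) := by
  rw [h.dvg_XT, h.norm_XT_sq]
  have := (h.pos x).ne'
  field_simp; ring

lemma norm_XT_le (h : AdmT A b C) : ∃ K, 0 ≤ K ∧ ∀ x, ‖XT A b C x‖ ≤ K / √(jb x) := by
  obtain ⟨m, hm, hm2⟩ := h.cmp
  have hA := h.posA
  refine ⟨√((((d:ℝ) - 2) / 2) ^ 2 * (4 * A) / m), by positivity, fun x => ?_⟩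
  have hT := h.pos x
  have hP := jb_pos x
  rw [← Real.sqrt_div (by positivity)]
  apply Real.le_sqrt_of_sq_le
  rw [h.norm_XT_sq]
  calc (((d:ℝ) - 2) / 2) ^ 2 * (qf A b C x)⁻¹ ^ 2 * (4 * A * qf A b C x - 4) ≤
        (((d:ℝ) - 2) / 2) ^ 2 * (qf A b C x)⁻¹ ^ 2 * (4 * A * qf A b C x) := by gcongr; linarith
    _ = (((d:ℝ) - 2) / 2) ^ 2 * (4 * A) * (qf A b C x)⁻¹ := by field_simp
    _ ≤ (((d:ℝ) - 2) / 2) ^ 2 * (4 * A) * (m * jb x)⁻¹ := by gcongr; exact hm2 x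
    _ = _ := by rw [mul_inv]; ring

lemma jb_le (h : AdmT A b C) : ∃ K > 0, ∀ x, (qf A b C x)⁻¹ ≤ K / jb x := by
  obtain ⟨m, hm, hm2⟩ := h.cmp
  refine ⟨m⁻¹, by positivity, fun x => ?_⟩
  have hP := jb_pos x
  rw [div_eq_mul_inv, ← mul_inv]
  exact inv_anti₀ (by positivity) (hm2 x)

end AdmT

lemma admT_jb {d : ℕ} : AdmT (d := d) 1 0 1 := ⟨by simp, by norm_num, 1, by norm_num, fun x => by rw [jb_eq_qf]; simp⟩

namespace MemD12
variable {d : ℕ} {u : EE d → ℝ}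

lemma memLp_div (hd : 3 ≤ d) (hu : MemD12 d u) : MemLp (fun x => u x / √(jb x)) 2 := by
  rw [memLp_two_iff_integrable_sq]
  · simp_rw [div_pow]
    convert (hu.hardy hd).1 using 3 with x
    exact Real.sq_sqrt (jb_pos _).le
  · exact (hu.cont.div continuous_jb.sqrt (fun x => (Real.sqrt_pos.2 (jb_pos x)).ne')).aestronglyMeasurable

lemma memLp_smul_X (hd : 3 ≤ d) (hu : MemD12 d u) {X : EE d → EE d} (hX : Measurable X) {K : ℝ}
    (h2 : ∀ x, ‖X x‖ ≤ K / √(jb x)) : MemLp (fun x => u x • X x) 2 := by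
  refine (hu.memLp_div hd).of_le_mul (c := K) ?_ (Eventually.of_forall fun x => ?_)
  · exact (hu.cont.measurable.smul hX).aestronglyMeasurable
  · rw [norm_smul, norm_div, Real.norm_of_nonneg (Real.sqrt_nonneg (jb x))]
    calc ‖u x‖ * ‖X x‖ ≤ ‖u x‖ * (K / √(jb x)) := by gcongr; exact h2 x
      _ = _ := by ring

lemma int_sq_div (hd : 3 ≤ d) (hu : MemD12 d u) {A C : ℝ} {b : EE d} (h : AdmT A b C) :
    Integrable fun x => u x ^ 2 / (qf A b C x) ^ 2 := by
  obtain ⟨K, hK, hK2⟩ := h.jb_le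
  have hi := hu.int_sq_mul hd (s := 2) (by norm_num)
  refine (hi.const_mul (K^2)).mono' ?_ (Eventually.of_forall fun x => ?_)
  · exact ((hu.cont.pow 2).div ((contDiff_qf (n := 0) A b C).continuous.pow 2) (fun x => (pow_pos (h.pos x) 2).ne')).aestronglyMeasurable
  · have hT := h.pos x
    have hP := jb_pos x
    rw [Real.norm_of_nonneg (by positivity), div_eq_mul_inv, ← inv_pow]
    calc u x ^ 2 * (qf A b C x)⁻¹ ^ 2 ≤ u x ^ 2 * (K / jb x) ^ 2 := by gcongr; exact hK2 x
      _ = _ := by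
        rw [Real.rpow_neg hP.le, div_pow]; norm_cast; ring

lemma memLp_D (hd : 3 ≤ d) (hu : MemD12 d u) {A C : ℝ} {b : EE d} (h : AdmT A b C) :
    MemLp (fun x => gradient u x - u x • XT A b C x) 2 := by
  obtain ⟨K, hK, hK2⟩ := h.norm_XT_le
  exact hu.memLp_grad.sub (hu.memLp_smul_X hd (h.contDiff_XT (n := 0)).continuous.measurable hK2)

lemma int_D (hd : 3 ≤ d) (hu : MemD12 d u) {A C : ℝ} {b : EE d} (h : AdmT A b C) :
    Integrable (fun x => ‖gradient u x - u x • XT A b C x‖ ^ 2) :=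
  (memLp_two_iff_integrable_sq_norm (hu.memLp_D hd h).1).1 (hu.memLp_D hd h)

/-- ground state representation -/
lemma ground (hd : 3 ≤ d) (hu : MemD12 d u) {A C : ℝ} {b : EE d} (h : AdmT A b C) :
    ∫ x, ‖gradient u x‖ ^ 2 = (∫ x, ‖gradient u x - u x • XT A b C x‖ ^ 2) + d * ((d:ℝ) - 2) * ∫ x, u x ^ 2 / (qf A b C x) ^ 2 := by
  have i1 := hu.int_D hd h
  have i2 := hu.int_sq_div hd h
  have pt : ∀ x, inner ℝ (gradient (fun x => u x ^ 2) x) (XT A b C x) + u x ^ 2 * dvg (XT A b C) x =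
      ‖gradient u x‖ ^ 2 - ‖gradient u x - u x • XT A b C x‖ ^ 2 - d * ((d:ℝ) - 2) * (u x ^ 2 / (qf A b C x) ^ 2) := by
    intro x
    rw [gradient_sq hu.1, norm_sub_sq_real, norm_smul, inner_smul_left, inner_smul_right, mul_pow, Real.norm_eq_abs, sq_abs]
    have := h.riccati x
    have h2 : dvg (XT A b C) x = - (d * ((d:ℝ) - 2) / (qf A b C x) ^ 2) - ‖XT A b C x‖ ^ 2 := by linarith
    rw [h2]; simp; ring
  obtain ⟨K, hK, hK2⟩ := h.norm_XT_le
  have key := ibp (fun x => u x ^ 2) (XT A b C) (hu.1.pow 2) h.contDiff_XT hu.loc_grad_sq (by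
    simp_rw [pt]
    exact (hu.2.1.sub i1).sub (i2.const_mul _)) (by
    refine Integrable.mono' ((hu.hardy hd).1.const_mul K) ?_ (Eventually.of_forall fun x => ?_)
    · refine Continuous.aestronglyMeasurable ?_
      exact ((hu.cont.pow 2).mul (h.contDiff_XT (n := 0)).continuous.norm).div (continuous_jb.sqrt) (fun x => (Real.sqrt_pos.2 (jb_pos x)).ne')
    · have hs := Real.sqrt_pos.2 (jb_pos x)
      rw [Real.norm_of_nonneg (by positivity)]
      calc u x ^ 2 * ‖XT A b C x‖ / √(jb x) ≤ u x ^ 2 * (K / √(jb x)) / √(jb x) := by gcongr; exact hK2 x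
        _ = K * u x ^ 2 / (√(jb x) * √(jb x)) := by field_simp
        _ = _ := by rw [Real.mul_self_sqrt (jb_pos x).le]; ring)
  simp_rw [pt] at key
  have i12 : Integrable fun x => ‖gradient u x‖ ^ 2 - ‖gradient u x - u x • XT A b C x‖ ^ 2 := hu.2.1.sub i1
  rw [integral_sub i12 (i2.const_mul _), integral_sub hu.2.1 i1, integral_const_mul] at key
  linarith

end MemD12

/-- Conformal factor: h = (T/P)^{-κ}. -/
def hT {d : ℕ} (A : ℝ) (b : EE d) (C : ℝ) (x : EE d) : ℝ := (qf A b C x / jb x) ^ (-(((d:ℝ) - 2) / 2))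

lemma hT_eq {d : ℕ} {A C : ℝ} {b : EE d} (h : AdmT A b C) :
    hT A b C = fun x => qf A b C x ^ (-(((d:ℝ) - 2) / 2)) * jb x ^ ((((d:ℝ) - 2) / 2)) := by
  ext x
  have hT' := h.pos x
  have hP := jb_pos x
  rw [hT, Real.div_rpow hT'.le hP.le, Real.rpow_neg hP.le, div_inv_eq_mul]

lemma hT_grad {d : ℕ} {A C : ℝ} {b : EE d} (h : AdmT A b C) (x : EE d) :
    HasGradientAt (hT A b C) (hT A b C x • (XT A b C x - XT 1 0 1 x)) x := by
  have hT := h.pos x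
  have hP := jb_pos x
  have h1 := (hasGradientAt_qf A b C x).rpow_const' (-(((d:ℝ) - 2) / 2)) (Or.inl hT.ne')
  have h2 := hasGradientAt_jb_rpow (((d:ℝ) - 2) / 2) x
  have h3 := h1.mul' h2
  rw [hT_eq h]
  convert h3 using 1
  simp only [XT, smul_smul, smul_sub, ← jb_eq_qf, Real.rpow_sub_one hT.ne', Real.rpow_sub_one hP.ne']
  module

lemma hT_pos {d : ℕ} {A C : ℝ} {b : EE d} (h : AdmT A b C) (x : EE d) : 0 < hT A b C x :=
  Real.rpow_pos_of_pos (div_pos (h.pos x) (jb_pos x)) _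

lemma hT_bdd {d : ℕ} (hd : 3 ≤ d) {A C : ℝ} {b : EE d} (h : AdmT A b C) :
    ∃ K, ∀ x, |hT A b C x| ≤ K ∧ ‖gradient (hT A b C) x‖ ≤ K / √(jb x) := by
  have hd' : (3:ℝ) ≤ d := by exact_mod_cast hd
  obtain ⟨m, hm, hm2⟩ := h.cmp
  obtain ⟨K1, hK1, h1⟩ := h.norm_XT_le
  obtain ⟨K2, hK2, h2⟩ := (admT_jb (d := d)).norm_XT_le
  set K0 := m ^ (-(((d:ℝ) - 2) / 2)) with hK0
  have hK0p : 0 < K0 := Real.rpow_pos_of_pos hm _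
  have hb : ∀ x, |hT A b C x| ≤ K0 := by
    intro x
    rw [abs_of_pos (hT_pos h x), hT, hK0]
    apply Real.rpow_le_rpow_of_nonpos hm _ (by linarith)
    rw [le_div_iff₀ (jb_pos x)]; exact hm2 x
  refine ⟨K0 * (1 + K1 + K2), fun x => ⟨?_, ?_⟩⟩
  · refine (hb x).trans ?_
    nlinarith [mul_nonneg hK0p.le hK1, mul_nonneg hK0p.le hK2]
  · rw [(hT_grad h x).gradient, norm_smul]
    have hs := Real.sqrt_pos.2 (jb_pos x)
    calc _ ≤ K0 * (K1 / √(jb x) + K2 / √(jb x)) := by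
          gcongr
          · exact hb x
          · exact (norm_sub_le _ _).trans (add_le_add (h1 x) (h2 x))
      _ = K0 * (K1 + K2) / √(jb x) := by ring
      _ ≤ _ := by gcongr; linarith

/-- Dirichlet energy relative to the bubble. -/
def DD {d : ℕ} (u : EE d → ℝ) : ℝ := ∫ x, ‖gradient u x - u x • XT 1 0 1 x‖ ^ 2

namespace MemD12
variable {d : ℕ} {u : EE d → ℝ}

lemma mul_hT (hd : 3 ≤ d) (hu : MemD12 d u) {A C : ℝ} {b : EE d} (h : AdmT A b C) :
    MemD12 d (fun x => u x * hT A b C x) := by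
  obtain ⟨K, hK⟩ := hT_bdd hd h
  exact hu.mul_bdd hd (fun x => (hT_grad h x).differentiableAt') (fun x => (hK x).1) (fun x => (hK x).2)

lemma energy_hT (hd : 3 ≤ d) (hu : MemD12 d u) {A C : ℝ} {b : EE d} (h : AdmT A b C) :
    ∫ x, ‖gradient (fun x => u x * hT A b C x) x‖ ^ 2 =
      (∫ x, hT A b C x ^ 2 * ‖gradient u x - u x • XT 1 0 1 x‖ ^ 2) +
      d * ((d:ℝ) - 2) * ∫ x, (u x * hT A b C x) ^ 2 / (qf A b C x) ^ 2 := by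
  rw [(hu.mul_hT hd h).ground hd h]
  congr 2
  ext x
  rw [gradient_mul' (hu.1 x) (hT_grad h x).differentiableAt', (hT_grad h x).gradient]
  rw [← sq_abs (hT A b C x), ← Real.norm_eq_abs, ← mul_pow, ← norm_smul]
  congr 2
  module

lemma energy_eq (hd : 3 ≤ d) (hu : MemD12 d u) :
    ∫ x, ‖gradient u x‖ ^ 2 = DD u + d * ((d:ℝ) - 2) * ∫ x, u x ^ 2 / (jb x) ^ 2 := by
  rw [hu.ground hd admT_jb]; simp_rw [← jb_eq_qf]; rfl

lemma int_D0 (hd : 3 ≤ d) (hu : MemD12 d u) : Integrable (fun x => ‖gradient u x - u x • XT 1 0 1 x‖ ^ 2) :=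
  hu.int_D hd admT_jb

lemma int_sq_div_jb (hd : 3 ≤ d) (hu : MemD12 d u) : Integrable fun x => u x ^ 2 / (jb x) ^ 2 := by
  have := hu.int_sq_div hd admT_jb
  simp_rw [← jb_eq_qf] at this; exact this

lemma DD_nonneg (u : EE d → ℝ) : 0 ≤ DD u := integral_nonneg fun x => by positivity

end MemD12

lemma UU_grad_XT {d : ℕ} (x : EE d) : gradient UU x = UU x • XT 1 0 1 x := by
  rw [(UU_grad x).gradient, XT, ← jb_eq_qf, UU, add_zero, smul_smul, smul_smul]
  congr 1
  rw [show -((d:ℝ)/2) = -(((d:ℝ) - 2) / 2) - 1 by ring, Real.rpow_sub_one (jb_pos x).ne']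
  field_simp

/-- Adding a multiple of the bubble does not change DD. -/
lemma DD_add_UU {d : ℕ} {u : EE d → ℝ} (hu : Differentiable ℝ u) (α β : ℝ) :
    DD (fun x => α * u x + β * UU x) = α ^ 2 * DD u := by
  have hU : Differentiable ℝ (UU : EE d → ℝ) := fun x => (UU_grad x).differentiableAt'
  unfold DD
  rw [← integral_const_mul]
  congr 1; ext x
  rw [MemD12.gradient_add' (hu.const_mul α) (hU.const_mul β), MemD12.gradient_const_mul' hu, MemD12.gradient_const_mul' hU]
  simp only
  rw [UU_grad_XT, ← sq_abs α, ← Real.norm_eq_abs, ← mul_pow, ← norm_smul]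
  congr 2
  module
end

open MeasureTheory Real
noncomputable section
open scoped ContDiff Topology
open Filter

open scoped Convolution in
lemma mollify_grad {d : ℕ} {f ψ : EE d → ℝ} (hf : ContDiff ℝ ∞ f) (hfc : HasCompactSupport f)
    (hψ : Differentiable ℝ ψ) (hψg : Integrable (gradient ψ)) (x : EE d) :
    HasGradientAt (f ⋆[ContinuousLinearMap.lsmul ℝ ℝ, volume] ψ) (∫ t, f (x - t) • gradient ψ t) x := by
  have hd := hfc.hasFDerivAt_convolution_left (μ := volume) (ContinuousLinearMap.lsmul ℝ ℝ) (hf.of_le (by simp))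
    hψ.continuous.locallyIntegrable x
  rw [hasGradientAt_iff_hasFDerivAt]
  refine hd.congr_fderiv ?_
  ext v
  obtain ⟨K, hK⟩ := hfc.exists_bound_of_continuous hf.continuous
  have hfx : Continuous fun t => f (x - t) := hf.continuous.comp (by fun_prop)
  have hIntegX : Integrable fun t => f (x - t) • gradient ψ t := by
    refine (hψg.norm.const_mul K).mono' (hfx.aestronglyMeasurable.smul hψg.1) (Eventually.of_forall fun t => ?_)
    rw [norm_smul]; gcongr; exact hK _
  have hcs : HasCompactSupport fun t => f (x - t) := by
    have := hfc.comp_homeomorph (Homeomorph.subLeft x)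
    exact this
  rw [convolution_eq_swap]
  have hcf : HasCompactSupport fun t => fderiv ℝ f (x - t) := by
    have := (hfc.fderiv (𝕜 := ℝ)).comp_homeomorph (Homeomorph.subLeft x)
    exact this
  have hcont : Continuous fun t => fderiv ℝ f (x - t) := (hf.continuous_fderiv (by simp)).comp (by fun_prop)
  have hint2 : Integrable fun t => ((ContinuousLinearMap.lsmul ℝ ℝ).precompL (EE d) (fderiv ℝ f (x - t))) (ψ t) := by
    refine Continuous.integrable_of_hasCompactSupport ?_ ?_
    · have := hψ.continuous
      exact (((ContinuousLinearMap.lsmul ℝ ℝ).precompL (EE d)).continuous.comp hcont).clm_apply this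
    · refine hcf.mono ?_
      intro t ht
      simp only [Function.mem_support] at ht ⊢
      intro h; apply ht; rw [h]; simp
  rw [ContinuousLinearMap.integral_apply hint2]
  simp only [InnerProductSpace.toDual_apply_apply]
  have hi3 : inner ℝ (∫ t, f (x - t) • gradient ψ t) v = ∫ t, f (x - t) * fderiv ℝ ψ t v := by
    rw [real_inner_comm, ← integral_inner hIntegX]
    congr 1; ext t
    rw [inner_smul_right, real_inner_comm, inner_gradient_left]
  rw [hi3]
  have hfd : ∀ t, fderiv ℝ (fun t => f (x - t)) t v = - fderiv ℝ f (x - t) v := by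
    intro t
    have h1 : HasFDerivAt f (fderiv ℝ f (x - t)) (x - t) := (hf.differentiable (by simp) _).hasFDerivAt
    have h2 : HasFDerivAt (fun t : EE d => x - t) (-ContinuousLinearMap.id ℝ (EE d)) t := (hasFDerivAt_id t).const_sub x
    have h3 : fderiv ℝ (fun t => f (x - t)) t = _ := (h1.comp t h2).fderiv
    rw [h3]; simp
  have := integral_mul_fderiv_eq_neg_fderiv_mul_of_integrable (μ := (volume : Measure (EE d)))
      (f := fun t => f (x - t)) (g := ψ) (v := v) ?_ ?_ ?_ (fun t _ => ?_) (fun t _ => hψ t)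
  · rw [this]
    simp_rw [hfd]
    simp [← integral_neg]
  · simp_rw [hfd]
    refine Continuous.integrable_of_hasCompactSupport ?_ ?_
    · exact (hcont.clm_apply continuous_const).neg.mul hψ.continuous
    · refine hcf.mono ?_
      intro t ht
      simp only [Function.mem_support] at ht ⊢
      intro h; apply ht; rw [h]; simp
  · have := hIntegX.inner_const (𝕜 := ℝ) v
    refine this.congr (Eventually.of_forall fun t => ?_)
    simp only
    rw [inner_smul_left, inner_gradient_left]; simp
  · exact (hfx.mul hψ.continuous).integrable_of_hasCompactSupport hcs.mul_right
  · exact (hf.differentiable (by simp) _).comp t (by fun_prop)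

lemma jensen_sq {α : Type*} [MeasurableSpace α] {μ : Measure α} {f g : α → ℝ} (hf : ∀ x, 0 ≤ f x) (hf1 : ∫ x, f x ∂μ = 1)
    (hfi : Integrable f μ) (h1 : Integrable (fun x => f x * g x) μ) (h2 : Integrable (fun x => f x * g x ^ 2) μ) :
    (∫ x, f x * g x ∂μ) ^ 2 ≤ ∫ x, f x * g x ^ 2 ∂μ := by
  set m := ∫ x, f x * g x ∂μ with hm
  have h3 : 0 ≤ ∫ x, (f x * g x ^ 2 - 2 * m * (f x * g x) + m ^ 2 * f x) ∂μ := by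
    apply integral_nonneg; intro x
    have : f x * g x ^ 2 - 2 * m * (f x * g x) + m ^ 2 * f x = f x * (g x - m) ^ 2 := by ring
    simp only [this]; exact mul_nonneg (hf x) (sq_nonneg _)
  have i1 : Integrable (fun x => f x * g x ^ 2 - 2 * m * (f x * g x)) μ := h2.sub (h1.const_mul _)
  rw [integral_add i1 (hfi.const_mul _), integral_sub h2 (h1.const_mul _), integral_const_mul, integral_const_mul, hf1, ← hm] at h3
  nlinarith

open scoped Convolution in
lemma mollify {d : ℕ} {ψ : EE d → ℝ} (hψ : Differentiable ℝ ψ) (hc : HasCompactSupport ψ)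
    (hg : MemLp (gradient ψ) 2) {ε : ℝ} (hε : 0 < ε) :
    ∃ g : EE d → ℝ, ContDiff ℝ ∞ g ∧ HasCompactSupport g ∧ (∀ x, |g x - ψ x| ≤ ε) ∧ ((∀ x, 0 ≤ ψ x) → ∀ x, 0 ≤ g x) ∧
      ∫ x, ‖gradient g x‖ ^ 2 ≤ ∫ x, ‖gradient ψ x‖ ^ 2 := by
  have huc := hc.uniformContinuous_of_continuous hψ.continuous
  obtain ⟨δ, hδ, h⟩ := Metric.uniformContinuous_iff.1 huc ε hε
  let b : ContDiffBump (0 : EE d) := ⟨δ/2, δ, by linarith, by linarith⟩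
  set f := b.normed (volume : Measure (EE d)) with hf
  have hfs : ContDiff ℝ ∞ f := b.contDiff_normed
  have hfc : HasCompactSupport f := b.hasCompactSupport_normed
  have hf0 : ∀ x, 0 ≤ f x := b.nonneg_normed
  have hf1 : ∫ x, f x = 1 := b.integral_normed
  have hfi : Integrable f := b.integrable_normed
  have hloc : LocallyIntegrable (gradient ψ) := hg.locallyIntegrable (by norm_num)
  have hgi : Integrable (gradient ψ) := by
    have hsub : Function.support (gradient ψ) ⊆ tsupport ψ := by
      intro x hx
      by_contra h
      apply hx
      have : fderiv ℝ ψ x = 0 := by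
        by_contra h'
        exact h (support_fderiv_subset ℝ h')
      rw [← norm_eq_zero, norm_gradient_eq, this, norm_zero]
    exact (integrableOn_iff_integrable_of_support_subset hsub).1 (hloc.integrableOn_isCompact hc)
  have hg2 : Integrable (fun x => ‖gradient ψ x‖ ^ 2) := (memLp_two_iff_integrable_sq_norm hg.1).1 hg
  refine ⟨f ⋆[ContinuousLinearMap.lsmul ℝ ℝ, volume] ψ, ?_, ?_, ?_, ?_, ?_⟩
  · exact hfc.contDiff_convolution_left _ hfs hψ.continuous.locallyIntegrable
  · exact hfc.convolution _ hc
  · intro x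
    refine b.dist_normed_convolution_le hψ.continuous.aestronglyMeasurable fun y hy => ?_
    exact (h (Metric.mem_ball.1 hy)).le
  · intro h0 x
    exact integral_nonneg fun t => mul_nonneg (hf0 _) (h0 _)
  · obtain ⟨K, hK⟩ := hfc.exists_bound_of_continuous hfs.continuous
    have hpt : ∀ x, ‖gradient (f ⋆[ContinuousLinearMap.lsmul ℝ ℝ, volume] ψ) x‖ ^ 2 ≤
        (f ⋆[ContinuousLinearMap.lsmul ℝ ℝ, volume] (fun y => ‖gradient ψ y‖ ^ 2)) x := by
      intro x
      rw [(mollify_grad hfs hfc hψ hgi x).gradient, convolution_lsmul_swap]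
      have hfx : Continuous fun t => f (x - t) := hfs.continuous.comp (by fun_prop)
      have hi1 : Integrable fun t => f (x - t) * ‖gradient ψ t‖ := by
        refine (hgi.norm.const_mul K).mono' (hfx.aestronglyMeasurable.mul hgi.1.norm) (Eventually.of_forall fun t => ?_)
        rw [norm_mul, norm_norm]; gcongr; exact hK _
      have hi2 : Integrable fun t => f (x - t) * ‖gradient ψ t‖ ^ 2 := by
        refine (hg2.const_mul K).mono' (hfx.aestronglyMeasurable.mul hg2.1) (Eventually.of_forall fun t => ?_)
        rw [norm_mul, norm_pow, norm_norm]; gcongr; exact hK _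
      have := jensen_sq (f := fun t => f (x - t)) (fun t => hf0 _) (by rw [integral_sub_left_eq_self f volume x, hf1])
        (hfi.comp_sub_left x) hi1 hi2
      refine le_trans ?_ this
      gcongr
      refine (norm_integral_le_integral_norm _).trans (le_of_eq ?_)
      congr 1; ext t
      rw [norm_smul, Real.norm_of_nonneg (hf0 _)]
    have hci : Integrable (f ⋆[ContinuousLinearMap.lsmul ℝ ℝ, volume] (fun y => ‖gradient ψ y‖ ^ 2)) := hfi.integrable_convolution _ hg2
    calc _ ≤ ∫ x, (f ⋆[ContinuousLinearMap.lsmul ℝ ℝ, volume] (fun y => ‖gradient ψ y‖ ^ 2)) x := by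
          refine integral_mono_of_nonneg (Eventually.of_forall fun x => by positivity) hci (Eventually.of_forall hpt)
      _ = _ := by
          rw [integral_convolution _ hfi hg2, hf1]; simp

lemma approx {d : ℕ} (hd : 3 ≤ d) {φ : EE d → ℝ} (hφ : MemD12 d φ) :
    ∃ (g : ℕ → EE d → ℝ) (c : ℕ → ℝ), (∀ n, ContDiff ℝ ∞ (g n)) ∧ (∀ n, HasCompactSupport (g n)) ∧
      ((∀ x, 0 ≤ φ x) → ∀ n x, 0 ≤ g n x) ∧ (∀ x, Tendsto (fun n => g n x) atTop (𝓝 (φ x))) ∧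
      (∀ n, ∫ x, ‖gradient (g n) x‖ ^ 2 ≤ c n) ∧ Tendsto c atTop (𝓝 (∫ x, ‖gradient φ x‖ ^ 2)) := by
  obtain ⟨χ, C, hC, h1, h2, h3, h4, h5, h6⟩ := exists_cutoff d
  have hχd : ∀ n, Differentiable ℝ (χ n) := fun n => (h1 n).differentiable (by simp)
  have hm : ∀ n, MemD12 d (fun x => φ x * χ n x) := fun n => by
    refine hφ.mul_bdd hd (hχd n) (K := 1 + C) (fun x => ?_) (fun x => (h4 n x).trans ?_)
    · rw [abs_of_nonneg (h3 n x).1]; linarith [(h3 n x).2]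
    · gcongr; linarith
  have he : ∀ n : ℕ, (0:ℝ) < 1 / ((n:ℝ) + 1) := fun n => by positivity
  choose g g1 g2 g3 g4 g5 using fun n => mollify (hm n).1 ((h2 n).mul_left) (hm n).memLp_grad (he n)
  refine ⟨g, fun n => ∫ x, ‖gradient (fun x => φ x * χ n x) x‖ ^ 2, g1, g2, ?_, ?_, g5, ?_⟩
  · intro h0 n; exact g4 n fun x => mul_nonneg (h0 x) (h3 n x).1
  · intro x
    have t1 : Tendsto (fun n => φ x * χ n x) atTop (𝓝 (φ x)) := by
      apply tendsto_const_nhds.congr'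
      filter_upwards [h5 x] with n hn
      rw [hn, mul_one]
    have t2 : Tendsto (fun n => g n x - φ x * χ n x) atTop (𝓝 0) :=
      squeeze_zero_norm (fun n => g3 n x) tendsto_one_div_add_atTop_nhds_zero_nat
    simpa using t2.add t1
  · have hgr : ∀ n x, gradient (fun x => φ x * χ n x) x = χ n x • gradient φ x + φ x • gradient (χ n) x :=
      fun n x => gradient_mul' (hφ.1 x) (hχd n x)
    refine tendsto_integral_of_dominated_convergence (fun x => 2 * ‖gradient φ x‖ ^ 2 + 2 * C ^ 2 * (φ x ^ 2 / jb x)) ?_ ?_ ?_ ?_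
    · intro n; exact ((measurable_gradient _).norm.pow_const 2).aestronglyMeasurable
    · exact (hφ.2.1.const_mul 2).add ((hφ.hardy hd).1.const_mul _)
    · intro n
      refine Eventually.of_forall fun x => ?_
      have hp := jb_pos x
      rw [Real.norm_of_nonneg (by positivity), hgr]
      have a1 : ‖χ n x • gradient φ x‖ ≤ ‖gradient φ x‖ := by
        rw [norm_smul, Real.norm_of_nonneg (h3 n x).1]
        exact mul_le_of_le_one_left (norm_nonneg _) (h3 n x).2
      have a2 : ‖φ x • gradient (χ n) x‖ ≤ |φ x| * (C / √(jb x)) := by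
        rw [norm_smul, Real.norm_eq_abs]; gcongr; exact h4 n x
      have a3 : (|φ x| * (C / √(jb x))) ^ 2 = C ^ 2 * (φ x ^ 2 / jb x) := by
        rw [mul_pow, sq_abs, div_pow, Real.sq_sqrt hp.le]; ring
      calc _ ≤ (‖gradient φ x‖ + |φ x| * (C / √(jb x))) ^ 2 := by
            gcongr; exact (norm_add_le _ _).trans (add_le_add a1 a2)
        _ ≤ 2 * ‖gradient φ x‖ ^ 2 + 2 * (|φ x| * (C / √(jb x))) ^ 2 := by
            nlinarith [sq_nonneg (‖gradient φ x‖ - |φ x| * (C / √(jb x)))]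
        _ = _ := by rw [a3]; ring
    · refine Eventually.of_forall fun x => ?_
      apply tendsto_const_nhds.congr'
      filter_upwards [h5 x, h6 x] with n a b
      rw [hgr, a, b]; simp

lemma memLp_of_smooth {d : ℕ} {g : EE d → ℝ} (h1 : ContDiff ℝ ∞ g) (h2 : HasCompactSupport g) :
    Integrable (fun x => ‖gradient g x‖ ^ 2) := by
  have hc : Continuous (fun x => ‖gradient g x‖ ^ 2) := by
    simp_rw [norm_gradient_eq]
    exact ((h1.continuous_fderiv (by simp)).norm).pow 2
  refine hc.integrable_of_hasCompactSupport ?_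
  refine (h2.fderiv (𝕜 := ℝ)).mono ?_
  intro x hx
  simp only [Function.mem_support] at hx ⊢
  intro h; apply hx; rw [norm_gradient_eq, h]; simp

lemma memD12_of_smooth {d : ℕ} (hd : 3 ≤ d) {g : EE d → ℝ} (h1 : ContDiff ℝ ∞ g) (h2 : HasCompactSupport g) : MemD12 d g := by
  have hp := two_lt_pp hd
  refine ⟨h1.differentiable (by simp), memLp_of_smooth h1 h2, ?_⟩
  change Integrable (fun x => |g x| ^ pp d)
  refine Continuous.integrable_of_hasCompactSupport ?_ ?_
  · exact h1.continuous.abs.rpow_const fun x => Or.inr (by linarith)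
  · refine h2.mono ?_
    intro x hx
    simp only [Function.mem_support] at hx ⊢
    intro h; apply hx; rw [h, abs_zero, Real.zero_rpow (by linarith)]

/-- `K` is a Sobolev constant. -/
def IsSob (d : ℕ) (K : ℝ) : Prop := ∀ u : EE d → ℝ, MemD12 d u → (∫ x, |u x| ^ pp d) ^ (2 / pp d) ≤ K * ∫ x, ‖gradient u x‖ ^ 2

lemma exists_sob_smooth {d : ℕ} (hd : 3 ≤ d) : ∃ K : ℝ, 0 ≤ K ∧ ∀ g : EE d → ℝ, ContDiff ℝ ∞ g → HasCompactSupport g →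
    (∫ x, |g x| ^ pp d) ^ (2 / pp d) ≤ K * ∫ x, ‖gradient g x‖ ^ 2 := by
  have hp := two_lt_pp hd
  have hd' : (3:ℝ) ≤ d := by exact_mod_cast hd
  set K := eLpNormLESNormFDerivOfEqInnerConst (volume : Measure (EE d)) ((2:NNReal):ℝ)
  refine ⟨(K:ℝ)^2, by positivity, fun g h1 h2 => ?_⟩
  have hm := memD12_of_smooth hd h1 h2
  have hs := eLpNorm_le_eLpNorm_fderiv_of_eq_inner (volume : Measure (EE d)) (h1.of_le (by simp) : ContDiff ℝ 1 g) h2 (p := 2)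
    (p' := (pp d).toNNReal) (by norm_num) (by simp; omega) (by
      rw [Real.coe_toNNReal _ (by linarith), pp]; simp
      have : (d:ℝ) - 2 ≠ 0 := by linarith
      field_simp)
  have e1 : eLpNorm g ((pp d).toNNReal) volume = ENNReal.ofReal ((∫ x, |g x| ^ pp d) ^ (pp d)⁻¹) := by
    have := (hm.memLp_pp hd).eLpNorm_eq_integral_rpow_norm (by simp; linarith) (by simp)
    rw [ENNReal.toReal_ofReal (by linarith)] at this
    exact this
  have e2 : eLpNorm (fderiv ℝ g) ((2:NNReal):ENNReal) volume = ENNReal.ofReal ((∫ x, ‖gradient g x‖ ^ 2) ^ (2:ℝ)⁻¹) := by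
    have h3 : MemLp (fderiv ℝ g) 2 := by
      rw [memLp_two_iff_integrable_sq_norm (measurable_fderiv ℝ g).aestronglyMeasurable]
      simp_rw [← norm_gradient_eq]; exact hm.2.1
    have := h3.eLpNorm_eq_integral_rpow_norm (by simp) (by simp)
    simp only [ENNReal.toReal_ofNat] at this
    simp_rw [norm_gradient_eq]
    rw [show ((2:NNReal):ENNReal) = 2 by rfl, this]
    norm_cast
  rw [e1, e2, ← ENNReal.ofReal_coe_nnreal, ← ENNReal.ofReal_mul (by positivity), ENNReal.ofReal_le_ofReal_iff (by positivity)] at hs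
  have h4 : 0 ≤ ∫ x, |g x| ^ pp d := integral_nonneg fun x => by positivity
  have h5 : 0 ≤ ∫ x, ‖gradient g x‖ ^ 2 := integral_nonneg fun x => by positivity
  calc (∫ x, |g x| ^ pp d) ^ (2 / pp d) = ((∫ x, |g x| ^ pp d) ^ (pp d)⁻¹) ^ 2 := by
        rw [← Real.rpow_natCast, ← Real.rpow_mul h4]; congr 1; push_cast; ring
    _ ≤ ((K:ℝ) * (∫ x, ‖gradient g x‖ ^ 2) ^ (2:ℝ)⁻¹) ^ 2 := by gcongr
    _ = _ := by
        rw [mul_pow]; congr 1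
        rw [← Real.rpow_natCast, ← Real.rpow_mul h5]; norm_num

lemma exists_sob {d : ℕ} (hd : 3 ≤ d) : ∃ K : ℝ, 0 < K ∧ IsSob d K := by
  have hp := two_lt_pp hd
  obtain ⟨K, hK, h⟩ := exists_sob_smooth hd
  refine ⟨K + 1, by linarith, fun u hu => ?_⟩
  obtain ⟨g, c, g1, g2, g3, g4, g5, g6⟩ := approx hd hu
  have hE : 0 ≤ ∫ x, ‖gradient u x‖ ^ 2 := integral_nonneg fun x => by positivity
  have key : ∫ x, |u x| ^ pp d ≤ (K * ∫ x, ‖gradient u x‖ ^ 2) ^ (pp d / 2) := by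
    refine (fatou_real (f := fun n x => |g n x| ^ pp d) (c := fun n => (K * c n) ^ (pp d / 2)) (fun n x => by positivity)
      (fun n => (memD12_of_smooth hd (g1 n) (g2 n)).int_pp) (fun n => ?_) ?_ (Eventually.of_forall fun x => ?_)).2
    · have h1 := (h (g n) (g1 n) (g2 n)).trans (mul_le_mul_of_nonneg_left (g5 n) hK)
      have h4 : 0 ≤ ∫ x, |g n x| ^ pp d := integral_nonneg fun x => by positivity
      calc ∫ x, |g n x| ^ pp d = ((∫ x, |g n x| ^ pp d) ^ (2 / pp d)) ^ (pp d / 2) := by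
            rw [← Real.rpow_mul h4]
            rw [show 2 / pp d * (pp d / 2) = 1 by field_simp, Real.rpow_one]
        _ ≤ _ := by gcongr
    · exact (g6.const_mul K).rpow_const (Or.inr (by linarith))
    · exact (g4 x).abs.rpow_const (Or.inr (by linarith))
  have h4 : 0 ≤ ∫ x, |u x| ^ pp d := integral_nonneg fun x => by positivity
  calc (∫ x, |u x| ^ pp d) ^ (2 / pp d) ≤ ((K * ∫ x, ‖gradient u x‖ ^ 2) ^ (pp d / 2)) ^ (2 / pp d) := by gcongr
    _ = K * ∫ x, ‖gradient u x‖ ^ 2 := by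
        rw [← Real.rpow_mul (by positivity)]
        rw [show pp d / 2 * (2 / pp d) = 1 by field_simp, Real.rpow_one]
    _ ≤ _ := by gcongr; linarith
end

open MeasureTheory Real
noncomputable section
open scoped ContDiff Topology
open Filter

lemma ftc_sq {f : ℝ → ℝ} (hf : Differentiable ℝ f) :
    ENNReal.ofReal ((f 1 - f 0) ^ 2) ≤ ∫⁻ t in Set.Ioc (0:ℝ) 1, ENNReal.ofReal (deriv f t ^ 2) := by
  by_cases h : ∫⁻ t in Set.Ioc (0:ℝ) 1, ENNReal.ofReal (deriv f t ^ 2) = ⊤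
  · rw [h]; exact le_top
  have hm : Measurable (deriv f) := measurable_deriv f
  have hi : Integrable (fun t => deriv f t ^ 2) (volume.restrict (Set.Ioc (0:ℝ) 1)) := by
    refine ⟨(hm.pow_const 2).aestronglyMeasurable, ?_⟩
    rw [hasFiniteIntegral_iff_ofReal (Eventually.of_forall fun t => sq_nonneg _)]
    exact lt_top_iff_ne_top.2 h
  have hl : MemLp (deriv f) 2 (volume.restrict (Set.Ioc (0:ℝ) 1)) := (memLp_two_iff_integrable_sq hm.aestronglyMeasurable).2 hi
  have hi1 : Integrable (deriv f) (volume.restrict (Set.Ioc (0:ℝ) 1)) := hl.integrable (by norm_num)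
  have e : ∫ t in (0:ℝ)..1, deriv f t = f 1 - f 0 :=
    intervalIntegral.integral_eq_sub_of_hasDerivAt (fun t _ => (hf t).hasDerivAt)
      ((intervalIntegrable_iff_integrableOn_Ioc_of_le zero_le_one).2 hi1)
  rw [intervalIntegral.integral_of_le zero_le_one] at e
  have := jensen_sq (μ := volume.restrict (Set.Ioc (0:ℝ) 1)) (f := fun _ => 1) (g := deriv f) (fun _ => zero_le_one) (by simp) (integrable_const _)
    (by simpa using hi1) (by simpa using hi)
  simp only [one_mul] at this
  rw [e] at this
  rw [← ofReal_integral_eq_lintegral_ofReal hi (Eventually.of_forall fun t => sq_nonneg _)]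
  exact ENNReal.ofReal_le_ofReal this

lemma lint_affine {d : ℕ} {G : EE d → ENNReal} (hG : Measurable G) {t : ℝ} (ht : 1/2 ≤ t) (c : EE d) :
    ∫⁻ x, G (c + t • x) ≤ 2 ^ d * ∫⁻ x, G x := by
  have ht0 : 0 < t := by linarith
  have h1 : ∫⁻ x, G (c + t • x) = ∫⁻ x, G (c + x) ∂(Measure.map (t • ·) (volume : Measure (EE d))) := by
    rw [lintegral_map (f := fun x => G (c + x)) (hG.comp (measurable_const_add c)) (measurable_const_smul t)]
  rw [h1, Measure.map_addHaar_smul _ ht0.ne', lintegral_smul_measure, lintegral_add_left_eq_self, smul_eq_mul]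
  gcongr
  simp only [finrank_euclideanSpace, Fintype.card_fin]
  rw [abs_of_pos (by positivity), ← inv_pow]
  have : t⁻¹ ≤ 2 := by
    rw [inv_le_comm₀ ht0 (by norm_num)]; linarith
  calc ENNReal.ofReal (t⁻¹ ^ d) ≤ ENNReal.ofReal (2 ^ d) := by
        apply ENNReal.ofReal_le_ofReal; gcongr
    _ = _ := by rw [ENNReal.ofReal_pow (by norm_num)]; simp

lemma lint_double {d : ℕ} {G : EE d → ENNReal} (hG : Measurable G) (B : Set (EE d)) (t : ℝ) :
    ∫⁻ y in B, ∫⁻ x in B, G ((1 - t) • y + t • x) ≤ 2 ^ d * volume B * ∫⁻ x, G x := by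
  have hm : Measurable (fun z : EE d × EE d => G ((1 - t) • z.1 + t • z.2)) :=
    hG.comp (by fun_prop)
  rcases le_total (1/2) t with ht | ht
  · calc _ ≤ ∫⁻ y in B, 2 ^ d * ∫⁻ x, G x := by
          refine lintegral_mono fun y => ?_
          exact (setLIntegral_le_lintegral _ _).trans (lint_affine hG ht _)
      _ = _ := by rw [setLIntegral_const]; ring
  · rw [lintegral_lintegral_swap hm.aemeasurable]
    calc _ ≤ ∫⁻ y in B, 2 ^ d * ∫⁻ x, G x := by
          refine lintegral_mono fun y => ?_
          refine (setLIntegral_le_lintegral _ _).trans ?_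
          have := lint_affine hG (t := 1 - t) (by linarith) (t • y)
          simpa [add_comm] using this
      _ = _ := by rw [setLIntegral_const]; ring

lemma ball_poincare {d : ℕ} {R : ℝ} (hR : 0 < R) {r : EE d → ℝ} (hr : Differentiable ℝ r) (K : ℝ) (hK : 0 ≤ K)
    (hIntegX : ∫⁻ x in Metric.closedBall (0 : EE d) R, ENNReal.ofReal (‖gradient r x‖ ^ 2) ≤ ENNReal.ofReal K) :
    ∃ y, ∫ x in Metric.closedBall (0 : EE d) R, (r x - r y) ^ 2 ≤ 4 * R ^ 2 * 2 ^ d * K := by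
  set B := Metric.closedBall (0 : EE d) R with hB
  have hBm : MeasurableSet B := measurableSet_closedBall
  set G : EE d → ENNReal := B.indicator fun x => ENNReal.ofReal (‖gradient r x‖ ^ 2) with hG
  have hGm : Measurable G := (((measurable_gradient r).norm.pow_const 2).ennreal_ofReal).indicator hBm
  have hGi : ∫⁻ x, G x ≤ ENNReal.ofReal K := by rwa [hG, lintegral_indicator hBm]
  have seg : ∀ y ∈ B, ∀ x ∈ B, ENNReal.ofReal ((r x - r y) ^ 2) ≤
      ENNReal.ofReal (4 * R ^ 2) * ∫⁻ t in Set.Ioc (0:ℝ) 1, G ((1 - t) • y + t • x) := by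
    intro y hy x hx
    have hder : ∀ t : ℝ, HasDerivAt (fun t : ℝ => r ((1 - t) • y + t • x)) (inner ℝ (gradient r ((1 - t) • y + t • x)) (x - y)) t := by
      intro t
      have h1 : HasDerivAt (fun t : ℝ => (1 - t) • y + t • x) (x - y) t := by
        have := (((hasDerivAt_id t).const_sub 1).smul_const y).add ((hasDerivAt_id t).smul_const x)
        refine this.congr_deriv ?_
        module
      have h2 := (hr ((1 - t) • y + t • x)).hasFDerivAt.comp_hasDerivAt t h1
      rw [inner_gradient_left]; exact h2
    have := ftc_sq (f := fun t : ℝ => r ((1 - t) • y + t • x)) (fun t => (hder t).differentiableAt)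
    simp only [sub_self, zero_smul, one_smul, zero_add, sub_zero, add_zero] at this
    refine this.trans ?_
    rw [← lintegral_const_mul']
    · refine setLIntegral_mono' measurableSet_Ioc fun t ht => ?_
      have hin : (1 - t) • y + t • x ∈ B :=
        convex_closedBall (0 : EE d) R hy hx (by linarith [ht.2]) ht.1.le (by ring)
      rw [hG, Set.indicator_of_mem hin, (hder t).deriv, ← ENNReal.ofReal_mul (by positivity)]
      apply ENNReal.ofReal_le_ofReal
      have h3 : ‖x - y‖ ≤ 2 * R := by
        have := norm_sub_le x y
        rw [hB, mem_closedBall_zero_iff] at hx hy; linarith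
      have h4 := abs_real_inner_le_norm (gradient r ((1 - t) • y + t • x)) (x - y)
      rw [← sq_abs]
      calc _ ≤ (‖gradient r ((1 - t) • y + t • x)‖ * (2 * R)) ^ 2 := by
            gcongr; exact h4.trans (by gcongr)
        _ = _ := by ring
    · exact ENNReal.ofReal_ne_top
  have hrm : Measurable r := hr.continuous.measurable
  have dbl : ∫⁻ y in B, ∫⁻ x in B, ENNReal.ofReal ((r x - r y) ^ 2) ≤ ENNReal.ofReal (4 * R ^ 2) * (2 ^ d * volume B * ENNReal.ofReal K) := by
    calc _ ≤ ∫⁻ y in B, ∫⁻ x in B, ENNReal.ofReal (4 * R ^ 2) * ∫⁻ t in Set.Ioc (0:ℝ) 1, G ((1 - t) • y + t • x) := by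
          refine setLIntegral_mono' hBm fun y hy => setLIntegral_mono' hBm fun x hx => seg y hy x hx
      _ = ENNReal.ofReal (4 * R ^ 2) * ∫⁻ y in B, ∫⁻ x in B, ∫⁻ t in Set.Ioc (0:ℝ) 1, G ((1 - t) • y + t • x) := by
          simp_rw [lintegral_const_mul' _ _ ENNReal.ofReal_ne_top]
      _ = ENNReal.ofReal (4 * R ^ 2) * ∫⁻ t in Set.Ioc (0:ℝ) 1, ∫⁻ y in B, ∫⁻ x in B, G ((1 - t) • y + t • x) := by
          congr 1
          have hm3 : Measurable (fun z : (EE d × ℝ) × EE d => G ((1 - z.1.2) • z.1.1 + z.1.2 • z.2)) := hGm.comp (by fun_prop)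
          have e1 : ∀ y, ∫⁻ x in B, ∫⁻ t in Set.Ioc (0:ℝ) 1, G ((1 - t) • y + t • x) = ∫⁻ t in Set.Ioc (0:ℝ) 1, ∫⁻ x in B, G ((1 - t) • y + t • x) := by
            intro y
            apply lintegral_lintegral_swap
            exact (hGm.comp (by fun_prop : Measurable (fun z : EE d × ℝ => (1 - z.2) • y + z.2 • z.1))).aemeasurable
          simp_rw [e1]
          apply lintegral_lintegral_swap
          exact (hm3.lintegral_prod_right' (ν := volume.restrict B)).aemeasurable
      _ ≤ ENNReal.ofReal (4 * R ^ 2) * ∫⁻ t in Set.Ioc (0:ℝ) 1, (2 ^ d * volume B * ENNReal.ofReal K) := by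
          gcongr with t
          exact (lint_double hGm B t).trans (by gcongr)
      _ = _ := by rw [setLIntegral_const]; simp
  have hB0 : volume B ≠ 0 := (Metric.measure_closedBall_pos volume _ hR).ne'
  have hBt : volume B ≠ ⊤ := measure_closedBall_lt_top.ne
  have hmm : Measurable fun y => ∫⁻ x in B, ENNReal.ofReal ((r x - r y) ^ 2) := by
    have : Measurable (fun z : EE d × EE d => ENNReal.ofReal ((r z.2 - r z.1) ^ 2)) := by fun_prop
    exact this.lintegral_prod_right' (ν := volume.restrict B)
  obtain ⟨y, hy, hle⟩ := exists_le_setLAverage hB0 hBt hmm.aemeasurable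
  refine ⟨y, ?_⟩
  rw [setLAverage_eq] at hle
  have h5 : ∫⁻ x in B, ENNReal.ofReal ((r x - r y) ^ 2) ≤ ENNReal.ofReal (4 * R ^ 2 * 2 ^ d * K) := by
    refine hle.trans ?_
    rw [ENNReal.div_le_iff hB0 hBt]
    refine dbl.trans (le_of_eq ?_)
    have e2 : ENNReal.ofReal (4 * R ^ 2 * 2 ^ d * K) = ENNReal.ofReal (4 * R ^ 2) * 2 ^ d * ENNReal.ofReal K := by
      rw [ENNReal.ofReal_mul (p := 4 * R ^ 2 * 2 ^ d) (by positivity), ENNReal.ofReal_mul (p := 4 * R ^ 2) (by positivity), ENNReal.ofReal_pow (p := 2) (by norm_num)]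
      simp
    rw [e2]; ring
  rw [integral_eq_lintegral_of_nonneg_ae (Eventually.of_forall fun x => sq_nonneg _) (by fun_prop)]
  exact ENNReal.toReal_le_of_le_ofReal (by positivity) h5

lemma inner_XT_jb {d : ℕ} (x : EE d) : inner ℝ (XT 1 0 1 x) x = -((d:ℝ) - 2) * ‖x‖ ^ 2 / jb x := by
  rw [XT, ← jb_eq_qf, inner_smul_left, inner_add_left, inner_smul_left, real_inner_self_eq_norm_sq]
  simp; ring

lemma hasGradientAt_div_UU {d : ℕ} {u : EE d → ℝ} (hu : Differentiable ℝ u) (x : EE d) :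
    HasGradientAt (fun x => u x * jb x ^ (((d:ℝ) - 2) / 2))
      (jb x ^ (((d:ℝ) - 2) / 2) • (gradient u x - u x • XT 1 0 1 x)) x := by
  have h := (hu x).hasGradientAt.mul' (hasGradientAt_jb_rpow (((d:ℝ) - 2) / 2) x)
  have hp := jb_pos x
  have e : ∀ a b : EE d, a = b → HasGradientAt (fun x => u x * jb x ^ (((d:ℝ) - 2) / 2)) a x →
    HasGradientAt (fun x => u x * jb x ^ (((d:ℝ) - 2) / 2)) b x := fun a b h => h ▸ id
  refine e _ _ ?_ h
  rw [XT, ← jb_eq_qf, add_zero, Real.rpow_sub_one hp.ne']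
  simp only [smul_sub, smul_smul]
  match_scalars <;> field_simp

lemma MemD12.local_est {d : ℕ} (hd : 3 ≤ d) {z : EE d → ℝ} (hz : MemD12 d z) :
    (1/2) * ∫ x, z x ^ 2 / jb x ^ 2 ≤ 2 * d * (∫ x in Metric.closedBall (0 : EE d) (√7), z x ^ 2) + 4 * DD z := by
  have hd' : (3:ℝ) ≤ d := by exact_mod_cast hd
  have hi := hz.int_sq_div_jb hd
  have hD := hz.int_D0 hd
  set B := Metric.closedBall (0 : EE d) (√7) with hB
  have hBm : MeasurableSet B := measurableSet_closedBall
  have hBi : Integrable (B.indicator fun x => z x ^ 2) := by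
    rw [integrable_indicator_iff hBm]
    exact (hz.cont.pow 2).continuousOn.integrableOn_compact (isCompact_closedBall _ _)
  set X : EE d → EE d := fun x => jb x ^ (-2:ℝ) • x with hX
  have hXc : ContDiff ℝ 1 X := contDiff_pow_smul_id _
  have h2 : ∀ x : EE d, jb x ^ (-2:ℝ) = (jb x ^ 2)⁻¹ := fun x => by
    rw [Real.rpow_neg (jb_pos x).le]; norm_cast
  have h3 : ∀ x : EE d, jb x ^ (-2-1:ℝ) = (jb x ^ 3)⁻¹ := fun x => by
    rw [show (-2-1:ℝ) = -3 by norm_num, Real.rpow_neg (jb_pos x).le]; norm_cast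
  have hn : ∀ x : EE d, ‖x‖ ^ 2 = jb x - 1 := fun x => by unfold jb; ring
  set c : EE d → ℝ := fun x => 2 * z x / jb x ^ 2 * inner ℝ (gradient z x - z x • XT 1 0 1 x) x with hc
  have pt : ∀ x, inner ℝ (gradient (fun x => z x ^ 2) x) (X x) + z x ^ 2 * dvg X x =
      c x + (2 * d * (z x ^ 2 / jb x ^ 2 / jb x) - d * (z x ^ 2 / jb x ^ 2)) := by
    intro x
    have hp := jb_pos x
    rw [MemD12.gradient_sq hz.1, hX, dvg_pow_smul_id, h2, h3, hc]
    simp only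
    rw [inner_smul_left, inner_smul_right, inner_sub_left, inner_smul_left, inner_XT_jb, hn]
    simp only [conj_trivial, h2]
    field_simp; ring
  have hcb : ∀ x, |c x| ≤ 1/4 * (z x ^ 2 / jb x ^ 2) + 4 * ‖gradient z x - z x • XT 1 0 1 x‖ ^ 2 := by
    intro x
    have hp := jb_pos x
    have h1 := abs_real_inner_le_norm (gradient z x - z x • XT 1 0 1 x) x
    have h4 : ‖x‖ ≤ jb x := by unfold jb; nlinarith [sq_nonneg (‖x‖ - 1)]
    rw [hc]; simp only
    rw [abs_mul, abs_div, abs_mul, abs_two, abs_of_pos (by positivity : 0 < jb x ^ 2)]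
    calc _ ≤ 2 * |z x| / jb x ^ 2 * (‖gradient z x - z x • XT 1 0 1 x‖ * jb x) := by
          gcongr; exact h1.trans (by gcongr)
      _ = 2 * (|z x| / jb x) * ‖gradient z x - z x • XT 1 0 1 x‖ := by field_simp
      _ ≤ 1/4 * (|z x| / jb x) ^ 2 + 4 * ‖gradient z x - z x • XT 1 0 1 x‖ ^ 2 := by
          nlinarith [sq_nonneg (|z x| / jb x - 4 * ‖gradient z x - z x • XT 1 0 1 x‖)]
      _ = _ := by rw [div_pow, sq_abs]
  have hXTc : Continuous (XT (d := d) 1 0 1) := (admT_jb.contDiff_XT (n := 0)).continuous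
  have hcm : Measurable c := by
    have := measurable_gradient z
    have := hz.cont.measurable
    have := hXTc.measurable
    have := (continuous_jb (d := d)).measurable
    rw [hc]; fun_prop
  have hci : Integrable c := by
    refine Integrable.mono' ((hi.const_mul (1/4)).add (hD.const_mul 4)) hcm.aestronglyMeasurable (Eventually.of_forall hcb)
  have hi3 : Integrable fun x => z x ^ 2 / jb x ^ 2 / jb x := by
    refine Integrable.mono' hi ?_ (Eventually.of_forall fun x => ?_)
    · have := hz.cont.measurable
      have := (continuous_jb (d := d)).measurable
      exact Measurable.aestronglyMeasurable (by fun_prop)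
    · have hp := jb_pos x
      rw [Real.norm_of_nonneg (by positivity)]
      exact div_le_self (by positivity) (one_le_jb x)
  have hi4 : Integrable fun x => 2 * d * (z x ^ 2 / jb x ^ 2 / jb x) - d * (z x ^ 2 / jb x ^ 2) := (hi3.const_mul (2 * (d:ℝ))).sub (hi.const_mul (d:ℝ))
  have key := ibp (fun x => z x ^ 2) X (hz.1.pow 2) hXc hz.loc_grad_sq (by
      simp_rw [pt]; exact hci.add hi4) (by
    refine Integrable.mono' hi ?_ (Eventually.of_forall fun x => ?_)
    · have := hXc.continuous
      refine Continuous.aestronglyMeasurable ?_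
      exact ((hz.cont.pow 2).mul this.norm).div (continuous_jb.sqrt) (fun x => (Real.sqrt_pos.2 (jb_pos x)).ne')
    · have hs := Real.sqrt_pos.2 (jb_pos x)
      have hp := jb_pos x
      have := norm_le_sqrt_jb x
      rw [Real.norm_of_nonneg (by positivity), hX]; simp only
      rw [norm_smul, h2, Real.norm_of_nonneg (by positivity), mul_div_assoc, mul_div_assoc, div_eq_mul_inv (z x ^ 2)]
      gcongr
      apply mul_le_of_le_one_right (by positivity)
      exact div_le_one_of_le₀ this (by positivity))
  simp_rw [pt] at key
  rw [integral_add hci hi4, integral_sub (hi3.const_mul _) (hi.const_mul _), integral_const_mul, integral_const_mul] at key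
  have k1 : ∫ x, c x ≤ 1/4 * (∫ x, z x ^ 2 / jb x ^ 2) + 4 * DD z := by
    rw [DD, ← integral_const_mul, ← integral_const_mul, ← integral_add (hi.const_mul _) (hD.const_mul 4)]
    exact integral_mono hci ((hi.const_mul _).add (hD.const_mul 4)) fun x => (le_abs_self _).trans (hcb x)
  have k2 : ∫ x, z x ^ 2 / jb x ^ 2 / jb x ≤ 1/8 * (∫ x, z x ^ 2 / jb x ^ 2) + ∫ x in B, z x ^ 2 := by
    rw [← integral_indicator hBm, ← integral_const_mul, ← integral_add (hi.const_mul _) hBi]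
    refine integral_mono hi3 ((hi.const_mul _).add hBi) fun x => ?_
    have hp := jb_pos x
    have hp1 := one_le_jb x
    simp only
    by_cases hx : x ∈ B
    · rw [Set.indicator_of_mem hx, div_div]
      have : z x ^ 2 / (jb x ^ 2 * jb x) ≤ z x ^ 2 := by
        apply div_le_self (by positivity)
        have : 1 ≤ jb x ^ 2 := one_le_pow₀ hp1
        nlinarith
      have : 0 ≤ z x ^ 2 / jb x ^ 2 := by positivity
      linarith
    · rw [Set.indicator_of_notMem hx, add_zero]
      rw [hB, mem_closedBall_zero_iff, not_le] at hx
      have : 7 < ‖x‖ ^ 2 := by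
        have := Real.sq_sqrt (show (0:ℝ) ≤ 7 by norm_num)
        have h7 := Real.sqrt_nonneg 7
        nlinarith
      have : 8 ≤ jb x := by unfold jb; linarith
      rw [div_le_iff₀ hp]
      have : 0 ≤ z x ^ 2 / jb x ^ 2 := by positivity
      nlinarith
  have n0 : 0 ≤ ∫ x, z x ^ 2 / jb x ^ 2 := integral_nonneg fun x => by positivity
  have k3 : 2 * d * (∫ x, z x ^ 2 / jb x ^ 2 / jb x) ≤ 2 * d * (1/8 * (∫ x, z x ^ 2 / jb x ^ 2) + ∫ x in B, z x ^ 2) := by gcongr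
  nlinarith

lemma poincare {d : ℕ} (hd : 3 ≤ d) : ∃ CP > 0, ∀ u : EE d → ℝ, MemD12 d u →
    ∃ k : ℝ, ((∀ x, 0 ≤ u x) → 0 ≤ k) ∧ ∫ x, (u x - k * UU x) ^ 2 / jb x ^ 2 ≤ CP * DD u := by
  have hd' : (3:ℝ) ≤ d := by exact_mod_cast hd
  refine ⟨2 * (2 * d * (4 * (√7) ^ 2 * 2 ^ d * 8 ^ ((d:ℝ) - 2)) + 4), by positivity, fun u hu => ?_⟩
  set r : EE d → ℝ := fun x => u x * jb x ^ (((d:ℝ) - 2) / 2) with hr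
  set B := Metric.closedBall (0 : EE d) (√7) with hB
  have hBm : MeasurableSet B := measurableSet_closedBall
  have hjB : ∀ x ∈ B, jb x ≤ 8 := fun x hx => by
    rw [hB, mem_closedBall_zero_iff] at hx
    have := Real.sq_sqrt (show (0:ℝ) ≤ 7 by norm_num)
    have := pow_le_pow_left₀ (norm_nonneg x) hx 2
    unfold jb; linarith
  have hD0 := MemD12.DD_nonneg u
  obtain ⟨y, hy⟩ := ball_poincare (d := d) (R := √7) (by positivity) (r := r) (fun x => (hasGradientAt_div_UU hu.1 x).differentiableAt')
    (8 ^ ((d:ℝ) - 2) * DD u) (by positivity) (by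
      have h0 : 0 ≤ᵐ[volume] fun x => 8 ^ ((d:ℝ) - 2) * ‖gradient u x - u x • XT 1 0 1 x‖ ^ 2 :=
        Eventually.of_forall fun x => by
          change 0 ≤ 8 ^ ((d:ℝ) - 2) * ‖gradient u x - u x • XT 1 0 1 x‖ ^ 2; positivity
      rw [DD, ← integral_const_mul, ofReal_integral_eq_lintegral_ofReal ((hu.int_D0 hd).const_mul _) h0]
      refine le_trans (setLIntegral_mono' hBm fun x hx => ?_) (setLIntegral_le_lintegral _ _)
      apply ENNReal.ofReal_le_ofReal
      have hp := jb_pos x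
      rw [(hasGradientAt_div_UU hu.1 x).gradient, norm_smul, mul_pow, Real.norm_of_nonneg (by positivity), ← Real.rpow_natCast, ← Real.rpow_mul hp.le]
      have : ((d:ℝ) - 2) / 2 * ((2:ℕ):ℝ) = (d:ℝ) - 2 := by push_cast; ring
      rw [this]
      gcongr
      · linarith
      · exact hjB x hx)
  refine ⟨r y, fun h => mul_nonneg (h y) (by have := jb_pos y; positivity), ?_⟩
  set k := r y with hk
  set z : EE d → ℝ := fun x => u x - k * UU x with hz
  have ez : z = fun x => 1 * u x + (-k) * UU x := by ext x; simp [hz]; ring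
  have hzm : MemD12 d z := by
    rw [ez]; exact (hu.const_mul hd 1).add hd ((memD12_UU hd).const_mul hd (-k))
  have hDz : DD z = DD u := by rw [ez, DD_add_UU hu.1]; ring
  have h1 := hzm.local_est hd
  have h2 : ∫ x in B, z x ^ 2 ≤ ∫ x in B, (r x - k) ^ 2 := by
    have hrc : Continuous r := by
      have := (contDiff_jb_rpow (d := d) (n := 0) (((d:ℝ) - 2) / 2)).continuous
      have := hu.cont
      fun_prop
    refine setIntegral_mono_on ((hzm.cont.pow 2).continuousOn.integrableOn_compact (isCompact_closedBall _ _))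
      (((hrc.sub continuous_const).pow 2).continuousOn.integrableOn_compact (isCompact_closedBall _ _)) hBm fun x hx => ?_
    have hp := jb_pos x
    have e : z x = UU x * (r x - k) := by
      have : UU x * jb x ^ (((d:ℝ) - 2) / 2) = 1 := by
        rw [UU, ← Real.rpow_add hp]; simp
      rw [hz, hr]; simp only; linear_combination (-(u x)) * this
    have hU1 : UU x ≤ 1 := Real.rpow_le_one_of_one_le_of_nonpos (one_le_jb x) (by linarith)
    rw [e, mul_pow]
    apply mul_le_of_le_one_left (sq_nonneg _)
    exact pow_le_one₀ (UU_pos x).le hU1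
  rw [hDz] at h1
  have h3 : ∫ x in B, z x ^ 2 ≤ 4 * (√7) ^ 2 * 2 ^ d * (8 ^ ((d:ℝ) - 2) * DD u) := h2.trans hy
  have h4 : 2 * d * (∫ x in B, z x ^ 2) ≤ 2 * d * (4 * (√7) ^ 2 * 2 ^ d * (8 ^ ((d:ℝ) - 2) * DD u)) := by gcongr
  calc ∫ x, z x ^ 2 / jb x ^ 2 ≤ 2 * (2 * d * (4 * (√7) ^ 2 * 2 ^ d * (8 ^ ((d:ℝ) - 2) * DD u)) + 4 * DD u) := by linarith
    _ = _ := by ring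
end

open MeasureTheory Real
noncomputable section
open scoped ContDiff Topology
open Filter

/-- normalized quadratic form `(λ² + |x-a|²)/λ` -/
def TT {d : ℕ} (a : EE d) (l : ℝ) (x : EE d) : ℝ := (l ^ 2 + ‖x - a‖ ^ 2) / l
def QQ {d : ℕ} (a : EE d) (l : ℝ) : ℝ := 2 * (1 + l ^ 2 + ‖a‖ ^ 2) / l

section
variable {d : ℕ} (a : EE d) {l : ℝ} (hl : 0 < l)
include hl

lemma TT_pos (x : EE d) : 0 < TT a l x := by unfold TT; positivity

lemma QQ_ge : 1 ≤ QQ a l := by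
  unfold QQ; rw [le_div_iff₀ hl]; nlinarith [sq_nonneg (l - 1), sq_nonneg ‖a‖]

lemma TT_le (x : EE d) : TT a l x ≤ QQ a l * jb x := by
  unfold TT QQ jb
  rw [div_mul_eq_mul_div]
  gcongr
  have := norm_sub_le x a
  have h2 : ‖x - a‖ ^ 2 ≤ 2 * ‖x‖ ^ 2 + 2 * ‖a‖ ^ 2 := by
    have := pow_le_pow_left₀ (norm_nonneg _) this 2
    nlinarith [sq_nonneg (‖x‖ - ‖a‖)]
  nlinarith [sq_nonneg ‖a‖, sq_nonneg ‖x‖, sq_nonneg l, mul_nonneg (sq_nonneg l) (sq_nonneg ‖x‖), mul_nonneg (sq_nonneg ‖a‖) (sq_nonneg ‖x‖)]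

lemma jb_le_TT (x : EE d) : jb x ≤ QQ a l * TT a l x := by
  unfold TT QQ jb
  rw [div_mul_div_comm, le_div_iff₀ (by positivity)]
  have h2 : ‖x‖ ^ 2 ≤ 2 * ‖x - a‖ ^ 2 + 2 * ‖a‖ ^ 2 := by
    have : ‖x‖ ≤ ‖x - a‖ + ‖a‖ := by simpa using norm_add_le (x - a) a
    have := pow_le_pow_left₀ (norm_nonneg _) this 2
    nlinarith [sq_nonneg (‖x - a‖ - ‖a‖)]
  have hl2 : 0 < l * l := by positivity
  have : (1 + ‖x‖ ^ 2) * (l * l) ≤ (1 + (2 * ‖x - a‖ ^ 2 + 2 * ‖a‖ ^ 2)) * (l * l) := by gcongr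
  nlinarith [sq_nonneg ‖a‖, sq_nonneg ‖x - a‖, sq_nonneg l, mul_nonneg (sq_nonneg ‖a‖) (sq_nonneg ‖x - a‖), mul_nonneg (sq_nonneg l) (sq_nonneg l)]

lemma TT_div_le (x : EE d) : TT a l x / jb x ≤ QQ a l := by
  rw [div_le_iff₀ (jb_pos x)]; exact TT_le a hl x

lemma le_TT_div (x : EE d) : (QQ a l)⁻¹ ≤ TT a l x / jb x := by
  have hQ : 0 < QQ a l := by linarith [QQ_ge a hl]
  rw [le_div_iff₀ (jb_pos x), inv_mul_le_iff₀ hQ]; exact jb_le_TT a hl x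

lemma abs_log_TT (x : EE d) : |Real.log (TT a l x / jb x)| ≤ Real.log (QQ a l) := by
  have hQ : 0 < QQ a l := by linarith [QQ_ge a hl]
  have h := div_pos (TT_pos a hl x) (jb_pos x)
  rw [abs_le]; constructor
  · rw [← Real.log_inv]; exact Real.log_le_log (by positivity) (le_TT_div a hl x)
  · exact Real.log_le_log h (TT_div_le a hl x)
end

lemma measurable_log_TT {d : ℕ} (a : EE d) (l : ℝ) : Measurable fun x => Real.log (TT a l x / jb x) := by
  have := (continuous_jb (d := d)).measurable
  unfold TT; fun_prop

/-- the functional to be minimised -/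
def FF {d : ℕ} (f : EE d → ℝ) (a : EE d) (l : ℝ) : ℝ := ∫ x, f x * Real.log (TT a l x / jb x)

section
variable {d : ℕ} {f : EE d → ℝ} (hf : Integrable f) (hc : Continuous f) (h0 : ∀ x, 0 ≤ f x)
include hf hc
lemma int_FF (a : EE d) {l : ℝ} (hl : 0 < l) : Integrable fun x => f x * Real.log (TT a l x / jb x) := by
  refine Integrable.mono' (hf.norm.const_mul (Real.log (QQ a l))) (hc.measurable.mul (measurable_log_TT a l)).aestronglyMeasurable
    (Eventually.of_forall fun x => ?_)
  rw [norm_mul, mul_comm]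
  gcongr
  exact abs_log_TT a hl x

include h0 in
lemma FF_coercive (hd : 3 ≤ d) (h1 : ∫ x, f x = 1) : ∃ Q0 : ℝ, ∀ a l, 0 < l → Q0 ≤ QQ a l → 0 < FF f a l := by
  -- choose a large ball
  have hex : ∃ ρ : ℝ, 0 < ρ ∧ ∫ x in (Metric.closedBall (0:EE d) ρ)ᶜ, f x ≤ 1/8 := by
    have ht : Tendsto (fun n : ℕ => ∫ x in (Metric.closedBall (0:EE d) (n:ℝ))ᶜ, f x) atTop (𝓝 0) := by
      have := tendsto_setIntegral_of_antitone (μ := (volume : Measure (EE d))) (f := f) (s := fun n : ℕ => (Metric.closedBall (0:EE d) (n:ℝ))ᶜ)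
        (fun n => measurableSet_closedBall.compl) (fun m n h => Set.compl_subset_compl.2 (Metric.closedBall_subset_closedBall (by exact_mod_cast h)))
        ⟨0, hf.integrableOn⟩
      have e : ⋂ n : ℕ, (Metric.closedBall (0:EE d) (n:ℝ))ᶜ = ∅ := by
        rw [← Set.compl_iUnion, Metric.iUnion_closedBall_nat, Set.compl_univ]
      rw [e] at this; simpa using this
    obtain ⟨n, hn, hn2⟩ := ((ht.eventually (ge_mem_nhds (show (0:ℝ) < 1/8 by norm_num))).and (eventually_ge_atTop 1)).exists
    exact ⟨n, by exact_mod_cast hn2, hn⟩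
  obtain ⟨ρ, hρ, hmass⟩ := hex
  obtain ⟨M, hM⟩ := (isCompact_closedBall (0:EE d) ρ).exists_bound_of_continuousOn hc.continuousOn
  have hM0 : 0 ≤ M := (norm_nonneg _).trans (hM 0 (by simp [hρ.le]))
  -- choose η small
  have hη : ∃ η : ℝ, 0 < η ∧ ∀ a : EE d, M * (volume (Metric.ball a η)).toReal ≤ 1/8 := by
    have hsmall : ∃ η : ℝ, 0 < η ∧ M * (volume (Metric.ball (0:EE d) η)).toReal ≤ 1/8 := by
      set v := (volume (Metric.ball (0:EE d) 1)).toReal with hv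
      have hv0 : 0 ≤ v := ENNReal.toReal_nonneg
      have hMv : 0 ≤ M * v := by positivity
      refine ⟨1 / (8 * (M * v + 1)), by positivity, ?_⟩
      rw [Measure.addHaar_ball_of_pos _ _ (by positivity), ENNReal.toReal_mul, ENNReal.toReal_ofReal (by positivity)]
      simp only [finrank_euclideanSpace, Fintype.card_fin]
      have h5 : (1 / (8 * (M * v + 1))) ^ d ≤ 1 / (8 * (M * v + 1)) := by
        apply pow_le_of_le_one (by positivity) _ (by omega)
        rw [div_le_one (by positivity)]; linarith
      calc M * ((1 / (8 * (M * v + 1))) ^ d * v) ≤ M * ((1 / (8 * (M * v + 1))) * v) := by gcongr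
        _ = (M * v) / (8 * (M * v + 1)) := by ring
        _ ≤ _ := by rw [div_le_iff₀ (by positivity)]; linarith
    obtain ⟨η, h, h2⟩ := hsmall
    refine ⟨η, h, fun a => ?_⟩
    rwa [Measure.addHaar_ball_center]
  obtain ⟨η, hη, hball⟩ := hη
  set e := min (1/4) (η ^ 2 / (2 * (1 + 2 * ρ ^ 2))) with he
  have he0 : 0 < e := by rw [he]; positivity
  have he1 : e ≤ 1/4 := min_le_left _ _
  have he2 : 2 * e * (1 + 2 * ρ ^ 2) ≤ η ^ 2 := by
    have := min_le_right (1/4) (η ^ 2 / (2 * (1 + 2 * ρ ^ 2)))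
    rw [← he, le_div_iff₀ (by positivity)] at this; linarith
  set ε := e / (2 * (1 + ρ ^ 2)) with hε
  have hε0 : 0 < ε := by positivity
  refine ⟨max (ε⁻¹) (Real.exp (2 * |Real.log ε|) + 1), fun a l hl hQ => ?_⟩
  have hQ1 : ε⁻¹ ≤ QQ a l := (le_max_left _ _).trans hQ
  have hQ2 : Real.exp (2 * |Real.log ε|) + 1 ≤ QQ a l := (le_max_right _ _).trans hQ
  have hQ0 : 0 < QQ a l := by linarith [QQ_ge a hl]
  have hεQ : 1 ≤ ε * QQ a l := by
    rw [inv_le_iff_one_le_mul₀ hε0] at hQ1; linarith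
  have hlog0 : 0 ≤ Real.log (ε * QQ a l) := Real.log_nonneg hεQ
  have hlogQ : 2 * |Real.log ε| < Real.log (QQ a l) := by
    rw [Real.lt_log_iff_exp_lt hQ0]; linarith
  have hlogQ0 : 0 ≤ Real.log (QQ a l) := (by positivity : 0 ≤ 2 * |Real.log ε|).trans hlogQ.le
  set s1 := (Metric.closedBall (0:EE d) ρ)ᶜ with hs1
  set s2 := Metric.ball a η ∩ Metric.closedBall (0:EE d) ρ with hs2
  have hs1m : MeasurableSet s1 := measurableSet_closedBall.compl
  have hs2m : MeasurableSet s2 := measurableSet_ball.inter measurableSet_closedBall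
  set c := Real.log (ε * QQ a l) + Real.log (QQ a l) with hc'
  have hc0 : 0 ≤ c := by positivity
  have hpt : ∀ x, Real.log (ε * QQ a l) * f x - c * (s1.indicator f x + s2.indicator f x) ≤ f x * Real.log (TT a l x / jb x) := by
    intro x
    have hi1 : 0 ≤ s1.indicator f x := Set.indicator_nonneg (fun x _ => h0 x) x
    have hi2 : 0 ≤ s2.indicator f x := Set.indicator_nonneg (fun x _ => h0 x) x
    by_cases hx : ε * QQ a l ≤ TT a l x / jb x
    · have := Real.log_le_log (by linarith) hx
      have := mul_le_mul_of_nonneg_left this (h0 x)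
      have : 0 ≤ c * (s1.indicator f x + s2.indicator f x) := by positivity
      linarith
    · have hin : f x ≤ s1.indicator f x + s2.indicator f x := by
        by_cases hx1 : x ∈ s1
        · rw [Set.indicator_of_mem hx1]; linarith
        · have hx1' : x ∈ Metric.closedBall (0:EE d) ρ := by rwa [hs1, Set.notMem_compl_iff] at hx1
          have hx2 : x ∈ s2 := by
            refine ⟨?_, hx1'⟩
            rw [mem_closedBall_zero_iff] at hx1'
            rw [not_le, div_lt_iff₀ (jb_pos x), TT, QQ, div_lt_iff₀ hl, hε] at hx
            have hj : jb x ≤ 1 + ρ ^ 2 := by unfold jb; gcongr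
            have h5 : l ^ 2 + ‖x - a‖ ^ 2 < e * (1 + l ^ 2 + ‖a‖ ^ 2) := by
              refine hx.trans_le ?_
              calc e / (2 * (1 + ρ ^ 2)) * (2 * (1 + l ^ 2 + ‖a‖ ^ 2) / l) * jb x * l
                  = e / (2 * (1 + ρ ^ 2)) * (2 * (1 + l ^ 2 + ‖a‖ ^ 2)) * jb x := by field_simp
                _ ≤ e / (2 * (1 + ρ ^ 2)) * (2 * (1 + l ^ 2 + ‖a‖ ^ 2)) * (1 + ρ ^ 2) := by gcongr
                _ = _ := by field_simp
            have h6 : ‖a‖ ^ 2 ≤ 2 * ‖x - a‖ ^ 2 + 2 * ρ ^ 2 := by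
              have : ‖a‖ ≤ ‖x - a‖ + ρ := by
                have h7 : ‖a‖ ≤ ‖x - a‖ + ‖x‖ := by
                  have := norm_sub_le x (x - a); simpa [add_comm] using this
                linarith
              have := pow_le_pow_left₀ (norm_nonneg _) this 2
              nlinarith [sq_nonneg (‖x - a‖ - ρ)]
            have h7 : e * (1 + l ^ 2 + ‖a‖ ^ 2) ≤ e * (1 + l ^ 2 + (2 * ‖x - a‖ ^ 2 + 2 * ρ ^ 2)) := by gcongr
            have h8 : ‖x - a‖ ^ 2 < η ^ 2 := by
              nlinarith [sq_nonneg l, sq_nonneg ‖x - a‖, mul_nonneg he0.le (sq_nonneg l)]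
            rw [Metric.mem_ball, dist_eq_norm]
            exact lt_of_pow_lt_pow_left₀ 2 hη.le h8
          rw [Set.indicator_of_mem hx2]; linarith
      have h9 := (abs_le.1 (abs_log_TT a hl x)).1
      have h10 := mul_le_mul_of_nonneg_left h9 (h0 x)
      have h11 := mul_le_mul_of_nonneg_left hin hc0
      rw [hc'] at h11 ⊢
      linarith
  have i1 : Integrable (s1.indicator f) := hf.indicator hs1m
  have i2 : Integrable (s2.indicator f) := hf.indicator hs2m
  have m2 : ∫ x, s2.indicator f x ≤ 1/8 := by
    rw [integral_indicator hs2m]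
    have := norm_setIntegral_le_of_norm_le_const (μ := volume) (s := s2) (f := f) (C := M) ((measure_mono Set.inter_subset_left).trans_lt measure_ball_lt_top) (fun x hx => hM x hx.2)
    refine (le_abs_self _).trans (this.trans ?_)
    refine le_trans ?_ (hball a)
    gcongr
    refine ENNReal.toReal_mono measure_ball_lt_top.ne (measure_mono Set.inter_subset_left)
  have m1 : ∫ x, s1.indicator f x ≤ 1/8 := by rw [integral_indicator hs1m]; exact hmass
  have i12 : Integrable (fun x => s1.indicator f x + s2.indicator f x) := i1.add i2
  have := integral_mono ((hf.const_mul (Real.log (ε * QQ a l))).sub (i12.const_mul c)) (int_FF hf hc a hl) hpt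
  rw [integral_sub' (hf.const_mul _) (i12.const_mul c), integral_const_mul, integral_const_mul, integral_add i1 i2, h1] at this
  unfold FF
  refine lt_of_lt_of_le ?_ this
  have h12 : c * ((∫ x, s1.indicator f x) + ∫ x, s2.indicator f x) ≤ c * (1/4) := by
    gcongr; linarith
  have h13 : Real.log (ε * QQ a l) = Real.log ε + Real.log (QQ a l) := Real.log_mul hε0.ne' hQ0.ne'
  have h14 := neg_abs_le (Real.log ε)
  rw [hc'] at h12 ⊢
  rw [h13] at h12 ⊢
  nlinarith

include h0 in
lemma FF_min (hd : 3 ≤ d) (h1 : ∫ x, f x = 1) : ∃ a l, 0 < l ∧ ∀ a' l', 0 < l' → FF f a l ≤ FF f a' l' := by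
  obtain ⟨Q0, hQ0⟩ := FF_coercive hf hc h0 hd h1
  set Q := max Q0 4 with hQ
  have hQ4 : 4 ≤ Q := le_max_right _ _
  set K : Set (EE d × ℝ) := Metric.closedBall (0:EE d) Q ×ˢ Set.Icc (1/Q) Q with hK
  have hKc : IsCompact K := (isCompact_closedBall _ _).prod isCompact_Icc
  have hKpos : ∀ z ∈ K, 0 < z.2 := fun z hz => lt_of_lt_of_le (by positivity) hz.2.1
  have hbd : ∀ z ∈ K, QQ z.1 z.2 ≤ 2 * (1 + Q ^ 2 + Q ^ 2) * Q := by
    intro z hz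
    have hz2 := hKpos z hz
    obtain ⟨h1, h2, h3⟩ := hz
    rw [mem_closedBall_zero_iff] at h1
    unfold QQ
    rw [div_le_iff₀ hz2]
    have : 1 ≤ Q * z.2 := by rw [div_le_iff₀ (by positivity)] at h2; linarith
    calc 2 * (1 + z.2 ^ 2 + ‖z.1‖ ^ 2) ≤ 2 * (1 + Q ^ 2 + Q ^ 2) * 1 := by rw [mul_one]; gcongr
      _ ≤ 2 * (1 + Q ^ 2 + Q ^ 2) * (Q * z.2) := by gcongr
      _ = _ := by ring
  have hcont : ContinuousOn (fun z : EE d × ℝ => FF f z.1 z.2) K := by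
    unfold FF
    refine continuousOn_of_dominated (bound := fun x => Real.log (2 * (1 + Q ^ 2 + Q ^ 2) * Q) * ‖f x‖) ?_ ?_ ?_ ?_
    · intro z hz
      exact (hc.measurable.mul (measurable_log_TT _ _)).aestronglyMeasurable
    · intro z hz
      refine Eventually.of_forall fun x => ?_
      rw [norm_mul, mul_comm]
      gcongr
      refine (abs_log_TT z.1 (hKpos z hz) x).trans ?_
      exact Real.log_le_log (by linarith [QQ_ge z.1 (hKpos z hz)]) (hbd z hz)
    · exact hf.norm.const_mul _
    · refine Eventually.of_forall fun x => ?_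
      refine continuousOn_const.mul (ContinuousOn.log ?_ fun z hz => (div_pos (TT_pos _ (hKpos z hz) x) (jb_pos x)).ne')
      unfold TT
      refine ContinuousOn.div_const (ContinuousOn.div (by fun_prop) (by fun_prop) fun z hz => (hKpos z hz).ne') _
  have h01 : ((0:EE d), (1:ℝ)) ∈ K := by
    refine ⟨by simp; linarith, ?_, by simp; linarith⟩
    simp only; rw [div_le_one (by linarith)]; linarith
  obtain ⟨⟨a, l⟩, hm, hmin⟩ := hKc.exists_isMinOn ⟨_, h01⟩ hcont
  have hF0 : FF f 0 1 = 0 := by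
    unfold FF
    have : ∀ x : EE d, TT 0 1 x / jb x = 1 := fun x => by
      unfold TT; simp; rw [div_eq_one_iff_eq (jb_pos x).ne']; rfl
    simp [this]
  refine ⟨a, l, hKpos _ hm, fun a' l' hl' => ?_⟩
  by_cases hz : (a', l') ∈ K
  · exact hmin hz
  · have h2 : FF f a l ≤ FF f 0 1 := hmin h01
    rw [hF0] at h2
    refine h2.trans (hQ0 a' l' hl' ?_).le
    by_contra hlt
    apply hz
    rw [not_le] at hlt
    have hlt : QQ a' l' < Q := hlt.trans_le (le_max_left _ _)
    unfold QQ at hlt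
    rw [div_lt_iff₀ hl'] at hlt
    have hll : l' ≤ Q := by nlinarith [sq_nonneg ‖a'‖]
    refine ⟨?_, ?_, hll⟩
    · rw [mem_closedBall_zero_iff]
      have : ‖a'‖ ^ 2 ≤ Q ^ 2 := by nlinarith
      exact le_of_sq_le_sq this (by linarith)
    · simp only; rw [div_le_iff₀ (by linarith)]; nlinarith [sq_nonneg ‖a'‖, sq_nonneg l']

include h0 in
lemma FF_var (a : EE d) {l : ℝ} (hl : 0 < l) (a' : EE d) {l' : ℝ} (hl' : 0 < l') (hle : FF f a l ≤ FF f a' l')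
    {g : EE d → ℝ} (hg : ∀ x, TT a' l' x / TT a l x - 1 ≤ g x) (hi : Integrable fun x => f x * g x) :
    0 ≤ ∫ x, f x * g x := by
  have h2 : FF f a' l' - FF f a l ≤ ∫ x, f x * g x := by
    unfold FF
    rw [← integral_sub (int_FF hf hc a' hl') (int_FF hf hc a hl)]
    refine integral_mono ((int_FF hf hc a' hl').sub (int_FF hf hc a hl)) hi fun x => ?_
    simp only
    rw [← mul_sub]
    refine mul_le_mul_of_nonneg_left ?_ (h0 x)
    have p1 := TT_pos a hl x
    have p2 := TT_pos a' hl' x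
    have p3 := jb_pos x
    rw [← Real.log_div (by positivity) (by positivity), div_div_div_cancel_right₀ p3.ne']
    exact (Real.log_le_sub_one_of_pos (by positivity)).trans (hg x)
  linarith

omit hc in
lemma int_bdd {g : EE d → ℝ} (hg : Measurable g) {K : ℝ} (h : ∀ x, |g x| ≤ K) : Integrable fun x => f x * g x :=
  hf.mul_bdd (c := K) hg.aestronglyMeasurable (Eventually.of_forall h)

include h0 in
lemma centering (hd : 3 ≤ d) (h1 : ∫ x, f x = 1) : ∃ (a : EE d) (l : ℝ), 0 < l ∧
    (∀ e : EE d, ∫ x, f x * (inner ℝ (x - a) e / (l ^ 2 + ‖x - a‖ ^ 2)) = 0) ∧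
    ∫ x, f x * ((l ^ 2 - ‖x - a‖ ^ 2) / (l ^ 2 + ‖x - a‖ ^ 2)) = 0 := by
  obtain ⟨a, l, hl, hmin⟩ := FF_min hf hc h0 hd h1
  have hp : ∀ x, 0 < l ^ 2 + ‖x - a‖ ^ 2 := fun x => by positivity
  have lin : ∀ (I K : ℝ), (∀ t : ℝ, |t| ≤ 1/2 → 0 ≤ t * I + t ^ 2 * K) → I = 0 := by
    intro I K h
    set m := 1 / (2 * (|I| + |K| + 1)) with hm
    have hm0 : 0 < m := by positivity
    have hmh : m ≤ 1/2 := by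
      rw [hm]; apply one_div_le_one_div_of_le (by norm_num); linarith [abs_nonneg I, abs_nonneg K]
    have hmK : m * |K| ≤ 1/2 := by
      rw [hm, div_mul_eq_mul_div, div_le_iff₀ (by positivity)]; linarith [abs_nonneg I]
    have hmI : m * |I| ≤ 1/2 := by
      rw [hm, div_mul_eq_mul_div, div_le_iff₀ (by positivity)]; linarith [abs_nonneg K]
    have := h (-(m * I)) (by rw [abs_neg, abs_mul, abs_of_pos hm0]; exact hmI)
    have h3 : m * K ≤ 1/2 := (mul_le_mul_of_nonneg_left (le_abs_self K) hm0.le).trans hmK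
    have h4 : m * I ^ 2 * (1 - m * K) ≤ 0 := by nlinarith
    have h5 : I ^ 2 ≤ 0 := by
      by_contra h6
      have : 0 < m * I ^ 2 * (1 - m * K) := by
        apply mul_pos (mul_pos hm0 (not_le.1 h6)); linarith
      linarith
    nlinarith
  refine ⟨a, l, hl, fun e => ?_, ?_⟩
  · have hm1 : Integrable fun x => f x * (inner ℝ (x - a) e / (l ^ 2 + ‖x - a‖ ^ 2)) := by
      refine int_bdd hf (K := ‖e‖ / l) (by fun_prop) fun x => ?_
      rw [abs_div, abs_of_pos (hp x), div_le_div_iff₀ (hp x) hl]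
      have h3 := abs_real_inner_le_norm (x - a) e
      have h4 : ‖x - a‖ * l ≤ l ^ 2 + ‖x - a‖ ^ 2 := by nlinarith [sq_nonneg (‖x - a‖ - l), sq_nonneg l, sq_nonneg ‖x - a‖]
      calc _ ≤ (‖x - a‖ * ‖e‖) * l := by gcongr
        _ = ‖e‖ * (‖x - a‖ * l) := by ring
        _ ≤ _ := by gcongr
    have hm2 : Integrable fun x => f x * (‖e‖ ^ 2 / (l ^ 2 + ‖x - a‖ ^ 2)) := by
      refine int_bdd hf (K := ‖e‖ ^ 2 / l ^ 2) (by fun_prop) fun x => ?_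
      rw [abs_of_nonneg (by have := hp x; positivity)]
      gcongr
      exact le_add_of_nonneg_right (by positivity)
    have := lin (∫ x, f x * (inner ℝ (x - a) e / (l ^ 2 + ‖x - a‖ ^ 2))) ((∫ x, f x * (‖e‖ ^ 2 / (l ^ 2 + ‖x - a‖ ^ 2))) / 4) ?_
    · exact this
    intro t _
    have h3 := FF_var hf hc h0 a hl (a - (t/2) • e) hl (hmin _ _ hl)
      (g := fun x => t * (inner ℝ (x - a) e / (l ^ 2 + ‖x - a‖ ^ 2)) + t ^ 2 / 4 * (‖e‖ ^ 2 / (l ^ 2 + ‖x - a‖ ^ 2))) (fun x => ?_) ?_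
    · have e1 : ∀ x, f x * (t * (inner ℝ (x - a) e / (l ^ 2 + ‖x - a‖ ^ 2)) + t ^ 2 / 4 * (‖e‖ ^ 2 / (l ^ 2 + ‖x - a‖ ^ 2))) =
        t * (f x * (inner ℝ (x - a) e / (l ^ 2 + ‖x - a‖ ^ 2))) + t ^ 2 / 4 * (f x * (‖e‖ ^ 2 / (l ^ 2 + ‖x - a‖ ^ 2))) := fun x => by ring
      simp_rw [e1] at h3
      rw [integral_add (hm1.const_mul _) (hm2.const_mul _), integral_const_mul, integral_const_mul] at h3
      linarith
    · have := hp x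
      rw [TT, TT, show x - (a - (t/2) • e) = (x - a) + (t/2) • e by abel, norm_add_sq_real, inner_smul_right, norm_smul, mul_pow, Real.norm_eq_abs, sq_abs]
      apply le_of_eq
      field_simp; ring
    · refine ((hm1.const_mul t).add (hm2.const_mul (t ^ 2 / 4))).congr (Eventually.of_forall fun x => ?_)
      simp only [Pi.add_apply]; ring
  · have hm1 : Integrable fun x => f x * ((l ^ 2 - ‖x - a‖ ^ 2) / (l ^ 2 + ‖x - a‖ ^ 2)) := by
      refine int_bdd hf (K := 1) (by fun_prop) fun x => ?_
      rw [abs_div, abs_of_pos (hp x), div_le_one (hp x), abs_le]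
      constructor <;> nlinarith [sq_nonneg l, sq_nonneg ‖x - a‖]
    have := lin (∫ x, f x * ((l ^ 2 - ‖x - a‖ ^ 2) / (l ^ 2 + ‖x - a‖ ^ 2))) 2 ?_
    · exact this
    intro t ht
    obtain ⟨ht1, ht2⟩ := abs_le.1 ht
    have h1t : 0 < 1 + t := by linarith
    have h3 := FF_var hf hc h0 a hl a (l' := l * (1 + t)) (by positivity) (hmin _ _ (by positivity))
      (g := fun x => t * ((l ^ 2 - ‖x - a‖ ^ 2) / (l ^ 2 + ‖x - a‖ ^ 2)) + t ^ 2 * 2) (fun x => ?_) ?_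
    · have e1 : ∀ x, f x * (t * ((l ^ 2 - ‖x - a‖ ^ 2) / (l ^ 2 + ‖x - a‖ ^ 2)) + t ^ 2 * 2) =
        t * (f x * ((l ^ 2 - ‖x - a‖ ^ 2) / (l ^ 2 + ‖x - a‖ ^ 2))) + t ^ 2 * 2 * f x := fun x => by ring
      simp_rw [e1] at h3
      rw [integral_add (hm1.const_mul _) (hf.const_mul _), integral_const_mul, integral_const_mul, h1] at h3
      linarith
    · have h2 := hp x
      have h4 : (1 + t)⁻¹ ≤ 1 - t + 2 * t ^ 2 := by
        rw [inv_le_iff_one_le_mul₀ h1t]; nlinarith [sq_nonneg t]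
      have e2 : TT a (l * (1 + t)) x = l * (1 + t) + ‖x - a‖ ^ 2 / l * (1 + t)⁻¹ := by
        unfold TT; field_simp
      have e3 : TT a l x = l + ‖x - a‖ ^ 2 / l := by unfold TT; field_simp
      have h5 : TT a (l * (1 + t)) x ≤ l * (1 + t) + ‖x - a‖ ^ 2 / l * (1 - t + 2 * t ^ 2) := by
        rw [e2]; gcongr
      have hTp := TT_pos a hl x
      rw [div_sub_one hTp.ne', div_le_iff₀ hTp]
      have e4 : (t * ((l ^ 2 - ‖x - a‖ ^ 2) / (l ^ 2 + ‖x - a‖ ^ 2)) + t ^ 2 * 2) * TT a l x =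
        t * (l - ‖x - a‖ ^ 2 / l) + 2 * t ^ 2 * (l + ‖x - a‖ ^ 2 / l) := by
        unfold TT; field_simp
      rw [e4, e3]
      have : 0 ≤ 2 * t ^ 2 * l := by positivity
      linarith
    · refine ((hm1.const_mul t).add (hf.const_mul (t ^ 2 * 2))).congr (Eventually.of_forall fun x => ?_)
      simp only [Pi.add_apply]; ring

end

/-- translation and dilation -/
def tr {d : ℕ} (a : EE d) (l : ℝ) (u : EE d → ℝ) (x : EE d) : ℝ := l ^ (((d:ℝ) - 2) / 2) * u (a + l • x)

def om {d : ℕ} : Option (Fin d) → EE d → ℝ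
  | none => fun x => (1 - ‖x‖ ^ 2) / jb x
  | some i => fun x => 2 * x i / jb x

def Cen {d : ℕ} (u : EE d → ℝ) : Prop := ∀ j, ∫ x, |u x| ^ pp d * om j x = 0

lemma integral_affine {d : ℕ} (F : EE d → ℝ) (a : EE d) {l : ℝ} (hl : 0 < l) :
    ∫ x, F (a + l • x) = (l ^ d)⁻¹ * ∫ x, F x := by
  rw [Measure.integral_comp_smul (μ := volume) (fun x => F (a + x)) l, integral_add_left_eq_self]
  simp [abs_of_pos hl]

lemma integrable_affine {d : ℕ} {F : EE d → ℝ} (hF : Integrable F) (a : EE d) {l : ℝ} (hl : 0 < l) :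
    Integrable fun x => F (a + l • x) :=
  ((hF.comp_add_left a).comp_smul hl.ne')

section
variable {d : ℕ} (hd : 3 ≤ d) {u : EE d → ℝ} (a : EE d) {l : ℝ} (hl : 0 < l)
include hd hl

lemma tr_grad (hu : Differentiable ℝ u) (x : EE d) :
    HasGradientAt (tr a l u) (l ^ ((d:ℝ) / 2) • gradient u (a + l • x)) x := by
  have h1 : HasFDerivAt (fun x : EE d => a + l • x) (l • ContinuousLinearMap.id ℝ (EE d)) x :=
    ((hasFDerivAt_id x).const_smul l).const_add a
  have h2 := ((hu (a + l • x)).hasGradientAt.hasFDerivAt.comp x h1).const_mul (l ^ (((d:ℝ) - 2) / 2))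
  rw [hasGradientAt_iff_hasFDerivAt]
  refine h2.congr_fderiv ?_
  ext v
  simp [inner_smul_left, inner_smul_right]
  rw [show (d:ℝ)/2 = ((d:ℝ) - 2) / 2 + 1 by ring, Real.rpow_add_one hl.ne']; ring

lemma tr_pp (x : EE d) : |tr a l u x| ^ pp d = l ^ d * |u (a + l • x)| ^ pp d := by
  have hd' : (3:ℝ) ≤ d := by exact_mod_cast hd
  unfold tr
  rw [abs_mul, abs_of_pos (by positivity), Real.mul_rpow (by positivity) (abs_nonneg _), ← Real.rpow_mul hl.le]
  have : ((d:ℝ) - 2) / 2 * pp d = d := by unfold pp; have : (d:ℝ) - 2 ≠ 0 := by linarith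
                                          field_simp
  rw [this, Real.rpow_natCast]

lemma grad_tr_sq (hu : Differentiable ℝ u) (x : EE d) : ‖gradient (tr a l u) x‖ ^ 2 = l ^ d * ‖gradient u (a + l • x)‖ ^ 2 := by
  rw [(tr_grad hd a hl hu x).gradient, norm_smul, mul_pow, Real.norm_of_nonneg (by positivity), ← Real.rpow_natCast (l ^ _),
    ← Real.rpow_mul hl.le]
  have : (d:ℝ) / 2 * ((2:ℕ):ℝ) = d := by push_cast; ring
  rw [this, Real.rpow_natCast]

lemma MemD12.tr (hu : MemD12 d u) : MemD12 d (tr a l u) := by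
  refine ⟨fun x => (tr_grad hd a hl hu.1 x).differentiableAt', ?_, ?_⟩
  · simp_rw [grad_tr_sq hd a hl hu.1]
    exact (integrable_affine hu.2.1 a hl).const_mul _
  · change Integrable fun x => |_root_.tr a l u x| ^ pp d
    simp_rw [tr_pp hd a hl]
    exact (integrable_affine hu.2.2 a hl).const_mul _

lemma energy_tr (hu : Differentiable ℝ u) : ∫ x, ‖gradient (tr a l u) x‖ ^ 2 = ∫ x, ‖gradient u x‖ ^ 2 := by
  simp_rw [grad_tr_sq hd a hl hu]
  rw [integral_const_mul, integral_affine (fun x => ‖gradient u x‖ ^ 2) a hl, ← mul_assoc, mul_inv_cancel₀ (by positivity), one_mul]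

lemma int_pp_tr : ∫ x, |tr a l u x| ^ pp d = ∫ x, |u x| ^ pp d := by
  simp_rw [tr_pp hd a hl]
  rw [integral_const_mul, integral_affine (fun x => |u x| ^ pp d) a hl, ← mul_assoc, mul_inv_cancel₀ (by positivity), one_mul]

lemma int_mix_tr (h0 : ∀ x, 0 ≤ u x) (φ : EE d → ℝ) :
    ∫ x, tr a l u x ^ (((d:ℝ) + 2) / ((d:ℝ) - 2)) * tr a l φ x = ∫ x, u x ^ (((d:ℝ) + 2) / ((d:ℝ) - 2)) * φ x := by
  have hd' : (3:ℝ) ≤ d := by exact_mod_cast hd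
  have e : ∀ x, tr a l u x ^ (((d:ℝ) + 2) / ((d:ℝ) - 2)) * tr a l φ x = l ^ d * (u (a + l • x) ^ (((d:ℝ) + 2) / ((d:ℝ) - 2)) * φ (a + l • x)) := by
    intro x
    unfold tr
    rw [Real.mul_rpow (by positivity) (h0 _), ← Real.rpow_mul hl.le]
    have e1 : ((d:ℝ) - 2) / 2 * (((d:ℝ) + 2) / ((d:ℝ) - 2)) = d - ((d:ℝ) - 2) / 2 := by
      have : (d:ℝ) - 2 ≠ 0 := by linarith
      field_simp; ring
    have e2 : l ^ (d - ((d:ℝ) - 2) / 2) * l ^ (((d:ℝ) - 2) / 2) = l ^ d := by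
      rw [← Real.rpow_add hl, sub_add_cancel, Real.rpow_natCast]
    rw [e1]
    linear_combination (u (a + l • x) ^ (((d:ℝ) + 2) / ((d:ℝ) - 2)) * φ (a + l • x)) * e2
  simp_rw [e]
  rw [integral_const_mul, integral_affine (fun x => u x ^ (((d:ℝ) + 2) / ((d:ℝ) - 2)) * φ x) a hl, ← mul_assoc, mul_inv_cancel₀ (by positivity), one_mul]

omit hd in
lemma tr_inv : tr (-(l⁻¹ • a)) l⁻¹ (tr a l u) = u := by
  ext x
  unfold tr
  rw [smul_add, smul_neg, smul_smul, smul_smul, mul_inv_cancel₀ hl.ne', one_smul, one_smul, add_neg_cancel_left, ← mul_assoc,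
    ← Real.mul_rpow (by positivity) hl.le, inv_mul_cancel₀ hl.ne', Real.one_rpow, one_mul]

omit hl in
lemma exists_centered (hu : MemD12 d u) (h1 : ∫ x, |u x| ^ pp d = 1) : ∃ (a : EE d) (l : ℝ), 0 < l ∧ Cen (tr a l u) := by
  have hd' : (3:ℝ) ≤ d := by exact_mod_cast hd
  have hpp : 0 ≤ pp d := by linarith [two_lt_pp hd]
  have hcont : Continuous fun x => |u x| ^ pp d := hu.cont.abs.rpow_const fun x => Or.inr hpp
  obtain ⟨a, l, hl, h2, h3⟩ := centering (f := fun x => |u x| ^ pp d) hu.2.2 hcont (fun x => by positivity) hd h1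
  refine ⟨a, l, hl, fun j => ?_⟩
  simp_rw [tr_pp hd a hl]
  have hld : (l ^ d : ℝ) ≠ 0 := by positivity
  cases j with
  | none =>
    have := integral_affine (fun x => |u x| ^ pp d * ((l ^ 2 - ‖x - a‖ ^ 2) / (l ^ 2 + ‖x - a‖ ^ 2))) a hl
    rw [h3, mul_zero] at this
    have e : ∀ x : EE d, l ^ d * |u (a + l • x)| ^ pp d * om none x = l ^ d * (|u (a + l • x)| ^ pp d * ((l ^ 2 - ‖a + l • x - a‖ ^ 2) / (l ^ 2 + ‖a + l • x - a‖ ^ 2))) := by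
      intro x
      have hp := jb_pos x
      have : (l ^ 2 - ‖a + l • x - a‖ ^ 2) / (l ^ 2 + ‖a + l • x - a‖ ^ 2) = om none x := by
        rw [add_sub_cancel_left, norm_smul, Real.norm_of_nonneg hl.le, mul_pow, om]
        unfold jb at *
        field_simp
      rw [this]; ring
    simp_rw [e]
    rw [integral_const_mul, this, mul_zero]
  | some i =>
    have := integral_affine (fun x => |u x| ^ pp d * (inner ℝ (x - a) (EuclideanSpace.single i (1:ℝ)) / (l ^ 2 + ‖x - a‖ ^ 2))) a hl
    rw [h2, mul_zero] at this
    have e : ∀ x : EE d, l ^ d * |u (a + l • x)| ^ pp d * om (some i) x = (l ^ d * (2 * l)) * (|u (a + l • x)| ^ pp d * (inner ℝ (a + l • x - a) (EuclideanSpace.single i (1:ℝ)) / (l ^ 2 + ‖a + l • x - a‖ ^ 2))) := by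
      intro x
      have hp := jb_pos x
      have : (2 * l) * (inner ℝ (a + l • x - a) (EuclideanSpace.single i (1:ℝ)) / (l ^ 2 + ‖a + l • x - a‖ ^ 2)) = om (some i) x := by
        rw [add_sub_cancel_left, norm_smul, Real.norm_of_nonneg hl.le, mul_pow, om, inner_smul_left, EuclideanSpace.inner_single_right]
        unfold jb at *
        simp
        field_simp
      rw [← this]; ring
    simp_rw [e]
    rw [integral_const_mul, this, mul_zero]
end
end

open MeasureTheory Real
noncomputable section
open scoped ContDiff Topology
open Filter

/-! Taylor estimates -/
lemma rpow_bd (b : ℝ) : ∃ K > 0, ∀ y : ℝ, |y| ≤ 1/2 → |(1 + y) ^ b| ≤ K := by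
  refine ⟨Real.exp (|b| * Real.log 2), by positivity, fun y hy => ?_⟩
  obtain ⟨h1, h2⟩ := abs_le.1 hy
  have hp : 0 < 1 + y := by linarith
  rw [abs_of_pos (by positivity), Real.rpow_def_of_pos hp]
  apply Real.exp_le_exp.2
  have hl : |Real.log (1 + y)| ≤ Real.log 2 := by
    rw [abs_le]; constructor
    · rw [← Real.log_inv]; exact Real.log_le_log (by norm_num) (by linarith)
    · exact Real.log_le_log hp (by linarith)
  calc Real.log (1 + y) * b ≤ |Real.log (1 + y) * b| := le_abs_self _
    _ = |Real.log (1 + y)| * |b| := abs_mul _ _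
    _ ≤ Real.log 2 * |b| := by gcongr
    _ = _ := by ring

lemma mvt_step {g g' : ℝ → ℝ} {K : ℝ} {n : ℕ} (hK : 0 ≤ K) (h0 : g 0 = 0)
    (hg : ∀ y, |y| ≤ 1/2 → HasDerivAt g (g' y) y) (hb : ∀ y, |y| ≤ 1/2 → |g' y| ≤ K * |y| ^ n) :
    ∀ y, |y| ≤ 1/2 → |g y| ≤ K * |y| ^ (n + 1) := by
  intro y hy
  have hseg : ∀ x ∈ Set.uIcc 0 y, |x| ≤ |y| := by
    intro x hx
    have := Set.abs_sub_left_of_mem_uIcc hx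
    simpa using this
  have := (convex_uIcc 0 y).norm_image_sub_le_of_norm_hasDerivWithin_le (f := g) (f' := g') (C := K * |y| ^ n)
    (fun x hx => (hg x ((hseg x hx).trans hy)).hasDerivWithinAt)
    (fun x hx => (hb x ((hseg x hx).trans hy)).trans (mul_le_mul_of_nonneg_left (pow_le_pow_left₀ (abs_nonneg x) (hseg x hx) n) hK)) Set.left_mem_uIcc Set.right_mem_uIcc
  simp only [h0, sub_zero, Real.norm_eq_abs] at this
  rw [pow_succ]; linarith

lemma hasDerivAt_one_add_rpow (a : ℝ) {y : ℝ} (hy : |y| ≤ 1/2) : HasDerivAt (fun y : ℝ => (1 + y) ^ a) (a * (1 + y) ^ (a - 1)) y := by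
  obtain ⟨h1, h2⟩ := abs_le.1 hy
  have := ((hasDerivAt_id y).const_add 1).rpow_const (p := a) (Or.inl (by simp; linarith))
  refine this.congr_deriv ?_
  simp

lemma taylor1 (a : ℝ) : ∃ K > 0, ∀ y : ℝ, |y| ≤ 1/2 → |(1 + y) ^ a - 1| ≤ K * |y| := by
  obtain ⟨K, hK, h⟩ := rpow_bd (a - 1)
  refine ⟨(|a| + 1) * K, by positivity, ?_⟩
  have := mvt_step (g := fun y : ℝ => (1 + y) ^ a - 1) (g' := fun y => a * (1 + y) ^ (a - 1)) (K := (|a| + 1) * K) (n := 0) (by positivity)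
    (by simp) (fun y hy => (hasDerivAt_one_add_rpow a hy).sub_const 1) (fun y hy => ?_)
  · simpa using this
  · rw [abs_mul, pow_zero, mul_one]; gcongr
    · linarith
    · exact h y hy

lemma taylor2 (a : ℝ) : ∃ K > 0, ∀ y : ℝ, |y| ≤ 1/2 → |(1 + y) ^ a - 1 - a * y| ≤ K * |y| ^ 2 := by
  obtain ⟨K, hK, h⟩ := taylor1 (a - 1)
  refine ⟨(|a| + 1) * K, by positivity, ?_⟩
  refine mvt_step (g := fun y : ℝ => (1 + y) ^ a - 1 - a * y) (g' := fun y => a * ((1 + y) ^ (a - 1) - 1)) (K := (|a| + 1) * K) (n := 1) (by positivity)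
    (by simp) (fun y hy => ?_) (fun y hy => ?_)
  · refine (((hasDerivAt_one_add_rpow a hy).sub_const 1).sub ((hasDerivAt_id y).const_mul a)).congr_deriv ?_
    simp; ring
  · rw [abs_mul, pow_one, mul_assoc]; gcongr
    · linarith
    · exact h y hy

lemma taylor3 (a : ℝ) : ∃ K > 0, ∀ y : ℝ, |y| ≤ 1/2 → |(1 + y) ^ a - 1 - a * y - a * (a - 1) / 2 * y ^ 2| ≤ K * |y| ^ 3 := by
  obtain ⟨K, hK, h⟩ := taylor2 (a - 1)
  refine ⟨(|a| + 1) * K, by positivity, ?_⟩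
  refine mvt_step (g := fun y : ℝ => (1 + y) ^ a - 1 - a * y - a * (a - 1) / 2 * y ^ 2) (g' := fun y => a * ((1 + y) ^ (a - 1) - 1 - (a - 1) * y)) (K := (|a| + 1) * K) (n := 2) (by positivity)
    (by simp) (fun y hy => ?_) (fun y hy => ?_)
  · refine ((((hasDerivAt_one_add_rpow a hy).sub_const 1).sub ((hasDerivAt_id y).const_mul a)).sub (((hasDerivAt_pow 2 y)).const_mul (a * (a - 1) / 2))).congr_deriv ?_
    simp; ring
  · rw [abs_mul, mul_assoc]; gcongr
    · linarith
    · exact h y hy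

lemma rpow_theta_lower {θ x : ℝ} (h0 : 0 ≤ θ) (h1 : θ ≤ 1) (hx : 0 < x) : 1 + θ * (x - 1) - (1 - θ) * (x - 1) ^ 2 ≤ x ^ θ := by
  have h2 : x ^ (1 - θ) ≤ 1 + (1 - θ) * (x - 1) := by
    have := rpow_one_add_le_one_add_mul_self (s := x - 1) (by linarith) (p := 1 - θ) (by linarith) (by linarith)
    simpa using this
  have h3 : 0 < x ^ (1 - θ) := by positivity
  have h4 : x ^ θ * x ^ (1 - θ) = x := by rw [← Real.rpow_add hx]; simp
  have h5 : 0 < x ^ θ := by positivity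
  set z := (1 - θ) * (x - 1)
  by_cases hz : z ≤ 1
  · have h6 : x ≤ x ^ θ * (1 + z) := by nlinarith
    have h7 : x * (1 - z) ≤ x ^ θ * (1 + z) * (1 - z) := by nlinarith
    have h8 : x ^ θ * (1 + z) * (1 - z) ≤ x ^ θ := by nlinarith [sq_nonneg z, mul_nonneg h5.le (sq_nonneg z)]
    have h9 : 1 + θ * (x - 1) - (1 - θ) * (x - 1) ^ 2 = x * (1 - z) := by simp only [z]; ring
    linarith
  · have h9 : 1 + θ * (x - 1) - (1 - θ) * (x - 1) ^ 2 = x * (1 - z) := by simp only [z]; ring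
    rw [h9]; nlinarith

/-! signed sphere coordinates -/
abbrev Ix (d : ℕ) := Option (Fin d) × Bool

def sgb (b : Bool) : ℝ := if b then 1 else -1
def ok {d : ℕ} (k : Ix d) (x : EE d) : ℝ := sgb k.2 * om k.1 x

lemma sgb_sq (b : Bool) : sgb b ^ 2 = 1 := by cases b <;> simp [sgb]
lemma om_sum {d : ℕ} (x : EE d) : ∑ j, om j x ^ 2 = 1 := by
  have hp := jb_pos x
  rw [Fintype.sum_option]
  simp only [om, div_pow, mul_pow]
  rw [← Finset.sum_div, ← Finset.mul_sum]
  have : ∑ i, x i ^ 2 = ‖x‖ ^ 2 := by rw [EuclideanSpace.norm_sq_eq]; simp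
  rw [this, ← add_div, div_eq_one_iff_eq (by positivity)]
  unfold jb; ring

lemma ok_abs {d : ℕ} (k : Ix d) (x : EE d) : |ok k x| ≤ 1 := by
  rw [← sq_le_one_iff_abs_le_one, ok, mul_pow, sgb_sq, one_mul, ← om_sum x]
  exact Finset.single_le_sum (f := fun j => om j x ^ 2) (fun j _ => sq_nonneg _) (Finset.mem_univ _)

lemma ok_sum {d : ℕ} (x : EE d) : ∑ k, ok k x = 0 := by
  rw [Fintype.sum_prod_type]
  simp [ok, sgb]

lemma ok_sum_sq {d : ℕ} (x : EE d) : ∑ k, ok k x ^ 2 = 2 := by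
  rw [Fintype.sum_prod_type]
  simp only [ok, sgb, mul_pow]
  simp only [Fintype.sum_bool]
  have := om_sum x
  norm_num
  norm_num at this
  rw [Finset.sum_add_distrib]; linarith

lemma card_Ix (d : ℕ) : (Fintype.card (Ix d) : ℝ) = 2 * (d + 1) := by
  simp; ring

lemma om_cont {d : ℕ} (j : Option (Fin d)) : Continuous (om (d := d) j) := by
  cases j with
  | none => exact (by fun_prop : Continuous fun x : EE d => 1 - ‖x‖^2).div continuous_jb fun x => (jb_pos x).ne'
  | some i => exact (by fun_prop : Continuous fun x : EE d => 2 * x i).div continuous_jb fun x => (jb_pos x).ne'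

lemma ok_cont {d : ℕ} (k : Ix d) : Continuous (ok (d := d) k) := continuous_const.mul (om_cont k.1)

def WW {d : ℕ} (k : Ix d) (s : ℝ) (x : EE d) : ℝ := √(1 + s ^ 2) + s * ok k x

lemma sqrt_bds {s : ℝ} (h0 : 0 < s) (h1 : s ≤ 1/4) : |√(1 + s ^ 2) - 1 - s ^ 2 / 2| ≤ s ^ 3 ∧ |√(1 + s ^ 2) - 1| ≤ s := by
  have h2 : √(1 + s ^ 2) ≤ 1 + s ^ 2 / 2 := by
    rw [Real.sqrt_le_left (by positivity)]; nlinarith [sq_nonneg (s^2)]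
  have h3 : 1 + s ^ 2 / 2 - s ^ 3 ≤ √(1 + s ^ 2) := by
    apply Real.le_sqrt_of_sq_le
    nlinarith [pow_pos h0 3, pow_pos h0 4, pow_pos h0 5, pow_pos h0 6, mul_le_mul_of_nonneg_left h1 (pow_pos h0 3).le, mul_le_mul_of_nonneg_left h1 (pow_pos h0 5).le]
  have h4 : 1 ≤ √(1 + s ^ 2) := by apply Real.le_sqrt_of_sq_le; nlinarith
  have := pow_pos h0 3
  constructor
  · rw [abs_le]; constructor <;> linarith
  · rw [abs_le]; constructor <;> nlinarith

lemma WW_bd {d : ℕ} (k : Ix d) {s : ℝ} (h0 : 0 < s) (h1 : s ≤ 1/4) (x : EE d) : |WW k s x - 1| ≤ 2 * s := by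
  have h2 := (sqrt_bds h0 h1).2
  have h3 : |s * ok k x| ≤ s := by
    rw [abs_mul, abs_of_pos h0]; exact mul_le_of_le_one_right h0.le (ok_abs k x)
  rw [WW, show √(1 + s ^ 2) + s * ok k x - 1 = (√(1 + s ^ 2) - 1) + s * ok k x by ring]
  exact (abs_add_le _ _).trans (by linarith)

lemma WW_pos {d : ℕ} (k : Ix d) {s : ℝ} (h0 : 0 < s) (h1 : s ≤ 1/4) (x : EE d) : 0 < WW k s x := by
  have := (abs_le.1 (WW_bd k h0 h1 x)).1; linarith

lemma WW_cont {d : ℕ} (k : Ix d) (s : ℝ) : Continuous (WW (d := d) k s) :=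
  continuous_const.add (continuous_const.mul (ok_cont k))

lemma WW_pow_cont {d : ℕ} (k : Ix d) {s : ℝ} (h0 : 0 < s) (h1 : s ≤ 1/4) (a : ℝ) : Continuous fun x : EE d => WW k s x ^ a :=
  (WW_cont k s).rpow_const fun x => Or.inl (WW_pos k h0 h1 x).ne'

lemma WW_pow_bd {d : ℕ} (a : ℝ) : ∃ K > 0, ∀ s, 0 < s → s ≤ 1/4 → ∀ (k : Ix d) x, |WW k s x ^ a| ≤ K := by
  obtain ⟨K, hK, h⟩ := rpow_bd a
  refine ⟨K, hK, fun s h0 h1 k x => ?_⟩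
  have := h (WW k s x - 1) ((WW_bd k h0 h1 x).trans (by linarith))
  simpa using this

lemma WW_taylor {d : ℕ} (a : ℝ) : ∃ K > 0, ∀ s, 0 < s → s ≤ 1/4 → ∀ (k : Ix d) x,
    |WW k s x ^ a - (1 + a * s * ok k x + a / 2 * s ^ 2 + a * (a - 1) / 2 * s ^ 2 * ok k x ^ 2)| ≤ K * s ^ 3 := by
  obtain ⟨K, hK, h⟩ := taylor3 a
  refine ⟨K * 8 + |a| + |a * (a - 1) / 2| * 3, by positivity, fun s h0 h1 k x => ?_⟩
  set y := WW k s x - 1 with hy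
  have hyb : |y| ≤ 2 * s := WW_bd k h0 h1 x
  have h2 := h y (hyb.trans (by linarith))
  have e1 : 1 + y = WW k s x := by rw [hy]; ring
  rw [e1] at h2
  have h3 : K * |y| ^ 3 ≤ K * 8 * s ^ 3 := by
    calc K * |y| ^ 3 ≤ K * (2 * s) ^ 3 := by gcongr
      _ = _ := by ring
  obtain ⟨h4, h5⟩ := sqrt_bds h0 h1
  have hok := ok_abs k x
  set w := ok k x
  set m := √(1 + s ^ 2) - 1 - s ^ 2 / 2 with hm
  have ey : y = s * w + s ^ 2 / 2 + m := by rw [hy, WW, hm]; ring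
  have h6 : |y ^ 2 - s ^ 2 * w ^ 2| ≤ 3 * s ^ 3 := by
    have e : y ^ 2 - s ^ 2 * w ^ 2 = (y - s * w) * (y + s * w) := by ring
    rw [e, abs_mul]
    have h7 : |y - s * w| ≤ s ^ 2 := by
      rw [ey, show s * w + s ^ 2 / 2 + m - s * w = s ^ 2 / 2 + m by ring]
      refine (abs_add_le _ _).trans ?_
      rw [abs_of_pos (by positivity)]
      have : s ^ 3 ≤ s ^ 2 / 2 := by nlinarith [sq_nonneg s]
      linarith
    have h8 : |y + s * w| ≤ 3 * s := by
      refine (abs_add_le _ _).trans ?_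
      rw [abs_mul, abs_of_pos h0]; nlinarith
    calc _ ≤ s ^ 2 * (3 * s) := by gcongr
      _ = _ := by ring
  have e2 : WW k s x ^ a - (1 + a * s * w + a / 2 * s ^ 2 + a * (a - 1) / 2 * s ^ 2 * w ^ 2) =
    (WW k s x ^ a - 1 - a * y - a * (a - 1) / 2 * y ^ 2) + a * m + a * (a - 1) / 2 * (y ^ 2 - s ^ 2 * w ^ 2) := by
    rw [ey]; ring
  rw [e2]
  refine (abs_add_le _ _).trans ((add_le_add_left (abs_add_le _ _) _).trans ?_)
  rw [abs_mul a, abs_mul (a * (a - 1) / 2)]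
  have h9 : |a| * |m| ≤ |a| * s ^ 3 := by gcongr
  have h10 : |a * (a - 1) / 2| * |y ^ 2 - s ^ 2 * w ^ 2| ≤ |a * (a - 1) / 2| * (3 * s ^ 3) := by gcongr
  linarith

lemma WW_avg {d : ℕ} (a : ℝ) : ∃ K > 0, ∀ s, 0 < s → s ≤ 1/4 → ∀ x : EE d,
    |∑ k : Ix d, WW k s x ^ a - 2 * (d + 1) - (a * (d + 1) + a * (a - 1)) * s ^ 2| ≤ K * s ^ 3 := by
  obtain ⟨K, hK, h⟩ := WW_taylor (d := d) a
  refine ⟨2 * (d + 1) * K, by positivity, fun s h0 h1 x => ?_⟩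
  have e : ∑ k : Ix d, WW k s x ^ a - 2 * (d + 1) - (a * (d + 1) + a * (a - 1)) * s ^ 2 =
    ∑ k : Ix d, (WW k s x ^ a - (1 + a * s * ok k x + a / 2 * s ^ 2 + a * (a - 1) / 2 * s ^ 2 * ok k x ^ 2)) := by
    rw [Finset.sum_sub_distrib, Finset.sum_add_distrib, Finset.sum_add_distrib, Finset.sum_add_distrib, ← Finset.mul_sum, ← Finset.mul_sum Finset.univ (fun k => ok k x ^ 2), ok_sum, ok_sum_sq]
    rw [Finset.sum_const, Finset.sum_const, Finset.card_univ, nsmul_eq_mul, nsmul_eq_mul, card_Ix]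
    ring
  rw [e]
  calc _ ≤ ∑ k : Ix d, |WW k s x ^ a - (1 + a * s * ok k x + a / 2 * s ^ 2 + a * (a - 1) / 2 * s ^ 2 * ok k x ^ 2)| := Finset.abs_sum_le_sum_abs _ _
    _ ≤ ∑ k : Ix d, K * s ^ 3 := Finset.sum_le_sum fun k _ => h s h0 h1 k x
    _ = _ := by rw [Finset.sum_const, Finset.card_univ, nsmul_eq_mul, card_Ix]; ring

lemma adm_k {d : ℕ} (k : Ix d) {s : ℝ} (h0 : 0 < s) (h1 : s ≤ 1/4) :
    ∃ (A : ℝ) (b : EE d) (C : ℝ), AdmT A b C ∧ ∀ x, qf A b C x = jb x * WW k s x := by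
  set c := √(1 + s ^ 2) with hc
  have hc2 : c ^ 2 = 1 + s ^ 2 := Real.sq_sqrt (by positivity)
  have hc1 : 1 ≤ c := by rw [hc]; apply Real.le_sqrt_of_sq_le; nlinarith
  obtain ⟨j, e⟩ := k
  set t := s * sgb e with ht
  have ht2 : t ^ 2 = s ^ 2 := by rw [ht, mul_pow, sgb_sq, mul_one]
  have htb : |t| ≤ 1/4 := by
    rw [← abs_of_pos h0] at h1
    refine le_trans (le_of_eq ?_) h1
    rw [← sq_eq_sq_iff_abs_eq_abs, ht2]
  obtain ⟨tb1, tb2⟩ := abs_le.1 htb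
  have hcmp : ∀ x : EE d, (1/2) * jb x ≤ jb x * WW (j, e) s x := by
    intro x
    have := (abs_le.1 (WW_bd (j, e) h0 h1 x)).1
    have hp := jb_pos x
    nlinarith
  cases j with
  | none =>
    have hq : ∀ x : EE d, qf (c - t) 0 (c + t) x = jb x * WW (none, e) s x := by
      intro x
      have hp := jb_pos x
      rw [WW, ok, om, ← hc, ← mul_assoc, ← ht, qf]
      simp
      field_simp
      unfold jb; ring
    refine ⟨c - t, 0, c + t, ⟨?_, by linarith, 1/2, by norm_num, fun x => ?_⟩, hq⟩
    · simp; nlinarith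
    · rw [hq]; exact hcmp x
  | some i =>
    have hq : ∀ x : EE d, qf c (EuclideanSpace.single i (2 * t)) c x = jb x * WW (some i, e) s x := by
      intro x
      have hp := jb_pos x
      have e1 : s * (sgb e * (2 * x i / jb x)) = t * (2 * x i / jb x) := by rw [ht]; ring
      rw [WW, ok, om, ← hc, e1, qf, EuclideanSpace.inner_single_left]
      simp only [conj_trivial]
      clear_value t c
      field_simp
      unfold jb; ring
    refine ⟨c, EuclideanSpace.single i (2 * t), c, ⟨?_, by linarith, 1/2, by norm_num, fun x => ?_⟩, hq⟩
    · rw [EuclideanSpace.norm_single, Real.norm_eq_abs, sq_abs]; nlinarith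
    · rw [hq]; exact hcmp x

/-- theta = 2/p -/
lemma theta_bds {d : ℕ} (hd : 3 ≤ d) : 0 < 2 / pp d ∧ 2 / pp d < 1 := by
  have := two_lt_pp hd
  constructor
  · positivity
  · rw [div_lt_one (by linarith)]; exact this

lemma int_mul_WW {d : ℕ} {f : EE d → ℝ} (hf : Integrable f) (k : Ix d) {s : ℝ} (h0 : 0 < s) (h1 : s ≤ 1/4) (a : ℝ) :
    Integrable fun x => f x * WW k s x ^ a := by
  obtain ⟨K, hK, h⟩ := WW_pow_bd (d := d) a
  exact int_bdd hf (WW_pow_cont k h0 h1 a).measurable (h s h0 h1 k)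

lemma sob_k {d : ℕ} (hd : 3 ≤ d) {S' : ℝ} (hS : IsSob d S') {u : EE d → ℝ} (hu : MemD12 d u) (k : Ix d) {s : ℝ} (h0 : 0 < s) (h1 : s ≤ 1/4) :
    (∫ x, |u x| ^ pp d * WW k s x ^ (-(d:ℝ))) ^ (2 / pp d) ≤
      S' * ((∫ x, ‖gradient u x - u x • XT 1 0 1 x‖ ^ 2 * WW k s x ^ (-((d:ℝ) - 2))) + d * ((d:ℝ) - 2) * ∫ x, u x ^ 2 / jb x ^ 2 * WW k s x ^ (-(d:ℝ))) := by
  have hd' : (3:ℝ) ≤ d := by exact_mod_cast hd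
  obtain ⟨A, b, C, hA, hq⟩ := adm_k k h0 h1
  have h2 := hS _ (hu.mul_hT hd hA)
  rw [hu.energy_hT hd hA] at h2
  have hh : ∀ x, hT A b C x = WW k s x ^ (-(((d:ℝ) - 2) / 2)) := by
    intro x
    have := jb_pos x
    rw [hT, hq, mul_div_cancel_left₀ _ this.ne']
  have hpos := WW_pos k h0 h1
  have hsq : ∀ x, hT A b C x ^ 2 = WW k s x ^ (-((d:ℝ) - 2)) := by
    intro x
    rw [hh, ← Real.rpow_natCast, ← Real.rpow_mul (hpos x).le]; congr 1; push_cast; ring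
  have e1 : ∀ x, |u x * hT A b C x| ^ pp d = |u x| ^ pp d * WW k s x ^ (-(d:ℝ)) := by
    intro x
    rw [abs_mul, Real.mul_rpow (abs_nonneg _) (abs_nonneg _), abs_of_pos (hT_pos hA x), hh, ← Real.rpow_mul (hpos x).le]
    congr 2
    unfold pp; have : (d:ℝ) - 2 ≠ 0 := by linarith
    field_simp
  have e2 : ∀ x, hT A b C x ^ 2 * ‖gradient u x - u x • XT 1 0 1 x‖ ^ 2 = ‖gradient u x - u x • XT 1 0 1 x‖ ^ 2 * WW k s x ^ (-((d:ℝ) - 2)) := by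
    intro x; rw [hsq, mul_comm]
  have e3 : ∀ x, (u x * hT A b C x) ^ 2 / qf A b C x ^ 2 = u x ^ 2 / jb x ^ 2 * WW k s x ^ (-(d:ℝ)) := by
    intro x
    have hp := hpos x
    have hj := jb_pos x
    rw [mul_pow, hsq, hq, show -(d:ℝ) = -((d:ℝ) - 2) - 2 by ring, Real.rpow_sub hp]
    norm_cast
    field_simp
  simp_rw [e1, e2, e3] at h2
  exact h2

/-- the averaged weight minus one -/
def BB {d : ℕ} (s : ℝ) (x : EE d) : ℝ := (∑ k : Ix d, WW k s x ^ (-(d:ℝ))) / (2 * (d + 1)) - 1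

lemma BB_bd (d : ℕ) : ∃ K > 0, ∀ s, 0 < s → s ≤ 1/4 → ∀ x : EE d, |BB s x| ≤ K * s ^ 3 := by
  obtain ⟨K, hK, h⟩ := WW_avg (d := d) (-(d:ℝ))
  refine ⟨K, hK, fun s h0 h1 x => ?_⟩
  have h2 := h s h0 h1 x
  have e : ∑ k : Ix d, WW k s x ^ (-(d:ℝ)) - 2 * (d + 1) - (-(d:ℝ) * (d + 1) + -(d:ℝ) * (-(d:ℝ) - 1)) * s ^ 2 = 2 * (d + 1) * BB s x := by
    unfold BB; field_simp; ring
  rw [e, abs_mul, abs_of_pos (by positivity)] at h2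
  have : (0:ℝ) ≤ d := by positivity
  nlinarith [abs_nonneg (BB s x)]

lemma BB_cont {d : ℕ} {s : ℝ} (h0 : 0 < s) (h1 : s ≤ 1/4) : Continuous (BB (d := d) s) := by
  unfold BB
  exact ((continuous_finset_sum _ fun k _ => WW_pow_cont k h0 h1 _).div_const _).sub continuous_const

lemma int_mul_BB {d : ℕ} {f : EE d → ℝ} (hf : Integrable f) {s : ℝ} (h0 : 0 < s) (h1 : s ≤ 1/4) :
    Integrable fun x => f x * BB s x := by
  obtain ⟨K, hK, h⟩ := BB_bd d
  exact int_bdd hf (BB_cont h0 h1).measurable (h s h0 h1)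

lemma sum_int_WW {d : ℕ} {f : EE d → ℝ} (hf : Integrable f) {s : ℝ} (h0 : 0 < s) (h1 : s ≤ 1/4) :
    ∑ k : Ix d, ∫ x, f x * WW k s x ^ (-(d:ℝ)) = 2 * (d + 1) * ((∫ x, f x) + ∫ x, f x * BB s x) := by
  rw [← integral_finset_sum _ (fun k _ => int_mul_WW hf k h0 h1 _), ← integral_add hf (int_mul_BB hf h0 h1), ← integral_const_mul]
  congr 1; ext x
  rw [← Finset.mul_sum]
  unfold BB; field_simp; ring

/-- the k-th perturbed mass minus one -/
def xk {d : ℕ} (u : EE d → ℝ) (s : ℝ) (k : Ix d) : ℝ := (∫ x, |u x| ^ pp d * WW k s x ^ (-(d:ℝ))) - 1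

lemma key_ineq {d : ℕ} (hd : 3 ≤ d) : ∃ K > 0, ∀ s, 0 < s → s ≤ 1/4 → ∀ S', 0 ≤ S' → IsSob d S' → ∀ u : EE d → ℝ, MemD12 d u →
    ∫ x, |u x| ^ pp d = 1 →
    1 + 2 / pp d * (∫ x, |u x| ^ pp d * BB s x) - (1 - 2 / pp d) * ((∑ k, xk u s k ^ 2) / (2 * (d + 1))) ≤
      S' * ((1 - ((d:ℝ) - 2) / (d + 1) * s ^ 2 + K * s ^ 3) * DD u + d * ((d:ℝ) - 2) * ((∫ x, u x ^ 2 / jb x ^ 2) + ∫ x, u x ^ 2 / jb x ^ 2 * BB s x)) := by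
  have hd' : (3:ℝ) ≤ d := by exact_mod_cast hd
  obtain ⟨K, hK, h⟩ := WW_avg (d := d) (-((d:ℝ) - 2))
  obtain ⟨hθ0, hθ1⟩ := theta_bds hd
  refine ⟨K, hK, fun s h0 h1 S' hS'0 hS' u hu hu1 => ?_⟩
  set θ := 2 / pp d with hθ
  have hN : (0:ℝ) < 2 * (d + 1) := by positivity
  have hip : Integrable fun x => |u x| ^ pp d := hu.2.2
  have hlow : ∀ k : Ix d, 1 + θ * xk u s k - (1 - θ) * xk u s k ^ 2 ≤
      S' * ((∫ x, ‖gradient u x - u x • XT 1 0 1 x‖ ^ 2 * WW k s x ^ (-((d:ℝ) - 2))) + d * ((d:ℝ) - 2) * ∫ x, u x ^ 2 / jb x ^ 2 * WW k s x ^ (-(d:ℝ))) := by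
    intro k
    refine le_trans ?_ (sob_k hd hS' hu k h0 h1)
    have hpos : 0 < ∫ x, |u x| ^ pp d * WW k s x ^ (-(d:ℝ)) := by
      have hb : ∀ x, (2:ℝ) ^ (-(d:ℝ)) ≤ WW k s x ^ (-(d:ℝ)) := fun x => by
        have := (abs_le.1 (WW_bd k h0 h1 x)).2
        exact Real.rpow_le_rpow_of_nonpos (WW_pos k h0 h1 x) (by linarith) (by linarith)
      calc 0 < (2:ℝ) ^ (-(d:ℝ)) * ∫ x, |u x| ^ pp d := by rw [hu1]; positivity
        _ = ∫ x, |u x| ^ pp d * (2:ℝ) ^ (-(d:ℝ)) := by rw [integral_mul_const, mul_comm]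
        _ ≤ _ := by
          refine integral_mono (hip.mul_const _) (int_mul_WW hip k h0 h1 _) fun x => ?_
          exact mul_le_mul_of_nonneg_left (hb x) (by positivity)
    exact rpow_theta_lower hθ0.le hθ1.le hpos
  have hsum := Finset.sum_le_sum fun k (_ : k ∈ Finset.univ) => hlow k
  rw [Finset.sum_sub_distrib, Finset.sum_add_distrib, ← Finset.mul_sum, ← Finset.mul_sum, ← Finset.mul_sum, Finset.sum_add_distrib, ← Finset.mul_sum,
    Finset.sum_const, Finset.card_univ, nsmul_eq_mul, card_Ix, mul_one, sum_int_WW (hu.int_sq_div_jb hd) h0 h1] at hsum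
  have ex : ∑ k, xk u s k = 2 * (d + 1) * ∫ x, |u x| ^ pp d * BB s x := by
    unfold xk
    rw [Finset.sum_sub_distrib, sum_int_WW hip h0 h1, Finset.sum_const, Finset.card_univ, nsmul_eq_mul, card_Ix, hu1]; ring
  rw [ex] at hsum
  have hD := hu.int_D0 hd
  have hDsum : ∑ k : Ix d, ∫ x, ‖gradient u x - u x • XT 1 0 1 x‖ ^ 2 * WW k s x ^ (-((d:ℝ) - 2)) ≤
      2 * (d + 1) * ((1 - ((d:ℝ) - 2) / (d + 1) * s ^ 2 + K * s ^ 3) * DD u) := by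
    rw [← integral_finset_sum _ (fun k _ => int_mul_WW hD k h0 h1 _), DD, ← mul_assoc, ← integral_const_mul]
    refine integral_mono (integrable_finset_sum _ (fun k _ => int_mul_WW hD k h0 h1 _)) (hD.const_mul _) fun x => ?_
    simp only
    rw [← Finset.mul_sum, mul_comm]
    gcongr
    have h2 := (abs_le.1 (h s h0 h1 x)).2
    have e : 2 * ((d:ℝ) + 1) * (1 - ((d:ℝ) - 2) / (d + 1) * s ^ 2 + K * s ^ 3) = 2 * (d + 1) - 2 * ((d:ℝ) - 2) * s ^ 2 + 2 * (d + 1) * (K * s ^ 3) := by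
      field_simp
    rw [e]
    have : 0 < K * s ^ 3 := by positivity
    nlinarith
  have hm := mul_le_mul_of_nonneg_left (add_le_add_left hDsum (d * ((d:ℝ) - 2) * (2 * (d + 1) * ((∫ x, u x ^ 2 / jb x ^ 2) + ∫ x, u x ^ 2 / jb x ^ 2 * BB s x)))) hS'0
  have hfin := hsum.trans hm
  rw [← mul_le_mul_iff_right₀ hN]
  refine le_trans (le_of_eq ?_) (hfin.trans (le_of_eq ?_))
  · field_simp
  · ring
end

open MeasureTheory Real
noncomputable section
open scoped ContDiff Topology
open Filter

lemma integral_jb_rpow {d : ℕ} {s : ℝ} (hs : (d : ℝ) / 2 < s) :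
    ∫ x : EE d, jb x ^ (-s) = Real.pi ^ ((d:ℝ) / 2) * Real.Gamma (s - d / 2) / Real.Gamma s := by
  have hs0 : 0 < s := lt_of_le_of_lt (by positivity) hs
  have hG : 0 < Real.Gamma s := Real.Gamma_pos_of_pos hs0
  have hG2 : 0 < Real.Gamma (s - d / 2) := Real.Gamma_pos_of_pos (by linarith)
  have h1 : ∀ x : EE d, Real.Gamma s * jb x ^ (-s) = ∫ t in Set.Ioi (0:ℝ), t ^ (s - 1) * Real.exp (-(jb x * t)) := by
    intro x
    rw [Real.integral_rpow_mul_exp_neg_mul_Ioi hs0 (jb_pos x), Real.rpow_neg (jb_pos x).le, one_div, Real.inv_rpow (jb_pos x).le]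
    ring
  -- swap
  have hIntegX : ∀ x : EE d, IntegrableOn (fun t => t ^ (s - 1) * Real.exp (-(jb x * t))) (Set.Ioi (0:ℝ)) := by
    intro x
    by_contra h
    have := h1 x
    rw [integral_undef h] at this
    have := mul_pos hG (Real.rpow_pos_of_pos (jb_pos x) (-s))
    linarith
  have hF : ∀ t ∈ Set.Ioi (0:ℝ), (Integrable fun x : EE d => t ^ (s - 1) * Real.exp (-(jb x * t))) ∧
      ∫ x : EE d, t ^ (s - 1) * Real.exp (-(jb x * t)) = Real.pi ^ ((d:ℝ)/2) * (t ^ (s - d/2 - 1) * Real.exp (-(1 * t))) := by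
    intro t ht
    have ht : 0 < t := ht
    have e : ∀ x : EE d, t ^ (s - 1) * Real.exp (-(jb x * t)) = (t ^ (s - 1) * Real.exp (-t)) * Real.exp (-t * ‖x‖ ^ 2) := by
      intro x
      rw [mul_assoc, ← Real.exp_add]; congr 2; unfold jb; ring
    have hv : ∫ x : EE d, Real.exp (-t * ‖x‖ ^ 2) = (Real.pi / t) ^ ((d:ℝ)/2) := by
      rw [GaussianFourier.integral_rexp_neg_mul_sq_norm ht]; simp
    have hi : Integrable fun x : EE d => Real.exp (-t * ‖x‖ ^ 2) := by
      by_contra h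
      rw [integral_undef h] at hv
      have : 0 < (Real.pi / t) ^ ((d:ℝ)/2) := by positivity
      linarith
    simp_rw [e]
    refine ⟨hi.const_mul _, ?_⟩
    rw [integral_const_mul, hv, Real.div_rpow Real.pi_pos.le ht.le]
    rw [show s - d/2 - 1 = (s - 1) - d/2 by ring, Real.rpow_sub ht (s-1), one_mul]
    ring
  have hmeas : Measurable fun z : EE d × ℝ => z.2 ^ (s - 1) * Real.exp (-(jb z.1 * z.2)) := by
    have : Measurable (jb : EE d → ℝ) := continuous_jb.measurable
    fun_prop
  have hpi : Integrable (fun z : EE d × ℝ => z.2 ^ (s - 1) * Real.exp (-(jb z.1 * z.2))) (volume.prod (volume.restrict (Set.Ioi (0:ℝ)))) := by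
    rw [integrable_prod_iff' hmeas.aestronglyMeasurable]
    constructor
    · filter_upwards [ae_restrict_mem measurableSet_Ioi] with t ht using (hF t ht).1
    · have : IntegrableOn (fun t : ℝ => Real.pi ^ ((d:ℝ)/2) * (t ^ (s - d/2 - 1) * Real.exp (-(1 * t)))) (Set.Ioi 0) := by
        refine Integrable.const_mul ?_ _
        have := Real.GammaIntegral_convergent (s := s - d/2) (by linarith)
        refine this.congr_fun (fun t _ => ?_) measurableSet_Ioi
        simp [mul_comm]
      refine this.congr_fun (fun t ht => ?_) measurableSet_Ioi
      simp only
      rw [← (hF t ht).2]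
      refine integral_congr_ae (Eventually.of_forall fun x => ?_)
      simp only
      rw [Real.norm_of_nonneg]
      have : 0 < t := ht
      positivity
  have hsw := integral_integral_swap (f := fun (x : EE d) (t : ℝ) => t ^ (s - 1) * Real.exp (-(jb x * t))) hpi
  have hL : ∫ x : EE d, ∫ t in Set.Ioi (0:ℝ), t ^ (s - 1) * Real.exp (-(jb x * t)) = Real.Gamma s * ∫ x : EE d, jb x ^ (-s) := by
    rw [← integral_const_mul]; simp_rw [h1]
  have hR : ∫ t in Set.Ioi (0:ℝ), ∫ x : EE d, t ^ (s - 1) * Real.exp (-(jb x * t)) = Real.pi ^ ((d:ℝ)/2) * Real.Gamma (s - d/2) := by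
    rw [setIntegral_congr_fun measurableSet_Ioi (fun t ht => (hF t ht).2), integral_const_mul,
      Real.integral_rpow_mul_exp_neg_mul_Ioi (by linarith) one_pos]
    simp
  have : Real.Gamma s * ∫ x : EE d, jb x ^ (-s) = Real.pi ^ ((d:ℝ)/2) * Real.Gamma (s - d/2) := by
    rw [← hL, ← hR]; exact hsw
  rw [← this]; field_simp

/-- volume of the sphere -/
def sig (d : ℕ) : ℝ := ∫ x : EE d, jb x ^ (-(d:ℝ))

lemma sig_eq {d : ℕ} (hd : 3 ≤ d) : sig d = Real.pi ^ ((d:ℝ) / 2) * Real.Gamma (d / 2) / Real.Gamma d := by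
  have : (3:ℝ) ≤ d := by exact_mod_cast hd
  rw [sig, integral_jb_rpow (by linarith)]
  congr 3; ring

lemma sig_pos {d : ℕ} (hd : 3 ≤ d) : 0 < sig d := by
  have : (3:ℝ) ≤ d := by exact_mod_cast hd
  rw [sig_eq hd]
  have := Real.Gamma_pos_of_pos (show (0:ℝ) < d / 2 by linarith)
  have := Real.Gamma_pos_of_pos (show (0:ℝ) < d by linarith)
  positivity

lemma sobolevConst_pos {d : ℕ} (hd : 3 ≤ d) : 0 < sobolevConst d := by
  have : (3:ℝ) ≤ d := by exact_mod_cast hd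
  have := Real.Gamma_pos_of_pos (show (0:ℝ) < d / 2 by linarith)
  have := Real.Gamma_pos_of_pos (show (0:ℝ) < d by linarith)
  have : (0:ℝ) < d - 2 := by linarith
  unfold sobolevConst
  positivity

lemma sob_sig {d : ℕ} (hd : 3 ≤ d) : sobolevConst d * (d * ((d:ℝ) - 2)) = sig d ^ (-(2 / (d:ℝ))) := by
  have h3 : (3:ℝ) ≤ d := by exact_mod_cast hd
  have h1 := Real.Gamma_pos_of_pos (show (0:ℝ) < d / 2 by linarith)
  have h2 := Real.Gamma_pos_of_pos (show (0:ℝ) < d by linarith)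
  have h4 : (0:ℝ) < d - 2 := by linarith
  rw [sig_eq hd, sobolevConst, Real.rpow_neg (by positivity), ← Real.inv_rpow (by positivity)]
  rw [show (Real.pi ^ ((d:ℝ) / 2) * Real.Gamma (d / 2) / Real.Gamma d)⁻¹ = (Real.pi ^ ((d:ℝ) / 2))⁻¹ * (Real.Gamma d / Real.Gamma (d / 2)) by
    field_simp]
  rw [Real.mul_rpow (by positivity) (by positivity), ← Real.rpow_neg Real.pi_pos.le, ← Real.rpow_mul Real.pi_pos.le]
  rw [show -((d:ℝ)/2) * (2 / d) = -1 by field_simp, Real.rpow_neg_one]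
  field_simp

lemma two_div_pp {d : ℕ} (hd : 3 ≤ d) : 2 / pp d = 1 - 2 / (d:ℝ) := by
  have h3 : (3:ℝ) ≤ d := by exact_mod_cast hd
  have h4 : (0:ℝ) < d - 2 := by linarith
  unfold pp; field_simp

/-- 1/S = d(d-2) σ^{2/d} -/
lemma sob_sig' {d : ℕ} (hd : 3 ≤ d) : sobolevConst d * (d * ((d:ℝ) - 2) * sig d) = sig d ^ (2 / pp d) := by
  rw [← mul_assoc, sob_sig hd, two_div_pp hd, sub_eq_add_neg, Real.rpow_add (sig_pos hd), Real.rpow_one, mul_comm]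

section norms
variable {d : ℕ}

lemma lpNorm'_eq {p : ℝ} (hp : 1 ≤ p) {f : EE d → ℝ} (hf : MemLp f (ENNReal.ofReal p)) :
    lpNorm' p f = (eLpNorm f (ENNReal.ofReal p) volume).toReal := by
  rw [hf.eLpNorm_eq_integral_rpow_norm (by simp; linarith) (by simp)]
  have h0 : 0 ≤ ∫ x, |f x| ^ p := integral_nonneg fun x => by positivity
  rw [ENNReal.toReal_ofReal (show 0 ≤ p by linarith)]
  simp only [Real.norm_eq_abs]
  rw [ENNReal.toReal_ofReal (by positivity), lpNorm', one_div]

lemma lpNorm'_nonneg (p : ℝ) (f : EE d → ℝ) : 0 ≤ lpNorm' p f := by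
  unfold lpNorm'
  have : 0 ≤ ∫ x, |f x| ^ p := integral_nonneg fun x => by positivity
  positivity

lemma lpNorm'_add_le {p : ℝ} (hp : 1 ≤ p) {f g : EE d → ℝ} (hf : MemLp f (ENNReal.ofReal p)) (hg : MemLp g (ENNReal.ofReal p)) :
    lpNorm' p (fun x => f x + g x) ≤ lpNorm' p f + lpNorm' p g := by
  rw [lpNorm'_eq hp hf, lpNorm'_eq hp hg, show (fun x => f x + g x) = f + g from rfl, lpNorm'_eq hp (hf.add hg), ← ENNReal.toReal_add hf.2.ne hg.2.ne]
  exact ENNReal.toReal_mono (ENNReal.add_ne_top.2 ⟨hf.2.ne, hg.2.ne⟩) (eLpNorm_add_le hf.1 hg.1 (by rw [ENNReal.one_le_ofReal]; exact hp))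

lemma lpNorm'_const_mul {p : ℝ} (hp : 1 ≤ p) (c : ℝ) (f : EE d → ℝ) :
    lpNorm' p (fun x => c * f x) = |c| * lpNorm' p f := by
  unfold lpNorm'
  have : ∀ x, |c * f x| ^ p = |c| ^ p * |f x| ^ p := fun x => by rw [abs_mul, Real.mul_rpow (abs_nonneg _) (abs_nonneg _)]
  simp_rw [this]
  rw [integral_const_mul, Real.mul_rpow (by positivity) (integral_nonneg fun x => by positivity), ← Real.rpow_mul (abs_nonneg _), mul_one_div_cancel (by linarith), Real.rpow_one]

lemma lpNorm'_rpow {p : ℝ} (hp : 0 < p) (f : EE d → ℝ) : lpNorm' p f ^ p = ∫ x, |f x| ^ p := by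
  rw [lpNorm', ← Real.rpow_mul (integral_nonneg fun x => by positivity), one_div_mul_cancel hp.ne', Real.rpow_one]

lemma lpNorm'_rpow_two {p : ℝ} (f : EE d → ℝ) : lpNorm' p f ^ (2:ℝ) = (∫ x, |f x| ^ p) ^ (2 / p) := by
  rw [lpNorm', ← Real.rpow_mul (integral_nonneg fun x => by positivity)]; congr 1; ring

lemma lpNorm'_sq {p : ℝ} (f : EE d → ℝ) : lpNorm' p f ^ 2 = (∫ x, |f x| ^ p) ^ (2 / p) := by
  rw [← lpNorm'_rpow_two]; norm_num

end norms

lemma lp_UU {d : ℕ} (hd : 3 ≤ d) : ∫ x : EE d, |UU x| ^ pp d = sig d := by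
  unfold sig
  congr 1; ext x; rw [abs_of_pos (UU_pos x), UU_pp hd]

lemma UU_sq_div {d : ℕ} (x : EE d) : UU x ^ 2 / jb x ^ 2 = jb x ^ (-(d:ℝ)) := by
  have h := jb_pos x
  rw [UU, ← Real.rpow_natCast, ← Real.rpow_mul h.le, ← Real.rpow_natCast (jb x) 2, ← Real.rpow_sub h]
  congr 1; push_cast; ring

lemma IsSob.pos {d : ℕ} (hd : 3 ≤ d) {S' : ℝ} (h : IsSob d S') : 0 < S' := by
  have := h UU (memD12_UU hd)
  rw [lp_UU hd] at this
  have h1 : 0 < sig d ^ (2 / pp d) := Real.rpow_pos_of_pos (sig_pos hd) _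
  by_contra h2
  push Not at h2
  have : S' * ∫ x : EE d, ‖gradient UU x‖ ^ 2 ≤ 0 := mul_nonpos_of_nonpos_of_nonneg h2 (integral_nonneg fun x => by positivity)
  linarith
end

open MeasureTheory Real
noncomputable section
open scoped ContDiff Topology
open Filter

def RR {d : ℕ} (k : Ix d) (s : ℝ) (x : EE d) : ℝ := WW k s x ^ (-(d:ℝ)) - 1 + d * s * ok k x

lemma RR_bd (d : ℕ) : ∃ K > 0, ∀ s, 0 < s → s ≤ 1/4 → ∀ (k : Ix d) x, |RR k s x| ≤ K * s ^ 2 := by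
  obtain ⟨K, hK, h⟩ := WW_taylor (d := d) (-(d:ℝ))
  refine ⟨K + d / 2 + d * (d + 1) / 2, by positivity, fun s h0 h1 k x => ?_⟩
  have := abs_le.1 (h s h0 h1 k x)
  have ho : ok k x ^ 2 ≤ 1 := by
    have := ok_abs k x
    rw [← sq_abs]; nlinarith [abs_nonneg (ok k x)]
  have ho2 := sq_nonneg (ok k x)
  have h3 : K * s ^ 3 ≤ K * s ^ 2 := by
    apply mul_le_mul_of_nonneg_left _ hK.le; nlinarith [sq_nonneg s]
  have hd0 : (0:ℝ) ≤ d := by positivity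
  have h4 : 0 ≤ d * (d + 1) / 2 * s ^ 2 := by positivity
  have h5 : d * ((d:ℝ) + 1) / 2 * s ^ 2 * ok k x ^ 2 ≤ d * (d + 1) / 2 * s ^ 2 := by nlinarith
  have h6 : 0 ≤ d * ((d:ℝ) + 1) / 2 * s ^ 2 * ok k x ^ 2 := by positivity
  have h7 : 0 ≤ d / 2 * s ^ 2 := by positivity
  unfold RR
  rw [abs_le]
  constructor <;> nlinarith

lemma RR_cont {d : ℕ} (k : Ix d) {s : ℝ} (h0 : 0 < s) (h1 : s ≤ 1/4) : Continuous (RR (d := d) k s) := by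
  unfold RR
  exact ((WW_pow_cont k h0 h1 _).sub continuous_const).add (continuous_const.mul (ok_cont k))

lemma int_mul_RR {d : ℕ} {f : EE d → ℝ} (hf : Integrable f) (k : Ix d) {s : ℝ} (h0 : 0 < s) (h1 : s ≤ 1/4) :
    Integrable fun x => f x * RR k s x := by
  obtain ⟨K, hK, h⟩ := RR_bd d
  exact int_bdd hf (RR_cont k h0 h1).measurable (h s h0 h1 k)

lemma int_mul_ok {d : ℕ} {f : EE d → ℝ} (hf : Integrable f) (k : Ix d) :
    Integrable fun x => f x * ok k x := int_bdd hf (ok_cont k).measurable (ok_abs k)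

lemma int_RR {d : ℕ} {f : EE d → ℝ} (hf : Integrable f) (k : Ix d) {s : ℝ} (h0 : 0 < s) (h1 : s ≤ 1/4) :
    ∫ x, f x * RR k s x = (∫ x, f x * WW k s x ^ (-(d:ℝ))) - (∫ x, f x) + d * s * ∫ x, f x * ok k x := by
  have e : ∀ x, f x * RR k s x = (f x * WW k s x ^ (-(d:ℝ)) - f x) + d * s * (f x * ok k x) := fun x => by unfold RR; ring
  simp_rw [e]
  have i1 : Integrable (fun x => f x * WW k s x ^ (-(d:ℝ)) - f x) := (int_mul_WW hf k h0 h1 _).sub hf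
  rw [integral_add i1 ((int_mul_ok hf k).const_mul _), integral_sub (int_mul_WW hf k h0 h1 _) hf, integral_const_mul]

lemma Cen.ok {d : ℕ} {u : EE d → ℝ} (h : Cen u) (k : Ix d) : ∫ x, |u x| ^ pp d * ok k x = 0 := by
  have : ∀ x, |u x| ^ pp d * _root_.ok k x = sgb k.2 * (|u x| ^ pp d * om k.1 x) := fun x => by unfold _root_.ok; ring
  simp_rw [this]
  rw [integral_const_mul, h]; simp

lemma xk_eq {d : ℕ} {u : EE d → ℝ} (hu : MemD12 d u) (h1 : ∫ x, |u x| ^ pp d = 1) (hc : Cen u) (k : Ix d) {s : ℝ} (hs0 : 0 < s) (hs1 : s ≤ 1/4) :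
    xk u s k = ∫ x, |u x| ^ pp d * RR k s x := by
  rw [int_RR hu.int_pp k hs0 hs1, hc.ok, h1, xk]; ring

lemma abs_int_mul_le {d : ℕ} {f g : EE d → ℝ} (hf : Integrable f) {K : ℝ} (hg : ∀ x, |g x| ≤ K) :
    |∫ x, f x * g x| ≤ K * ∫ x, |f x| := by
  rw [← integral_const_mul, ← Real.norm_eq_abs]
  refine norm_integral_le_of_norm_le (hf.abs.const_mul K) (Eventually.of_forall fun x => ?_)
  rw [Real.norm_eq_abs, abs_mul, mul_comm]
  exact mul_le_mul_of_nonneg_right (hg x) (abs_nonneg _)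

lemma crude {d : ℕ} (hd : 3 ≤ d) {S' : ℝ} (hS : IsSob d S') {ε : ℝ} (hε : 0 < ε) :
    ∃ δ > 0, ∀ u : EE d → ℝ, MemD12 d u → ∫ x, |u x| ^ pp d = 1 → Cen u → S' * ∫ x, ‖gradient u x‖ ^ 2 ≤ 1 + δ → DD u ≤ ε := by
  have hS0 := hS.pos hd
  have h3 : (3:ℝ) ≤ d := by exact_mod_cast hd
  obtain ⟨K1, hK1, k1⟩ := key_ineq hd
  obtain ⟨K2, hK2, k2⟩ := RR_bd d
  obtain ⟨K3, hK3, k3⟩ := BB_bd d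
  set c : ℝ := ((d:ℝ) - 2) / (d + 1) with hc
  have hc0 : 0 < c := by apply div_pos <;> linarith
  set L : ℝ := K3 + K2 ^ 2 + 2 * K1 + 2 * K3 with hL
  have hL0 : 0 < L := by positivity
  -- choose s with L * s ≤ c S' ε / 2
  set s : ℝ := min (1/4) (c * S' * ε / (2 * L)) with hs
  have hs0 : 0 < s := lt_min (by norm_num) (by positivity)
  have hs1 : s ≤ 1/4 := min_le_left _ _
  have hs2 : L * s ≤ c * S' * ε / 2 := by
    have : s ≤ c * S' * ε / (2 * L) := min_le_right _ _
    calc L * s ≤ L * (c * S' * ε / (2 * L)) := by gcongr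
      _ = _ := by field_simp
  refine ⟨min 1 (c * s ^ 2 * S' * ε / 2), lt_min one_pos (by positivity), fun u hu hu1 hcen hE => ?_⟩
  have hE1 := hE.trans (add_le_add_right (min_le_left 1 (c * s ^ 2 * S' * ε / 2)) 1)
  have hE2 := hE.trans (add_le_add_right (min_le_right 1 (c * s ^ 2 * S' * ε / 2)) 1)
  have key := k1 s hs0 hs1 S' hS0.le hS u hu hu1
  rw [hu.energy_eq hd] at hE1 hE2
  have hM0 : 0 ≤ ∫ x, u x ^ 2 / jb x ^ 2 := integral_nonneg fun x => by positivity
  have hD0 := MemD12.DD_nonneg u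
  rw [mul_add] at hE1 hE2
  obtain ⟨ht0, ht1⟩ := theta_bds hd
  have b1 : |∫ x, |u x| ^ pp d * BB s x| ≤ K3 * s ^ 3 := by
    have := abs_int_mul_le hu.int_pp (k3 s hs0 hs1)
    simp_rw [abs_of_nonneg (show 0 ≤ |u _| ^ pp d by positivity)] at this
    rwa [hu1, mul_one] at this
  have b2 : |∫ x, u x ^ 2 / jb x ^ 2 * BB s x| ≤ K3 * s ^ 3 * ∫ x, u x ^ 2 / jb x ^ 2 := by
    have := abs_int_mul_le (hu.int_sq_div_jb hd) (k3 s hs0 hs1)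
    simp_rw [abs_of_nonneg (show 0 ≤ u _ ^ 2 / jb _ ^ 2 by positivity)] at this
    exact this
  have b3 : (∑ k, xk u s k ^ 2) / (2 * (d + 1)) ≤ K2 ^ 2 * s ^ 3 := by
    rw [div_le_iff₀ (by positivity)]
    have : ∀ k, xk u s k ^ 2 ≤ K2 ^ 2 * s ^ 3 := by
      intro k
      have h := abs_int_mul_le hu.int_pp (k2 s hs0 hs1 k)
      simp_rw [abs_of_nonneg (show 0 ≤ |u _| ^ pp d by positivity)] at h
      rw [hu1, mul_one, ← xk_eq hu hu1 hcen k hs0 hs1] at h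
      have h' : xk u s k ^ 2 ≤ (K2 * s ^ 2) ^ 2 := by
        rw [← sq_abs]; exact pow_le_pow_left₀ (abs_nonneg _) h 2
      refine h'.trans ?_
      rw [mul_pow]
      refine mul_le_mul_of_nonneg_left ?_ (by positivity)
      rw [← pow_mul]
      exact pow_le_pow_of_le_one hs0.le (by linarith) (by norm_num)
    calc ∑ k, xk u s k ^ 2 ≤ ∑ k : Ix d, K2 ^ 2 * s ^ 3 := Finset.sum_le_sum fun k _ => this k
      _ = _ := by rw [Finset.sum_const, nsmul_eq_mul, Finset.card_univ, card_Ix]; ring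
  set M : ℝ := d * ((d:ℝ) - 2) * ∫ x, u x ^ 2 / jb x ^ 2 with hM
  have hM1 : 0 ≤ M := by apply mul_nonneg _ hM0; nlinarith
  have b2' : d * ((d:ℝ) - 2) * ∫ x, u x ^ 2 / jb x ^ 2 * BB s x ≤ K3 * s ^ 3 * M := by
    rw [hM]
    have := (abs_le.1 b2).2
    have h9 : (0:ℝ) ≤ d * (d - 2) := by nlinarith
    calc _ ≤ d * ((d:ℝ) - 2) * (K3 * s ^ 3 * ∫ x, u x ^ 2 / jb x ^ 2) := mul_le_mul_of_nonneg_left this h9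
      _ = _ := by ring
  have b1' := (abs_le.1 b1).1
  set I1 := ∫ x, |u x| ^ pp d * BB s x
  set X := (∑ k, xk u s k ^ 2) / (2 * ((d:ℝ) + 1))
  have hX0 : 0 ≤ X := div_nonneg (Finset.sum_nonneg fun _ _ => sq_nonneg _) (by positivity)
  have hs3 : 0 < s ^ 3 := by positivity
  have c1 : -(K3 * s ^ 3) ≤ 2 / pp d * I1 := by
    have : 2 / pp d * (-(K3 * s ^ 3)) ≤ 2 / pp d * I1 := mul_le_mul_of_nonneg_left b1' ht0.le
    have h12 : 2 / pp d * (K3 * s ^ 3) ≤ 1 * (K3 * s ^ 3) := mul_le_mul_of_nonneg_right ht1.le (by positivity)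
    linarith
  have c2 : (1 - 2 / pp d) * X ≤ K2 ^ 2 * s ^ 3 := by
    have : (1 - 2 / pp d) * X ≤ 1 * X := mul_le_mul_of_nonneg_right (by linarith) hX0
    linarith
  have c3 : S' * (d * ((d:ℝ) - 2) * ((∫ x, u x ^ 2 / jb x ^ 2) + ∫ x, u x ^ 2 / jb x ^ 2 * BB s x)) ≤ S' * M + 2 * K3 * s ^ 3 := by
    have : S' * (d * ((d:ℝ) - 2) * ((∫ x, u x ^ 2 / jb x ^ 2) + ∫ x, u x ^ 2 / jb x ^ 2 * BB s x)) ≤ S' * (M + K3 * s ^ 3 * M) := by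
      refine mul_le_mul_of_nonneg_left ?_ hS0.le
      rw [mul_add]; linarith
    have h8 : S' * M ≤ 2 := by
      have := mul_nonneg hS0.le hD0
      linarith
    have : S' * M * (K3 * s ^ 3) ≤ 2 * (K3 * s ^ 3) := mul_le_mul_of_nonneg_right h8 (by positivity)
    linarith
  have hD2 : S' * DD u ≤ 2 := by
      have := mul_nonneg hS0.le hM1
      linarith
  have c4 : S' * DD u * (K1 * s ^ 3) ≤ 2 * (K1 * s ^ 3) := mul_le_mul_of_nonneg_right hD2 (by positivity)
  have fin : c * s ^ 2 * (S' * DD u) ≤ c * s ^ 2 * S' * ε / 2 + L * s ^ 3 := by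
    rw [mul_add] at key
    rw [hL]
    linarith
  have : L * s ^ 3 ≤ s ^ 2 * (c * S' * ε / 2) := by
    calc L * s ^ 3 = s ^ 2 * (L * s) := by ring
      _ ≤ _ := by gcongr
  have h10 : c * s ^ 2 * S' * DD u ≤ c * s ^ 2 * S' * ε := by linarith
  exact le_of_mul_le_mul_left h10 (by positivity)
end

open MeasureTheory Real
noncomputable section
open scoped ContDiff Topology
open Filter

lemma near {d : ℕ} (hd : 3 ≤ d) : ∃ C > 0, ∀ u : EE d → ℝ, MemD12 d u → ∃ k : ℝ, ((∀ x, 0 ≤ u x) → 0 ≤ k) ∧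
    MemD12 d (fun x => u x - k * UU x) ∧
    lpNorm' (pp d) (fun x => u x - k * UU x) ≤ √(C * DD u) ∧ ∫ x, (u x - k * UU x) ^ 2 / jb x ^ 2 ≤ C * DD u := by
  have h3 : (3:ℝ) ≤ d := by exact_mod_cast hd
  have h4 : (0:ℝ) < d - 2 := by linarith
  obtain ⟨S', hS0, hS⟩ := exists_sob hd
  obtain ⟨CP, hCP, hP⟩ := poincare hd
  refine ⟨CP + S' * (1 + d * ((d:ℝ) - 2) * CP), by positivity, fun u hu => ?_⟩
  obtain ⟨k, hk0, hk⟩ := hP u hu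
  have hD := MemD12.DD_nonneg u
  have hz : MemD12 d (fun x => 1 * u x + -k * UU x) := (hu.const_mul hd 1).add hd ((memD12_UU hd).const_mul hd (-k))
  have hzD := DD_add_UU hu.diff 1 (-k)
  have e : (fun x => 1 * u x + -k * UU x) = fun x => u x - k * UU x := by ext x; ring
  rw [e] at hz hzD
  refine ⟨k, hk0, hz, ?_, ?_⟩
  · apply Real.le_sqrt_of_sq_le
    rw [lpNorm'_sq]
    refine (hS _ hz).trans ?_
    rw [hz.energy_eq hd, hzD]
    have : S' * (1 ^ 2 * DD u + d * ((d:ℝ) - 2) * ∫ x, (u x - k * UU x) ^ 2 / jb x ^ 2) ≤ S' * (1 ^ 2 * DD u + d * ((d:ℝ) - 2) * (CP * DD u)) := by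
      gcongr
    refine this.trans ?_
    nlinarith [mul_nonneg hCP.le hD]
  · refine hk.trans (mul_le_mul_of_nonneg_right ?_ hD)
    have : 0 ≤ S' * (1 + d * ((d:ℝ) - 2) * CP) := by positivity
    linarith

lemma lpNorm'_two {d : ℕ} (f : EE d → ℝ) : lpNorm' 2 f = √(∫ x, f x ^ 2) := by
  rw [lpNorm', Real.sqrt_eq_rpow]; congr 1
  refine integral_congr_ae (Eventually.of_forall fun x => ?_)
  simp

lemma lpNorm'_UU {d : ℕ} (hd : 3 ≤ d) : lpNorm' (pp d) (UU : EE d → ℝ) = sig d ^ (1 / pp d) := by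
  rw [lpNorm', lp_UU hd]

lemma one_le_pp {d : ℕ} (hd : 3 ≤ d) : 1 ≤ pp d := by linarith [two_lt_pp hd]

lemma lpNorm'_sub_comm {d : ℕ} (p : ℝ) (f g : EE d → ℝ) : lpNorm' p (fun x => f x - g x) = lpNorm' p (fun x => g x - f x) := by
  unfold lpNorm'; simp_rw [abs_sub_comm]

lemma near_k {d : ℕ} (hd : 3 ≤ d) {u : EE d → ℝ} (hu : MemD12 d u) (h1 : ∫ x, |u x| ^ pp d = 1) {k η : ℝ}
    (hz : MemD12 d (fun x => u x - k * UU x)) (h : lpNorm' (pp d) (fun x => u x - k * UU x) ≤ η) :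
    |(|k| * sig d ^ (1 / pp d) - 1)| ≤ η := by
  have hp := one_le_pp hd
  have hkU : MemD12 d (fun x => k * UU x) := (memD12_UU hd).const_mul hd k
  have n1 : lpNorm' (pp d) u = 1 := by rw [lpNorm', h1, Real.one_rpow]
  have n2 : lpNorm' (pp d) (fun x : EE d => k * UU x) = |k| * sig d ^ (1 / pp d) := by rw [lpNorm'_const_mul hp, lpNorm'_UU hd]
  have t1 := lpNorm'_add_le hp (hz.memLp_pp hd) (hkU.memLp_pp hd)
  have hz' : MemD12 d (fun x => k * UU x - u x) := by
    have := hz.const_mul hd (-1)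
    have e : (fun x => -1 * (u x - k * UU x)) = fun x => k * UU x - u x := by ext x; ring
    rwa [e] at this
  have t2 := lpNorm'_add_le hp (hz'.memLp_pp hd) (hu.memLp_pp hd)
  simp only [sub_add_cancel] at t1 t2
  rw [lpNorm'_sub_comm] at t2
  rw [n1, n2] at t1 t2
  rw [abs_le]; constructor <;> linarith

lemma sob_step {d : ℕ} (hd : 3 ≤ d) {S' : ℝ} (hS : IsSob d S') (hmin : ∀ K, K < S' → ¬ IsSob d K) : ∃ C > 0, ∀ ε > 0,
    (1 - √(C * ε)) * (sig d ^ (1 / pp d))⁻¹ * √(sig d) ≤ √((1 + ε) / (S' * (d * ((d:ℝ) - 2)))) + √(C * ε) := by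
  have h3 : (3:ℝ) ≤ d := by exact_mod_cast hd
  have h4 : (0:ℝ) < d - 2 := by linarith
  have hS0 := hS.pos hd
  have hsig := sig_pos hd
  have hsp : 0 < sig d ^ (1 / pp d) := Real.rpow_pos_of_pos hsig _
  obtain ⟨C, hC, hn⟩ := near hd
  refine ⟨C, hC, fun ε hε => ?_⟩
  obtain ⟨δ, hδ, hcr⟩ := crude hd hS hε
  set δ' := min δ ε with hδ'
  have hδ0 : 0 < δ' := lt_min hδ hε
  -- near minimiser
  obtain ⟨u, hu, hlt⟩ : ∃ u : EE d → ℝ, MemD12 d u ∧ S' / (1 + δ') * (∫ x, ‖gradient u x‖ ^ 2) < (∫ x, |u x| ^ pp d) ^ (2 / pp d) := by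
    have := hmin (S' / (1 + δ')) (by rw [div_lt_iff₀ (by positivity)]; nlinarith)
    unfold IsSob at this
    push Not at this
    obtain ⟨u, hu, h⟩ := this
    exact ⟨u, hu, h⟩
  have hE0 : 0 ≤ ∫ x, ‖gradient u x‖ ^ 2 := integral_nonneg fun x => by positivity
  have hI0 : 0 ≤ ∫ x, |u x| ^ pp d := integral_nonneg fun x => by positivity
  have hp2 := two_lt_pp hd
  have hIpos : 0 < ∫ x, |u x| ^ pp d := by
    rcases hI0.lt_or_eq with h | h
    · exact h
    · rw [← h, Real.zero_rpow (by positivity)] at hlt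
      have : 0 ≤ S' / (1 + δ') * (∫ x, ‖gradient u x‖ ^ 2) := by positivity
      linarith
  set N := lpNorm' (pp d) u with hN
  have hN0 : 0 < N := Real.rpow_pos_of_pos hIpos _
  have hN2 : N ^ 2 = (∫ x, |u x| ^ pp d) ^ (2 / pp d) := lpNorm'_sq u
  -- normalise
  set w : EE d → ℝ := fun x => N⁻¹ * u x with hw
  have hwM : MemD12 d w := hu.const_mul hd _
  have hw1 : ∫ x, |w x| ^ pp d = 1 := by
    rw [← lpNorm'_rpow (by linarith), hw, lpNorm'_const_mul (one_le_pp hd), ← hN, abs_of_pos (by positivity), inv_mul_cancel₀ hN0.ne', Real.one_rpow]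
  have hwE : S' * ∫ x, ‖gradient w x‖ ^ 2 ≤ 1 + δ' := by
    rw [hw, MemD12.gradient_const_mul' hu.diff]
    simp_rw [norm_smul, mul_pow, Real.norm_eq_abs, sq_abs]
    rw [integral_const_mul]
    rw [← hN2] at hlt
    rw [div_mul_eq_mul_div, div_lt_iff₀ (by positivity)] at hlt
    rw [show S' * (N⁻¹ ^ 2 * ∫ x, ‖gradient u x‖ ^ 2) = S' * (∫ x, ‖gradient u x‖ ^ 2) / N ^ 2 by field_simp, div_le_iff₀ (by positivity)]
    linarith
  obtain ⟨a, l, hl, hcen⟩ := exists_centered hd hwM hw1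
  have hvM := MemD12.tr hd a hl hwM
  have hv1 := (int_pp_tr (u := w) hd a hl).trans hw1
  have hvE : S' * ∫ x, ‖gradient (tr a l w) x‖ ^ 2 ≤ 1 + δ' := by rw [energy_tr hd a hl hwM.diff]; exact hwE
  set v := tr a l w
  have hDv := hcr v hvM hv1 hcen (hvE.trans (by linarith [min_le_left δ ε]))
  obtain ⟨k, -, hz, hk1, hk2⟩ := hn v hvM
  have hle : √(C * DD v) ≤ √(C * ε) := Real.sqrt_le_sqrt (by gcongr)
  have hk := (abs_le.1 (near_k hd hvM hv1 hz (hk1.trans hle))).1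
  -- weighted L2 triangle
  have m1 : MemLp (fun x => v x / jb x) (ENNReal.ofReal 2) := by
    rw [ENNReal.ofReal_ofNat]
    rw [memLp_two_iff_integrable_sq (by
      exact (hvM.cont.div continuous_jb fun x => (jb_pos x).ne').aestronglyMeasurable)]
    simpa [div_pow] using hvM.int_sq_div_jb hd
  have m2 : MemLp (fun x => (-1 : ℝ) * ((v x - k * UU x) / jb x)) (ENNReal.ofReal 2) := by
    refine MemLp.const_mul ?_ _
    rw [ENNReal.ofReal_ofNat]
    rw [memLp_two_iff_integrable_sq (by
      exact (hz.cont.div continuous_jb fun x => (jb_pos x).ne').aestronglyMeasurable)]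
    simpa [div_pow] using hz.int_sq_div_jb hd
  have tri := lpNorm'_add_le (by norm_num) m1 m2
  have e1 : (fun x => v x / jb x + (-1 : ℝ) * ((v x - k * UU x) / jb x)) = fun x => k * (UU x / jb x) := by ext x; ring
  rw [e1, lpNorm'_const_mul (by norm_num), lpNorm'_const_mul (by norm_num), lpNorm'_two, lpNorm'_two, lpNorm'_two] at tri
  simp_rw [div_pow, UU_sq_div] at tri
  rw [show ∫ x : EE d, jb x ^ (-(d:ℝ)) = sig d from rfl] at tri
  have a1 : √(∫ x, (v x - k * UU x) ^ 2 / jb x ^ 2) ≤ √(C * ε) := Real.sqrt_le_sqrt (hk2.trans (by gcongr))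
  have a2 : √(∫ x, v x ^ 2 / jb x ^ 2) ≤ √((1 + ε) / (S' * (d * ((d:ℝ) - 2)))) := by
    apply Real.sqrt_le_sqrt
    rw [hvM.energy_eq hd] at hvE
    rw [le_div_iff₀ (by positivity)]
    have := mul_nonneg hS0.le (MemD12.DD_nonneg v)
    have := min_le_right δ ε
    nlinarith
  have a3 : (1 - √(C * ε)) * (sig d ^ (1 / pp d))⁻¹ ≤ |k| := by
    rw [← div_eq_mul_inv, div_le_iff₀ hsp]; linarith
  calc _ ≤ |k| * √(sig d) := by gcongr
    _ ≤ _ := by simp at tri; linarith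

theorem sharp_sob {d : ℕ} (hd : 3 ≤ d) : IsSob d (sobolevConst d) := by
  have h3 : (3:ℝ) ≤ d := by exact_mod_cast hd
  have h4 : (0:ℝ) < d - 2 := by linarith
  have hsig := sig_pos hd
  obtain ⟨K0, hK0, hK0S⟩ := exists_sob hd
  set S' := sInf {K | IsSob d K} with hS'
  have hbdd : BddBelow {K | IsSob d K} := ⟨0, fun K hK => (IsSob.pos hd hK).le⟩
  have hS : IsSob d S' := by
    intro u hu
    have hE0 : 0 ≤ ∫ x, ‖gradient u x‖ ^ 2 := integral_nonneg fun x => by positivity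
    rcases hE0.lt_or_eq with h | h
    · rw [← div_le_iff₀ h]
      refine le_csInf ⟨K0, hK0S⟩ fun K hK => ?_
      rw [div_le_iff₀ h]; exact hK u hu
    · have := hK0S u hu
      rw [← h] at this ⊢; simpa using this
  have hmin : ∀ K, K < S' → ¬ IsSob d K := fun K hK h => not_lt.2 (csInf_le hbdd h) hK
  obtain ⟨C, hC, hst⟩ := sob_step hd hS hmin
  have hS0 := hS.pos hd
  have lim : (1 - √(C * 0)) * (sig d ^ (1 / pp d))⁻¹ * √(sig d) ≤ √((1 + 0) / (S' * (d * ((d:ℝ) - 2)))) + √(C * 0) := by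
    have t1 : Tendsto (fun ε => (1 - √(C * ε)) * (sig d ^ (1 / pp d))⁻¹ * √(sig d)) (𝓝[>] 0) (𝓝 ((1 - √(C * 0)) * (sig d ^ (1 / pp d))⁻¹ * √(sig d))) := by
      apply tendsto_nhdsWithin_of_tendsto_nhds
      exact Continuous.tendsto (by fun_prop) 0
    have t2 : Tendsto (fun ε => √((1 + ε) / (S' * (d * ((d:ℝ) - 2)))) + √(C * ε)) (𝓝[>] 0) (𝓝 (√((1 + 0) / (S' * (d * ((d:ℝ) - 2)))) + √(C * 0))) := by
      apply tendsto_nhdsWithin_of_tendsto_nhds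
      exact Continuous.tendsto (by fun_prop) 0
    refine le_of_tendsto_of_tendsto t1 t2 ?_
    filter_upwards [self_mem_nhdsWithin] with ε hε using hst ε hε
  simp only [mul_zero, Real.sqrt_zero, sub_zero, one_mul, add_zero] at lim
  have hp := one_le_pp hd
  have sq := pow_le_pow_left₀ (by positivity) lim 2
  rw [Real.sq_sqrt (by positivity), mul_pow, Real.sq_sqrt hsig.le, ← Real.rpow_neg hsig.le, ← Real.rpow_natCast, ← Real.rpow_mul hsig.le] at sq
  nth_rewrite 2 [← Real.rpow_one (sig d)] at sq
  rw [← Real.rpow_add hsig] at sq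
  have e : -(1 / pp d) * ((2:ℕ):ℝ) + 1 = 2 / (d:ℝ) := by
    have := two_div_pp hd
    push_cast
    rw [show -(1 / pp d) * 2 = -(2 / pp d) by ring, this]; ring
  rw [e, le_div_iff₀ (by positivity)] at sq
  have hle : S' ≤ sobolevConst d := by
    have h5 := sob_sig hd
    have h6 : sig d ^ (2 / (d:ℝ)) * sig d ^ (-(2 / (d:ℝ))) = 1 := by rw [← Real.rpow_add hsig]; simp
    rw [← h5] at h6
    have h7 : 0 < sig d ^ (2 / (d:ℝ)) := by positivity
    have h8 : (0:ℝ) < d * (d - 2) := by positivity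
    have : sig d ^ (2 / (d:ℝ)) * (d * (d - 2)) * S' ≤ sig d ^ (2 / (d:ℝ)) * (d * (d - 2)) * sobolevConst d := by nlinarith
    exact le_of_mul_le_mul_left this (by positivity)
  intro u hu
  exact (hS u hu).trans (mul_le_mul_of_nonneg_right hle (integral_nonneg fun x => by positivity))
end

open MeasureTheory Real
noncomputable section
open scoped ContDiff Topology
open Filter

/-- normalised extremal -/
def VV {d : ℕ} (x : EE d) : ℝ := (sig d ^ (1 / pp d))⁻¹ * UU x

section VVs
variable {d : ℕ} (hd : 3 ≤ d)
include hd

lemma VV_pos (x : EE d) : 0 < VV x := by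
  have := Real.rpow_pos_of_pos (sig_pos hd) (1 / pp d)
  have := UU_pos x
  unfold VV; positivity

lemma memD12_VV : MemD12 d VV := (memD12_UU hd).const_mul hd _

lemma VV_pp (x : EE d) : VV x ^ pp d = (sig d)⁻¹ * jb x ^ (-(d:ℝ)) := by
  have h := sig_pos hd
  have hp := one_le_pp hd
  rw [VV, Real.mul_rpow (by positivity) (UU_pos x).le, UU_pp hd, Real.inv_rpow (by positivity), ← Real.rpow_mul h.le,
    one_div_mul_cancel (by linarith), Real.rpow_one]

lemma VV_sq (x : EE d) : VV x ^ pp d = sobolevConst d * (d * ((d:ℝ) - 2)) / jb x ^ 2 * VV x ^ 2 := by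
  have h := sig_pos hd
  rw [VV_pp hd, ← UU_sq_div, sob_sig hd, VV, mul_pow, inv_pow, ← Real.rpow_natCast (sig d ^ (1 / pp d)), ← Real.rpow_mul h.le, ← Real.rpow_neg h.le]
  have : sig d ^ (-(2 / (d:ℝ))) * sig d ^ (-(1 / pp d * ((2:ℕ):ℝ))) = (sig d)⁻¹ := by
    rw [← Real.rpow_add h, ← Real.rpow_neg_one]; congr 1
    have := two_div_pp hd
    push_cast
    rw [show 1 / pp d * 2 = 2 / pp d by ring, this]; ring
  rw [← this]; ring

lemma int_VV_pp : ∫ x : EE d, VV x ^ pp d = 1 := by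
  simp_rw [VV_pp hd]
  rw [integral_const_mul]
  exact inv_mul_cancel₀ (sig_pos hd).ne'

lemma integrable_VV_pp : Integrable fun x : EE d => VV x ^ pp d := by
  have := (memD12_VV hd).int_pp
  simpa [abs_of_pos (VV_pos hd _)] using this

lemma nearV : ∃ C > 0, ∀ u : EE d → ℝ, MemD12 d u → (∀ x, 0 ≤ u x) → ∫ x, |u x| ^ pp d = 1 →
    MemD12 d (fun x => u x - VV x) ∧ ∫ x, (u x - VV x) ^ 2 / jb x ^ 2 ≤ C * DD u ∧ ∫ x, |u x - VV x| ^ pp d ≤ C * DD u ^ (pp d / 2) := by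
  obtain ⟨C, hC, hn⟩ := near hd
  have hsig := sig_pos hd
  have hp := one_le_pp hd
  set c := sig d ^ (1 / pp d) with hc
  have hc0 : 0 < c := Real.rpow_pos_of_pos hsig _
  refine ⟨2 * C + 2 * C / c ^ 2 * sig d + (4 * C) ^ (pp d / 2), by positivity, fun u hu h0 h1 => ?_⟩
  have hD := MemD12.DD_nonneg u
  obtain ⟨k, hk0, hz, hk1, hk2⟩ := hn u hu
  have hk0 := hk0 h0
  set η := √(C * DD u) with hη
  have hη0 : 0 ≤ η := Real.sqrt_nonneg _
  have hη2 : η ^ 2 = C * DD u := Real.sq_sqrt (by positivity)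
  have hkk := near_k hd hu h1 hz hk1
  rw [abs_of_nonneg hk0, ← hc] at hkk
  have hb : |k - c⁻¹| ≤ η / c := by
    rw [le_div_iff₀ hc0, ← abs_of_pos hc0, ← abs_mul, abs_of_pos hc0, sub_mul, inv_mul_cancel₀ hc0.ne']; exact hkk
  have hU2 : MemD12 d (fun x => (k - c⁻¹) * UU x) := (memD12_UU hd).const_mul hd _
  have e : (fun x => (u x - k * UU x) + (k - c⁻¹) * UU x) = fun x => u x - VV x := by ext x; unfold VV; rw [← hc]; ring
  have hw := hz.add hd hU2
  have tri := lpNorm'_add_le hp (hz.memLp_pp hd) (hU2.memLp_pp hd)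
  rw [e] at hw tri
  rw [lpNorm'_const_mul hp, lpNorm'_UU hd, ← hc] at tri
  have hn2 : lpNorm' (pp d) (fun x => u x - VV x) ≤ 2 * η := by
    have : |k - c⁻¹| * c ≤ η / c * c := by gcongr
    rw [div_mul_cancel₀ _ hc0.ne'] at this
    linarith
  have hDp : 0 ≤ DD u ^ (pp d / 2) := by positivity
  refine ⟨hw, ?_, ?_⟩
  · have i1 := hz.int_sq_div_jb hd
    have i2 := hU2.int_sq_div_jb hd
    have : ∫ x, (u x - VV x) ^ 2 / jb x ^ 2 ≤ ∫ x, (2 * ((u x - k * UU x) ^ 2 / jb x ^ 2) + 2 * (((k - c⁻¹) * UU x) ^ 2 / jb x ^ 2)) := by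
      refine integral_mono (hw.int_sq_div_jb hd) ((i1.const_mul 2).add (i2.const_mul 2)) fun x => ?_
      have hx := congrFun e x
      simp only at hx ⊢
      rw [← hx, ← mul_div_assoc, ← mul_div_assoc, ← add_div]
      gcongr
      nlinarith [sq_nonneg ((u x - k * UU x) - (k - c⁻¹) * UU x)]
    rw [integral_add (i1.const_mul 2) (i2.const_mul 2), integral_const_mul, integral_const_mul] at this
    have e3 : ∫ x : EE d, ((k - c⁻¹) * UU x) ^ 2 / jb x ^ 2 = (k - c⁻¹) ^ 2 * sig d := by
      simp_rw [mul_pow, mul_div_assoc, UU_sq_div]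
      rw [integral_const_mul]; rfl
    have e4 : (k - c⁻¹) ^ 2 ≤ C * DD u / c ^ 2 := by
      rw [← sq_abs, ← hη2, ← div_pow]
      exact pow_le_pow_left₀ (abs_nonneg _) hb 2
    rw [e3] at this
    have e5 : (k - c⁻¹) ^ 2 * sig d ≤ C * DD u / c ^ 2 * sig d := by gcongr
    have e6 : 0 ≤ (4 * C) ^ (pp d / 2) * DD u := by positivity
    have e7 : 2 * C / c ^ 2 * sig d * DD u = 2 * (C * DD u / c ^ 2 * sig d) := by ring
    nlinarith
  · rw [← lpNorm'_rpow (by linarith)]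
    calc _ ≤ (2 * η) ^ pp d := Real.rpow_le_rpow (lpNorm'_nonneg _ _) hn2 (by linarith)
      _ = (4 * C) ^ (pp d / 2) * DD u ^ (pp d / 2) := by
          rw [← Real.mul_rpow (by positivity) hD, show 4 * C * DD u = (2 * η) ^ 2 by rw [mul_pow, hη2]; ring,
            ← Real.rpow_natCast, ← Real.rpow_mul (by positivity)]
          congr 1; push_cast; ring
      _ ≤ _ := by
          refine mul_le_mul_of_nonneg_right ?_ hDp
          have : 0 ≤ 2 * C + 2 * C / c ^ 2 * sig d := by positivity
          linarith
end VVs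

lemma int_qf {d : ℕ} {A C : ℝ} {b : EE d} (h : AdmT A b C) : ∫ x, qf A b C x ^ (-(d:ℝ)) = sig d := by
  have hA := h.posA
  have e : ∀ x, qf A b C x ^ (-(d:ℝ)) = A ^ d * jb ((1/2:ℝ) • b + A • x) ^ (-(d:ℝ)) := by
    intro x
    have : qf A b C x = A⁻¹ * jb ((1/2:ℝ) • b + A • x) := by
      rw [jb, norm_add_sq_real, norm_smul, norm_smul, inner_smul_left, inner_smul_right, Real.norm_of_nonneg hA.le, qf]
      have := h.disc
      simp only [conj_trivial, Real.norm_eq_abs]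
      rw [abs_of_pos (by norm_num)]
      field_simp
      nlinarith
    rw [this, Real.mul_rpow (by positivity) (jb_pos _).le, Real.inv_rpow hA.le, Real.rpow_neg hA.le, inv_inv, Real.rpow_natCast]
  simp_rw [e]
  rw [integral_const_mul, integral_affine (fun x => jb x ^ (-(d:ℝ))) _ hA, sig]
  field_simp

lemma int_jb_WW {d : ℕ} (k : Ix d) {s : ℝ} (h0 : 0 < s) (h1 : s ≤ 1/4) : ∫ x : EE d, jb x ^ (-(d:ℝ)) * WW k s x ^ (-(d:ℝ)) = sig d := by
  obtain ⟨A, b, C, hT, he⟩ := adm_k k h0 h1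
  rw [← int_qf hT]
  congr 1; ext x
  rw [he, Real.mul_rpow (jb_pos x).le (WW_pos k h0 h1 x).le]

section VVs
variable {d : ℕ} (hd : 3 ≤ d)
include hd

lemma int_VV_WW (k : Ix d) {s : ℝ} (h0 : 0 < s) (h1 : s ≤ 1/4) : ∫ x : EE d, VV x ^ pp d * WW k s x ^ (-(d:ℝ)) = 1 := by
  simp_rw [VV_pp hd, mul_assoc]
  rw [integral_const_mul, int_jb_WW k h0 h1]
  exact inv_mul_cancel₀ (sig_pos hd).ne'

lemma int_VV_BB {s : ℝ} (h0 : 0 < s) (h1 : s ≤ 1/4) : ∫ x : EE d, VV x ^ pp d * BB s x = 0 := by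
  have := sum_int_WW (integrable_VV_pp hd) h0 h1
  simp_rw [int_VV_WW hd _ h0 h1] at this
  rw [int_VV_pp hd, Finset.sum_const, nsmul_eq_mul, Finset.card_univ, card_Ix] at this
  have h : (0:ℝ) < 2 * (d + 1) := by positivity
  have := mul_left_cancel₀ h.ne' this
  linarith

lemma int_VV_ok (k : Ix d) : ∫ x : EE d, VV x ^ pp d * ok k x = 0 := by
  obtain ⟨K, hK, h⟩ := RR_bd d
  have hd0 : (0:ℝ) < d := by exact_mod_cast (by omega : 0 < d)
  set I := ∫ x : EE d, VV x ^ pp d * ok k x with hI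
  have key : ∀ s, 0 < s → s ≤ 1/4 → |I| ≤ K / d * s := by
    intro s h0 h1
    have e := int_RR (integrable_VV_pp hd) k h0 h1
    rw [int_VV_WW hd k h0 h1, int_VV_pp hd, ← hI] at e
    have b := abs_int_mul_le (integrable_VV_pp hd) (h s h0 h1 k)
    simp_rw [abs_of_pos (Real.rpow_pos_of_pos (VV_pos hd _) _)] at b
    rw [int_VV_pp hd, e, sub_self, zero_add, abs_mul, abs_of_pos (by positivity)] at b
    rw [div_mul_eq_mul_div, le_div_iff₀ hd0]
    have : s * (|I| * d) ≤ s * (K * s) := by nlinarith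
    exact le_of_mul_le_mul_left this h0
  by_contra hne
  have hpos : 0 < |I| := abs_pos.2 hne
  have hs : 0 < min (1/4) (|I| / (2 * (K / d))) := lt_min (by norm_num) (by positivity)
  have := key _ hs (min_le_left _ _)
  have h2 : K / d * min (1/4) (|I| / (2 * (K / d))) ≤ K / d * (|I| / (2 * (K / d))) := by gcongr; exact min_le_right _ _
  have h3 : K / d * (|I| / (2 * (K / d))) = |I| / 2 := by field_simp
  linarith

lemma int_VV_RR (k : Ix d) {s : ℝ} (h0 : 0 < s) (h1 : s ≤ 1/4) : ∫ x : EE d, VV x ^ pp d * RR k s x = 0 := by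
  rw [int_RR (integrable_VV_pp hd) k h0 h1, int_VV_WW hd k h0 h1, int_VV_pp hd, int_VV_ok hd]; simp

end VVs

/- scalar lemmas -/
lemma far_bd {p r a ρ : ℝ} (hr : 0 < r) (ha : 0 ≤ a) (hap : a ≤ p) (hρ : 0 ≤ ρ) (h : r < |ρ - 1|) :
    ρ ^ a ≤ (1 / r + 1) ^ p * |ρ - 1| ^ p := by
  have h1 : 1 ≤ 1 / r * |ρ - 1| := by rw [one_div, inv_mul_eq_div, le_div_iff₀ hr]; linarith
  have h2 : ρ ≤ (1 / r + 1) * |ρ - 1| := by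
    have := le_abs_self (ρ - 1); linarith
  have h3 : 1 ≤ (1 / r + 1) * |ρ - 1| := by have := abs_nonneg (ρ - 1); linarith
  rw [← Real.mul_rpow (by positivity) (by positivity)]
  calc ρ ^ a ≤ ((1 / r + 1) * |ρ - 1|) ^ a := Real.rpow_le_rpow hρ h2 ha
    _ ≤ _ := Real.rpow_le_rpow_of_exponent_le h3 hap

lemma sc1 {p : ℝ} (hp : 2 < p) : ∃ K > 0, ∀ ρ : ℝ, 0 ≤ ρ → |ρ ^ 2 - 2 / p * ρ ^ p - 1 + 2 / p| ≤ K * (|ρ - 1| ^ 2 + |ρ - 1| ^ p) := by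
  obtain ⟨K, hK, h⟩ := taylor2 p
  have hth : 2 / p < 1 := by rw [div_lt_one (by linarith)]; exact hp
  have hth0 : 0 < 2 / p := by positivity
  refine ⟨K + 1 + 4 * (1 / (1/2) + 1) ^ p, by positivity, fun ρ hρ => ?_⟩
  have hq : 0 ≤ |ρ - 1| ^ p := by positivity
  have hq2 : 0 ≤ |ρ - 1| ^ 2 := by positivity
  rcases le_or_gt |ρ - 1| (1/2) with hh | hh
  · have := h (ρ - 1) hh
    rw [show 1 + (ρ - 1) = ρ by ring] at this
    have e : ρ ^ 2 - 2 / p * ρ ^ p - 1 + 2 / p = (ρ - 1) ^ 2 - 2 / p * (ρ ^ p - 1 - p * (ρ - 1)) := by field_simp; ring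
    rw [e]
    have t1 : |(ρ - 1) ^ 2 - 2 / p * (ρ ^ p - 1 - p * (ρ - 1))| ≤ |ρ - 1| ^ 2 + K * |ρ - 1| ^ 2 := by
      refine (abs_sub _ _).trans ?_
      rw [abs_pow, abs_mul, abs_of_pos hth0]
      have : 2 / p * |ρ ^ p - 1 - p * (ρ - 1)| ≤ 1 * (K * |ρ - 1| ^ 2) := by gcongr
      linarith
    have : 0 ≤ 4 * (1 / (1/2) + 1) ^ p * (|ρ - 1| ^ 2 + |ρ - 1| ^ p) := by positivity
    nlinarith
  · have a1 := far_bd (r := 1/2) (p := p) (a := 2) (by norm_num) (by norm_num) hp.le hρ hh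
    have a2 := far_bd (r := 1/2) (p := p) (a := p) (by norm_num) (by linarith) le_rfl hρ hh
    have a3 := far_bd (r := 1/2) (p := p) (a := 0) (by norm_num) (by norm_num) (by linarith) hρ hh
    rw [Real.rpow_two] at a1
    rw [Real.rpow_zero] at a3
    set Z := (1 / (1/2:ℝ) + 1) ^ p * |ρ - 1| ^ p
    have b0 : 0 ≤ ρ ^ p := by positivity
    have b1 : 2 / p * ρ ^ p ≤ 1 * Z := by gcongr
    have b2 : 0 ≤ 2 / p * ρ ^ p := by positivity
    have b3 : |ρ ^ 2 - 2 / p * ρ ^ p - 1 + 2 / p| ≤ 4 * Z := by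
      rw [abs_le]; constructor <;> nlinarith [sq_nonneg ρ]
    refine b3.trans ?_
    have : 4 * Z = 4 * (1 / (1/2:ℝ) + 1) ^ p * |ρ - 1| ^ p := by ring
    rw [this]
    have c1 : 0 ≤ (K + 1) * (|ρ - 1| ^ 2 + |ρ - 1| ^ p) := by positivity
    have c2 : 0 ≤ 4 * (1 / (1/2:ℝ) + 1) ^ p * |ρ - 1| ^ 2 := by positivity
    linarith

lemma sc2 {p : ℝ} (hp : 2 < p) : ∃ K > 0, ∀ ρ : ℝ, 0 ≤ ρ → |ρ ^ p - 1| ≤ K * (|ρ - 1| + |ρ - 1| ^ p) := by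
  obtain ⟨K, hK, h⟩ := taylor1 p
  refine ⟨K + 1 * (1 / (1/2) + 1) ^ p, by positivity, fun ρ hρ => ?_⟩
  have hq : 0 ≤ |ρ - 1| ^ p := by positivity
  have hq2 : 0 ≤ |ρ - 1| := by positivity
  rcases le_or_gt |ρ - 1| (1/2) with hh | hh
  · have := h (ρ - 1) hh
    rw [show 1 + (ρ - 1) = ρ by ring] at this
    have c1 : 0 ≤ 1 * (1 / (1/2:ℝ) + 1) ^ p * (|ρ - 1| + |ρ - 1| ^ p) := by positivity
    have c2 : 0 ≤ K * |ρ - 1| ^ p := by positivity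
    linarith
  · have a2 := far_bd (r := 1/2) (p := p) (a := p) (by norm_num) (by linarith) le_rfl hρ hh
    have a3 := far_bd (r := 1/2) (p := p) (a := 0) (by norm_num) (by norm_num) (by linarith) hρ hh
    rw [Real.rpow_zero] at a3
    have b0 : 0 ≤ ρ ^ p := by positivity
    have c1 : 0 ≤ K * (|ρ - 1| + |ρ - 1| ^ p) := by positivity
    have c2 : 0 ≤ 1 * (1 / (1/2:ℝ) + 1) ^ p * |ρ - 1| := by positivity
    rw [abs_le]; constructor <;> linarith

lemma sc3 {q : ℝ} (hq : 1 < q) {ε : ℝ} (hε : 0 < ε) : ∃ K > 0, ∀ ρ : ℝ, 0 ≤ ρ →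
    |ρ ^ q - ρ - (q - 1) / (q + 1) * (ρ ^ (q + 1) - 1)| ≤ ε * |ρ - 1| ^ 2 + K * |ρ - 1| ^ (q + 1) := by
  obtain ⟨K1, hK1, h1⟩ := taylor3 q
  obtain ⟨K2, hK2, h2⟩ := taylor3 (q + 1)
  have hc : (q - 1) / (q + 1) < 1 := by rw [div_lt_one (by linarith)]; linarith
  have hc0 : 0 < (q - 1) / (q + 1) := div_pos (by linarith) (by linarith)
  set r := min (1/2) (ε / (K1 + K2)) with hr
  have hr0 : 0 < r := lt_min (by norm_num) (by positivity)
  refine ⟨4 * (1 / r + 1) ^ (q + 1), by positivity, fun ρ hρ => ?_⟩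
  have hq0 : 0 ≤ |ρ - 1| ^ (q + 1) := by positivity
  have hq2 : 0 ≤ |ρ - 1| ^ 2 := by positivity
  rcases le_or_gt |ρ - 1| r with hh | hh
  · have a1 := h1 (ρ - 1) (hh.trans (min_le_left _ _))
    have a2 := h2 (ρ - 1) (hh.trans (min_le_left _ _))
    rw [show 1 + (ρ - 1) = ρ by ring] at a1 a2
    set R1 := ρ ^ q - 1 - q * (ρ - 1) - q * (q - 1) / 2 * (ρ - 1) ^ 2 with hR1
    set R2 := ρ ^ (q + 1) - 1 - (q + 1) * (ρ - 1) - (q + 1) * (q + 1 - 1) / 2 * (ρ - 1) ^ 2 with hR2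
    have hq1 : q + 1 ≠ 0 := by linarith
    have e : ρ ^ q - ρ - (q - 1) / (q + 1) * (ρ ^ (q + 1) - 1) = R1 - (q - 1) / (q + 1) * R2 := by
      rw [hR1, hR2]; field_simp; ring
    rw [e]
    have t1 : |R1 - (q - 1) / (q + 1) * R2| ≤ (K1 + K2) * |ρ - 1| ^ 3 := by
      refine (abs_sub _ _).trans ?_
      rw [abs_mul, abs_of_pos hc0]
      have : (q - 1) / (q + 1) * |R2| ≤ 1 * (K2 * |ρ - 1| ^ 3) := by gcongr
      linarith
    have t2 : (K1 + K2) * |ρ - 1| ^ 3 ≤ ε * |ρ - 1| ^ 2 := by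
      have : (K1 + K2) * |ρ - 1| ≤ ε := by
        have := hh.trans (min_le_right (1/2) (ε / (K1 + K2)))
        rw [le_div_iff₀ (by positivity)] at this; linarith
      calc (K1 + K2) * |ρ - 1| ^ 3 = ((K1 + K2) * |ρ - 1|) * |ρ - 1| ^ 2 := by ring
        _ ≤ _ := by gcongr
    have : 0 ≤ 4 * (1 / r + 1) ^ (q + 1) * |ρ - 1| ^ (q + 1) := by positivity
    linarith
  · have a1 := far_bd (p := q + 1) (a := q) hr0 (by linarith) (by linarith) hρ hh
    have a2 := far_bd (p := q + 1) (a := q + 1) hr0 (by linarith) le_rfl hρ hh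
    have a3 := far_bd (p := q + 1) (a := 0) hr0 le_rfl (by linarith) hρ hh
    have a4 := far_bd (p := q + 1) (a := 1) hr0 (by linarith) (by linarith) hρ hh
    rw [Real.rpow_zero] at a3
    rw [Real.rpow_one] at a4
    set Z := (1 / r + 1) ^ (q + 1) * |ρ - 1| ^ (q + 1)
    have b0 : 0 ≤ ρ ^ (q + 1) := by positivity
    have b1 : (q - 1) / (q + 1) * ρ ^ (q + 1) ≤ 1 * Z := by gcongr
    have b2 : 0 ≤ (q - 1) / (q + 1) * ρ ^ (q + 1) := by positivity
    have b4 : 0 ≤ ρ ^ q := by positivity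
    have b3 : |ρ ^ q - ρ - (q - 1) / (q + 1) * (ρ ^ (q + 1) - 1)| ≤ 4 * Z := by
      rw [abs_le]; constructor <;> linarith
    refine b3.trans ?_
    have : 4 * Z = 4 * (1 / r + 1) ^ (q + 1) * |ρ - 1| ^ (q + 1) := by ring
    rw [this]
    have : 0 ≤ ε * |ρ - 1| ^ 2 := by positivity
    linarith
end

open MeasureTheory Real
noncomputable section
open scoped ContDiff Topology
open Filter

def kap (d : ℕ) : ℝ := sobolevConst d * (d * ((d:ℝ) - 2))

section
variable {d : ℕ} (hd : 3 ≤ d)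
include hd

lemma kap_pos : 0 < kap d := by
  have h3 : (3:ℝ) ≤ d := by exact_mod_cast hd
  have h4 : (0:ℝ) < d - 2 := by linarith
  have := sobolevConst_pos hd
  unfold kap; positivity

lemma rho_two (u : EE d → ℝ) (x : EE d) : VV x ^ pp d * |u x / VV x - 1| ^ 2 = kap d * ((u x - VV x) ^ 2 / jb x ^ 2) := by
  have hv := VV_pos hd x
  have hj := jb_pos x
  rw [VV_sq hd, sq_abs, kap]; field_simp

lemma rho_two' (u : EE d → ℝ) (x : EE d) : VV x ^ pp d * (u x / VV x) ^ 2 = kap d * (u x ^ 2 / jb x ^ 2) := by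
  have hv := VV_pos hd x
  have hj := jb_pos x
  rw [VV_sq hd, kap]; field_simp

lemma rho_pp (u : EE d → ℝ) (x : EE d) : VV x ^ pp d * |u x / VV x - 1| ^ pp d = |u x - VV x| ^ pp d := by
  have hv := VV_pos hd x
  rw [← Real.mul_rpow hv.le (abs_nonneg _)]
  congr 1
  nth_rewrite 1 [← abs_of_pos hv]
  rw [← abs_mul]; congr 1; field_simp

lemma rho_pp' {u : EE d → ℝ} (h0 : ∀ x, 0 ≤ u x) (x : EE d) : VV x ^ pp d * (u x / VV x) ^ pp d = |u x| ^ pp d := by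
  have hv := VV_pos hd x
  rw [← Real.mul_rpow hv.le (div_nonneg (h0 x) hv.le), abs_of_nonneg (h0 x)]
  congr 1; field_simp

set_option maxHeartbeats 1600000 in
theorem stability : ∃ δ > 0, ∃ C > 0, ∀ u : EE d → ℝ, MemD12 d u → (∀ x, 0 ≤ u x) → ∫ x, |u x| ^ pp d = 1 → Cen u →
    sobolevConst d * (∫ x, ‖gradient u x‖ ^ 2) ≤ 1 + δ → DD u ≤ C * (sobolevConst d * (∫ x, ‖gradient u x‖ ^ 2) - 1) ∧ DD u ≤ 1 := by
  have hS := sharp_sob hd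
  set S := sobolevConst d with hSdef
  have hS0 : 0 < S := sobolevConst_pos hd
  have h3 : (3:ℝ) ≤ d := by exact_mod_cast hd
  have hp2 := two_lt_pp hd
  obtain ⟨δ, hδ, hcr⟩ := crude hd hS one_pos
  obtain ⟨C1, hC1, hV⟩ := nearV hd
  obtain ⟨K1, hK1, k1⟩ := key_ineq hd
  obtain ⟨K2, hK2, k2⟩ := RR_bd d
  obtain ⟨K3, hK3, k3⟩ := BB_bd d
  obtain ⟨L1, hL1, l1⟩ := sc1 hp2
  obtain ⟨L2, hL2, l2⟩ := sc2 hp2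
  have hkap := kap_pos hd
  set c : ℝ := ((d:ℝ) - 2) / (d + 1) with hc
  have hc0 : 0 < c := by apply div_pos <;> linarith
  set M1 : ℝ := L1 * (kap d * C1 + C1) with hM1
  have hM1p : 0 < M1 := by positivity
  set M2 : ℝ := L2 * (√(kap d * C1) + C1) with hM2
  have hM2p : 0 < M2 := by positivity
  set L : ℝ := K1 * S + K3 * M1 + K2 ^ 2 * M2 ^ 2 with hL
  have hL0 : 0 < L := by positivity
  set s : ℝ := min (1/4) (c * S / (2 * L)) with hs
  have hs0 : 0 < s := lt_min (by norm_num) (by positivity)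
  have hs1 : s ≤ 1/4 := min_le_left _ _
  have hs2 : L * s ≤ c * S / 2 := by
    have : s ≤ c * S / (2 * L) := min_le_right _ _
    calc L * s ≤ L * (c * S / (2 * L)) := by gcongr
      _ = _ := by field_simp
  refine ⟨δ, hδ, 2 / (c * S * s ^ 2), by positivity, fun u hu h0 hu1 hcen hE => ?_⟩
  have hD1 := hcr u hu hu1 hcen hE
  refine ⟨?_, hD1⟩
  have hD0 := MemD12.DD_nonneg u
  obtain ⟨hw, hw2, hwp⟩ := hV u hu h0 hu1
  have key := k1 s hs0 hs1 S hS0.le hS u hu hu1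
  have hrho0 : ∀ x, 0 ≤ u x / VV x := fun x => div_nonneg (h0 x) (VV_pos hd x).le
  have hDp : DD u ^ (pp d / 2) ≤ DD u := by
    calc DD u ^ (pp d / 2) ≤ DD u ^ (1:ℝ) := Real.rpow_le_rpow_of_exponent_ge_of_imp hD0 hD1 (by linarith) (by intro _ h; linarith)
      _ = _ := Real.rpow_one _
  -- weighted integrals
  have i2 : Integrable fun x => VV x ^ pp d * |u x / VV x - 1| ^ 2 := by
    simp_rw [rho_two hd]; exact (hw.int_sq_div_jb hd).const_mul _
  have ip : Integrable fun x => VV x ^ pp d * |u x / VV x - 1| ^ pp d := by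
    simp_rw [rho_pp hd]; exact hw.int_pp
  have w2 : ∫ x, VV x ^ pp d * |u x / VV x - 1| ^ 2 ≤ kap d * C1 * DD u := by
    simp_rw [rho_two hd]; rw [integral_const_mul, mul_assoc]; gcongr
  have wp : ∫ x, VV x ^ pp d * |u x / VV x - 1| ^ pp d ≤ C1 * DD u := by
    simp_rw [rho_pp hd]; exact hwp.trans (by gcongr)
  have hVc : Continuous (VV : EE d → ℝ) := (memD12_VV hd).cont
  have hrc : Continuous fun x => u x / VV x := hu.cont.div hVc fun x => (VV_pos hd x).ne'
  have hVpc : Continuous fun x : EE d => VV x ^ pp d := hVc.rpow_const fun x => Or.inr (by linarith)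
  have hVp0 : ∀ x : EE d, 0 ≤ VV x ^ pp d := fun x => Real.rpow_nonneg (VV_pos hd x).le _
  have i1 : Integrable fun x => VV x ^ pp d * |u x / VV x - 1| := by
    refine Integrable.mono' ((integrable_VV_pp hd).add i2) (hVpc.mul (hrc.sub continuous_const).abs).aestronglyMeasurable (Eventually.of_forall fun x => ?_)
    rw [Real.norm_of_nonneg (mul_nonneg (hVp0 x) (abs_nonneg _))]
    simp only [Pi.add_apply]
    nlinarith [hVp0 x, sq_nonneg (|u x / VV x - 1| - 1), mul_nonneg (hVp0 x) (sq_nonneg (|u x / VV x - 1| - 1)), mul_nonneg (hVp0 x) (sq_nonneg (|u x / VV x - 1|))]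
  have w1 : ∫ x, VV x ^ pp d * |u x / VV x - 1| ≤ √(kap d * C1 * DD u) := by
    apply Real.le_sqrt_of_sq_le
    exact (jensen_sq hVp0 (int_VV_pp hd) (integrable_VV_pp hd) i1 i2).trans w2
  -- bracket
  have hsp : 0 < s ^ 3 := by positivity
  have br : kap d * (∫ x, u x ^ 2 / jb x ^ 2 * BB s x) - 2 / pp d * (∫ x, |u x| ^ pp d * BB s x) ≤ K3 * s ^ 3 * (M1 * DD u) := by
    have j1 := int_mul_BB (hu.int_sq_div_jb hd) hs0 hs1
    have j2 := int_mul_BB hu.int_pp hs0 hs1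
    have j3 := int_mul_BB (integrable_VV_pp hd) hs0 hs1
    have e : ∀ x, VV x ^ pp d * ((u x / VV x) ^ 2 - 2 / pp d * (u x / VV x) ^ pp d - 1 + 2 / pp d) * BB s x =
        (kap d * (u x ^ 2 / jb x ^ 2 * BB s x) - 2 / pp d * (|u x| ^ pp d * BB s x)) - (1 - 2 / pp d) * (VV x ^ pp d * BB s x) := by
      intro x
      rw [← rho_pp' hd h0]
      have := rho_two' hd u x
      linear_combination BB s x * this
    have j4 : Integrable fun x => kap d * (u x ^ 2 / jb x ^ 2 * BB s x) - 2 / pp d * (|u x| ^ pp d * BB s x) :=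
      (j1.const_mul _).sub (j2.const_mul _)
    have e2 : ∫ x, VV x ^ pp d * ((u x / VV x) ^ 2 - 2 / pp d * (u x / VV x) ^ pp d - 1 + 2 / pp d) * BB s x =
        kap d * (∫ x, u x ^ 2 / jb x ^ 2 * BB s x) - 2 / pp d * (∫ x, |u x| ^ pp d * BB s x) := by
      simp_rw [e]
      rw [integral_sub j4 (j3.const_mul _), integral_sub (j1.const_mul _) (j2.const_mul _), integral_const_mul, integral_const_mul, integral_const_mul, int_VV_BB hd hs0 hs1]
      ring
    rw [← e2]
    have jj : Integrable fun x => K3 * s ^ 3 * L1 * (VV x ^ pp d * |u x / VV x - 1| ^ 2 + VV x ^ pp d * |u x / VV x - 1| ^ pp d) := (i2.add ip).const_mul _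
    refine (le_abs_self _).trans ?_
    rw [← Real.norm_eq_abs]
    refine (norm_integral_le_of_norm_le jj (Eventually.of_forall fun x => ?_)).trans ?_
    · rw [Real.norm_eq_abs, abs_mul, abs_mul, abs_of_nonneg (hVp0 x)]
      calc _ ≤ VV x ^ pp d * (L1 * (|u x / VV x - 1| ^ 2 + |u x / VV x - 1| ^ pp d)) * (K3 * s ^ 3) := by
            gcongr
            · exact mul_nonneg (hVp0 x) (by positivity)
            · exact hVp0 x
            · exact l1 _ (hrho0 x)
            · exact k3 s hs0 hs1 x
        _ = _ := by ring
    · rw [integral_const_mul, integral_add i2 ip]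
      calc _ ≤ K3 * s ^ 3 * L1 * (kap d * C1 * DD u + C1 * DD u) := by gcongr
        _ = _ := by rw [hM1]; ring
  have bx : (∑ k, xk u s k ^ 2) / (2 * (d + 1)) ≤ K2 ^ 2 * s ^ 3 * (M2 ^ 2 * DD u) := by
    rw [div_le_iff₀ (by positivity)]
    have hk : ∀ k, xk u s k ^ 2 ≤ K2 ^ 2 * s ^ 3 * (M2 ^ 2 * DD u) := by
      intro k
      have e1 : xk u s k = ∫ x, (|u x| ^ pp d - VV x ^ pp d) * RR k s x := by
        simp_rw [sub_mul]
        rw [integral_sub (int_mul_RR hu.int_pp k hs0 hs1) (int_mul_RR (integrable_VV_pp hd) k hs0 hs1), int_VV_RR hd k hs0 hs1, xk_eq hu hu1 hcen k hs0 hs1, sub_zero]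
      have ii : Integrable fun x => |u x| ^ pp d - VV x ^ pp d := hu.int_pp.sub (integrable_VV_pp hd)
      have b := abs_int_mul_le ii (k2 s hs0 hs1 k)
      rw [← e1] at b
      have b2 : ∫ x, |(|u x| ^ pp d - VV x ^ pp d)| ≤ M2 * √(DD u) := by
        have jj : Integrable fun x => L2 * (VV x ^ pp d * |u x / VV x - 1| + VV x ^ pp d * |u x / VV x - 1| ^ pp d) := (i1.add ip).const_mul _
        refine (integral_mono ii.abs jj fun x => ?_).trans ?_
        · simp only
          rw [← rho_pp' hd h0, show VV x ^ pp d * (u x / VV x) ^ pp d - VV x ^ pp d = VV x ^ pp d * ((u x / VV x) ^ pp d - 1) by ring, abs_mul, abs_of_nonneg (hVp0 x)]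
          calc _ ≤ VV x ^ pp d * (L2 * (|u x / VV x - 1| + |u x / VV x - 1| ^ pp d)) := by
                gcongr
                · exact hVp0 x
                · exact l2 _ (hrho0 x)
            _ = _ := by ring
        · rw [integral_const_mul, integral_add i1 ip]
          have hsq : DD u ≤ √(DD u) := by
            apply Real.le_sqrt_of_sq_le; rw [sq]; exact mul_le_of_le_one_left hD0 hD1
          rw [Real.sqrt_mul (by positivity)] at w1
          calc _ ≤ L2 * (√(kap d * C1) * √(DD u) + C1 * √(DD u)) := by
                gcongr
                exact wp.trans (by gcongr)
            _ = _ := by rw [hM2]; ring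
      have b3 : |xk u s k| ≤ K2 * s ^ 2 * (M2 * √(DD u)) := b.trans (by gcongr)
      have h' : xk u s k ^ 2 ≤ (K2 * s ^ 2 * (M2 * √(DD u))) ^ 2 := by
        rw [← sq_abs]; exact pow_le_pow_left₀ (abs_nonneg _) b3 2
      refine h'.trans ?_
      rw [mul_pow, mul_pow, mul_pow, Real.sq_sqrt hD0, ← pow_mul]
      gcongr ?_ * ?_ * _
      exact pow_le_pow_of_le_one hs0.le (by linarith) (by norm_num)
    calc ∑ k, xk u s k ^ 2 ≤ ∑ k : Ix d, K2 ^ 2 * s ^ 3 * (M2 ^ 2 * DD u) := Finset.sum_le_sum fun k _ => hk k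
      _ = _ := by rw [Finset.sum_const, nsmul_eq_mul, Finset.card_univ, card_Ix]; ring
  rw [hu.energy_eq hd]
  obtain ⟨ht0, ht1⟩ := theta_bds hd
  set X := (∑ k, xk u s k ^ 2) / (2 * ((d:ℝ) + 1))
  have hX0 : 0 ≤ X := div_nonneg (Finset.sum_nonneg fun _ _ => sq_nonneg _) (by positivity)
  have c2 : (1 - 2 / pp d) * X ≤ 1 * X := mul_le_mul_of_nonneg_right (by linarith) hX0
  have ek : kap d = S * (d * ((d:ℝ) - 2)) := rfl
  rw [ek] at br
  set I1 := ∫ x, |u x| ^ pp d * BB s x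
  set I2 := ∫ x, u x ^ 2 / jb x ^ 2
  set I3 := ∫ x, u x ^ 2 / jb x ^ 2 * BB s x
  set D := DD u
  clear_value I1 I2 I3 D X
  have fin : c * s ^ 2 * S * D ≤ (S * (D + d * ((d:ℝ) - 2) * I2) - 1) + L * s ^ 3 * D := by
    rw [hL]; linarith
  have f2 : L * s ^ 3 * D ≤ s ^ 2 * D * (c * S / 2) := by
    calc L * s ^ 3 * D = s ^ 2 * D * (L * s) := by ring
      _ ≤ _ := by gcongr
  rw [div_mul_eq_mul_div, le_div_iff₀ (by positivity)]
  linarith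
end
end

open MeasureTheory Real
noncomputable section
open scoped ContDiff Topology
open Filter

/-- the dual exponent -/
def qq (d : ℕ) : ℝ := ((d:ℝ) + 2) / ((d:ℝ) - 2)

section
variable {d : ℕ} (hd : 3 ≤ d)
include hd

lemma qq_add_one : qq d + 1 = pp d := by
  have h3 : (3:ℝ) ≤ d := by exact_mod_cast hd
  have h4 : (0:ℝ) < d - 2 := by linarith
  unfold qq pp; field_simp; ring

lemma one_lt_qq : 1 < qq d := by linarith [qq_add_one hd, two_lt_pp hd]

lemma int_rho {u : EE d → ℝ} (hu : MemD12 d u) (h0 : ∀ x, 0 ≤ u x) {a : ℝ} (ha : 0 ≤ a) (hap : a ≤ pp d) :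
    Integrable fun x => VV x ^ pp d * (u x / VV x) ^ a := by
  have hVc : Continuous (VV : EE d → ℝ) := (memD12_VV hd).cont
  have hrc : Continuous fun x => u x / VV x := hu.cont.div hVc fun x => (VV_pos hd x).ne'
  have hp := one_le_pp hd
  have hVpc : Continuous fun x : EE d => VV x ^ pp d := hVc.rpow_const fun x => Or.inr (by linarith)
  have hVp0 : ∀ x : EE d, 0 ≤ VV x ^ pp d := fun x => Real.rpow_nonneg (VV_pos hd x).le _
  refine Integrable.mono' ((integrable_VV_pp hd).add hu.int_pp) (hVpc.mul (hrc.rpow_const fun x => Or.inr ha)).aestronglyMeasurable (Eventually.of_forall fun x => ?_)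
  have hr := div_nonneg (h0 x) (VV_pos hd x).le
  rw [Real.norm_of_nonneg (mul_nonneg (hVp0 x) (Real.rpow_nonneg hr _))]
  simp only [Pi.add_apply]
  rw [← rho_pp' hd h0]
  have : (u x / VV x) ^ a ≤ 1 + (u x / VV x) ^ pp d := by
    rcases le_total (u x / VV x) 1 with h | h
    · have := Real.rpow_le_one hr h ha
      have := Real.rpow_nonneg hr (pp d); linarith
    · have := Real.rpow_le_rpow_of_exponent_le h hap; linarith
  nlinarith [hVp0 x]

lemma rho_qq {u : EE d → ℝ} (h0 : ∀ x, 0 ≤ u x) (x : EE d) : VV x ^ pp d * (u x / VV x) ^ qq d = u x ^ qq d * VV x := by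
  have hv := VV_pos hd x
  rw [← qq_add_one hd, Real.rpow_add hv, Real.rpow_one, Real.div_rpow (h0 x) hv.le]
  have := Real.rpow_pos_of_pos hv (qq d)
  field_simp

lemma mul_qq {u : EE d → ℝ} (h0 : ∀ x, 0 ≤ u x) (x : EE d) : u x ^ qq d * u x = |u x| ^ pp d := by
  have := one_lt_qq hd
  rw [abs_of_nonneg (h0 x), ← qq_add_one hd, Real.rpow_add_one' (h0 x) (by linarith)]

/-- functional bounding the HLS deficit from above -/
def HH (u φ : EE d → ℝ) : ℝ := sobolevConst d - 2 * (∫ x, u x ^ qq d * φ x) + ∫ x, ‖gradient φ x‖ ^ 2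

omit hd in
lemma energy_const_mul {u : EE d → ℝ} (hu : Differentiable ℝ u) (c : ℝ) :
    ∫ x, ‖gradient (fun x => c * u x) x‖ ^ 2 = c ^ 2 * ∫ x, ‖gradient u x‖ ^ 2 := by
  rw [MemD12.gradient_const_mul' hu]
  simp_rw [norm_smul, mul_pow, Real.norm_eq_abs, sq_abs]
  rw [integral_const_mul]

/-- case of large deficit -/
lemma ub_far {u : EE d → ℝ} (hu : MemD12 d u) (h0 : ∀ x, 0 ≤ u x) (h1 : ∫ x, |u x| ^ pp d = 1) {δ : ℝ} (hδ : 0 < δ)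
    (hJ : δ ≤ sobolevConst d * (∫ x, ‖gradient u x‖ ^ 2) - 1) :
    ∃ φ : EE d → ℝ, MemD12 d φ ∧ (∀ x, 0 ≤ φ x) ∧ sobolevConst d - 2 * (∫ x, u x ^ qq d * φ x) + ∫ x, ‖gradient φ x‖ ^ 2 ≤
      sobolevConst d / (1 + δ) * (sobolevConst d * (∫ x, ‖gradient u x‖ ^ 2) - 1) := by
  have hS := sobolevConst_pos hd
  set S := sobolevConst d
  set E := ∫ x, ‖gradient u x‖ ^ 2 with hE
  have hE1 : 0 < S * E := by linarith
  have hEp : 0 < E := by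
    by_contra h; push Not at h; nlinarith
  refine ⟨fun x => (S / (S * E)) * u x, hu.const_mul hd _, fun x => mul_nonneg (by positivity) (h0 x), ?_⟩
  rw [energy_const_mul hu.diff, ← hE]
  have e : ∀ x, u x ^ qq d * (S / (S * E) * u x) = S / (S * E) * |u x| ^ pp d := fun x => by rw [← mul_qq hd h0]; ring
  simp_rw [e]
  rw [integral_const_mul, h1]
  have : S - 2 * (S / (S * E) * 1) + (S / (S * E)) ^ 2 * E = S / (S * E) * (S * E - 1) := by field_simp; ring
  rw [this]
  have h2 : 0 ≤ S * E - 1 := by linarith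
  gcongr
  linarith

set_option maxHeartbeats 1000000 in
lemma ub_near : ∃ δ > 0, ∃ t > 0, t ≤ 1 ∧ ∀ u : EE d → ℝ, MemD12 d u → (∀ x, 0 ≤ u x) → ∫ x, |u x| ^ pp d = 1 → Cen u →
    sobolevConst d * (∫ x, ‖gradient u x‖ ^ 2) - 1 ≤ δ →
    ∃ φ : EE d → ℝ, MemD12 d φ ∧ (∀ x, 0 ≤ φ x) ∧ sobolevConst d - 2 * (∫ x, u x ^ qq d * φ x) + ∫ x, ‖gradient φ x‖ ^ 2 ≤
      sobolevConst d * (1 - t / 2) * (sobolevConst d * (∫ x, ‖gradient u x‖ ^ 2) - 1) := by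
  have hS := sobolevConst_pos hd
  have hkap := kap_pos hd
  have hp2 := two_lt_pp hd
  have hsob := sharp_sob hd
  obtain ⟨δ0, hδ0, C, hC, hst⟩ := stability hd
  obtain ⟨C1, hC1, hV⟩ := nearV hd
  obtain ⟨K, hK, hg⟩ := sc3 (one_lt_qq hd) (ε := 1 / (4 * (kap d * C1 * C))) (by positivity)
  rw [qq_add_one hd] at hg
  set S := sobolevConst d with hSd
  set C' := S * C + kap d * C1 * C with hC'
  have hC'0 : 0 < C' := by positivity
  set β := pp d / 2 - 1 with hβ
  have hβ0 : 0 < β := by rw [hβ]; linarith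
  -- small delta
  set Q := 1 / (4 * (K * C1 * C)) with hQ
  have hQ0 : 0 < Q := by positivity
  set δ1 := Q ^ (1 / β) / C with hδ1
  have hδ10 : 0 < δ1 := by positivity
  refine ⟨min δ0 δ1, lt_min hδ0 hδ10, min 1 (1 / (2 * C')), lt_min one_pos (by positivity), min_le_left _ _, fun u hu h0 h1 hcen hJ => ?_⟩
  set t := min 1 (1 / (2 * C')) with ht
  have ht0 : 0 < t := lt_min one_pos (by positivity)
  have ht1 : t ≤ 1 := min_le_left _ _
  have ht2 : t * C' ≤ 1 / 2 := by
    have : t ≤ 1 / (2 * C') := min_le_right _ _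
    calc t * C' ≤ 1 / (2 * C') * C' := by gcongr
      _ = _ := by field_simp
  have hJ1 := hJ.trans (min_le_left _ _)
  have hJ2 := hJ.trans (min_le_right _ _)
  obtain ⟨hDJ, hD1⟩ := hst u hu h0 h1 hcen (by linarith)
  obtain ⟨hw, hw2, hwp⟩ := hV u hu h0 h1
  have hD0 := MemD12.DD_nonneg u
  have hJ0 : 0 ≤ S * (∫ x, ‖gradient u x‖ ^ 2) - 1 := by
    have := hsob u hu
    rw [h1, Real.one_rpow] at this; linarith
  have hen := hu.energy_eq hd
  set J := S * (∫ x, ‖gradient u x‖ ^ 2) - 1 with hJd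
  set D := DD u with hD
  have hDp : D ^ (pp d / 2) ≤ Q * (C * J) := by
    have e : pp d / 2 = β + 1 := by rw [hβ]; ring
    rw [e, Real.rpow_add_one' hD0 (by linarith)]
    have : D ^ β ≤ Q := by
      calc D ^ β ≤ (C * δ1) ^ β := Real.rpow_le_rpow hD0 (hDJ.trans (by gcongr)) hβ0.le
        _ = Q := by
          rw [hδ1, mul_div_cancel₀ _ hC.ne', ← Real.rpow_mul hQ0.le, one_div_mul_cancel hβ0.ne', Real.rpow_one]
    gcongr
  have hrho0 : ∀ x, 0 ≤ u x / VV x := fun x => div_nonneg (h0 x) (VV_pos hd x).le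
  have hVp0 : ∀ x : EE d, 0 ≤ VV x ^ pp d := fun x => Real.rpow_nonneg (VV_pos hd x).le _
  have i2 : Integrable fun x => VV x ^ pp d * |u x / VV x - 1| ^ 2 := by
    simp_rw [rho_two hd]; exact (hw.int_sq_div_jb hd).const_mul _
  have ip : Integrable fun x => VV x ^ pp d * |u x / VV x - 1| ^ pp d := by
    simp_rw [rho_pp hd]; exact hw.int_pp
  have w2 : ∫ x, VV x ^ pp d * |u x / VV x - 1| ^ 2 ≤ kap d * C1 * D := by
    simp_rw [rho_two hd]; rw [integral_const_mul, mul_assoc]; gcongr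
  have wp : ∫ x, VV x ^ pp d * |u x / VV x - 1| ^ pp d ≤ C1 * (Q * (C * J)) := by
    simp_rw [rho_pp hd]; exact hwp.trans (by gcongr)
  have hq1 := one_lt_qq hd
  have hqp := qq_add_one hd
  have r0 := integrable_VV_pp hd
  have r1 : Integrable fun x => VV x ^ pp d * (u x / VV x) := by
    have := int_rho hd hu h0 (a := 1) (by norm_num) (by linarith)
    simpa using this
  have rq := int_rho hd hu h0 (a := qq d) (by linarith) (by linarith)
  have rp := int_rho hd hu h0 (a := pp d) (by linarith) le_rfl
  have r2 : Integrable fun x => VV x ^ pp d * (u x / VV x) ^ 2 := by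
    have := int_rho hd hu h0 (a := 2) (by norm_num) (by linarith)
    simpa using this
  have vp : ∫ x, VV x ^ pp d * (u x / VV x) ^ pp d = 1 := by simp_rw [rho_pp' hd h0]; exact h1
  -- the error term
  set G := ∫ x, VV x ^ pp d * ((u x / VV x) ^ qq d - u x / VV x - (qq d - 1) / pp d * ((u x / VV x) ^ pp d - 1)) with hG
  have hGb : |G| ≤ J / 2 := by
    have jj : Integrable fun x => 1 / (4 * (kap d * C1 * C)) * (VV x ^ pp d * |u x / VV x - 1| ^ 2) + K * (VV x ^ pp d * |u x / VV x - 1| ^ pp d) :=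
      (i2.const_mul _).add (ip.const_mul _)
    rw [hG, ← Real.norm_eq_abs]
    refine (norm_integral_le_of_norm_le jj (Eventually.of_forall fun x => ?_)).trans ?_
    · rw [Real.norm_eq_abs, abs_mul, abs_of_nonneg (hVp0 x)]
      have := mul_le_mul_of_nonneg_left (hg _ (hrho0 x)) (hVp0 x)
      linarith
    · rw [integral_add (i2.const_mul _) (ip.const_mul _), integral_const_mul, integral_const_mul]
      have a1 : 1 / (4 * (kap d * C1 * C)) * ∫ x, VV x ^ pp d * |u x / VV x - 1| ^ 2 ≤ 1 / (4 * (kap d * C1 * C)) * (kap d * C1 * (C * J)) := by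
        gcongr
        exact w2.trans (by gcongr)
      have a2 : K * ∫ x, VV x ^ pp d * |u x / VV x - 1| ^ pp d ≤ K * (C1 * (Q * (C * J))) := by gcongr
      have a3 : 1 / (4 * (kap d * C1 * C)) * (kap d * C1 * (C * J)) = J / 4 := by field_simp
      have a4 : K * (C1 * (Q * (C * J))) = J / 4 := by rw [hQ]; field_simp
      linarith
  have hGe : G = (∫ x, VV x ^ pp d * (u x / VV x) ^ qq d) - ∫ x, VV x ^ pp d * (u x / VV x) := by
    have e : ∀ x, VV x ^ pp d * ((u x / VV x) ^ qq d - u x / VV x - (qq d - 1) / pp d * ((u x / VV x) ^ pp d - 1)) =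
      (VV x ^ pp d * (u x / VV x) ^ qq d - VV x ^ pp d * (u x / VV x)) - (qq d - 1) / pp d * (VV x ^ pp d * (u x / VV x) ^ pp d - VV x ^ pp d) := fun x => by ring
    rw [hG]
    simp_rw [e]
    have j1 : Integrable fun x => VV x ^ pp d * (u x / VV x) ^ qq d - VV x ^ pp d * (u x / VV x) := rq.sub r1
    have j2 : Integrable fun x => VV x ^ pp d * (u x / VV x) ^ pp d - VV x ^ pp d := rp.sub r0
    rw [integral_sub j1 (j2.const_mul _), integral_const_mul, integral_sub rp r0, integral_sub rq r1, vp, int_VV_pp hd]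
    ring
  -- energy of the test function
  set ψ : EE d → ℝ := fun x => (1 - t) * u x + t * (sig d ^ (1 / pp d))⁻¹ * UU x with hψ
  have hψe : ∀ x, ψ x = (1 - t) * u x + t * VV x := fun x => by rw [hψ, VV]; ring
  have hψM : MemD12 d ψ := (hu.const_mul hd _).add hd ((memD12_UU hd).const_mul hd _)
  have hψD : DD ψ = (1 - t) ^ 2 * D := DD_add_UU hu.diff _ _
  have hψE := hψM.energy_eq hd
  rw [hψD] at hψE
  have ek : kap d = S * (d * ((d:ℝ) - 2)) := rfl
  have m1 : kap d * ∫ x, u x ^ 2 / jb x ^ 2 = ∫ x, VV x ^ pp d * (u x / VV x) ^ 2 := by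
    simp_rw [rho_two' hd]; rw [integral_const_mul]
  have m2 : kap d * ∫ x, ψ x ^ 2 / jb x ^ 2 = (∫ x, VV x ^ pp d * (u x / VV x) ^ 2) - 2 * t * ((∫ x, VV x ^ pp d * (u x / VV x) ^ 2) - ∫ x, VV x ^ pp d * (u x / VV x))
      + t ^ 2 * ∫ x, VV x ^ pp d * |u x / VV x - 1| ^ 2 := by
    rw [← integral_const_mul]
    simp_rw [← rho_two' hd]
    have e : ∀ x, VV x ^ pp d * (ψ x / VV x) ^ 2 = (VV x ^ pp d * (u x / VV x) ^ 2 - 2 * t * (VV x ^ pp d * (u x / VV x) ^ 2 - VV x ^ pp d * (u x / VV x))) + t ^ 2 * (VV x ^ pp d * |u x / VV x - 1| ^ 2) := by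
      intro x
      have hv := VV_pos hd x
      rw [hψe, sq_abs, add_div, mul_div_cancel_right₀ _ hv.ne', mul_div_assoc]
      ring
    simp_rw [e]
    have j1 : Integrable fun x => VV x ^ pp d * (u x / VV x) ^ 2 - VV x ^ pp d * (u x / VV x) := r2.sub r1
    have j2 : Integrable fun x => VV x ^ pp d * (u x / VV x) ^ 2 - 2 * t * (VV x ^ pp d * (u x / VV x) ^ 2 - VV x ^ pp d * (u x / VV x)) := r2.sub (j1.const_mul _)
    rw [integral_add j2 (i2.const_mul _), integral_sub r2 (j1.const_mul _), integral_const_mul, integral_const_mul, integral_sub r2 r1]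
  have m3 : ∫ x, u x ^ qq d * (S * ψ x) = S * ((1 - t) + t * ∫ x, VV x ^ pp d * (u x / VV x) ^ qq d) := by
    have e : ∀ x, u x ^ qq d * (S * ψ x) = S * ((1 - t) * |u x| ^ pp d + t * (VV x ^ pp d * (u x / VV x) ^ qq d)) := fun x => by
      rw [hψe, ← mul_qq hd h0, rho_qq hd h0]; ring
    simp_rw [e]
    rw [integral_const_mul, integral_add (hu.int_pp.const_mul _) (rq.const_mul _), integral_const_mul, integral_const_mul, h1, mul_one]
  refine ⟨fun x => S * ψ x, hψM.const_mul hd _, fun x => ?_, ?_⟩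
  · beta_reduce
    rw [hψe]
    have := (VV_pos hd x).le
    have h2 := h0 x
    have : 0 ≤ 1 - t := by linarith
    positivity
  beta_reduce
  rw [energy_const_mul hψM.diff, m3, hψE]
  rw [hen] at hJd
  rw [ek] at m1 m2
  rw [ek] at w2
  set A2 := ∫ x, VV x ^ pp d * (u x / VV x) ^ 2
  set A1 := ∫ x, VV x ^ pp d * (u x / VV x)
  set Aq := ∫ x, VV x ^ pp d * (u x / VV x) ^ qq d
  set W2 := ∫ x, VV x ^ pp d * |u x / VV x - 1| ^ 2
  set B := ∫ x, ψ x ^ 2 / jb x ^ 2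
  set B0 := ∫ x, u x ^ 2 / jb x ^ 2
  have hGl := (abs_le.1 hGb).1
  rw [ek] at hC'
  clear_value A2 A1 Aq W2 B B0 J D t G
  have hW : S * D + W2 ≤ C' * J := by
    rw [hC']
    have z1 : S * D ≤ S * (C * J) := by gcongr
    have z2 : S * (d * ((d:ℝ) - 2)) * C1 * D ≤ S * (d * ((d:ℝ) - 2)) * C1 * (C * J) := by
      rw [← ek]; gcongr
    linarith
  have hmain : 1 - 2 * ((1 - t) + t * Aq) + S * ((1 - t) ^ 2 * D + d * ((d:ℝ) - 2) * B) = J - 2 * t * (J + G) + t ^ 2 * (S * D + W2) := by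
    linear_combination m2 + (-1 + 2 * t) * hJd - (1 - 2 * t) * m1 + 2 * t * hGe
  have hfin : 1 - 2 * ((1 - t) + t * Aq) + S * ((1 - t) ^ 2 * D + d * ((d:ℝ) - 2) * B) ≤ (1 - t / 2) * J := by
    rw [hmain]
    have y1 : t ^ 2 * (S * D + W2) ≤ t ^ 2 * (C' * J) := by gcongr
    have y2 : t ^ 2 * (C' * J) ≤ t * J / 2 := by
      calc t ^ 2 * (C' * J) = (t * C') * (t * J) := by ring
        _ ≤ 1 / 2 * (t * J) := by gcongr
        _ = _ := by ring
    have y3 : t * (J / 2) ≤ t * (J + G) := by gcongr; linarith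
    linarith
  calc _ = S * (1 - 2 * ((1 - t) + t * Aq) + S * ((1 - t) ^ 2 * D + d * ((d:ℝ) - 2) * B)) := by ring
    _ ≤ S * ((1 - t / 2) * J) := by gcongr
    _ = _ := by ring

theorem ub : ∃ C, 0 < C ∧ C < sobolevConst d ∧ ∀ u : EE d → ℝ, MemD12 d u → (∀ x, 0 ≤ u x) →
    ∃ φ : EE d → ℝ, MemD12 d φ ∧ (∀ x, 0 ≤ φ x) ∧
      sobolevConst d * lpNorm' (pp d) u ^ (2 * qq d) - 2 * (∫ x, u x ^ qq d * φ x) + ∫ x, ‖gradient φ x‖ ^ 2 ≤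
      C * lpNorm' (pp d) u ^ ((8:ℝ) / ((d:ℝ) - 2)) * (sobolevConst d * (∫ x, ‖gradient u x‖ ^ 2) - lpNorm' (pp d) u ^ (2:ℝ)) := by
  have hS := sobolevConst_pos hd
  have h3 : (3:ℝ) ≤ d := by exact_mod_cast hd
  have h4 : (0:ℝ) < d - 2 := by linarith
  have hq1 := one_lt_qq hd
  have hp2 := two_lt_pp hd
  obtain ⟨δ, hδ, t, ht0, ht1, hn⟩ := ub_near hd
  set S := sobolevConst d with hSd
  set C := max (S / (1 + δ)) (S * (1 - t / 2)) with hC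
  have hsob := sharp_sob hd
  refine ⟨C, lt_max_of_lt_left (by positivity), max_lt ?_ ?_, fun u hu h0 => ?_⟩
  · rw [div_lt_iff₀ (by positivity)]; nlinarith
  · nlinarith
  set N := lpNorm' (pp d) u with hN
  rcases (lpNorm'_nonneg (pp d) u).lt_or_eq with hN0 | hN0
  · rw [← hN] at hN0
    set w : EE d → ℝ := fun x => N⁻¹ * u x with hw
    have hwM : MemD12 d w := hu.const_mul hd _
    have hw1 : ∫ x, |w x| ^ pp d = 1 := by
      rw [← lpNorm'_rpow (by linarith), hw, lpNorm'_const_mul (one_le_pp hd), ← hN, abs_of_pos (by positivity), inv_mul_cancel₀ hN0.ne', Real.one_rpow]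
    have hw0 : ∀ x, 0 ≤ w x := fun x => mul_nonneg (by positivity) (h0 x)
    obtain ⟨a, l, hl, hcen⟩ := exists_centered hd hwM hw1
    have hvM := MemD12.tr hd a hl hwM
    have hv1 := (int_pp_tr (u := w) hd a hl).trans hw1
    have hvE := energy_tr hd a hl hwM.diff
    have hv0 : ∀ x, 0 ≤ tr a l w x := fun x => mul_nonneg (by positivity) (hw0 _)
    have hinv := tr_inv (u := w) a hl
    set v := tr a l w
    have hJ0 : 0 ≤ S * (∫ x, ‖gradient v x‖ ^ 2) - 1 := by
      have := hsob v hvM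
      rw [hv1, Real.one_rpow] at this; linarith
    obtain ⟨φ, hφM, hφ0, hφ⟩ : ∃ φ : EE d → ℝ, MemD12 d φ ∧ (∀ x, 0 ≤ φ x) ∧ S - 2 * (∫ x, v x ^ qq d * φ x) + ∫ x, ‖gradient φ x‖ ^ 2 ≤
        C * (S * (∫ x, ‖gradient v x‖ ^ 2) - 1) := by
      rcases le_total (S * (∫ x, ‖gradient v x‖ ^ 2) - 1) δ with h | h
      · obtain ⟨φ, a1, a2, a3⟩ := hn v hvM hv0 hv1 hcen h
        exact ⟨φ, a1, a2, a3.trans (mul_le_mul_of_nonneg_right (le_max_right _ _) hJ0)⟩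
      · obtain ⟨φ, a1, a2, a3⟩ := ub_far hd hvM hv0 hv1 hδ h
        exact ⟨φ, a1, a2, a3.trans (mul_le_mul_of_nonneg_right (le_max_left _ _) hJ0)⟩
    have hl' : 0 < l⁻¹ := by positivity
    set φ' := tr (-(l⁻¹ • a)) l⁻¹ φ with hφ'
    have hφ'M : MemD12 d φ' := MemD12.tr hd _ hl' hφM
    have mix := int_mix_tr (u := v) hd (-(l⁻¹ • a)) hl' hv0 φ
    rw [hinv, ← hφ'] at mix
    have en : ∫ x, ‖gradient φ' x‖ ^ 2 = ∫ x, ‖gradient φ x‖ ^ 2 := energy_tr hd _ hl' hφM.diff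
    refine ⟨fun x => N ^ qq d * φ' x, hφ'M.const_mul hd _, fun x => mul_nonneg (by positivity) (mul_nonneg (by positivity) (hφ0 _)), ?_⟩
    rw [energy_const_mul hφ'M.diff, en]
    have e1 : ∫ x, u x ^ qq d * (N ^ qq d * φ' x) = N ^ (2 * qq d) * ∫ x, v x ^ qq d * φ x := by
      have : ∫ x, v x ^ qq d * φ x = ∫ x, w x ^ qq d * φ' x := mix.symm
      rw [this, ← integral_const_mul]
      congr 1; ext x
      rw [hw, Real.mul_rpow (by positivity) (h0 x), Real.inv_rpow hN0.le, two_mul, Real.rpow_add hN0]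
      have : 0 < N ^ qq d := by positivity
      field_simp
    have e2 : (N ^ qq d) ^ 2 = N ^ (2 * qq d) := by rw [two_mul, Real.rpow_add hN0, sq]
    have e3 : ∫ x, ‖gradient v x‖ ^ 2 = N⁻¹ ^ 2 * ∫ x, ‖gradient u x‖ ^ 2 := by rw [hvE, hw, energy_const_mul hu.diff]
    have e4 : N ^ (2 * qq d) = N ^ ((8:ℝ) / ((d:ℝ) - 2)) * N ^ 2 := by
      rw [← Real.rpow_natCast, ← Real.rpow_add hN0]; congr 1; unfold qq; push_cast; field_simp; ring
    rw [e1, e2, Real.rpow_two]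
    rw [e3] at hφ
    have hP : 0 < N ^ (2 * qq d) := by positivity
    calc _ = N ^ (2 * qq d) * (S - 2 * (∫ x, v x ^ qq d * φ x) + ∫ x, ‖gradient φ x‖ ^ 2) := by ring
      _ ≤ N ^ (2 * qq d) * (C * (S * (N⁻¹ ^ 2 * ∫ x, ‖gradient u x‖ ^ 2) - 1)) := by gcongr
      _ = _ := by rw [e4]; field_simp
  · rw [← hN] at hN0
    have hg0 : gradient (fun _ : EE d => (0:ℝ)) = fun _ => 0 := by ext1 x; exact gradient_fun_const x (0:ℝ)
    have hz : MemD12 d (fun _ => 0) := by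
      have := hu.const_mul hd 0
      simpa using this
    refine ⟨fun _ => 0, hz, fun _ => le_rfl, ?_⟩
    rw [← hN0, hg0, Real.zero_rpow (by linarith), Real.zero_rpow (by positivity)]
    simp
end
end

open MeasureTheory Real
noncomputable section
open scoped ContDiff Topology
open Filter

/-! fundamental solution -/

section
variable {d : ℕ}

/-- regularised squared distance -/
def QT (x : EE d) (ε : ℝ) : EE d → ℝ := qf 1 ((-2:ℝ) • x) (‖x‖ ^ 2 + ε ^ 2)

lemma QT_eq (x : EE d) (ε : ℝ) (y : EE d) : QT x ε y = ‖y - x‖ ^ 2 + ε ^ 2 := by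
  unfold QT qf
  rw [@norm_sub_sq_real, inner_smul_left, real_inner_comm]; simp; ring

lemma QT_pos (x : EE d) {ε : ℝ} (hε : 0 < ε) (y : EE d) : 0 < QT x ε y := by
  rw [QT_eq]; positivity

lemma QT_ge (x : EE d) {ε : ℝ} (hε : 0 < ε) : ∃ k > 0, ∀ y, k * jb y ≤ QT x ε y := by
  have hp : 0 < (1 + 2 * ‖x‖ ^ 2) / ε ^ 2 + 2 := by positivity
  refine ⟨((1 + 2 * ‖x‖ ^ 2) / ε ^ 2 + 2)⁻¹, by positivity, fun y => ?_⟩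
  rw [QT_eq, inv_mul_le_iff₀ hp]
  have h1 : ‖y‖ ≤ ‖y - x‖ + ‖x‖ := by simpa using norm_add_le (y - x) x
  have h2 : ‖y‖ ^ 2 ≤ (‖y - x‖ + ‖x‖) ^ 2 := by gcongr
  have h3 : (1 + 2 * ‖x‖ ^ 2) / ε ^ 2 * ε ^ 2 = 1 + 2 * ‖x‖ ^ 2 := by field_simp
  have h4 : 0 ≤ (1 + 2 * ‖x‖ ^ 2) / ε ^ 2 * ‖y - x‖ ^ 2 := by positivity
  unfold jb
  nlinarith [sq_nonneg (‖y - x‖ - ‖x‖), sq_nonneg ε]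

lemma QT_rpow_le {x : EE d} {ε k s : ℝ} (hs : 0 ≤ s) (hk : 0 < k) (h : ∀ y, k * jb y ≤ QT x ε y) (y : EE d) :
    QT x ε y ^ (-s) ≤ k ^ (-s) * jb y ^ (-s) := by
  have := jb_pos y
  rw [← Real.mul_rpow hk.le this.le]
  exact Real.rpow_le_rpow_of_nonpos (by positivity) (h y) (by linarith)

lemma grad_QT_rpow (x : EE d) {ε : ℝ} (hε : 0 < ε) (s : ℝ) (y : EE d) :
    HasGradientAt (fun z => QT x ε z ^ (-s)) ((-(2 * s) * QT x ε y ^ (-(s + 1))) • (y - x)) y := by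
  have h := (hasGradientAt_qf 1 ((-2:ℝ) • x) (‖x‖ ^ 2 + ε ^ 2) y).rpow_const' (-s) (Or.inl (QT_pos x hε y).ne')
  have e : (-s * qf 1 ((-2:ℝ) • x) (‖x‖ ^ 2 + ε ^ 2) y ^ (-s - 1)) • ((2 * 1 : ℝ) • y + (-2:ℝ) • x) = ((-(2 * s) * QT x ε y ^ (-(s + 1))) • (y - x)) := by
    have : (2 * 1 : ℝ) • y + (-2:ℝ) • x = (2:ℝ) • (y - x) := by module
    rw [this, smul_smul]
    congr 1
    unfold QT
    rw [show -s - 1 = -(s + 1) by ring]; ring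
  rw [e] at h
  exact h

lemma contDiff_QT_rpow (x : EE d) {ε : ℝ} (hε : 0 < ε) (s : ℝ) {n : WithTop ℕ∞} : ContDiff ℝ n (fun z => QT x ε z ^ (-s)) :=
  (contDiff_qf _ _ _).rpow_const_of_ne fun y => (QT_pos x hε y).ne'

lemma norm_sub_le_QT (x : EE d) (ε : ℝ) (y : EE d) : ‖y - x‖ ≤ QT x ε y ^ (1/2:ℝ) := by
  rw [← Real.sqrt_eq_rpow]
  apply Real.le_sqrt_of_sq_le
  rw [QT_eq]; nlinarith [sq_nonneg ε]

/-- domination principle -/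
lemma int_of_dom {f : EE d → ℝ} (hf : AEStronglyMeasurable f volume) {s C : ℝ} (hs : (d:ℝ) / 2 < s) (h : ∀ y, |f y| ≤ C * jb y ^ (-s)) : Integrable f :=
  Integrable.mono' ((integrable_jb_rpow hs).const_mul C) hf (Eventually.of_forall h)

lemma fund_eps (hd : 3 ≤ d) {φ : EE d → ℝ} {Z : EE d → EE d} (hZ : ContDiff ℝ 1 Z) (hφ : ∀ y, HasGradientAt φ (Z y) y)
    {K : ℝ} (hK : 0 ≤ K) (b0 : ∀ y, |φ y| ≤ K * jb y ^ (-(1/2):ℝ)) (b1 : ∀ y, ‖Z y‖ ≤ K * jb y ^ (-1:ℝ))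
    (b2 : ∀ y, |dvg Z y| ≤ K * jb y ^ (-(3/2):ℝ)) (hdZ : Continuous (dvg Z)) (x : EE d) {ε : ℝ} (hε : 0 < ε) :
    ∫ y, QT x ε y ^ (-(((d:ℝ) - 2) / 2)) * dvg Z y = - (((d:ℝ) - 2) * d) * ∫ z, φ (x + ε • z) * jb z ^ (-(((d:ℝ) + 2) / 2)) := by
  have h3 : (3:ℝ) ≤ d := by exact_mod_cast hd
  obtain ⟨k, hk, hT⟩ := QT_ge x hε
  have hTp := QT_pos x hε
  set s : ℝ := ((d:ℝ) - 2) / 2 with hs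
  have hs0 : 0 < s := by rw [hs]; linarith
  have hφc : Continuous φ := continuous_iff_continuousAt.2 fun y => (hφ y).differentiableAt'.continuousAt
  have hφg : gradient φ = Z := funext fun y => (hφ y).gradient
  set W : EE d → EE d := fun y => (-(2 * s) * QT x ε y ^ (-(s + 1))) • (y - x) with hW
  have hWc : ContDiff ℝ 1 W := (contDiff_const.mul (contDiff_QT_rpow x hε (s + 1))).smul (contDiff_id.sub contDiff_const)
  have hWn : ∀ y, ‖W y‖ ≤ 2 * s * QT x ε y ^ (-(s + 1/2)) := fun y => by
    rw [hW, norm_smul, norm_mul, norm_neg, Real.norm_of_nonneg (by positivity), Real.norm_of_nonneg (Real.rpow_nonneg (hTp y).le _), mul_assoc]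
    have : QT x ε y ^ (-(s + 1/2)) = QT x ε y ^ (-(s + 1)) * QT x ε y ^ (1/2:ℝ) := by
      rw [← Real.rpow_add (hTp y)]; congr 1; ring
    rw [this]
    have := norm_sub_le_QT x ε y
    have := Real.rpow_nonneg (hTp y).le (-(s + 1))
    gcongr
  have hWd : ∀ y, dvg W y = -(2 * s) * d * (ε ^ 2 * QT x ε y ^ (-(s + 2))) := fun y => by
    rw [hW, dvg_smul (a := fun y => -(2 * s) * QT x ε y ^ (-(s + 1))) (X := fun y => y - x)]
    · have g := (grad_QT_rpow x hε (s + 1) y)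
      have g2 : gradient (fun y => -(2 * s) * QT x ε y ^ (-(s + 1))) y = (-(2*s)) • ((-(2 * (s + 1)) * QT x ε y ^ (-(s + 1 + 1))) • (y - x)) :=
        (HasGradientAt.scomp (f := fun t => -(2*s) * t) (f' := -(2*s)) (by simpa using (hasDerivAt_id' _).const_mul (-(2*s))) g).gradient
      have e2 : dvg (fun y : EE d => y - x) y = d := by
        have := dvg_add (X := fun y : EE d => y) (Y := fun _ => -x) (x := y) (by fun_prop) (by fun_prop)
        rw [dvg_id, dvg_const, add_zero] at this
        simpa [sub_eq_add_neg] using this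
      rw [g2, e2, inner_smul_left, inner_smul_left, real_inner_self_eq_norm_sq]
      have e3 : QT x ε y ^ (-(s + 1)) = QT x ε y ^ (-(s + 2)) * (‖y - x‖ ^ 2 + ε ^ 2) := by
        rw [← QT_eq]
        nth_rw 3 [← Real.rpow_one (QT x ε y)]
        rw [← Real.rpow_add (hTp y)]; congr 1; ring
      have e4 : (d:ℝ) = 2 * (s + 1) := by rw [hs]; ring
      rw [e3, show s + 1 + 1 = s + 2 by ring, e4]
      simp; ring
    · exact ((contDiff_const.mul (contDiff_QT_rpow x hε (s + 1) (n := 1))).differentiable (by simp)) y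
    · fun_prop
  have jbp := fun y : EE d => jb_pos y
  have jc : ∀ a b : ℝ, ∀ y : EE d, jb y ^ a * jb y ^ b = jb y ^ (a + b) := fun a b y => (Real.rpow_add (jbp y) _ _).symm
  -- continuity facts
  have cT : ∀ r : ℝ, Continuous fun y => QT x ε y ^ (-r) := fun r => (contDiff_QT_rpow x hε r (n := 0)).continuous
  have cW := hWc.continuous
  have cZ := hZ.continuous
  have cJ : ∀ r : ℝ, Continuous fun y : EE d => jb y ^ r := fun r => (contDiff_jb_rpow (n := 0) r).continuous
  -- integrability
  have i1 : Integrable fun y => QT x ε y ^ (-s) * dvg Z y := by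
    refine int_of_dom ((cT s).mul hdZ).aestronglyMeasurable (s := s + 3/2) (C := k ^ (-s) * K) (by rw [hs]; linarith) fun y => ?_
    rw [abs_mul, abs_of_nonneg (Real.rpow_nonneg (hTp y).le _)]
    calc _ ≤ (k ^ (-s) * jb y ^ (-s)) * (K * jb y ^ (-(3/2):ℝ)) := by
          gcongr
          · have := (jbp y).le; positivity
          · exact QT_rpow_le hs0.le hk hT y
          · exact b2 y
      _ = k ^ (-s) * K * (jb y ^ (-s) * jb y ^ (-(3/2):ℝ)) := by ring
      _ = _ := by rw [jc]; congr 2; ring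
  have bW : ∀ y, ‖W y‖ ≤ 2 * s * k ^ (-(s + 1/2)) * jb y ^ (-(s + 1/2)) := fun y => by
    refine (hWn y).trans ?_
    rw [mul_assoc (2 * s) (k ^ _)]
    exact mul_le_mul_of_nonneg_left (QT_rpow_le (by linarith) hk hT y) (by positivity)
  have i2 : Integrable fun y => inner ℝ (W y) (Z y) := by
    refine int_of_dom (cW.inner cZ).aestronglyMeasurable (s := s + 3/2) (C := 2 * s * k ^ (-(s + 1/2)) * K) (by rw [hs]; linarith) fun y => ?_
    calc _ ≤ ‖W y‖ * ‖Z y‖ := abs_real_inner_le_norm _ _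
      _ ≤ (2 * s * k ^ (-(s + 1/2)) * jb y ^ (-(s + 1/2))) * (K * jb y ^ (-1:ℝ)) := by
          gcongr
          · have := (jbp y).le; positivity
          · exact bW y
          · exact b1 y
      _ = 2 * s * k ^ (-(s + 1/2)) * K * (jb y ^ (-(s+1/2)) * jb y ^ (-1:ℝ)) := by ring
      _ = _ := by rw [jc]; congr 2; ring
  have i3 : Integrable fun y => φ y * (ε ^ 2 * QT x ε y ^ (-(s + 2))) := by
    refine int_of_dom (hφc.mul (continuous_const.mul (cT (s+2)))).aestronglyMeasurable (s := s + 5/2) (C := K * (ε ^ 2 * k ^ (-(s + 2)))) (by rw [hs]; linarith) fun y => ?_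
    rw [abs_mul, abs_mul, abs_of_nonneg (Real.rpow_nonneg (hTp y).le _), abs_of_nonneg (sq_nonneg ε)]
    calc _ ≤ (K * jb y ^ (-(1/2):ℝ)) * (ε ^ 2 * (k ^ (-(s + 2)) * jb y ^ (-(s+2)))) := by
          gcongr
          · exact mul_nonneg (sq_nonneg _) (Real.rpow_nonneg (hTp y).le _)
          · have := (jbp y).le; positivity
          · exact b0 y
          · exact QT_rpow_le (by linarith) hk hT y
      _ = K * (ε ^ 2 * k ^ (-(s + 2))) * (jb y ^ (-(1/2):ℝ) * jb y ^ (-(s+2))) := by ring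
      _ = _ := by rw [jc]; congr 2; ring
  have gT : gradient (fun z => QT x ε z ^ (-s)) = W := funext fun y => (grad_QT_rpow x hε s y).gradient
  have sj : ∀ y : EE d, (√(jb y))⁻¹ = jb y ^ (-(1/2):ℝ) := fun y => by rw [sqrt_jb_eq, Real.rpow_neg (jbp y).le]
  have i4 : Integrable fun y => inner ℝ (W y) (Z y) + QT x ε y ^ (-s) * dvg Z y := i2.add i1
  have I1 := ibp (fun z => QT x ε z ^ (-s)) Z ((contDiff_QT_rpow x hε s (n := 1)).differentiable (by simp)) hZ
    (by rw [gT]; exact cW.locallyIntegrable) (by rw [gT]; exact i4) (by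
      refine int_of_dom (((cT s).mul cZ.norm).div (continuous_jb.sqrt) fun y => (Real.sqrt_pos.2 (jbp y)).ne').aestronglyMeasurable (s := s + 3/2) (C := k ^ (-s) * K) (by rw [hs]; linarith) fun y => ?_
      rw [div_eq_mul_inv, sj, abs_of_nonneg (by have := (jbp y).le; have := (hTp y).le; positivity)]
      calc _ ≤ (k ^ (-s) * jb y ^ (-s)) * (K * jb y ^ (-1:ℝ)) * jb y ^ (-(1/2):ℝ) := by
            have := (jbp y).le
            gcongr
            · exact QT_rpow_le hs0.le hk hT y
            · exact b1 y
        _ = k ^ (-s) * K * ((jb y ^ (-s) * jb y ^ (-1:ℝ)) * jb y ^ (-(1/2):ℝ)) := by ring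
        _ = _ := by rw [jc, jc]; congr 2; ring)
  have i5 : Integrable fun y => inner ℝ (Z y) (W y) := by simpa only [real_inner_comm] using i2
  have i6 : Integrable fun y => φ y * dvg W y := by
    simp_rw [hWd]
    have := i3.const_mul (-(2 * s) * d)
    refine this.congr (Eventually.of_forall fun y => ?_)
    simp only; ring
  have i7 : Integrable fun y => inner ℝ (Z y) (W y) + φ y * dvg W y := i5.add i6
  have I2 := ibp φ W (fun y => (hφ y).differentiableAt') hWc (by rw [hφg]; exact cZ.locallyIntegrable) (by rw [hφg]; exact i7) (by
      refine int_of_dom ((hφc.mul cW.norm).div (continuous_jb.sqrt) fun y => (Real.sqrt_pos.2 (jbp y)).ne').aestronglyMeasurable (s := s + 3/2) (C := K * (2 * s * k ^ (-(s + 1/2)))) (by rw [hs]; linarith) fun y => ?_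
      have := (jbp y).le
      rw [div_eq_mul_inv, sj, abs_mul, abs_mul, abs_of_nonneg (norm_nonneg (W y)), abs_of_nonneg (by positivity : 0 ≤ jb y ^ (-(1/2):ℝ))]
      calc _ ≤ (K * jb y ^ (-(1/2):ℝ)) * (2 * s * k ^ (-(s + 1/2)) * jb y ^ (-(s + 1/2))) * jb y ^ (-(1/2):ℝ) := by
            gcongr
            · exact b0 y
            · exact bW y
        _ = K * (2 * s * k ^ (-(s + 1/2))) * ((jb y ^ (-(1/2):ℝ) * jb y ^ (-(s+1/2))) * jb y ^ (-(1/2):ℝ)) := by ring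
        _ = _ := by rw [jc, jc]; congr 2; ring)
  rw [gT, integral_add i2 i1] at I1
  rw [hφg, integral_add i5 i6] at I2
  have e5 : ∫ y, inner ℝ (Z y) (W y) = ∫ y, inner ℝ (W y) (Z y) := by simp only [real_inner_comm]
  have e6 : ∫ y, φ y * dvg W y = -(2 * s) * d * ∫ y, φ y * (ε ^ 2 * QT x ε y ^ (-(s + 2))) := by
    rw [← integral_const_mul]; congr 1; ext y; rw [hWd]; ring
  have e7 : ∫ y, φ y * (ε ^ 2 * QT x ε y ^ (-(s + 2))) = ∫ z, φ (x + ε • z) * jb z ^ (-(((d:ℝ) + 2) / 2)) := by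
    have := integral_affine (fun y => φ y * (ε ^ 2 * QT x ε y ^ (-(s + 2)))) x hε
    rw [eq_inv_mul_iff_mul_eq₀ (by positivity), ← integral_const_mul] at this
    rw [← this]
    congr 1; ext z
    have : QT x ε (x + ε • z) = ε ^ 2 * jb z := by
      rw [QT_eq, add_sub_cancel_left, norm_smul, Real.norm_of_nonneg hε.le]; unfold jb; ring
    rw [this, Real.mul_rpow (by positivity) (jbp z).le, ← Real.rpow_natCast, ← Real.rpow_natCast, ← Real.rpow_mul hε.le]
    have e8 : ε ^ ((d:ℕ):ℝ) * (ε ^ ((2:ℕ):ℝ) * ε ^ (((2:ℕ):ℝ) * -(s + 2))) = 1 := by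
      rw [← Real.rpow_add hε, ← Real.rpow_add hε]
      convert Real.rpow_zero ε using 2
      push_cast; rw [hs]; ring
    have e9 : -(s + 2) = -(((d:ℝ) + 2) / 2) := by rw [hs]; ring
    rw [← e9]
    linear_combination (φ (x + ε • z) * jb z ^ (-(s + 2))) * e8
  rw [← e7]
  have e10 : 2 * s = (d:ℝ) - 2 := by rw [hs]; ring
  rw [← e10]
  linarith

end
end

open MeasureTheory Real
noncomputable section
open scoped ContDiff Topology
open Filter

section
variable {d : ℕ}

lemma int_near (hd : 3 ≤ d) : Integrable ((Metric.ball (0:EE d) 1).indicator fun z => ‖z‖ ^ ((2:ℝ) - d)) := by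
  have h3 : (3:ℝ) ≤ d := by exact_mod_cast hd
  rw [integrable_indicator_iff Metric.isOpen_ball.measurableSet]
  refine integrableOn_ball_of_norm_le_rpow (C := 1) (α := d - 2) (by simp; omega) (by simp) (Eventually.of_forall fun x => ?_) (measurable_norm.pow_const _).aestronglyMeasurable
  rw [Real.norm_of_nonneg (by positivity), one_mul, neg_sub]

lemma far_le (hd : 3 ≤ d) {x : EE d} {k : ℝ} (hk : 0 < k) (hT : ∀ y, k * jb y ≤ QT x 1 y) {y : EE d} (h : 1 ≤ ‖y - x‖) :
    ‖y - x‖ ^ ((2:ℝ) - d) ≤ (k / 2) ^ (-(((d:ℝ) - 2) / 2)) * jb y ^ (-(((d:ℝ) - 2) / 2)) := by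
  have h3 : (3:ℝ) ≤ d := by exact_mod_cast hd
  have hj := jb_pos y
  rw [← Real.mul_rpow (by positivity) hj.le]
  have e : ‖y - x‖ ^ ((2:ℝ) - d) = (‖y - x‖ ^ 2) ^ (-(((d:ℝ) - 2) / 2)) := by
    rw [← Real.rpow_natCast, ← Real.rpow_mul (by positivity)]; congr 1; push_cast; ring
  rw [e]
  refine Real.rpow_le_rpow_of_nonpos (by positivity) ?_ (by linarith)
  have := hT y
  rw [QT_eq] at this
  nlinarith

lemma int_green_dom (hd : 3 ≤ d) (x : EE d) : Integrable fun y => ‖y - x‖ ^ ((2:ℝ) - d) * jb y ^ (-(3/2):ℝ) := by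
  have h3 : (3:ℝ) ≤ d := by exact_mod_cast hd
  obtain ⟨k, hk, hT⟩ := QT_ge x one_pos
  set s : ℝ := ((d:ℝ) - 2) / 2 with hs
  have i1 := ((int_near hd).comp_sub_right x)
  have i2 := ((integrable_jb_rpow (d := d) (s := s + 3/2) (by rw [hs]; linarith)).const_mul ((k/2) ^ (-s)))
  have m1 : Continuous fun y : EE d => jb y ^ (-(3/2):ℝ) := (contDiff_jb_rpow (n := 0) _).continuous
  refine Integrable.mono' (i1.add i2) ?_ (Eventually.of_forall fun y => ?_)
  · exact AEStronglyMeasurable.mul ((measurable_id.sub_const x).norm.pow_const _).aestronglyMeasurable m1.aestronglyMeasurable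
  have hj := jb_pos y
  have hj1 := one_le_jb y
  rw [Real.norm_of_nonneg (by positivity)]
  simp only [Pi.add_apply]
  by_cases h : ‖y - x‖ < 1
  · rw [Set.indicator_of_mem (by simpa using h)]
    have : jb y ^ (-(3/2):ℝ) ≤ 1 := Real.rpow_le_one_of_one_le_of_nonpos hj1 (by norm_num)
    have h1 : ‖y - x‖ ^ ((2:ℝ) - d) * jb y ^ (-(3/2):ℝ) ≤ ‖y - x‖ ^ ((2:ℝ) - d) * 1 := by gcongr
    have h2 : 0 ≤ (k / 2) ^ (-s) * jb y ^ (-(s + 3/2)) := by positivity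
    linarith
  · push Not at h
    rw [Set.indicator_of_notMem (by simpa using h), zero_add]
    have := far_le hd hk hT h
    have e : jb y ^ (-(s + 3/2)) = jb y ^ (-s) * jb y ^ (-(3/2):ℝ) := by rw [← Real.rpow_add hj]; congr 1; ring
    rw [e, ← mul_assoc]
    gcongr

lemma sphere_pos (hd : 3 ≤ d) : 0 < sphereArea d := by
  unfold sphereArea
  have : (0:ℝ) < d := by exact_mod_cast (by omega : 0 < d)
  have := Real.Gamma_pos_of_pos (half_pos this)
  positivity

lemma fund (hd : 3 ≤ d) {φ : EE d → ℝ} {Z : EE d → EE d} (hZ : ContDiff ℝ 1 Z) (hφ : ∀ y, HasGradientAt φ (Z y) y)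
    {K : ℝ} (hK : 0 ≤ K) (b0 : ∀ y, |φ y| ≤ K * jb y ^ (-(1/2):ℝ)) (b1 : ∀ y, ‖Z y‖ ≤ K * jb y ^ (-1:ℝ))
    (b2 : ∀ y, |dvg Z y| ≤ K * jb y ^ (-(3/2):ℝ)) (hdZ : Continuous (dvg Z)) (x : EE d) :
    invLap d (fun y => - dvg Z y) x = φ x := by
  have h3 : (3:ℝ) ≤ d := by exact_mod_cast hd
  have hφc : Continuous φ := continuous_iff_continuousAt.2 fun y => (hφ y).differentiableAt'.continuousAt
  set s : ℝ := ((d:ℝ) - 2) / 2 with hs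
  set e : ℕ → ℝ := fun n => 1 / ((n:ℝ) + 1) with he
  have he0 : ∀ n, 0 < e n := fun n => by rw [he]; positivity
  have het : Tendsto e atTop (𝓝 0) := tendsto_one_div_add_atTop_nhds_zero_nat
  have key := fun n => fund_eps hd hZ hφ hK b0 b1 b2 hdZ x (he0 n)
  rw [← hs] at key
  have hjc : ∀ r : ℝ, Continuous fun y : EE d => jb y ^ r := fun r => (contDiff_jb_rpow (n := 0) r).continuous
  have T1 : Tendsto (fun n => ∫ y, QT x (e n) y ^ (-s) * dvg Z y) atTop (𝓝 (∫ y, ‖y - x‖ ^ ((2:ℝ) - d) * dvg Z y)) := by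
    refine tendsto_integral_of_dominated_convergence (fun y => K * (‖y - x‖ ^ ((2:ℝ) - d) * jb y ^ (-(3/2):ℝ)))
      (fun n => ((contDiff_QT_rpow x (he0 n) s (n := 0)).continuous.mul hdZ).aestronglyMeasurable) ((int_green_dom hd x).const_mul K) (fun n => ?_) ?_
    · have : ∀ᵐ y : EE d, y ≠ x := by
        have : Nontrivial (EE d) := by
          apply Module.nontrivial_of_finrank_pos (R := ℝ); simp; omega
        simp [ae_iff, measure_singleton]
      filter_upwards [this] with y hy
      have hn : 0 < ‖y - x‖ := norm_pos_iff.2 (sub_ne_zero.2 hy)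
      have hq := QT_pos x (he0 n) y
      rw [norm_mul, Real.norm_of_nonneg (by positivity)]
      have e1 : ‖y - x‖ ^ ((2:ℝ) - d) = (‖y - x‖ ^ 2) ^ (-s) := by
        rw [← Real.rpow_natCast, ← Real.rpow_mul (by positivity)]; congr 1; push_cast; rw [hs]; ring
      have e2 : QT x (e n) y ^ (-s) ≤ ‖y - x‖ ^ ((2:ℝ) - d) := by
        rw [e1]
        refine Real.rpow_le_rpow_of_nonpos (by positivity) ?_ (by rw [hs]; linarith)
        rw [QT_eq]; nlinarith [sq_nonneg (e n)]
      have hj := jb_pos y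
      calc _ ≤ ‖y - x‖ ^ ((2:ℝ) - d) * (K * jb y ^ (-(3/2):ℝ)) := by
            gcongr
            exact b2 y
        _ = _ := by ring
    · have : ∀ᵐ y : EE d, y ≠ x := by
        have : Nontrivial (EE d) := by
          apply Module.nontrivial_of_finrank_pos (R := ℝ); simp; omega
        simp [ae_iff, measure_singleton]
      filter_upwards [this] with y hy
      have hn : 0 < ‖y - x‖ := norm_pos_iff.2 (sub_ne_zero.2 hy)
      have e1 : ‖y - x‖ ^ ((2:ℝ) - d) = (‖y - x‖ ^ 2 + 0 ^ 2) ^ (-s) := by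
        rw [← Real.rpow_natCast, zero_pow (by norm_num), add_zero, ← Real.rpow_mul (by positivity)]; congr 1; push_cast; rw [hs]; ring
      rw [e1]
      simp_rw [QT_eq]
      exact ((((het.pow 2).const_add _)).rpow_const (Or.inl (by positivity))).mul_const _
  have T2 : Tendsto (fun n => ∫ z, φ (x + e n • z) * jb z ^ (-(((d:ℝ) + 2) / 2))) atTop (𝓝 (∫ z : EE d, φ x * jb z ^ (-(((d:ℝ) + 2) / 2)))) := by
    refine tendsto_integral_of_dominated_convergence (fun z => K * jb z ^ (-(((d:ℝ) + 2) / 2))) (fun n => ?_) ((integrable_jb_rpow (by linarith)).const_mul K) (fun n => Eventually.of_forall fun z => ?_) (Eventually.of_forall fun z => ?_)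
    · exact ((hφc.comp (by fun_prop)).mul (hjc _)).aestronglyMeasurable
    · have hj := jb_pos z
      rw [norm_mul, Real.norm_of_nonneg (by positivity : 0 ≤ jb z ^ (-(((d:ℝ) + 2) / 2)))]
      gcongr
      refine (b0 _).trans ?_
      have : jb (x + e n • z) ^ (-(1/2):ℝ) ≤ 1 := Real.rpow_le_one_of_one_le_of_nonpos (one_le_jb _) (by norm_num)
      nlinarith
    · refine Tendsto.mul_const _ ?_
      have : Tendsto (fun n => x + e n • z) atTop (𝓝 (x + (0:ℝ) • z)) := (het.smul_const z).const_add x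
      rw [zero_smul, add_zero] at this
      exact (hφc.tendsto x).comp this
  have T3 := T2.const_mul (-(((d:ℝ) - 2) * d))
  simp_rw [← key] at T3
  have R := tendsto_nhds_unique T1 T3
  rw [integral_const_mul, integral_jb_rpow (by linarith)] at R
  have g1 : ((d:ℝ) + 2) / 2 - d / 2 = 1 := by ring
  have g2 : ((d:ℝ) + 2) / 2 = d / 2 + 1 := by ring
  rw [g1, g2, Real.Gamma_one, Real.Gamma_add_one (by positivity)] at R
  have hG := Real.Gamma_pos_of_pos (by linarith : (0:ℝ) < d / 2)
  have hsA := sphere_pos hd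
  have h4 : (0:ℝ) < d - 2 := by linarith
  unfold invLap greenKernel
  have e1 : ∀ y, ‖x - y‖ ^ ((2:ℝ) - d) / (((d:ℝ) - 2) * sphereArea d) * -dvg Z y = (-(((d:ℝ) - 2) * sphereArea d)⁻¹) * (‖y - x‖ ^ ((2:ℝ) - d) * dvg Z y) := fun y => by
    rw [norm_sub_rev]; field_simp
  simp_rw [e1]
  rw [integral_const_mul, R]
  unfold sphereArea at hsA ⊢
  field_simp
end
end

open MeasureTheory Real
noncomputable section
open scoped ContDiff Topology
open Filter

section
variable {d : ℕ}

/-- dual Sobolev exponent -/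
def rr (d : ℕ) : ℝ := 2 * (d:ℝ) / ((d:ℝ) + 2)

/-- majorant for the rescaled kernel -/
def Phi (z : EE d) : ℝ := (Metric.ball (0:EE d) 1).indicator (fun z => ‖z‖ ^ ((2:ℝ) - d)) z + (2:ℝ) ^ (d:ℝ) * jb z ^ (-(d:ℝ))

lemma Phi_int (hd : 3 ≤ d) : Integrable (Phi (d := d)) := by
  have h3 : (3:ℝ) ≤ d := by exact_mod_cast hd
  exact (int_near hd).add ((integrable_jb_rpow (by linarith)).const_mul _)

lemma Phi_near {z : EE d} (h : ‖z‖ < 1) : ‖z‖ ^ ((2:ℝ) - d) ≤ Phi z := by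
  have := jb_pos z
  unfold Phi
  rw [Set.indicator_of_mem (by simpa using h)]
  have : 0 ≤ (2:ℝ) ^ (d:ℝ) * jb z ^ (-(d:ℝ)) := by positivity
  linarith

lemma Phi_far {z : EE d} (h : 1 ≤ ‖z‖) : ‖z‖ ^ (-(2 * d):ℝ) ≤ Phi z := by
  have hj := jb_pos z
  unfold Phi
  rw [Set.indicator_of_notMem (by simpa using h), zero_add]
  have e : (2:ℝ) ^ (d:ℝ) * jb z ^ (-(d:ℝ)) = (jb z / 2) ^ (-(d:ℝ)) := by
    rw [Real.div_rpow hj.le (by norm_num), Real.rpow_neg (by norm_num : (0:ℝ) ≤ 2)]; field_simp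
  have e2 : ‖z‖ ^ (-(2 * d):ℝ) = (‖z‖ ^ 2) ^ (-(d:ℝ)) := by
    rw [← Real.rpow_natCast, ← Real.rpow_mul (by positivity)]; congr 1; push_cast; ring
  rw [e, e2]
  refine Real.rpow_le_rpow_of_nonpos (by positivity) ?_ (by simp)
  unfold jb; nlinarith

lemma Phi_nonneg (z : EE d) : 0 ≤ Phi z := by
  have hj := jb_pos z
  unfold Phi
  refine add_nonneg (Set.indicator_nonneg (fun z _ => by positivity) z) (by positivity)

lemma hls_pt (hd : 3 ≤ d) {m t : ℝ} (hm : 0 < m) (ht : 0 ≤ t) (htm : t ≤ m) (z : EE d) :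
    ‖z‖ ^ ((2:ℝ) - d) * t ≤ m ^ ((3 * (d:ℝ) - 2) / (d + 2)) * Phi (m ^ (2 / ((d:ℝ) + 2)) • z) + m ^ (((d:ℝ) - 2) / (d + 2)) * t ^ rr d := by
  have h3 : (3:ℝ) ≤ d := by exact_mod_cast hd
  have hd2 : (0:ℝ) < d + 2 := by linarith
  have hd3 : (0:ℝ) < d - 2 := by linarith
  set l := m ^ (2 / ((d:ℝ) + 2)) with hl
  have hl0 : 0 < l := by positivity
  have hn : ‖l • z‖ = l * ‖z‖ := by rw [norm_smul, Real.norm_of_nonneg hl0.le]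
  by_cases h : ‖l • z‖ < 1
  · have h1 := Phi_near h
    have e : m ^ ((3 * (d:ℝ) - 2) / (d + 2)) * ‖l • z‖ ^ ((2:ℝ) - d) = ‖z‖ ^ ((2:ℝ) - d) * m := by
      rw [hn, Real.mul_rpow hl0.le (norm_nonneg _), hl, ← Real.rpow_mul hm.le, ← mul_assoc, ← Real.rpow_add hm, mul_comm]
      congr 1
      nth_rw 2 [← Real.rpow_one m]
      congr 1; field_simp; ring
    calc _ ≤ ‖z‖ ^ ((2:ℝ) - d) * m := by gcongr
      _ = m ^ ((3 * (d:ℝ) - 2) / (d + 2)) * ‖l • z‖ ^ ((2:ℝ) - d) := e.symm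
      _ ≤ m ^ ((3 * (d:ℝ) - 2) / (d + 2)) * Phi (l • z) := by gcongr
      _ ≤ _ := le_add_of_nonneg_right (by positivity)
  · push Not at h
    have h1 := Phi_far h
    have hz : 0 < ‖z‖ := by
      rw [hn] at h
      by_contra hc
      have : ‖z‖ = 0 := le_antisymm (not_lt.1 hc) (norm_nonneg _)
      rw [this] at h; norm_num at h
    set lam := m ^ (-(((d:ℝ) - 2) / (2 * d))) with hlam
    have hlp : 0 < lam := by positivity
    have hconj : (pp d).HolderConjugate (rr d) := by
      have hp := two_lt_pp hd
      rw [Real.holderConjugate_iff]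
      refine ⟨by linarith, ?_⟩
      unfold pp rr; field_simp; ring
    have y := Real.young_inequality_of_nonneg (a := lam * ‖z‖ ^ ((2:ℝ) - d)) (b := t / lam) (by positivity) (by positivity) hconj
    have e1 : lam * ‖z‖ ^ ((2:ℝ) - d) * (t / lam) = ‖z‖ ^ ((2:ℝ) - d) * t := by field_simp
    have e2 : (lam * ‖z‖ ^ ((2:ℝ) - d)) ^ pp d = m ^ ((3 * (d:ℝ) - 2) / (d + 2)) * ‖l • z‖ ^ (-(2 * d):ℝ) := by
      rw [hn, Real.mul_rpow hlp.le (by positivity), Real.mul_rpow hl0.le hz.le, hlam, hl, ← Real.rpow_mul hm.le, ← Real.rpow_mul hm.le, ← Real.rpow_mul hz.le, ← mul_assoc, ← Real.rpow_add hm]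
      unfold pp
      congr 2
      · field_simp; ring
      · field_simp; ring
    have e3 : (t / lam) ^ rr d = m ^ (((d:ℝ) - 2) / (d + 2)) * t ^ rr d := by
      rw [Real.div_rpow ht hlp.le, div_eq_mul_inv, hlam, ← Real.rpow_mul hm.le, ← Real.rpow_neg hm.le, mul_comm]
      unfold rr
      congr 2
      field_simp
    rw [e1, e2, e3] at y
    refine y.trans ?_
    have p1 : 1 ≤ pp d := hconj.lt.le
    have p2 : 1 ≤ rr d := hconj.symm.lt.le
    gcongr
    · exact (div_le_self (by positivity) p1).trans (by gcongr)
    · exact div_le_self (by positivity) p2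

lemma hls_int (hd : 3 ≤ d) {w : EE d → ℝ} (hw : Measurable w) (h0 : ∀ x, 0 ≤ w x) (hi : Integrable fun x => w x ^ rr d) :
    Integrable (fun z : EE d × EE d => w z.1 * ‖z.1 - z.2‖ ^ ((2:ℝ) - d) * w z.2) (volume.prod volume) := by
  have h3 : (3:ℝ) ≤ d := by exact_mod_cast hd
  have hd2 : (0:ℝ) < d + 2 := by linarith
  set b : ℝ := ((d:ℝ) - 2) / (d + 2) with hb
  set a : ℝ := (3 * (d:ℝ) - 2) / (d + 2) with ha
  have mF : Measurable (fun z : EE d × EE d => w z.1 * ‖z.1 - z.2‖ ^ ((2:ℝ) - d) * w z.2) := by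
    exact ((hw.comp measurable_fst).mul ((measurable_fst.sub measurable_snd).norm.pow_const _)).mul (hw.comp measurable_snd)
  set A : Set (EE d × EE d) := {z | w z.2 ≤ w z.1} with hA
  have mA : MeasurableSet A := measurableSet_le (hw.comp measurable_snd) (hw.comp measurable_fst)
  set H := A.indicator (fun z : EE d × EE d => w z.1 * ‖z.1 - z.2‖ ^ ((2:ℝ) - d) * w z.2) with hH
  have mH : Measurable H := mF.indicator mA
  have H0 : ∀ z, 0 ≤ H z := fun z => Set.indicator_nonneg (fun z _ => by have := h0 z.1; have := h0 z.2; positivity) z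
  -- the majorant
  set M : EE d → EE d → ℝ := fun x y => w x * (w x ^ a * Phi (w x ^ (2 / ((d:ℝ) + 2)) • (x - y)) + w x ^ b * w y ^ rr d) with hM
  have hMi : ∀ x, 0 < w x → Integrable (M x) ∧ ∫ y, M x y = ((∫ z, Phi (d := d) z) + ∫ y, w y ^ rr d) * w x ^ rr d := by
    intro x hx
    have hl : 0 < w x ^ (2 / ((d:ℝ) + 2)) := by positivity
    have i1 : Integrable fun y => Phi (w x ^ (2 / ((d:ℝ) + 2)) • (x - y)) := ((Phi_int hd).comp_smul hl.ne').comp_sub_left x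
    have e1 : ∫ y, Phi (w x ^ (2 / ((d:ℝ) + 2)) • (x - y)) = ((w x ^ (2 / ((d:ℝ) + 2))) ^ d)⁻¹ * ∫ z, Phi (d := d) z := by
      have := integral_sub_left_eq_self (μ := volume) (fun y => Phi (w x ^ (2 / ((d:ℝ) + 2)) • y)) x
      rw [this]
      have := integral_affine (Phi (d := d)) 0 hl
      simpa using this
    have i2 : Integrable fun y => w x ^ a * Phi (w x ^ (2 / ((d:ℝ) + 2)) • (x - y)) := i1.const_mul _
    have i3 : Integrable fun y => w x ^ b * w y ^ rr d := hi.const_mul _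
    refine ⟨(i2.add i3).const_mul _, ?_⟩
    rw [hM, integral_const_mul, integral_add i2 i3, integral_const_mul, integral_const_mul, e1]
    have e2 : w x ^ rr d = w x * w x ^ b := by
      nth_rw 2 [← Real.rpow_one (w x)]
      rw [← Real.rpow_add hx, hb]; unfold rr; congr 1; field_simp; ring
    have e3 : w x ^ a * ((w x ^ (2 / ((d:ℝ) + 2))) ^ d)⁻¹ = w x ^ b := by
      rw [← Real.rpow_natCast, ← Real.rpow_mul hx.le, ← Real.rpow_neg hx.le, ← Real.rpow_add hx, ha, hb]
      congr 1; field_simp; ring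
    rw [e2]
    linear_combination (w x * ∫ z, Phi (d := d) z) * e3
  have hHM : ∀ x y, 0 < w x → H (x, y) ≤ M x y := by
    intro x y hx
    by_cases h : (x, y) ∈ A
    · rw [hH, Set.indicator_of_mem h, hM]
      simp only
      rw [mul_assoc]
      gcongr
      exact hls_pt hd hx (h0 y) h _
    · rw [hH, Set.indicator_of_notMem h, hM]
      have := h0 y
      have := Phi_nonneg (w x ^ (2 / ((d:ℝ) + 2)) • (x - y))
      positivity
  have hHz : ∀ x y, w x = 0 → H (x, y) = 0 := by
    intro x y hx
    rw [hH, Set.indicator_apply]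
    simp [hx]
  have hHint : ∀ x, Integrable fun y => H (x, y) := by
    intro x
    rcases (h0 x).lt_or_eq with hx | hx
    · refine Integrable.mono' (hMi x hx).1 (mH.comp measurable_prodMk_left).aestronglyMeasurable (Eventually.of_forall fun y => ?_)
      rw [Real.norm_of_nonneg (H0 _)]
      exact hHM x y hx
    · simp_rw [hHz x _ hx.symm]; exact integrable_zero _ _ _
  have hHi : Integrable H (volume.prod volume) := by
    rw [integrable_prod_iff mH.aestronglyMeasurable]
    refine ⟨Eventually.of_forall hHint, ?_⟩
    refine Integrable.mono' (hi.const_mul ((∫ z, Phi (d := d) z) + ∫ y, w y ^ rr d)) mH.aestronglyMeasurable.norm.integral_prod_right' (Eventually.of_forall fun x => ?_)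
    rw [Real.norm_of_nonneg (integral_nonneg fun y => norm_nonneg _)]
    simp_rw [Real.norm_of_nonneg (H0 _)]
    rcases (h0 x).lt_or_eq with hx | hx
    · rw [← (hMi x hx).2]
      exact integral_mono (hHint x) (hMi x hx).1 fun y => hHM x y hx
    · simp_rw [hHz x _ hx.symm]
      rw [integral_zero]
      have : 0 ≤ ∫ z, Phi (d := d) z := integral_nonneg Phi_nonneg
      have : 0 ≤ ∫ y, w y ^ rr d := integral_nonneg fun y => Real.rpow_nonneg (h0 y) _
      have := h0 x
      positivity
  refine Integrable.mono' (hHi.add hHi.swap) mF.aestronglyMeasurable (Eventually.of_forall fun z => ?_)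
  have z1 := h0 z.1
  have z2 := h0 z.2
  rw [Real.norm_of_nonneg (by positivity)]
  simp only [Pi.add_apply, Function.comp]
  rcases le_total (w z.2) (w z.1) with h | h
  · have : H z = w z.1 * ‖z.1 - z.2‖ ^ ((2:ℝ) - d) * w z.2 := Set.indicator_of_mem (s := A) h _
    linarith [H0 z.swap]
  · have : H z.swap = w z.1 * ‖z.1 - z.2‖ ^ ((2:ℝ) - d) * w z.2 := by
      rw [hH, Set.indicator_of_mem (show z.swap ∈ A from h)]
      simp only [Prod.fst_swap, Prod.snd_swap]
      rw [norm_sub_rev]; ring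
    linarith [H0 z]
end
end

open MeasureTheory Real
noncomputable section
open scoped ContDiff Topology
open Filter

section

lemma pos_abs {X T : Type*} [MeasurableSpace X] [MeasurableSpace T] {μ : Measure X} [SFinite μ] {ν : Measure T} [SFinite ν]
    {k : X → T → ℝ} (hk : Measurable (Function.uncurry k)) (k0 : ∀ x t, 0 ≤ k x t) {w : X → ℝ} (hw : Measurable w)
    {K : X × X → ℝ} (hK : ∀ᵐ z ∂(μ.prod μ), Integrable (fun t => k z.1 t * k z.2 t) ν ∧ ∫ t, k z.1 t * k z.2 t ∂ν = K z)
    (hi : Integrable (fun z : X × X => w z.1 * w z.2 * K z) (μ.prod μ)) :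
    0 ≤ ∫ z, w z.1 * w z.2 * K z ∂(μ.prod μ) := by
  have mk1 : Measurable fun p : (X × X) × T => k p.1.1 p.2 := hk.comp ((measurable_fst.comp measurable_fst).prodMk measurable_snd)
  have mk2 : Measurable fun p : (X × X) × T => k p.1.2 p.2 := hk.comp ((measurable_snd.comp measurable_fst).prodMk measurable_snd)
  have mF : Measurable fun p : (X × X) × T => w p.1.1 * w p.1.2 * (k p.1.1 p.2 * k p.1.2 p.2) :=
    ((hw.comp (measurable_fst.comp measurable_fst)).mul (hw.comp (measurable_snd.comp measurable_fst))).mul (mk1.mul mk2)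
  have iF : Integrable (fun p : (X × X) × T => w p.1.1 * w p.1.2 * (k p.1.1 p.2 * k p.1.2 p.2)) ((μ.prod μ).prod ν) := by
    rw [integrable_prod_iff mF.aestronglyMeasurable]
    constructor
    · filter_upwards [hK] with z hz
      exact hz.1.const_mul _
    · refine hi.norm.congr ?_
      filter_upwards [hK] with z hz
      rw [← hz.2]
      have e : ∀ t, ‖w z.1 * w z.2 * (k z.1 t * k z.2 t)‖ = ‖w z.1 * w z.2‖ * (k z.1 t * k z.2 t) := fun t => by
        rw [norm_mul, Real.norm_of_nonneg (mul_nonneg (k0 _ _) (k0 _ _))]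
      simp_rw [e]
      rw [integral_const_mul, norm_mul, Real.norm_of_nonneg (integral_nonneg fun t => mul_nonneg (k0 _ _) (k0 _ _))]
  have e1 : ∫ z, w z.1 * w z.2 * K z ∂(μ.prod μ) = ∫ z, ∫ t, w z.1 * w z.2 * (k z.1 t * k z.2 t) ∂ν ∂(μ.prod μ) := by
    apply integral_congr_ae
    filter_upwards [hK] with z hz
    rw [integral_const_mul, hz.2]
  rw [e1, integral_integral_swap (f := fun (z : X × X) t => w z.1 * w z.2 * (k z.1 t * k z.2 t)) iF]
  refine integral_nonneg fun t => ?_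
  have e2 : ∀ z : X × X, w z.1 * w z.2 * (k z.1 t * k z.2 t) = (w z.1 * k z.1 t) * (w z.2 * k z.2 t) := fun z => by ring
  simp_rw [e2]
  rw [integral_prod_mul (fun x => w x * k x t) (fun x => w x * k x t)]
  exact mul_self_nonneg _

variable {d : ℕ}

lemma gauss_prod {s : ℝ} (hs : 0 < s) (x y : EE d) :
    Integrable (fun z : EE d => rexp (-s * (‖x - z‖ ^ 2 + ‖y - z‖ ^ 2))) ∧
    ∫ z : EE d, rexp (-s * (‖x - z‖ ^ 2 + ‖y - z‖ ^ 2)) = (π / (2 * s)) ^ ((d:ℝ) / 2) * rexp (-(‖x - y‖ ^ 2 / 2) * s) := by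
  set m : EE d := (1/2:ℝ) • (x + y) with hm
  have g : ∫ z : EE d, rexp (-(2 * s) * ‖z‖ ^ 2) = (π / (2 * s)) ^ ((d:ℝ) / 2) := by
    have := GaussianFourier.integral_rexp_neg_mul_sq_norm (V := EE d) (b := 2 * s) (by positivity)
    simpa using this
  have gi : Integrable fun z : EE d => rexp (-(2 * s) * ‖z‖ ^ 2) := by
    by_contra h
    rw [integral_undef h] at g
    have : 0 < (π / (2 * s)) ^ ((d:ℝ) / 2) := by positivity
    linarith
  have e : ∀ z : EE d, rexp (-s * (‖x - z‖ ^ 2 + ‖y - z‖ ^ 2)) = rexp (-(2 * s) * ‖z - m‖ ^ 2) * rexp (-(‖x - y‖ ^ 2 / 2) * s) := fun z => by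
    rw [← Real.exp_add]
    congr 1
    have h1 : x - z = (m - z) + (1/2:ℝ) • (x - y) := by rw [hm]; module
    have h2 : y - z = (m - z) - (1/2:ℝ) • (x - y) := by rw [hm]; module
    have p := parallelogram_law_with_norm ℝ (m - z) ((1/2:ℝ) • (x - y))
    rw [← h1, ← h2, norm_smul, norm_sub_rev m z] at p
    norm_num at p
    rw [p]; ring
  simp_rw [e]
  refine ⟨(gi.comp_sub_right m).mul_const _, ?_⟩
  rw [integral_mul_const, integral_sub_right_eq_self (μ := volume) (fun z : EE d => rexp (-(2 * s) * ‖z‖ ^ 2)) m, g]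

/-- factor of the Green kernel -/
def kf (d : ℕ) (x : EE d) (t : ℝ × EE d) : ℝ := t.1 ^ (((d:ℝ) - 2) / 2) * rexp (-t.1 * ‖x - t.2‖ ^ 2)

/-- constant in the kernel factorisation -/
def kc (d : ℕ) : ℝ := (π / 2) ^ ((d:ℝ) / 2) * ((1 / 2) ^ (-((d:ℝ)/2 - 1)) * Gamma ((d:ℝ)/2 - 1))

lemma kf_int (hd : 3 ≤ d) {x y : EE d} (hxy : x ≠ y) :
    Integrable (fun t => kf d x t * kf d y t) ((volume.restrict (Set.Ioi (0:ℝ))).prod volume) ∧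
    ∫ t, kf d x t * kf d y t ∂((volume.restrict (Set.Ioi (0:ℝ))).prod volume) = kc d * ‖x - y‖ ^ ((2:ℝ) - d) := by
  have h3 : (3:ℝ) ≤ d := by exact_mod_cast hd
  set b : ℝ := ‖x - y‖ ^ 2 / 2 with hb
  have hn : 0 < ‖x - y‖ := norm_pos_iff.2 (sub_ne_zero.2 hxy)
  have hb0 : 0 < b := by positivity
  have e : ∀ s : ℝ, 0 < s → ∀ z : EE d, kf d x (s, z) * kf d y (s, z) = s ^ ((d:ℝ) - 2) * rexp (-s * (‖x - z‖ ^ 2 + ‖y - z‖ ^ 2)) := by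
    intro s hs z
    unfold kf
    simp only
    have e1 : s ^ ((d:ℝ) - 2) = s ^ (((d:ℝ) - 2) / 2) * s ^ (((d:ℝ) - 2) / 2) := by rw [← Real.rpow_add hs]; congr 1; ring
    rw [e1, mul_add, Real.exp_add]; ring
  have k0 : ∀ t : ℝ × EE d, 0 < t.1 → 0 ≤ kf d x t * kf d y t := fun t ht => by unfold kf; positivity
  have inner : ∀ s : ℝ, 0 < s → ∫ z, kf d x (s, z) * kf d y (s, z) = (π / 2) ^ ((d:ℝ) / 2) * (s ^ ((d:ℝ)/2 - 1 - 1) * rexp (-(b * s))) := by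
    intro s hs
    simp_rw [e s hs]
    rw [integral_const_mul, (gauss_prod hs x y).2]
    have e1 : (π / (2 * s)) ^ ((d:ℝ) / 2) = (π / 2) ^ ((d:ℝ) / 2) * s ^ (-((d:ℝ) / 2)) := by
      rw [← div_div, Real.div_rpow (by positivity) hs.le, Real.rpow_neg hs.le]; ring
    have e2 : s ^ ((d:ℝ)/2 - 1 - 1) = s ^ ((d:ℝ) - 2) * s ^ (-((d:ℝ) / 2)) := by rw [← Real.rpow_add hs]; congr 1; ring
    rw [e1, e2, hb, neg_mul]; ring
  have mk : Measurable (fun t => kf d x t * kf d y t) := by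
    unfold kf
    have : ∀ x : EE d, Measurable fun t : ℝ × EE d => t.1 ^ (((d:ℝ) - 2) / 2) * rexp (-t.1 * ‖x - t.2‖ ^ 2) := fun x =>
      (measurable_fst.pow_const _).mul (Real.measurable_exp.comp (measurable_fst.neg.mul ((measurable_const.sub measurable_snd).norm.pow_const 2)))
    exact (this x).mul (this y)
  have int1 : IntegrableOn (fun s : ℝ => s ^ ((d:ℝ)/2 - 1 - 1) * rexp (-(b * s))) (Set.Ioi 0) := by
    have := integrableOn_rpow_mul_exp_neg_mul_rpow (p := 1) (s := (d:ℝ)/2 - 1 - 1) (b := b) (by linarith) one_pos hb0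
    simpa using this
  have iK : Integrable (fun t => kf d x t * kf d y t) ((volume.restrict (Set.Ioi (0:ℝ))).prod volume) := by
    rw [integrable_prod_iff mk.aestronglyMeasurable]
    constructor
    · refine (ae_restrict_iff' measurableSet_Ioi).2 (Eventually.of_forall fun s hs => ?_)
      simp_rw [e s hs]
      exact (gauss_prod hs x y).1.const_mul _
    · refine (int1.const_mul ((π / 2) ^ ((d:ℝ) / 2))).congr ((ae_restrict_iff' measurableSet_Ioi).2 (Eventually.of_forall fun s hs => ?_))
      simp only
      rw [← inner s hs]
      refine integral_congr_ae (Eventually.of_forall fun z => ?_)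
      exact (Real.norm_of_nonneg (k0 (s, z) hs)).symm
  refine ⟨iK, ?_⟩
  rw [integral_prod _ iK, setIntegral_congr_fun measurableSet_Ioi (fun s hs => inner s hs), integral_const_mul, Real.integral_rpow_mul_exp_neg_mul_Ioi (by linarith) hb0]
  unfold kc
  have : (1 / b) ^ ((d:ℝ)/2 - 1) = (1/2) ^ (-((d:ℝ)/2 - 1)) * ‖x - y‖ ^ ((2:ℝ) - d) := by
    rw [one_div, Real.inv_rpow hb0.le, ← Real.rpow_neg hb0.le, hb, div_eq_mul_one_div, Real.mul_rpow (by positivity) (by norm_num), ← Real.rpow_natCast, ← Real.rpow_mul hn.le, mul_comm]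
    congr 2; push_cast; ring
  rw [this]; ring

lemma kc_pos (hd : 3 ≤ d) : 0 < kc d := by
  have h3 : (3:ℝ) ≤ d := by exact_mod_cast hd
  unfold kc
  have := Real.Gamma_pos_of_pos (by linarith : (0:ℝ) < d/2 - 1)
  positivity

/-- nonnegative-time version of the kernel -/
def kg (d : ℕ) (x : EE d) (t : ℝ × EE d) : ℝ := max (kf d x t) 0

lemma pos_green (hd : 3 ≤ d) {w : EE d → ℝ} (hw : Measurable w)
    (hi : Integrable (fun z : EE d × EE d => w z.1 * w z.2 * ‖z.1 - z.2‖ ^ ((2:ℝ) - d)) (volume.prod volume)) :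
    0 ≤ ∫ z : EE d × EE d, w z.1 * w z.2 * ‖z.1 - z.2‖ ^ ((2:ℝ) - d) ∂(volume.prod volume) := by
  have hkc := kc_pos hd
  have hne : ∀ᵐ z : EE d × EE d ∂(volume.prod volume), z.1 ≠ z.2 := by
    have : Nontrivial (EE d) := by
      apply Module.nontrivial_of_finrank_pos (R := ℝ); simp; omega
    have hm : MeasurableSet {z : EE d × EE d | z.1 ≠ z.2} := (measurableSet_eq_fun measurable_fst measurable_snd).compl
    refine (Measure.ae_prod_iff_ae_ae hm).2 (Eventually.of_forall fun x => ?_)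
    have : ∀ᵐ y : EE d, y ≠ x := by simp [ae_iff, measure_singleton]
    filter_upwards [this] with y hy using hy.symm
  have mk : Measurable (Function.uncurry (kg d)) := by
    unfold kg kf
    refine Measurable.max ?_ measurable_const
    exact ((measurable_fst.comp measurable_snd).pow_const _).mul (Real.measurable_exp.comp ((measurable_fst.comp measurable_snd).neg.mul ((measurable_fst.sub (measurable_snd.comp measurable_snd)).norm.pow_const 2)))
  have kae : ∀ x y : EE d, (fun t => kf d x t * kf d y t) =ᵐ[(volume.restrict (Set.Ioi (0:ℝ))).prod volume] (fun t => kg d x t * kg d y t) := by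
    intro x y
    have h : ∀ᵐ t : ℝ × EE d ∂((volume.restrict (Set.Ioi (0:ℝ))).prod volume), 0 < t.1 := by
      have : MeasurableSet {t : ℝ × EE d | 0 < t.1} := measurableSet_lt measurable_const measurable_fst
      refine (Measure.ae_prod_iff_ae_ae this).2 ((ae_restrict_iff' measurableSet_Ioi).2 (Eventually.of_forall fun s hs => Eventually.of_forall fun _ => hs))
    filter_upwards [h] with t ht
    unfold kg
    rw [max_eq_left (by unfold kf; positivity), max_eq_left (by unfold kf; positivity)]
  have := pos_abs (μ := (volume : Measure (EE d))) (ν := (volume.restrict (Set.Ioi (0:ℝ))).prod (volume : Measure (EE d))) (k := kg d) mk (fun x t => le_max_right _ _) hw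
    (K := fun z => kc d * ‖z.1 - z.2‖ ^ ((2:ℝ) - d)) (by
      filter_upwards [hne] with z hz
      obtain ⟨a, b⟩ := kf_int hd hz
      exact ⟨a.congr (kae _ _), (integral_congr_ae (kae _ _)).symm.trans b⟩) (by
      refine (hi.const_mul (kc d)).congr (Eventually.of_forall fun z => ?_)
      simp only; ring)
  have e : ∀ z : EE d × EE d, w z.1 * w z.2 * (kc d * ‖z.1 - z.2‖ ^ ((2:ℝ) - d)) = kc d * (w z.1 * w z.2 * ‖z.1 - z.2‖ ^ ((2:ℝ) - d)) := fun z => by ring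
  simp_rw [e] at this
  rw [integral_const_mul] at this
  exact nonneg_of_mul_nonneg_right this hkc
end
end

open MeasureTheory Real
noncomputable section
open scoped ContDiff Topology
open Filter

section
variable {d : ℕ}

lemma bdd_jb {F : Type*} [NormedAddCommGroup F] [NormedSpace ℝ F] {h : EE d → F} (hc : Continuous h) (hs : HasCompactSupport h) (a : ℝ) :
    ∃ K, 0 ≤ K ∧ ∀ y, ‖h y‖ ≤ K * jb y ^ (-a) := by
  have hj : Continuous fun y : EE d => jb y ^ a := (contDiff_jb_rpow (n := 0) a).continuous
  obtain ⟨C, hC⟩ := (hj.smul hc).bounded_above_of_compact_support hs.smul_left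
  refine ⟨C, (norm_nonneg _).trans (hC 0), fun y => ?_⟩
  have := hC y
  have hp : 0 < jb y ^ a := Real.rpow_pos_of_pos (jb_pos y) _
  rw [Pi.smul_apply', norm_smul, Real.norm_of_nonneg hp.le] at this
  rw [Real.rpow_neg (jb_pos y).le, ← div_eq_mul_inv, le_div_iff₀ hp, mul_comm]
  exact this

lemma gk_eq (x y : EE d) (hd : 3 ≤ d) : ‖x - y‖ ^ ((2:ℝ) - d) = (((d:ℝ) - 2) * sphereArea d) * greenKernel d (x - y) := by
  have h3 : (3:ℝ) ≤ d := by exact_mod_cast hd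
  have := sphere_pos hd
  have h4 : (0:ℝ) < d - 2 := by linarith
  unfold greenKernel
  field_simp

lemma gk_prod (hd : 3 ≤ d) {a b : EE d → ℝ}
    (hi : Integrable (fun z : EE d × EE d => a z.1 * b z.2 * ‖z.1 - z.2‖ ^ ((2:ℝ) - d)) (volume.prod volume)) :
    Integrable (fun x => (((d:ℝ) - 2) * sphereArea d) * (a x * invLap d b x)) ∧
    ∫ z : EE d × EE d, a z.1 * b z.2 * ‖z.1 - z.2‖ ^ ((2:ℝ) - d) ∂(volume.prod volume) = (((d:ℝ) - 2) * sphereArea d) * ∫ x, a x * invLap d b x := by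
  have e : ∀ x, ∫ y, a x * b y * ‖x - y‖ ^ ((2:ℝ) - d) = (((d:ℝ) - 2) * sphereArea d) * (a x * invLap d b x) := fun x => by
    unfold invLap
    rw [← integral_const_mul, ← integral_const_mul]
    congr 1; ext y
    rw [gk_eq x y hd]; ring
  have := hi.integral_prod_left
  simp only [e] at this
  refine ⟨this, ?_⟩
  rw [integral_prod _ hi]
  simp only [e]
  rw [integral_const_mul]

lemma one_lt_rr (hd : 3 ≤ d) : 1 < rr d := by
  have h3 : (3:ℝ) ≤ d := by exact_mod_cast hd
  unfold rr
  rw [lt_div_iff₀ (by linarith)]; linarith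

lemma rpow_add_int (hd : 3 ≤ d) {a b : EE d → ℝ} (ma : Measurable a) (mb : Measurable b) (a0 : ∀ x, 0 ≤ a x) (b0 : ∀ x, 0 ≤ b x)
    (ia : Integrable fun x => a x ^ rr d) (ib : Integrable fun x => b x ^ rr d) : Integrable fun x => (a x + b x) ^ rr d := by
  have h1 := one_lt_rr hd
  have hr : 0 ≤ rr d := by linarith
  refine Integrable.mono' ((ia.add ib).const_mul (2 ^ rr d)) ((ma.add mb).pow_const _).aestronglyMeasurable (Eventually.of_forall fun x => ?_)
  have ha := a0 x
  have hb := b0 x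
  rw [Real.norm_of_nonneg (by positivity)]
  simp only [Pi.add_apply]
  rcases le_total (a x) (b x) with h | h
  · calc _ ≤ (2 * b x) ^ rr d := by gcongr; linarith
      _ = 2 ^ rr d * b x ^ rr d := Real.mul_rpow (by norm_num) hb
      _ ≤ _ := by gcongr; exact le_add_of_nonneg_left (by positivity)
  · calc _ ≤ (2 * a x) ^ rr d := by gcongr; linarith
      _ = 2 ^ rr d * a x ^ rr d := Real.mul_rpow (by norm_num) ha
      _ ≤ _ := by gcongr; exact le_add_of_nonneg_right (by positivity)

lemma dual_smooth (hd : 3 ≤ d) {v : EE d → ℝ} (hv : Measurable v) (h0 : ∀ x, 0 ≤ v x) (hi : Integrable fun x => v x ^ rr d)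
    {φ : EE d → ℝ} (hφ : ContDiff ℝ ∞ φ) (hs : HasCompactSupport φ) :
    Integrable (fun x => v x * φ x) ∧ 2 * ∫ x, v x * φ x ≤ (∫ x, v x * invLap d v x) + ∫ x, ‖gradient φ x‖ ^ 2 := by
  have h3 : (3:ℝ) ≤ d := by exact_mod_cast hd
  have h1r := one_lt_rr hd
  set Z : EE d → EE d := gradient φ with hZ
  have hZe : Z = fun x => (InnerProductSpace.toDual ℝ (EE d)).symm (fderiv ℝ φ x) := rfl
  have hZc : ContDiff ℝ 2 Z := by
    rw [hZe]
    exact (LinearIsometryEquiv.contDiff _).comp ((contDiff_infty.1 hφ 3 : ContDiff ℝ ((3:ℕ):WithTop ℕ∞) φ).fderiv_right (m := 2) (by norm_num))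
  have hZs : HasCompactSupport Z := by
    rw [hZe]
    exact (hs.fderiv (𝕜 := ℝ)).comp_left (map_zero _)
  have hφZ : ∀ y, HasGradientAt φ (Z y) y := fun y => (hφ.differentiable (by simp) y).hasGradientAt
  have hDe : dvg Z = fun x => ∑ i, (fderiv ℝ Z x (EuclideanSpace.single i 1)) i := rfl
  have hDc : Continuous (dvg Z) := by
    rw [hDe]
    have h5 : Continuous (fderiv ℝ Z) := hZc.continuous_fderiv (by simp)
    refine continuous_finsetSum _ fun i _ => ?_
    exact (EuclideanSpace.proj (𝕜 := ℝ) i).continuous.comp (h5.clm_apply continuous_const)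
  have hDs : HasCompactSupport (dvg Z) := by
    refine (hZs.fderiv (𝕜 := ℝ)).mono' ?_
    refine (Function.support_subset_iff'.2 fun x hx => ?_ : Function.support (dvg Z) ⊆ Function.support (fderiv ℝ Z)).trans (subset_tsupport _)
    rw [Function.notMem_support] at hx
    rw [hDe]; simp [hx]
  obtain ⟨K0, k0, hK0⟩ := bdd_jb hφ.continuous hs (1/2)
  obtain ⟨K1, k1, hK1⟩ := bdd_jb hZc.continuous hZs 1
  obtain ⟨K2, k2, hK2⟩ := bdd_jb hDc hDs (3/2)
  have hfund : ∀ x, invLap d (fun y => - dvg Z y) x = φ x := by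
    refine fund hd (hZc.of_le (by norm_num)) hφZ (K := K0 + K1 + K2) (by positivity) (fun y => ?_) (fun y => ?_) (fun y => ?_) hDc
    all_goals have hj := jb_pos y
    · refine (hK0 y).trans ?_
      gcongr; linarith
    · refine (hK1 y).trans ?_
      gcongr; linarith
    · refine (hK2 y).trans ?_
      gcongr; linarith
  set f : EE d → ℝ := fun y => - dvg Z y with hf
  have hfc : Continuous f := hDc.neg
  have hff : invLap d f = φ := funext hfund
  -- integrability
  have ifr : Integrable fun x => |f x| ^ rr d := by
    refine Continuous.integrable_of_hasCompactSupport (hfc.abs.rpow_const fun _ => Or.inr (by linarith)) ?_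
    have : HasCompactSupport f := hDs.neg
    exact this.comp_left (g := fun t => |t| ^ rr d) (by simp only [abs_zero]; exact Real.zero_rpow (by linarith))
  have iW := hls_int hd (hv.add hfc.abs.measurable) (fun x => add_nonneg (h0 x) (abs_nonneg _)) (rpow_add_int hd hv hfc.abs.measurable h0 (fun x => abs_nonneg _) hi ifr)
  have dom : ∀ a b : EE d → ℝ, Measurable a → Measurable b → (∀ x, |a x| ≤ v x + |f x|) → (∀ x, |b x| ≤ v x + |f x|) →
      Integrable (fun z : EE d × EE d => a z.1 * b z.2 * ‖z.1 - z.2‖ ^ ((2:ℝ) - d)) (volume.prod volume) := by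
    intro a b ma mb ha hb
    refine iW.mono' (((ma.comp measurable_fst).mul (mb.comp measurable_snd)).mul ((measurable_fst.sub measurable_snd).norm.pow_const _)).aestronglyMeasurable (Eventually.of_forall fun z => ?_)
    rw [norm_mul, norm_mul, Real.norm_of_nonneg (by positivity : 0 ≤ ‖z.1 - z.2‖ ^ ((2:ℝ) - d))]
    have := ha z.1
    have := hb z.2
    have := h0 z.1
    have := h0 z.2
    calc _ ≤ (v z.1 + |f z.1|) * (v z.2 + |f z.2|) * ‖z.1 - z.2‖ ^ ((2:ℝ) - d) := by gcongr <;> assumption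
      _ = _ := by simp only [Pi.add_apply]; ring
  have bv : ∀ x, |v x| ≤ v x + |f x| := fun x => by rw [abs_of_nonneg (h0 x)]; linarith [abs_nonneg (f x)]
  have bf : ∀ x, |f x| ≤ v x + |f x| := fun x => by linarith [h0 x]
  have mf := hfc.measurable
  have ivv := dom v v hv hv bv bv
  have ivf := dom v f hv mf bv bf
  have ifv := dom f v mf hv bf bv
  have iff' := dom f f mf mf bf bf
  have hpos := pos_green hd (hv.sub mf) (dom _ _ (hv.sub mf) (hv.sub mf)
    (fun x => by simp only [Pi.sub_apply]; exact (abs_sub _ _).trans (by rw [abs_of_nonneg (h0 x)]))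
    (fun x => by simp only [Pi.sub_apply]; exact (abs_sub _ _).trans (by rw [abs_of_nonneg (h0 x)])))
  have e : ∀ z : EE d × EE d, (v - f) z.1 * (v - f) z.2 * ‖z.1 - z.2‖ ^ ((2:ℝ) - d) =
      (v z.1 * v z.2 * ‖z.1 - z.2‖ ^ ((2:ℝ) - d) - v z.1 * f z.2 * ‖z.1 - z.2‖ ^ ((2:ℝ) - d)) -
      (f z.1 * v z.2 * ‖z.1 - z.2‖ ^ ((2:ℝ) - d) - f z.1 * f z.2 * ‖z.1 - z.2‖ ^ ((2:ℝ) - d)) := fun z => by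
    simp only [Pi.sub_apply]; ring
  have j1 : Integrable (fun z : EE d × EE d => v z.1 * v z.2 * ‖z.1 - z.2‖ ^ ((2:ℝ) - d) - v z.1 * f z.2 * ‖z.1 - z.2‖ ^ ((2:ℝ) - d)) (volume.prod volume) := ivv.sub ivf
  have j2 : Integrable (fun z : EE d × EE d => f z.1 * v z.2 * ‖z.1 - z.2‖ ^ ((2:ℝ) - d) - f z.1 * f z.2 * ‖z.1 - z.2‖ ^ ((2:ℝ) - d)) (volume.prod volume) := ifv.sub iff'
  have hsw : ∫ z : EE d × EE d, f z.1 * v z.2 * ‖z.1 - z.2‖ ^ ((2:ℝ) - d) ∂(volume.prod volume) = ∫ z : EE d × EE d, v z.1 * f z.2 * ‖z.1 - z.2‖ ^ ((2:ℝ) - d) ∂(volume.prod volume) := by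
    rw [← integral_prod_swap]
    congr 1; ext z
    simp only [Prod.fst_swap, Prod.snd_swap]
    rw [norm_sub_rev]; ring
  simp_rw [e] at hpos
  rw [integral_sub j1 j2, integral_sub ivv ivf, integral_sub ifv iff', hsw, (gk_prod hd ivv).2, (gk_prod hd ivf).2, (gk_prod hd iff').2, hff] at hpos
  have hC : 0 < ((d:ℝ) - 2) * sphereArea d := mul_pos (by linarith) (sphere_pos hd)
  have hen : ∫ x, f x * φ x = ∫ x, ‖Z x‖ ^ 2 := by
    have i1 : Integrable fun x => ‖Z x‖ ^ 2 := by
      refine Continuous.integrable_of_hasCompactSupport (hZc.continuous.norm.pow 2) ?_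
      exact hZs.comp_left (g := fun t => ‖t‖ ^ 2) (by simp)
    have i2 : Integrable fun x => φ x * dvg Z x :=
      Continuous.integrable_of_hasCompactSupport (hφ.continuous.mul hDc) hs.mul_right
    have i3 : Integrable fun x => φ x * ‖Z x‖ / √(jb x) := by
      refine Continuous.integrable_of_hasCompactSupport ((hφ.continuous.mul hZc.continuous.norm).div continuous_jb.sqrt fun y => (Real.sqrt_pos.2 (jb_pos y)).ne') ?_
      simp_rw [mul_div_assoc]
      exact hs.mul_right
    have i4 : Integrable fun x => ‖Z x‖ ^ 2 + φ x * dvg Z x := i1.add i2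
    have I := ibp φ Z (hφ.differentiable (by simp)) (hZc.of_le (by norm_num)) hZc.continuous.locallyIntegrable (by
      simp_rw [← hZ, real_inner_self_eq_norm_sq]; exact i4) i3
    simp_rw [← hZ, real_inner_self_eq_norm_sq] at I
    rw [integral_add i1 i2] at I
    have : ∫ x, f x * φ x = - ∫ x, φ x * dvg Z x := by
      rw [← integral_neg]; congr 1; ext x; rw [hf]; ring
    linarith
  rw [hen] at hpos
  constructor
  · have := (gk_prod hd ivf).1
    rw [hff] at this
    exact (integrable_const_mul_iff (IsUnit.mk0 _ hC.ne') _).1 this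
  · have : 0 ≤ (((d:ℝ) - 2) * sphereArea d) * ((∫ x, v x * invLap d v x) - 2 * (∫ x, v x * φ x) + ∫ x, ‖Z x‖ ^ 2) := by linarith
    have := nonneg_of_mul_nonneg_right this hC
    linarith

lemma qq_rr (hd : 3 ≤ d) : qq d * rr d = pp d := by
  have h3 : (3:ℝ) ≤ d := by exact_mod_cast hd
  have h4 : (d:ℝ) - 2 ≠ 0 := by linarith
  unfold qq rr pp; field_simp

lemma dual (hd : 3 ≤ d) {u φ : EE d → ℝ} (hu : MemD12 d u) (u0 : ∀ x, 0 ≤ u x) (hφ : MemD12 d φ) (p0 : ∀ x, 0 ≤ φ x) :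
    2 * ∫ x, u x ^ qq d * φ x ≤ (∫ x, u x ^ qq d * invLap d (fun y => u y ^ qq d) x) + ∫ x, ‖gradient φ x‖ ^ 2 := by
  have hv : Measurable fun x => u x ^ qq d := hu.cont.measurable.pow_const _
  have hi : Integrable fun x => (u x ^ qq d) ^ rr d := by
    refine hu.int_pp.congr (Eventually.of_forall fun x => ?_)
    simp only
    rw [← Real.rpow_mul (u0 x), qq_rr hd, abs_of_nonneg (u0 x)]
  obtain ⟨g, c, g1, g2, g3, g4, g5, g6⟩ := approx hd hφ
  have D := fun n => dual_smooth hd hv (fun x => Real.rpow_nonneg (u0 x) _) hi (g1 n) (g2 n)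
  have := (fatou_real (f := fun n x => u x ^ qq d * g n x) (c := fun n => ((∫ x, u x ^ qq d * invLap d (fun y => u y ^ qq d) x) + c n) / 2)
    (fun n x => mul_nonneg (Real.rpow_nonneg (u0 x) _) (g3 p0 n x)) (fun n => (D n).1) (fun n => by linarith [(D n).2, g5 n])
    ((g6.const_add _).div_const 2) (Eventually.of_forall fun x => (g4 x).const_mul _)).2
  linarith
end
end

open MeasureTheory Real
noncomputable section
open scoped ContDiff Topology
open Filter
variable {d : ℕ}

/-- The frozen admissible set of constants. -/
def AdmC (d : ℕ) (C : ℝ) : Prop := 0 < C ∧ ∀ u : EE d → ℝ, (∀ x, 0 ≤ u x) → MemD12 d u →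
  sobolevConst d * lpNorm' (rr d) (fun x => u x ^ qq d) ^ (2:ℝ) - (∫ x, u x ^ qq d * invLap d (fun y => u y ^ qq d) x) ≤
   C * lpNorm' (pp d) u ^ ((8:ℝ) / ((d:ℝ) - 2)) * (sobolevConst d * (∫ x, ‖gradient u x‖ ^ 2) - lpNorm' (pp d) u ^ (2:ℝ))

lemma rr_pos (hd : 3 ≤ d) : 0 < rr d := by linarith [one_lt_rr hd]

lemma norm_uq (hd : 3 ≤ d) {u : EE d → ℝ} (h0 : ∀ x, 0 ≤ u x) :
    lpNorm' (rr d) (fun x => u x ^ qq d) ^ (2:ℝ) = lpNorm' (pp d) u ^ (2 * qq d) := by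
  have hp : 0 < pp d := by linarith [two_lt_pp hd]
  have hr := rr_pos hd
  have hq : 0 < qq d := by linarith [one_lt_qq hd]
  rw [lpNorm'_rpow_two]
  unfold lpNorm'
  rw [← Real.rpow_mul (integral_nonneg fun x => by positivity)]
  congr 1
  · congr 1; ext x
    rw [abs_of_nonneg (Real.rpow_nonneg (h0 x) _), ← Real.rpow_mul (h0 x), qq_rr hd, abs_of_nonneg (h0 x)]
  · rw [← qq_rr hd]; field_simp

lemma upper (hd : 3 ≤ d) : ∃ C, AdmC d C ∧ C < sobolevConst d := by
  obtain ⟨C, h0, h1, h2⟩ := ub hd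
  refine ⟨C, ⟨h0, fun u u0 hu => ?_⟩, h1⟩
  obtain ⟨φ, hφ, p0, h⟩ := h2 u hu u0
  have := dual hd hu u0 hφ p0
  rw [norm_uq hd u0]
  linarith
end

open MeasureTheory Real
noncomputable section
open scoped ContDiff Topology
open Filter
variable {d : ℕ}

/-- gradient of `x_i x_j` -/
def BB2 (i j : Fin d) (x : EE d) : EE d := x j • EuclideanSpace.single i (1:ℝ) + x i • EuclideanSpace.single j (1:ℝ)

/-- `x_i x_j (1+|x|²)^s` -/
def Fm (i j : Fin d) (s : ℝ) (x : EE d) : ℝ := x i * x j * jb x ^ s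

/-- gradient of `Fm` -/
def Gm (i j : Fin d) (s : ℝ) (x : EE d) : EE d := jb x ^ s • BB2 i j x + (2 * s * Fm i j (s - 1) x) • x

lemma coord_grad (i : Fin d) (x : EE d) : HasGradientAt (fun y : EE d => y i) (EuclideanSpace.single i (1:ℝ)) x := by
  rw [hasGradientAt_iff_hasFDerivAt]
  refine ((EuclideanSpace.proj (𝕜 := ℝ) i : EE d →L[ℝ] ℝ).hasFDerivAt (x := x)).congr_fderiv ?_
  ext y
  simp [EuclideanSpace.inner_single_left]

lemma mm_grad (i j : Fin d) (x : EE d) : HasGradientAt (fun y : EE d => y i * y j) (BB2 i j x) x :=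
  (coord_grad i x).mul' (coord_grad j x)

lemma Fm_grad (i j : Fin d) (s : ℝ) (x : EE d) : HasGradientAt (Fm i j s) (Gm i j s x) x := by
  have := (mm_grad i j x).mul' (hasGradientAt_jb_rpow s x)
  have e : Gm i j s x = jb x ^ s • BB2 i j x + (x i * x j) • (2 * s * jb x ^ (s - 1)) • x := by
    unfold Gm Fm
    rw [smul_smul]; congr 2; ring
  rw [e]; exact this

lemma contDiff_coord (i : Fin d) {n : WithTop ℕ∞} : ContDiff ℝ n (fun x : EE d => x i) :=
  (EuclideanSpace.proj (𝕜 := ℝ) i : EE d →L[ℝ] ℝ).contDiff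

lemma contDiff_BB2 (i j : Fin d) {n : WithTop ℕ∞} : ContDiff ℝ n (BB2 i j) :=
  ((contDiff_coord j).smul contDiff_const).add ((contDiff_coord i).smul contDiff_const)

lemma contDiff_Fm (i j : Fin d) (s : ℝ) {n : WithTop ℕ∞} : ContDiff ℝ n (Fm i j s) :=
  ((contDiff_coord i).mul (contDiff_coord j)).mul (contDiff_jb_rpow s)

lemma contDiff_Gm (i j : Fin d) (s : ℝ) {n : WithTop ℕ∞} : ContDiff ℝ n (Gm i j s) :=
  ((contDiff_jb_rpow s).smul (contDiff_BB2 i j)).add ((contDiff_const.mul (contDiff_Fm i j _)).smul contDiff_id)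

lemma inner_BB2 (i j : Fin d) (x : EE d) : inner ℝ (BB2 i j x) x = 2 * (x i * x j) := by
  unfold BB2
  rw [inner_add_left, inner_smul_left, inner_smul_left, EuclideanSpace.inner_single_left, EuclideanSpace.inner_single_left]
  simp; ring

lemma dvg_BB2 {i j : Fin d} (h : i ≠ j) (x : EE d) : dvg (BB2 i j) x = 0 := by
  have h1 : ∀ i j : Fin d, i ≠ j → dvg (fun y : EE d => y j • EuclideanSpace.single i (1:ℝ)) x = 0 := fun i j h => by
    rw [dvg_smul (coord_grad j x).differentiableAt' (X := fun _ => EuclideanSpace.single i (1:ℝ)) (differentiableAt_const _), dvg_const, (coord_grad j x).gradient, EuclideanSpace.inner_single_left]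
    simp [h.symm]
  unfold BB2
  rw [dvg_add, h1 _ _ h, h1 _ _ h.symm, add_zero]
  · exact (coord_grad j x).differentiableAt'.smul (differentiableAt_const _)
  · exact (coord_grad i x).differentiableAt'.smul (differentiableAt_const _)

lemma dvg_Gm {i j : Fin d} (h : i ≠ j) (s : ℝ) (x : EE d) :
    dvg (Gm i j s) x = 2 * s * (2 + 2 * s + d) * Fm i j (s - 1) x - 4 * s * (s - 1) * Fm i j (s - 2) x := by
  have h1 := hasGradientAt_jb_rpow s x
  have h2 : HasGradientAt (fun y => 2 * s * Fm i j (s - 1) y) ((2 * s) • Gm i j (s - 1) x) x :=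
    HasGradientAt.scomp (f := fun t => 2 * s * t) (by simpa using (hasDerivAt_id (Fm i j (s-1) x)).const_mul (2 * s)) (Fm_grad i j (s - 1) x)
  have hB : DifferentiableAt ℝ (BB2 i j) x := (contDiff_BB2 i j (n := 1)).differentiable (by simp) x
  unfold Gm
  rw [dvg_add (X := fun y => jb y ^ s • BB2 i j y) (Y := fun y => (2 * s * Fm i j (s - 1) y) • y) (h1.differentiableAt'.smul hB) (h2.differentiableAt'.smul differentiableAt_id), dvg_smul h1.differentiableAt' hB,
    dvg_smul h2.differentiableAt' (X := fun y => y) differentiableAt_id, h1.gradient, h2.gradient, dvg_id, dvg_BB2 h]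
  rw [inner_smul_left, inner_smul_left, real_inner_comm, inner_BB2, Gm, inner_add_left, inner_smul_left, inner_smul_left, inner_BB2, real_inner_self_eq_norm_sq]
  have hn : ‖x‖ ^ 2 = jb x - 1 := by unfold jb; ring
  rw [hn]
  have e1 : jb x ^ (s - 1) = jb x ^ (s - 2) * jb x := by
    rw [← Real.rpow_add_one (jb_pos x).ne']; congr 1; ring
  simp only [Fm, conj_trivial]
  rw [show s - 1 - 1 = s - 2 by ring, e1]; ring

lemma coord_le (i : Fin d) (x : EE d) : |x i| ≤ ‖x‖ := by
  simpa using PiLp.norm_apply_le x i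

lemma Fm_le (i j : Fin d) (s : ℝ) (x : EE d) : |Fm i j s x| ≤ jb x ^ (s + 1) := by
  have hp := jb_pos x
  unfold Fm
  rw [abs_mul, abs_mul, abs_of_pos (Real.rpow_pos_of_pos hp s), Real.rpow_add_one hp.ne', mul_comm]
  gcongr
  have : |x i| * |x j| ≤ ‖x‖ * ‖x‖ := by gcongr <;> exact coord_le _ _
  unfold jb; nlinarith

lemma Gm_le (i j : Fin d) (s : ℝ) (x : EE d) : ‖Gm i j s x‖ ≤ (2 + 2 * |s|) * jb x ^ (s + 1/2) := by
  have hp := jb_pos x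
  have h1 : ‖BB2 i j x‖ ≤ 2 * ‖x‖ := by
    unfold BB2
    refine (norm_add_le _ _).trans ?_
    rw [norm_smul, norm_smul]
    simp only [PiLp.norm_single, norm_one, mul_one, Real.norm_eq_abs]
    linarith [coord_le i x, coord_le j x]
  have h2 : ‖x‖ ≤ jb x ^ (1/2:ℝ) := by rw [← sqrt_jb_eq]; exact norm_le_sqrt_jb x
  have h3 := Fm_le i j (s - 1) x
  rw [sub_add_cancel] at h3
  unfold Gm
  refine (norm_add_le _ _).trans ?_
  rw [norm_smul, norm_smul, Real.norm_of_nonneg (by positivity : 0 ≤ jb x ^ s), Real.norm_eq_abs, abs_mul, abs_mul, abs_two, Real.rpow_add hp]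
  calc jb x ^ s * ‖BB2 i j x‖ + 2 * |s| * |Fm i j (s-1) x| * ‖x‖ ≤ jb x ^ s * (2 * jb x ^ (1/2:ℝ)) + 2 * |s| * jb x ^ s * jb x ^ (1/2:ℝ) := by
        gcongr; linarith
    _ = _ := by ring
end

open MeasureTheory Real
noncomputable section
open scoped ContDiff Topology
open Filter
variable {d : ℕ}

/-- the perturbation direction -/
def YY (i j : Fin d) (x : EE d) : ℝ := Fm i j (-2) x

def mu (d : ℕ) : ℝ := ((d:ℝ) + 2) * (d + 4) / (d * ((d:ℝ) - 2))

lemma mu_pos (hd : 3 ≤ d) : 0 < mu d := by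
  have h3 : (3:ℝ) ≤ d := by exact_mod_cast hd
  have : 0 < (d:ℝ) - 2 := by linarith
  unfold mu; positivity

lemma YY_le (i j : Fin d) (x : EE d) : |YY i j x| ≤ 1 := by
  refine (Fm_le i j (-2) x).trans (Real.rpow_le_one_of_one_le_of_nonpos (one_le_jb x) (by norm_num))

lemma UU_YY (i j : Fin d) (x : EE d) : UU x * YY i j x = Fm i j (-(((d:ℝ) + 2) / 2)) x := by
  unfold UU YY Fm
  rw [show -(((d:ℝ) + 2) / 2) = -(((d:ℝ) - 2) / 2) + (-2) by ring, Real.rpow_add (jb_pos x)]; ring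

lemma VV_qq (hd : 3 ≤ d) (x : EE d) : VV x ^ qq d = kap d / jb x ^ 2 * VV x := by
  have h := VV_sq hd x
  have hV := VV_pos hd x
  rw [← qq_add_one hd, Real.rpow_add_one hV.ne'] at h
  have : (VV x ^ qq d - kap d / jb x ^ 2 * VV x) * VV x = 0 := by unfold kap; linarith
  rcases mul_eq_zero.1 this with h | h
  · linarith
  · exact absurd h hV.ne'

lemma dvg_const_smul {X : EE d → EE d} {x : EE d} (c : ℝ) (hX : DifferentiableAt ℝ X x) :
    dvg (fun y => c • X y) x = c * dvg X x := by
  rw [dvg_smul (a := fun _ => c) (differentiableAt_const _) hX, gradient_fun_const]; simp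

lemma rpow_jb_le {a b : ℝ} (h : a ≤ b) (x : EE d) : jb x ^ a ≤ jb x ^ b := Real.rpow_le_rpow_of_exponent_le (one_le_jb x) h

/-- explicit solution of the Poisson equation -/
lemma poisson (hd : 3 ≤ d) {i j : Fin d} (hij : i ≠ j) (a b : ℝ) (x : EE d) :
    invLap d (fun y => a * (d * ((d:ℝ) - 2) * jb y ^ (-((d:ℝ) / 2) - 1)) + b * (((d:ℝ) + 2) * (d + 4) * Fm i j (-(((d:ℝ) + 2) / 2) - 2) y)) x
      = a * UU x + b * Fm i j (-(((d:ℝ) + 2) / 2)) x := by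
  have h3 : (3:ℝ) ≤ d := by exact_mod_cast hd
  set σ : ℝ := -(((d:ℝ) + 2) / 2) with hσ
  have hU : ∀ y, HasGradientAt (fun y => a * UU y) ((-(a * ((d:ℝ) - 2))) • (jb y ^ (-((d:ℝ)/2)) • y)) y := fun y => by
    have := HasGradientAt.scomp (f := fun t => a * t) (f' := a) (by simpa using (hasDerivAt_id (UU y)).const_mul a) (UU_grad y)
    rw [smul_smul] at this ⊢
    convert this using 2; ring
  have hF : ∀ y, HasGradientAt (fun y => b * Fm i j σ y) (b • Gm i j σ y) y := fun y =>
    HasGradientAt.scomp (f := fun t => b * t) (f' := b) (by simpa using (hasDerivAt_id (Fm i j σ y)).const_mul b) (Fm_grad i j σ y)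
  have c1 := MemD12.contDiff_pow_smul_id (d := d) (-((d:ℝ)/2))
  have c2 := contDiff_Gm i j σ (n := 1)
  have hZ : ContDiff ℝ 1 (fun y : EE d => (-(a * ((d:ℝ) - 2))) • (jb y ^ (-((d:ℝ)/2)) • y) + b • Gm i j σ y) :=
    ContDiff.add (c1.const_smul _) (c2.const_smul _)
  have hφ : ∀ y, HasGradientAt (fun y => a * UU y + b * Fm i j σ y) ((-(a * ((d:ℝ) - 2))) • (jb y ^ (-((d:ℝ)/2)) • y) + b • Gm i j σ y) y := fun y => by
    have h1 := hU y
    have h2 := hF y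
    rw [hasGradientAt_iff_hasFDerivAt] at *
    rw [map_add]
    exact h1.add h2
  have hdv : ∀ y, dvg (fun y : EE d => (-(a * ((d:ℝ) - 2))) • (jb y ^ (-((d:ℝ)/2)) • y) + b • Gm i j σ y) y =
      -(a * (d * ((d:ℝ) - 2) * jb y ^ (-((d:ℝ) / 2) - 1)) + b * (((d:ℝ) + 2) * (d + 4) * Fm i j (σ - 2) y)) := fun y => by
    have d1 : DifferentiableAt ℝ (fun y : EE d => jb y ^ (-((d:ℝ)/2)) • y) y := c1.differentiable (by simp) y
    have d2 : DifferentiableAt ℝ (Gm i j σ) y := c2.differentiable (by simp) y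
    rw [dvg_add (X := fun y : EE d => (-(a * ((d:ℝ) - 2))) • (jb y ^ (-((d:ℝ)/2)) • y)) (Y := fun y => b • Gm i j σ y) (DifferentiableAt.fun_const_smul d1 _) (DifferentiableAt.fun_const_smul d2 _),
      dvg_const_smul _ d1, dvg_const_smul _ d2, MemD12.dvg_pow_smul_id, dvg_Gm hij]
    have hn : ‖y‖ ^ 2 = jb y - 1 := by unfold jb; ring
    have e1 : jb y ^ (-((d:ℝ)/2)) = jb y ^ (-((d:ℝ)/2) - 1) * jb y := by
      rw [← Real.rpow_add_one (jb_pos y).ne']; congr 1; ring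
    rw [hn, e1, hσ]; ring
  have := fund hd hZ hφ (K := (|a| + |b|) + (|a| * (d - 2) + |b| * (2 + 2 * |σ|)) + (|a| * (d * (d - 2)) + |b| * ((d + 2) * (d + 4)))) ?_ ?_ ?_ ?_ ?_ x
  · rw [← this]; congr 1; ext y; rw [hdv]; ring
  all_goals have hd2 : 0 ≤ (d:ℝ) - 2 := by linarith
  all_goals have n0 : 0 ≤ |a| + |b| := by positivity
  all_goals have n1 : 0 ≤ |a| * ((d:ℝ) - 2) + |b| * (2 + 2 * |σ|) := by positivity
  all_goals have n2 : 0 ≤ |a| * ((d:ℝ) * (d - 2)) + |b| * ((d + 2) * (d + 4)) := by positivity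
  · positivity
  · intro y
    have k1 : |a * UU y| ≤ |a| * jb y ^ (-(1/2):ℝ) := by
      rw [abs_mul, abs_of_pos (UU_pos y)]; gcongr; exact rpow_jb_le (by linarith) y
    have k2 : |b * Fm i j σ y| ≤ |b| * jb y ^ (-(1/2):ℝ) := by
      rw [abs_mul]; gcongr; exact (Fm_le i j σ y).trans (rpow_jb_le (by linarith) y)
    have hp := Real.rpow_pos_of_pos (jb_pos y) (-(1/2):ℝ)
    calc _ ≤ |a * UU y| + |b * Fm i j σ y| := abs_add_le _ _
      _ ≤ (|a| + |b|) * jb y ^ (-(1/2):ℝ) := by linarith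
      _ ≤ _ := by
        refine mul_le_mul_of_nonneg_right ?_ hp.le
        linarith
  · intro y
    have hp := Real.rpow_pos_of_pos (jb_pos y) (-1:ℝ)
    have k1 : ‖(-(a * ((d:ℝ) - 2))) • (jb y ^ (-((d:ℝ)/2)) • y)‖ ≤ |a| * (d - 2) * jb y ^ (-1:ℝ) := by
      rw [norm_smul, norm_neg, norm_mul, Real.norm_of_nonneg hd2, Real.norm_eq_abs, norm_smul, Real.norm_of_nonneg (Real.rpow_nonneg (jb_pos y).le _)]
      gcongr
      calc jb y ^ (-((d:ℝ)/2)) * ‖y‖ ≤ jb y ^ (-((d:ℝ)/2)) * jb y ^ (1/2:ℝ) := by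
            have := jb_pos y
            gcongr; rw [← sqrt_jb_eq]; exact norm_le_sqrt_jb y
        _ = jb y ^ (-((d:ℝ)/2) + 1/2) := by rw [Real.rpow_add (jb_pos y)]
        _ ≤ _ := rpow_jb_le (by linarith) y
    have k2 : ‖b • Gm i j σ y‖ ≤ |b| * (2 + 2 * |σ|) * jb y ^ (-1:ℝ) := by
      rw [norm_smul, Real.norm_eq_abs, mul_assoc]
      gcongr
      refine (Gm_le i j σ y).trans ?_
      gcongr
      · exact one_le_jb y
      · linarith
    calc _ ≤ _ := norm_add_le _ _
      _ ≤ (|a| * (d - 2) + |b| * (2 + 2 * |σ|)) * jb y ^ (-1:ℝ) := by linarith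
      _ ≤ _ := by
        refine mul_le_mul_of_nonneg_right ?_ hp.le
        linarith
  · intro y
    have hp := Real.rpow_pos_of_pos (jb_pos y) (-(3/2):ℝ)
    rw [hdv, abs_neg]
    have k1 : |a * (d * ((d:ℝ) - 2) * jb y ^ (-((d:ℝ) / 2) - 1))| ≤ |a| * (d * ((d:ℝ) - 2)) * jb y ^ (-(3/2):ℝ) := by
      rw [abs_mul, abs_of_nonneg (mul_nonneg (by positivity) (Real.rpow_nonneg (jb_pos y).le _)), mul_assoc |a|]
      gcongr
      · exact one_le_jb y
      · linarith
    have k2 : |b * (((d:ℝ) + 2) * (d + 4) * Fm i j (σ - 2) y)| ≤ |b| * ((d + 2) * (d + 4)) * jb y ^ (-(3/2):ℝ) := by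
      rw [abs_mul, abs_mul _ (Fm i j (σ - 2) y), abs_of_nonneg (by positivity : 0 ≤ ((d:ℝ) + 2) * (d + 4)), mul_assoc |b|]
      gcongr
      exact (Fm_le i j _ y).trans (rpow_jb_le (by linarith) y)
    calc _ ≤ _ := abs_add_le _ _
      _ ≤ (|a| * (d * (d - 2)) + |b| * ((d + 2) * (d + 4))) * jb y ^ (-(3/2):ℝ) := by linarith
      _ ≤ _ := by
        refine mul_le_mul_of_nonneg_right ?_ hp.le
        linarith
  · have : dvg (fun y : EE d => (-(a * ((d:ℝ) - 2))) • (jb y ^ (-((d:ℝ)/2)) • y) + b • Gm i j σ y) = fun y =>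
        -(a * (d * ((d:ℝ) - 2) * jb y ^ (-((d:ℝ) / 2) - 1)) + b * (((d:ℝ) + 2) * (d + 4) * Fm i j (σ - 2) y)) := funext hdv
    rw [this]
    have f1 : Continuous (fun y : EE d => jb y ^ (-((d:ℝ) / 2) - 1)) := (contDiff_jb_rpow (n := 0) _).continuous
    have f2 : Continuous (Fm i j (σ - 2)) := (contDiff_Fm (n := 0) i j _).continuous
    fun_prop

lemma invLap_VV (hd : 3 ≤ d) {i j : Fin d} (hij : i ≠ j) (s : ℝ) (x : EE d) :
    invLap d (fun y => VV y ^ qq d * (1 + s * YY i j y)) x = sobolevConst d * (VV x * (1 + s / mu d * YY i j x)) := by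
  have h3 : (3:ℝ) ≤ d := by exact_mod_cast hd
  have hm := (mu_pos hd).ne'
  set c := (sig d ^ (1 / pp d))⁻¹ with hc
  have h := poisson hd hij (sobolevConst d * c) (sobolevConst d * c * (s / mu d)) x
  rw [← UU_YY] at h
  have e : (fun y : EE d => VV y ^ qq d * (1 + s * YY i j y)) = (fun y => (sobolevConst d * c) * (d * ((d:ℝ) - 2) * jb y ^ (-((d:ℝ) / 2) - 1)) + (sobolevConst d * c * (s / mu d)) * (((d:ℝ) + 2) * (d + 4) * Fm i j (-(((d:ℝ) + 2) / 2) - 2) y)) := by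
    ext y
    have hp := jb_pos y
    rw [VV_qq hd, VV, ← hc, UU, YY, Fm, Fm, kap, mu]
    rw [show -(((d:ℝ) - 2) / 2) = -((d:ℝ)/2) - 1 + (2:ℕ) by push_cast; ring, show -(((d:ℝ) + 2) / 2) - 2 = -((d:ℝ)/2) - 1 + (-2) by ring, Real.rpow_add hp, Real.rpow_natCast, Real.rpow_add hp]
    have h2 : (d:ℝ) - 2 ≠ 0 := by linarith
    have h4 : (d:ℝ) + 4 ≠ 0 := by linarith
    have h5 : (d:ℝ) + 2 ≠ 0 := by linarith
    have h6 : (d:ℝ) ≠ 0 := by linarith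
    field_simp
  rw [e, h, VV, ← hc]; ring
end

open MeasureTheory Real
noncomputable section
open scoped ContDiff Topology
open Filter
variable {d : ℕ}

lemma YY_diff (i j : Fin d) : Differentiable ℝ (YY i j) := fun x => (Fm_grad i j (-2) x).differentiableAt'

lemma YY_grad (i j : Fin d) (x : EE d) : HasGradientAt (YY i j) (Gm i j (-2) x) x := Fm_grad i j (-2) x

lemma YY_grad_le (i j : Fin d) (x : EE d) : ‖Gm i j (-2) x‖ ≤ 6 / √(jb x) := by
  refine (Gm_le i j (-2) x).trans ?_
  rw [sqrt_jb_eq, div_eq_mul_inv (6:ℝ), ← Real.rpow_neg (jb_pos x).le, abs_of_neg (by norm_num)]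
  have := rpow_jb_le (show (-2 + 1/2 : ℝ) ≤ -(1/2) by norm_num) x
  norm_num at this ⊢
  linarith

lemma VV_grad_XT (x : EE d) : gradient VV x = VV x • XT 1 0 1 x := by
  have hU : Differentiable ℝ (UU : EE d → ℝ) := fun x => (UU_grad x).differentiableAt'
  unfold VV
  rw [MemD12.gradient_const_mul' hU]
  simp only
  rw [UU_grad_XT, smul_smul]

lemma VV_diff : Differentiable ℝ (VV : EE d → ℝ) := fun x => (UU_grad x).differentiableAt'.const_mul _

lemma DD_VV_mul {h : EE d → ℝ} (hh : Differentiable ℝ h) : DD (fun x => VV x * h x) = ∫ x, VV x ^ 2 * ‖gradient h x‖ ^ 2 := by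
  unfold DD
  congr 1; ext x
  rw [gradient_mul' (VV_diff x) (hh x), VV_grad_XT, ← sq_abs (VV x), ← Real.norm_eq_abs, ← mul_pow, ← norm_smul]
  congr 2
  module

lemma memD12_VY (hd : 3 ≤ d) (i j : Fin d) : MemD12 d (fun x => VV x * YY i j x) := by
  refine (memD12_VV hd).mul_bdd hd (YY_diff i j) (K := 6) (fun x => (YY_le i j x).trans (by norm_num)) fun x => ?_
  rw [(YY_grad i j x).gradient]; exact YY_grad_le i j x

lemma VY_eq (i j : Fin d) (x : EE d) : VV x * YY i j x = (sig d ^ (1 / pp d))⁻¹ * Fm i j (-(((d:ℝ) + 2) / 2)) x := by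
  rw [← UU_YY, VV]; ring

lemma energy_VY (hd : 3 ≤ d) {i j : Fin d} (hij : i ≠ j) :
    ∫ x, ‖gradient (fun x => VV x * YY i j x) x‖ ^ 2 = ((d:ℝ) + 2) * (d + 4) * ∫ x, (VV x * YY i j x) ^ 2 / jb x ^ 2 := by
  have h3 : (3:ℝ) ≤ d := by exact_mod_cast hd
  have hw := memD12_VY hd i j
  set c := (sig d ^ (1 / pp d))⁻¹ with hc
  set σ : ℝ := -(((d:ℝ) + 2) / 2) with hσ
  have hF : ∀ y, gradient (fun x => VV x * YY i j x) y = c • Gm i j σ y := fun y => by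
    simp_rw [VY_eq]
    exact (HasGradientAt.scomp (f := fun t => c * t) (f' := c) (by simpa using (hasDerivAt_id (Fm i j σ y)).const_mul c) (Fm_grad i j σ y)).gradient
  have c2 := contDiff_Gm i j σ (n := 1)
  have d2 := c2.differentiable (by simp)
  have hdv : ∀ y, (VV y * YY i j y) * dvg (fun y => c • Gm i j σ y) y = -(((d:ℝ) + 2) * (d + 4)) * ((VV y * YY i j y) ^ 2 / jb y ^ 2) := fun y => by
    have hp := jb_pos y
    rw [dvg_const_smul _ (d2 y), dvg_Gm hij, VY_eq, ← hc]
    have : Fm i j (σ - 2) y = Fm i j σ y / jb y ^ 2 := by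
      unfold Fm; rw [show σ - 2 = σ - (2:ℕ) by norm_num, Real.rpow_sub_natCast hp.ne']; ring
    rw [← hσ, this, hσ]; ring
  have i1 := hw.2.1
  have i2 := (hw.int_sq_div_jb hd).const_mul (-(((d:ℝ) + 2) * (d + 4)))
  have i3 : Integrable fun y => ‖gradient (fun x => VV x * YY i j x) y‖ ^ 2 + -(((d:ℝ) + 2) * (d + 4)) * ((VV y * YY i j y) ^ 2 / jb y ^ 2) := i1.add i2
  have key : ∀ y, inner ℝ (gradient (fun x => VV x * YY i j x) y) (c • Gm i j σ y) + (VV y * YY i j y) * dvg (fun y => c • Gm i j σ y) y = ‖gradient (fun x => VV x * YY i j x) y‖ ^ 2 + -(((d:ℝ) + 2) * (d + 4)) * ((VV y * YY i j y) ^ 2 / jb y ^ 2) := fun y => by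
    rw [hdv, ← hF, real_inner_self_eq_norm_sq]
  have cg : Continuous (fun y => c • Gm i j σ y) := c2.continuous.const_smul c
  have I := ibp (fun x => VV x * YY i j x) (fun y => c • Gm i j σ y) hw.1 (c2.const_smul c) (by
      rw [show gradient (fun x => VV x * YY i j x) = fun y => c • Gm i j σ y from funext hF]
      exact cg.locallyIntegrable) (by simp_rw [key]; exact i3) (by
      refine int_of_dom (s := (d:ℝ) + 1) (C := |c| * (|c| * (2 + 2 * |σ|))) ?_ (by linarith) fun y => ?_
      · exact ((hw.cont.mul cg.norm).div continuous_jb.sqrt fun y => (Real.sqrt_pos.2 (jb_pos y)).ne').aestronglyMeasurable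
      · have hp := jb_pos y
        rw [VY_eq, ← hc, abs_div, abs_mul, abs_mul, norm_smul, abs_of_nonneg (Real.sqrt_nonneg _), div_le_iff₀ (Real.sqrt_pos.2 hp), sqrt_jb_eq, abs_of_nonneg (by positivity : 0 ≤ ‖c‖ * ‖Gm i j σ y‖), Real.norm_eq_abs]
        calc |c| * |Fm i j σ y| * (|c| * ‖Gm i j σ y‖) ≤ |c| * jb y ^ (σ + 1) * (|c| * ((2 + 2 * |σ|) * jb y ^ (σ + 1/2))) := by
              gcongr
              · exact Fm_le i j σ y
              · exact Gm_le i j σ y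
          _ = |c| * (|c| * (2 + 2 * |σ|)) * (jb y ^ (σ + 1) * jb y ^ (σ + 1/2)) := by ring
          _ = _ := by rw [mul_assoc _ (jb y ^ (-((d:ℝ) + 1))), ← Real.rpow_add hp, ← Real.rpow_add hp, hσ]; congr 2; ring)
  simp_rw [key] at I
  rw [integral_add i1 i2, integral_const_mul] at I
  linarith

lemma VY_sq (hd : 3 ≤ d) (i j : Fin d) (x : EE d) : VV x ^ pp d * YY i j x ^ 2 = kap d * ((VV x * YY i j x) ^ 2 / jb x ^ 2) := by
  have := rho_two' hd (fun x => VV x * YY i j x) x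
  rw [mul_div_cancel_left₀ _ (VV_pos hd x).ne'] at this; exact this

/-- second moment -/
def y2 (i j : Fin d) : ℝ := ∫ x, VV x ^ pp d * YY i j x ^ 2

lemma grad_moment (hd : 3 ≤ d) {i j : Fin d} (hij : i ≠ j) :
    sobolevConst d * ∫ x, VV x ^ 2 * ‖gradient (YY i j) x‖ ^ 2 = (mu d - 1) * y2 i j := by
  have h3 : (3:ℝ) ≤ d := by exact_mod_cast hd
  have h := (memD12_VY hd i j).energy_eq hd
  rw [energy_VY hd hij, DD_VV_mul (YY_diff i j)] at h
  unfold y2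
  simp_rw [VY_sq hd]
  rw [integral_const_mul, eq_sub_of_add_eq h.symm, kap, mu]
  have h2 : (d:ℝ) - 2 ≠ 0 := by linarith
  have h6 : (d:ℝ) ≠ 0 := by linarith
  field_simp

lemma int_Vp (hd : 3 ≤ d) {g : EE d → ℝ} (hg : Measurable g) {K : ℝ} (h : ∀ x, |g x| ≤ K) : Integrable fun x => VV x ^ pp d * g x :=
  int_bdd (integrable_VV_pp hd) hg h

lemma y2_pos (hd : 3 ≤ d) (i j : Fin d) : 0 < y2 i j := by
  have hc : Continuous (fun x : EE d => VV x ^ pp d * YY i j x ^ 2) := by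
    refine Continuous.mul ?_ ((YY_diff i j).continuous.pow 2)
    exact VV_diff.continuous.rpow_const fun x => Or.inl (VV_pos hd x).ne'
  unfold y2
  have hi := int_Vp hd ((YY_diff i j).continuous.pow 2).measurable (K := 1) fun x => by
    rw [Pi.pow_apply, abs_pow]; exact pow_le_one₀ (abs_nonneg _) (YY_le i j x)
  rw [integral_pos_iff_support_of_nonneg (fun x => mul_nonneg (Real.rpow_nonneg (VV_pos hd x).le _) (sq_nonneg _)) hi]
  refine (hc.isOpen_support).measure_pos volume ⟨WithLp.toLp 2 (fun _ => 1), ?_⟩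
  have h1 := VV_pos hd (WithLp.toLp 2 (fun _ => 1))
  have h2 := jb_pos (d := d) (WithLp.toLp 2 (fun _ => 1))
  simp only [Function.mem_support, YY, Fm]
  positivity

/-- reflection of one coordinate -/
def refl1 (i : Fin d) : EE d ≃ₗᵢ[ℝ] EE d :=
  LinearIsometryEquiv.piLpCongrRight 2 fun k => if k = i then LinearIsometryEquiv.neg ℝ else LinearIsometryEquiv.refl ℝ ℝ

lemma int_VY {i j : Fin d} (hij : i ≠ j) : ∫ x, VV x ^ pp d * YY i j x = 0 := by
  have h := (refl1 i).measurePreserving.integral_comp (refl1 i).toHomeomorph.measurableEmbedding (fun x => VV x ^ pp d * YY i j x)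
  have e : ∀ x, VV (refl1 i x) ^ pp d * YY i j (refl1 i x) = - (VV x ^ pp d * YY i j x) := fun x => by
    have n : jb (refl1 i x) = jb x := by unfold jb; rw [LinearIsometryEquiv.norm_map]
    have e1 : (refl1 i x) i = - x i := by simp [refl1]
    have e2 : (refl1 i x) j = x j := by simp [refl1, hij.symm]
    unfold VV UU YY Fm
    rw [n, e1, e2]; ring
  simp_rw [e] at h
  rw [integral_neg] at h
  linarith
end

open MeasureTheory Real
noncomputable section
open scoped ContDiff Topology
open Filter
variable {d : ℕ}

lemma sY_le {i j : Fin d} {s : ℝ} (h0 : 0 < s) (h1 : s ≤ 1/2) (x : EE d) : |s * YY i j x| ≤ 1/2 := by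
  rw [abs_mul, abs_of_pos h0]
  nlinarith [YY_le i j x, abs_nonneg (YY i j x)]

lemma sY_pos {i j : Fin d} {s : ℝ} (h0 : 0 < s) (h1 : s ≤ 1/2) (x : EE d) : 0 < 1 + s * YY i j x := by
  linarith [(abs_le.1 (sY_le (i := i) (j := j) h0 h1 x)).1]

/-- moments -/
def Mo (i j : Fin d) (a s : ℝ) : ℝ := ∫ x, VV x ^ pp d * (1 + s * YY i j x) ^ a

lemma Mo_expand (hd : 3 ≤ d) {i j : Fin d} (hij : i ≠ j) (a : ℝ) : ∃ K > 0, ∀ s, 0 < s → s ≤ 1/2 →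
    |Mo i j a s - 1 - a * (a - 1) / 2 * y2 i j * s ^ 2| ≤ K * s ^ 3 := by
  obtain ⟨K, hK, h⟩ := taylor3 a
  obtain ⟨K', hK', h'⟩ := rpow_bd a
  refine ⟨K, hK, fun s h0 h1 => ?_⟩
  have cY := (YY_diff i j).continuous
  have i0 := integrable_VV_pp hd
  have i1 : Integrable fun x => VV x ^ pp d * YY i j x := int_Vp hd cY.measurable (YY_le i j)
  have i2 : Integrable fun x => VV x ^ pp d * YY i j x ^ 2 := int_Vp hd (cY.pow 2).measurable (K := 1) fun x => by
    rw [abs_pow]; exact pow_le_one₀ (abs_nonneg _) (YY_le i j x)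
  have ia : Integrable fun x => VV x ^ pp d * (1 + s * YY i j x) ^ a := int_Vp hd (((cY.measurable.const_mul s).const_add 1).pow_const a) (K := K') fun x => h' _ (sY_le h0 h1 x)
  have e : Mo i j a s - 1 - a * (a - 1) / 2 * y2 i j * s ^ 2 = ∫ x, VV x ^ pp d * ((1 + s * YY i j x) ^ a - 1 - a * (s * YY i j x) - a * (a - 1) / 2 * (s * YY i j x) ^ 2) := by
    have : ∀ x, VV x ^ pp d * ((1 + s * YY i j x) ^ a - 1 - a * (s * YY i j x) - a * (a - 1) / 2 * (s * YY i j x) ^ 2) = VV x ^ pp d * (1 + s * YY i j x) ^ a - VV x ^ pp d - a * s * (VV x ^ pp d * YY i j x) - a * (a - 1) / 2 * s ^ 2 * (VV x ^ pp d * YY i j x ^ 2) := fun x => by ring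
    simp_rw [this]
    have j0 : Integrable fun x => VV x ^ pp d * (1 + s * YY i j x) ^ a - VV x ^ pp d := ia.sub i0
    have j1 : Integrable fun x => VV x ^ pp d * (1 + s * YY i j x) ^ a - VV x ^ pp d - a * s * (VV x ^ pp d * YY i j x) := j0.sub (i1.const_mul _)
    rw [integral_sub j1 (i2.const_mul _), integral_sub j0 (i1.const_mul _), integral_sub ia i0, integral_const_mul, integral_const_mul, int_VY hij, int_VV_pp hd, Mo, y2]
    ring
  rw [e, ← Real.norm_eq_abs]
  have := norm_integral_le_of_norm_le (i0.const_mul (K * s ^ 3)) (Eventually.of_forall (p := fun x => ‖VV x ^ pp d * ((1 + s * YY i j x) ^ a - 1 - a * (s * YY i j x) - a * (a - 1) / 2 * (s * YY i j x) ^ 2)‖ ≤ K * s ^ 3 * VV x ^ pp d) fun x => ?_)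
  · rwa [integral_const_mul, int_VV_pp hd, mul_one] at this
  · have hV := Real.rpow_pos_of_pos (VV_pos hd x) (pp d)
    rw [norm_mul, Real.norm_of_nonneg hV.le, mul_comm]
    gcongr
    refine (h _ (sY_le h0 h1 x)).trans ?_
    gcongr
    rw [abs_mul, abs_of_pos h0]
    nlinarith [YY_le i j x, abs_nonneg (YY i j x)]

lemma ev_small : ∀ᶠ s : ℝ in 𝓝[>] 0, 0 < s ∧ s ≤ 1/2 := by
  filter_upwards [Ioo_mem_nhdsGT (show (0:ℝ) < 1/2 by norm_num)] with s hs using ⟨hs.1, hs.2.le⟩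

lemma tendsto_s : Tendsto (fun s : ℝ => s) (𝓝[>] 0) (𝓝 0) := tendsto_id.mono_left nhdsWithin_le_nhds

lemma Mo_lim (hd : 3 ≤ d) {i j : Fin d} (hij : i ≠ j) (a : ℝ) :
    Tendsto (fun s => (Mo i j a s - 1) / s ^ 2) (𝓝[>] 0) (𝓝 (a * (a - 1) / 2 * y2 i j)) := by
  obtain ⟨K, hK, h⟩ := Mo_expand hd hij a
  rw [tendsto_iff_norm_sub_tendsto_zero]
  refine squeeze_zero' (Eventually.of_forall fun _ => norm_nonneg _) (g := fun s => K * s) ?_ (by simpa using tendsto_s.const_mul K)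
  filter_upwards [ev_small] with s hs
  have e : (Mo i j a s - 1) / s ^ 2 - a * (a - 1) / 2 * y2 i j = (Mo i j a s - 1 - a * (a - 1) / 2 * y2 i j * s ^ 2) / s ^ 2 := by
    have := hs.1.ne'
    field_simp
  rw [e, norm_div, Real.norm_eq_abs, Real.norm_of_nonneg (sq_nonneg s), div_le_iff₀ (by have := hs.1; positivity)]
  calc _ ≤ _ := h s hs.1 hs.2
    _ = _ := by ring

lemma Mo_lim1 (hd : 3 ≤ d) {i j : Fin d} (hij : i ≠ j) (a : ℝ) :
    Tendsto (fun s => Mo i j a s) (𝓝[>] 0) (𝓝 1) := by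
  have := ((Mo_lim hd hij a).mul (tendsto_s.pow 2)).const_add 1
  simp only [ne_eq, OfNat.ofNat_ne_zero, not_false_eq_true, zero_pow, mul_zero, add_zero] at this
  refine this.congr' ?_
  filter_upwards [ev_small] with s hs
  have := hs.1.ne'
  field_simp; ring

lemma Mo_pow_lim (hd : 3 ≤ d) {i j : Fin d} (hij : i ≠ j) (a b : ℝ) :
    Tendsto (fun s => (Mo i j a s ^ b - 1) / s ^ 2) (𝓝[>] 0) (𝓝 (a * (a - 1) / 2 * y2 i j * b)) := by
  have hD : HasDerivAt (fun t : ℝ => t ^ b) b 1 := by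
    simpa using Real.hasDerivAt_rpow_const (x := 1) (p := b) (Or.inl one_ne_zero)
  have h1 := ((continuousAt_dslope_same.2 hD.differentiableAt).tendsto.comp (Mo_lim1 hd hij a))
  rw [dslope_same, hD.deriv] at h1
  refine ((Mo_lim hd hij a).mul h1).congr fun s => ?_
  have := sub_smul_dslope (fun t : ℝ => t ^ b) 1 (Mo i j a s)
  simp only [Real.one_rpow, smul_eq_mul] at this
  rw [← this]
  simp only [Function.comp]; ring

/-- test functions -/
def us (i j : Fin d) (s : ℝ) (x : EE d) : ℝ := VV x * (1 + s * YY i j x) ^ (1 / qq d)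

lemma us_pos (hd : 3 ≤ d) {i j : Fin d} {s : ℝ} (h0 : 0 < s) (h1 : s ≤ 1/2) (x : EE d) : 0 < us i j s x :=
  mul_pos (VV_pos hd x) (Real.rpow_pos_of_pos (sY_pos h0 h1 x) _)

lemma hs_grad {i j : Fin d} {s : ℝ} (h0 : 0 < s) (h1 : s ≤ 1/2) (b : ℝ) (x : EE d) :
    HasGradientAt (fun x => (1 + s * YY i j x) ^ b) ((b * (1 + s * YY i j x) ^ (b - 1) * s) • gradient (YY i j) x) x := by
  have h := HasGradientAt.scomp (f := fun t => 1 + s * t) (f' := s) (by simpa using ((hasDerivAt_id (YY i j x)).const_mul s).const_add 1) (YY_diff i j x).hasGradientAt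
  have := h.rpow_const' b (Or.inl (sY_pos h0 h1 x).ne')
  rw [smul_smul] at this
  exact this

lemma us_mem (hd : 3 ≤ d) {i j : Fin d} {s : ℝ} (h0 : 0 < s) (h1 : s ≤ 1/2) : MemD12 d (us i j s) := by
  obtain ⟨K1, k1, e1⟩ := rpow_bd (1 / qq d)
  obtain ⟨K2, k2, e2⟩ := rpow_bd (1 / qq d - 1)
  refine (memD12_VV hd).mul_bdd hd (fun x => (hs_grad h0 h1 _ x).differentiableAt') (K := K1 + |1 / qq d| * K2 * s * 6) (fun x => ?_) fun x => ?_
  · refine (e1 _ (sY_le h0 h1 x)).trans ?_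
    have : 0 ≤ |1 / qq d| * K2 * s * 6 := by positivity
    linarith
  · rw [(hs_grad h0 h1 _ x).gradient, norm_smul, norm_mul, norm_mul, Real.norm_eq_abs, Real.norm_eq_abs, Real.norm_of_nonneg h0.le, (YY_grad i j x).gradient]
    have hj := Real.sqrt_pos.2 (jb_pos x)
    calc |1 / qq d| * |(1 + s * YY i j x) ^ (1 / qq d - 1)| * s * ‖Gm i j (-2) x‖ ≤ |1 / qq d| * K2 * s * (6 / √(jb x)) := by
          gcongr
          · exact e2 _ (sY_le h0 h1 x)
          · exact YY_grad_le i j x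
      _ = (0 + |1 / qq d| * K2 * s * 6) / √(jb x) := by ring
      _ ≤ _ := by gcongr

lemma us_qq (hd : 3 ≤ d) {i j : Fin d} {s : ℝ} (h0 : 0 < s) (h1 : s ≤ 1/2) (x : EE d) : us i j s x ^ qq d = VV x ^ qq d * (1 + s * YY i j x) := by
  have hq : qq d ≠ 0 := by linarith [one_lt_qq hd]
  have hy := sY_pos (i := i) (j := j) h0 h1 x
  rw [us, Real.mul_rpow (VV_pos hd x).le (Real.rpow_nonneg hy.le _), ← Real.rpow_mul hy.le, one_div_mul_cancel hq, Real.rpow_one]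

lemma us_pp (hd : 3 ≤ d) {i j : Fin d} {s : ℝ} (h0 : 0 < s) (h1 : s ≤ 1/2) : ∫ x, |us i j s x| ^ pp d = Mo i j (pp d / qq d) s := by
  unfold Mo
  congr 1; ext x
  have hy := sY_pos (i := i) (j := j) h0 h1 x
  rw [abs_of_pos (us_pos hd h0 h1 x), us, Real.mul_rpow (VV_pos hd x).le (Real.rpow_nonneg hy.le _), ← Real.rpow_mul hy.le]
  congr 2; ring

lemma us_I (hd : 3 ≤ d) {i j : Fin d} (hij : i ≠ j) {s : ℝ} (h0 : 0 < s) (h1 : s ≤ 1/2) :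
    ∫ x, us i j s x ^ qq d * invLap d (fun y => us i j s y ^ qq d) x = sobolevConst d * (1 + s ^ 2 * y2 i j / mu d) := by
  simp_rw [us_qq hd h0 h1, invLap_VV hd hij]
  have cY := (YY_diff i j).continuous
  have i0 := integrable_VV_pp hd
  have i1 : Integrable fun x => VV x ^ pp d * YY i j x := int_Vp hd cY.measurable (YY_le i j)
  have i2 : Integrable fun x => VV x ^ pp d * YY i j x ^ 2 := int_Vp hd (cY.pow 2).measurable (K := 1) fun x => by
    rw [abs_pow]; exact pow_le_one₀ (abs_nonneg _) (YY_le i j x)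
  have : ∀ x, VV x ^ qq d * (1 + s * YY i j x) * (sobolevConst d * (VV x * (1 + s / mu d * YY i j x))) =
      sobolevConst d * (VV x ^ pp d + (s + s / mu d) * (VV x ^ pp d * YY i j x) + s * (s / mu d) * (VV x ^ pp d * YY i j x ^ 2)) := fun x => by
    rw [← qq_add_one hd, Real.rpow_add_one (VV_pos hd x).ne']; ring
  simp_rw [this]
  have j0 : Integrable fun x => VV x ^ pp d + (s + s / mu d) * (VV x ^ pp d * YY i j x) := i0.add (i1.const_mul _)
  rw [integral_const_mul, integral_add j0 (i2.const_mul _), integral_add i0 (i1.const_mul _), integral_const_mul, integral_const_mul, int_VY hij, int_VV_pp hd, y2]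
  ring

lemma us_energy (hd : 3 ≤ d) {i j : Fin d} (hij : i ≠ j) : ∃ K > 0, ∀ s, 0 < s → s ≤ 1/2 →
    sobolevConst d * ∫ x, ‖gradient (us i j s) x‖ ^ 2 ≤ s ^ 2 / qq d ^ 2 * (1 + K * s) * ((mu d - 1) * y2 i j) + Mo i j (2 / qq d) s := by
  obtain ⟨K, hK, h⟩ := taylor1 (2 / qq d - 2)
  have hq : 0 < qq d := by linarith [one_lt_qq hd]
  refine ⟨K, hK, fun s h0 h1 => ?_⟩
  have hu := us_mem hd (i := i) (j := j) h0 h1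
  have hS := sobolevConst_pos hd
  rw [hu.energy_eq hd, ← grad_moment hd hij]
  have e1 : sobolevConst d * (d * ((d:ℝ) - 2) * ∫ x, us i j s x ^ 2 / jb x ^ 2) = Mo i j (2 / qq d) s := by
    unfold Mo
    rw [← mul_assoc, ← kap, ← integral_const_mul]
    congr 1; ext x
    have hy := sY_pos (i := i) (j := j) h0 h1 x
    rw [← rho_two' hd (us i j s) x, us, mul_div_cancel_left₀ _ (VV_pos hd x).ne', ← Real.rpow_natCast, ← Real.rpow_mul hy.le]
    congr 2; push_cast; ring
  rw [mul_add, e1]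
  refine add_le_add_left ?_ _
  rw [show s ^ 2 / qq d ^ 2 * (1 + K * s) * (sobolevConst d * ∫ x, VV x ^ 2 * ‖gradient (YY i j) x‖ ^ 2) = sobolevConst d * (s ^ 2 / qq d ^ 2 * (1 + K * s) * ∫ x, VV x ^ 2 * ‖gradient (YY i j) x‖ ^ 2) by ring]
  gcongr
  have hdf : Differentiable ℝ (fun x => (1 + s * YY i j x) ^ (1 / qq d)) := fun x => (hs_grad h0 h1 _ x).differentiableAt'
  have E := DD_VV_mul hdf
  change DD (us i j s) = _ at E
  rw [E, ← integral_const_mul]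
  have hi : Integrable fun x => VV x ^ 2 * ‖gradient (YY i j) x‖ ^ 2 := by
    refine ((memD12_VY hd i j).int_D0 hd).congr (Eventually.of_forall fun x => ?_)
    simp only
    rw [gradient_mul' (VV_diff x) (YY_diff i j x), VV_grad_XT, ← sq_abs (VV x), ← Real.norm_eq_abs, ← mul_pow, ← norm_smul]
    congr 2
    module
  refine integral_mono_of_nonneg (Eventually.of_forall fun x => by positivity) (hi.const_mul _) (Eventually.of_forall fun x => ?_)
  simp only
  have hy := sY_pos (i := i) (j := j) h0 h1 x
  rw [(hs_grad h0 h1 _ x).gradient, norm_smul, mul_pow, Real.norm_eq_abs, sq_abs]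
  have e2 : (1 / qq d * (1 + s * YY i j x) ^ (1 / qq d - 1) * s) ^ 2 = s ^ 2 / qq d ^ 2 * (1 + s * YY i j x) ^ (2 / qq d - 2) := by
    rw [mul_pow, mul_pow, ← Real.rpow_natCast ((1 + s * YY i j x) ^ (1 / qq d - 1)), ← Real.rpow_mul hy.le]
    rw [show (1 / qq d - 1) * ((2:ℕ):ℝ) = 2 / qq d - 2 by push_cast; ring]; ring
  rw [e2]
  have e3 : (1 + s * YY i j x) ^ (2 / qq d - 2) ≤ 1 + K * s := by
    have a1 := (abs_le.1 (h _ (sY_le (i := i) (j := j) h0 h1 x))).2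
    have a2 : |s * YY i j x| ≤ s := by rw [abs_mul, abs_of_pos h0]; nlinarith [YY_le i j x]
    have a3 : K * |s * YY i j x| ≤ K * s := by gcongr
    linarith
  calc VV x ^ 2 * (s ^ 2 / qq d ^ 2 * (1 + s * YY i j x) ^ (2 / qq d - 2) * ‖gradient (YY i j) x‖ ^ 2)
      ≤ VV x ^ 2 * (s ^ 2 / qq d ^ 2 * (1 + K * s) * ‖gradient (YY i j) x‖ ^ 2) := by gcongr
    _ = _ := by ring
end

open MeasureTheory Real
noncomputable section
open scoped ContDiff Topology
open Filter
variable {d : ℕ}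

lemma lower (hd : 3 ≤ d) {C : ℝ} (h : AdmC d C) : (d:ℝ) / (d + 4) * sobolevConst d ≤ C := by
  obtain ⟨hC, h⟩ := h
  have h3 : (3:ℝ) ≤ d := by exact_mod_cast hd
  have hS := sobolevConst_pos hd
  set i : Fin d := ⟨0, by omega⟩ with hi
  set j : Fin d := ⟨1, by omega⟩ with hj
  have hij : i ≠ j := by simp [hi, hj]
  set y := y2 i j with hy
  have y0 : 0 < y := y2_pos hd i j
  have hq1 := one_lt_qq hd
  have hp := qq_add_one hd
  have hq : 0 < qq d := by linarith
  have hp0 : 0 < pp d := by linarith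
  have hm := mu_pos hd
  obtain ⟨K, hK, hE⟩ := us_energy hd hij
  have main : ∀ᶠ s in 𝓝[>] (0:ℝ), sobolevConst d * ((Mo i j (pp d / qq d) s ^ (2 * qq d / pp d) - 1) / s ^ 2) - sobolevConst d * (y / mu d) ≤
      C * Mo i j (pp d / qq d) s ^ (8 / ((d:ℝ) - 2) / pp d) * (1 / qq d ^ 2 * (1 + K * s) * ((mu d - 1) * y) + (Mo i j (2 / qq d) s - 1) / s ^ 2 - (Mo i j (pp d / qq d) s ^ (2 / pp d) - 1) / s ^ 2) := by
    filter_upwards [ev_small, (Mo_lim1 hd hij (pp d / qq d)).eventually (lt_mem_nhds (show (0:ℝ) < 1 by norm_num))] with s hs hM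
    obtain ⟨h0, h1⟩ := hs
    have H := h (us i j s) (fun x => (us_pos hd h0 h1 x).le) (us_mem hd h0 h1)
    rw [norm_uq hd (fun x => (us_pos hd h0 h1 x).le), us_I hd hij h0 h1, lpNorm'_rpow_two] at H
    simp only [lpNorm', us_pp hd h0 h1] at H
    rw [← Real.rpow_mul hM.le, ← Real.rpow_mul hM.le, show 1 / pp d * (2 * qq d) = 2 * qq d / pp d by ring, show 1 / pp d * (8 / ((d:ℝ) - 2)) = 8 / ((d:ℝ) - 2) / pp d by ring] at H
    have e := hE s h0 h1
    have P : 0 < C * Mo i j (pp d / qq d) s ^ (8 / ((d:ℝ) - 2) / pp d) := mul_pos hC (Real.rpow_pos_of_pos hM _)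
    have H2 := H.trans (mul_le_mul_of_nonneg_left (sub_le_sub_right e _) P.le)
    have s2 : 0 < s ^ 2 := by positivity
    have H3 := div_le_div_of_nonneg_right H2 s2.le
    calc _ = _ := ?_
      _ ≤ _ := H3
      _ = _ := ?_
    · field_simp; ring
    · field_simp; ring
  have L1 := ((Mo_pow_lim hd hij (pp d / qq d) (2 * qq d / pp d)).const_mul (sobolevConst d)).sub_const (sobolevConst d * (y / mu d))
  have L2 : Tendsto (fun s => Mo i j (pp d / qq d) s ^ (8 / ((d:ℝ) - 2) / pp d)) (𝓝[>] 0) (𝓝 1) := by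
    simpa using (Mo_lim1 hd hij (pp d / qq d)).rpow_const (p := 8 / ((d:ℝ) - 2) / pp d) (Or.inl one_ne_zero)
  have L3 : Tendsto (fun s : ℝ => 1 / qq d ^ 2 * (1 + K * s) * ((mu d - 1) * y)) (𝓝[>] 0) (𝓝 (1 / qq d ^ 2 * (1 + K * 0) * ((mu d - 1) * y))) :=
    (((tendsto_s.const_mul K).const_add 1).const_mul _).mul_const _
  have L4 := (L2.const_mul C).mul ((L3.add (Mo_lim hd hij (2 / qq d))).sub (Mo_pow_lim hd hij (pp d / qq d) (2 / pp d)))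
  have F := le_of_tendsto_of_tendsto L1 L4 main
  rw [← hy] at F
  have f1 : sobolevConst d * (pp d / qq d * (pp d / qq d - 1) / 2 * y * (2 * qq d / pp d)) - sobolevConst d * (y / mu d) = (y * (1 / qq d - 1 / mu d)) * sobolevConst d := by
    rw [← hp] at hp0 ⊢
    field_simp; ring
  have f2 : C * 1 * (1 / qq d ^ 2 * (1 + K * 0) * ((mu d - 1) * y) + 2 / qq d * (2 / qq d - 1) / 2 * y - pp d / qq d * (pp d / qq d - 1) / 2 * y * (2 / pp d)) = (y * (1 / qq d - 1 / mu d)) * (C * (mu d / qq d)) := by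
    rw [← hp] at hp0 ⊢
    field_simp; ring
  rw [f1, f2] at F
  have hmq : mu d / qq d = (d + 4) / d := by
    unfold mu qq
    have : (d:ℝ) - 2 ≠ 0 := by linarith
    field_simp
  have hlt : qq d < mu d := by
    have : 1 < mu d / qq d := by rw [hmq, lt_div_iff₀ (by linarith)]; linarith
    rwa [lt_div_iff₀ hq, one_mul] at this
  have pos : 0 < y * (1 / qq d - 1 / mu d) := mul_pos y0 (sub_pos.2 (one_div_lt_one_div_of_lt hq hlt))
  have G := le_of_mul_le_mul_left F pos
  rw [hmq, ← mul_div_assoc, le_div_iff₀ (by linarith)] at G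
  rw [div_mul_eq_mul_div, div_le_iff₀ (by linarith)]
  linarith
end

/-- the optimal proportionality constant `C_d` between the HLS deficit and
the Sobolev deficit satisfies `(d/(d+4)) S_d ≤ C_d < S_d`. -/
theorem optimal_proportionality_bounds (d : ℕ) (hd : 3 ≤ d) (Cd : ℝ)
    (hCd : IsLeast {C : ℝ | 0 < C ∧ ∀ u : EuclideanSpace ℝ (Fin d) → ℝ,
        (∀ x, 0 ≤ u x) → MemD12 d u →
        sobolevConst d *
            lpNorm' (2 * (d : ℝ) / ((d : ℝ) + 2))
              (fun x => u x ^ (((d : ℝ) + 2) / ((d : ℝ) - 2))) ^ (2 : ℝ) -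
          (∫ x, u x ^ (((d : ℝ) + 2) / ((d : ℝ) - 2)) *
            invLap d (fun y => u y ^ (((d : ℝ) + 2) / ((d : ℝ) - 2))) x) ≤
        C * lpNorm' (2 * (d : ℝ) / ((d : ℝ) - 2)) u ^ ((8 : ℝ) / ((d : ℝ) - 2)) *
          (sobolevConst d * (∫ x, ‖gradient u x‖ ^ 2) -
            lpNorm' (2 * (d : ℝ) / ((d : ℝ) - 2)) u ^ (2 : ℝ))} Cd) :
    (d : ℝ) / ((d : ℝ) + 4) * sobolevConst d ≤ Cd ∧ Cd < sobolevConst d := by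
  change IsLeast {C : ℝ | AdmC d C} Cd at hCd
  obtain ⟨C, hC, hlt⟩ := upper hd
  exact ⟨lower hd hCd.1, (hCd.2 hC).trans_lt hlt⟩
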